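/- Let n ≥ 5 and m ∈ ℕ. For every ε > 0 there exists a constant C_ε > 0 such that for every f ∈ C^∞(S^{n-1}) satisfying ∫_{S^{n-1}} p |f|^{2(n-1)/(n-4)} dμ_{S^{n-1}} = 0 for all p ∈ P̊_m, and every u ∈ H²(𝔹ⁿ) extending f with boundary conditions u = f and ∂u/∂r = -((n-4)/2) f on S^{n-1}, one has (∫_{S^{n-1}} |f|^{2(n-1)/(n-4)} dμ_{S^{n-1}})^{(n-4)/(n-1)} ≤ ( α(n) / Θ(m, (n-4)/(n-1), n-1) + ε ) ∫_{𝔹ⁿ} (Δu)² dx + C_ε ∫_{S^{n-1}} ( |∇f|²_{S^{n-1}} + b_n f² ) dμ_{S^{n-1}}, where b_n = n(n-4)/2 and α(n) = 4 / ( n(n-2)(n-4) |S^{n-1}|^{3/(n-1)} ). -/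

import Mathlib

open MeasureTheory Metric Filter
open scoped ENNReal RealInnerProductSpace

noncomputable section

abbrev E (n : ℕ) : Type := EuclideanSpace ℝ (Fin n)

/-- The standard surface measure on the unit sphere `S^{n-1}`, as a Borel measure on `ℝⁿ`. -/
def sphMeasure (n : ℕ) : Measure (E n) :=
  Measure.map Subtype.val ((volume : Measure (E n)).toSphere)

/-- `|S^{n-1}|` : the total mass of the surface measure. -/
def SA (n : ℕ) : ℝ := (sphMeasure n Set.univ).toReal

/-- `P̊_m` : polynomials of degree at most `m` with zero mean on the sphere. -/
def P0 (n m : ℕ) : Set (MvPolynomial (Fin n) ℝ) :=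
  {p | p.totalDegree ≤ m ∧ ∫ x, MvPolynomial.eval (fun i => x i) p ∂(sphMeasure n) = 0}

/-- `Θ(m, θ, n-1)` : the infimum of `Σ_i ν_iᶿ` over all probability measures
`ν = Σ_i ν_i δ_{ξ_i}` on `S^{n-1}` supported on countably many points such that
`∫ p dν = 0` for all `p ∈ P̊_m`. -/
def Theta (n m : ℕ) (θ : ℝ) : ℝ :=
  sInf {t : ℝ | ∃ (ξ : ℕ → E n) (w : ℕ → ℝ),
    (∀ i, ξ i ∈ Metric.sphere (0 : E n) 1) ∧ (∀ i, 0 ≤ w i) ∧ Summable w ∧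
    (∑' i, w i) = 1 ∧
    (∀ p ∈ P0 n m, (∑' i, w i * MvPolynomial.eval (fun j => ξ i j) p) = 0) ∧
    Summable (fun i => w i ^ θ) ∧ t = ∑' i, w i ^ θ}

/-- The Euclidean Laplacian `Δu = Σ_i ∂²u/∂x_i²`. -/
def lap (n : ℕ) (u : E n → ℝ) (x : E n) : ℝ :=
  ∑ i : Fin n, fderiv ℝ (fun y => fderiv ℝ u y (EuclideanSpace.single i 1)) x
    (EuclideanSpace.single i 1)

/-- `|∇f|²_{S^{n-1}}` at a point `x` of the unit sphere: the squared norm of the tangential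
gradient, i.e. `‖∇f‖² - ⟨∇f, x⟩²`. -/
def tgradNormSq (n : ℕ) (f : E n → ℝ) (x : E n) : ℝ :=
  ‖gradient f x‖ ^ 2 - (fderiv ℝ f x x) ^ 2

abbrev Sp (n : ℕ) : Type := Metric.sphere (0 : E n) 1

abbrev sg (n : ℕ) : Measure (Sp n) := (volume : Measure (E n)).toSphere

theorem Sp.norm_eq {n : ℕ} (x : Sp n) : ‖(x : E n)‖ = 1 := by
  simp

theorem Sp.inner_self {n : ℕ} (x : Sp n) : inner ℝ (x : E n) x = 1 := by
  rw [real_inner_self_eq_norm_sq, x.norm_eq]; norm_num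

theorem polar_lintegral {n : ℕ} (hn : 5 ≤ n) (F : E n → ℝ≥0∞) (hF : Measurable F) :
    ∫⁻ x, F x = ∫⁻ ω : Sp n, ∫⁻ r in Set.Ioi (0:ℝ), ENNReal.ofReal (r ^ (n-1)) * F (r • (ω : E n)) ∂volume ∂(sg n) := by
  have : Nontrivial (E n) := by
    have : Nonempty (Fin n) := ⟨⟨0, by omega⟩⟩
    infer_instance
  have hd : Module.finrank ℝ (E n) = n := by simp
  calc ∫⁻ x, F x = ∫⁻ x : ({(0)}ᶜ : Set (E n)), F x.1 ∂(volume.comap Subtype.val) := by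
        rw [lintegral_subtype_comap (measurableSet_singleton _).compl,
          restrict_compl_singleton]
    _ = ∫⁻ p, F ((p.2 : ℝ) • (p.1 : E n)) ∂((sg n).prod (Measure.volumeIoiPow (n - 1))) := by
        have := (volume : Measure (E n)).measurePreserving_homeomorphUnitSphereProd.lintegral_comp_emb
          (Homeomorph.measurableEmbedding _) (fun p => F ((p.2 : ℝ) • (p.1 : E n)))
        rw [hd] at this
        rw [← this]
        refine lintegral_congr fun x => ?_
        have hx : ‖(x:E n)‖ ≠ 0 := by
          have : (x : E n) ≠ 0 := x.2
          exact norm_ne_zero_iff.2 this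
        simp [smul_smul, hx]
    _ = _ := by
        rw [lintegral_prod]
        · refine lintegral_congr fun ω => ?_
          rw [Measure.volumeIoiPow, lintegral_withDensity_eq_lintegral_mul]
          · rw [← lintegral_subtype_comap measurableSet_Ioi]; rfl
          · fun_prop
          · exact hF.comp (by fun_prop)
        · exact (hF.comp (by fun_prop)).aemeasurable

theorem polar_integrable {n : ℕ} (hn : 5 ≤ n) (F : E n → ℝ) (hF : Integrable F) :
    Integrable (fun p : Sp n × ℝ => p.2 ^ (n-1) * F (p.2 • (p.1 : E n)))
      ((sg n).prod (volume.restrict (Set.Ioi (0:ℝ)))) ∧ 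
    ∫ x, F x = ∫ p : Sp n × ℝ, p.2 ^ (n-1) * F (p.2 • (p.1 : E n)) ∂((sg n).prod (volume.restrict (Set.Ioi (0:ℝ)))) := by
  have : Nontrivial (E n) := by
    have : Nonempty (Fin n) := ⟨⟨0, by omega⟩⟩
    infer_instance
  have hd : Module.finrank ℝ (E n) = n := by simp
  set W : Measure (Set.Ioi (0:ℝ)) := Measure.comap Subtype.val volume with hW
  have hfin : SigmaFinite W := by
    refine SigmaFinite.of_map W (f := Subtype.val) measurable_subtype_coe.aemeasurable ?_
    rw [hW, map_comap_subtype_coe measurableSet_Ioi]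
    infer_instance
  have hmap : MeasurePreserving (Subtype.val : Set.Ioi (0:ℝ) → ℝ) W (volume.restrict (Set.Ioi (0:ℝ))) := by
    refine ⟨measurable_subtype_coe, ?_⟩
    rw [hW, map_comap_subtype_coe measurableSet_Ioi]
  have hemb : MeasurableEmbedding (Prod.map id (Subtype.val : Set.Ioi (0:ℝ) → ℝ) : Sp n × Set.Ioi (0:ℝ) → Sp n × ℝ) :=
    MeasurableEmbedding.id.prodMap (MeasurableEmbedding.subtype_coe measurableSet_Ioi)
  have hmap2 : MeasurePreserving (Prod.map id (Subtype.val : Set.Ioi (0:ℝ) → ℝ) : Sp n × Set.Ioi (0:ℝ) → Sp n × ℝ) ((sg n).prod W) ((sg n).prod (volume.restrict (Set.Ioi (0:ℝ)))) :=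
    (MeasurePreserving.id _).prod hmap
  have hprod : (sg n).prod (Measure.volumeIoiPow (n-1)) = ((sg n).prod W).withDensity (fun p => ENNReal.ofReal (p.2.1 ^ (n-1))) := by
    rw [Measure.volumeIoiPow]
    rw [prod_withDensity_right (by fun_prop)]
  have hmp := (volume : Measure (E n)).measurePreserving_homeomorphUnitSphereProd
  rw [hd, hprod] at hmp
  set G : Sp n × Set.Ioi (0:ℝ) → ℝ := fun p => F ((p.2 : ℝ) • (p.1 : E n)) with hG
  have hGc : ∀ x : ({(0)}ᶜ : Set (E n)), G (homeomorphUnitSphereProd (E n) x) = F x.1 := by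
    intro x
    have hx : ‖(x:E n)‖ ≠ 0 := by
      have : (x : E n) ≠ 0 := x.2
      exact norm_ne_zero_iff.2 this
    simp [hG, smul_smul, hx]
  have hpos : ∀ p : Sp n × Set.Ioi (0:ℝ), (ENNReal.ofReal (p.2.1 ^ (n-1))).toReal = p.2.1 ^ (n-1) := by
    intro p
    have := p.2.2
    exact ENNReal.toReal_ofReal (pow_nonneg (le_of_lt this) _)
  constructor
  · rw [← hmap2.integrable_comp_emb hemb]
    have h1 : Integrable (fun x : ({(0)}ᶜ : Set (E n)) => F x.1) (volume.comap Subtype.val) := by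
      have := (integrableOn_iff_comap_subtypeVal (μ := volume) (f := F) (measurableSet_singleton (0 : E n)).compl).1 hF.integrableOn
      exact this
    have h2 : Integrable G (((sg n).prod W).withDensity (fun p => ENNReal.ofReal (p.2.1 ^ (n-1)))) := by
      rw [← hmp.integrable_comp_emb (Homeomorph.measurableEmbedding _)]
      refine h1.congr (ae_of_all _ fun x => ?_)
      exact (hGc x).symm
    rw [integrable_withDensity_iff_integrable_smul' (by fun_prop) (by simp)] at h2
    refine h2.congr (ae_of_all _ fun p => ?_)
    simp only [hpos, smul_eq_mul, hG]; rfl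
  · have h3 := hmap2.integral_comp hemb (fun p : Sp n × ℝ => p.2 ^ (n-1) * F (p.2 • (p.1 : E n)))
    rw [← h3]
    calc ∫ x, F x = ∫ x : ({(0)}ᶜ : Set (E n)), F x.1 ∂(volume.comap Subtype.val) := by
          rw [integral_subtype_comap (measurableSet_singleton _).compl, restrict_compl_singleton]
      _ = ∫ p, G p ∂(((sg n).prod W).withDensity (fun p => ENNReal.ofReal (p.2.1 ^ (n-1)))) := by
          rw [← hmp.integral_comp (Homeomorph.measurableEmbedding _)]
          exact integral_congr_ae (ae_of_all _ fun x => (hGc x).symm)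
      _ = _ := by
          rw [integral_withDensity_eq_integral_toReal_smul (by fun_prop) (by simp)]
          refine integral_congr_ae (ae_of_all _ fun p => ?_)
          simp only [hpos, smul_eq_mul, hG]; rfl

def kst (ε r : ℝ) : ℝ := deriv Real.smoothTransition ((1 - r^2)/ε) * (2 * r / ε)

theorem st_hasDeriv (x : ℝ) : HasDerivAt Real.smoothTransition (deriv Real.smoothTransition x) x :=
  (Real.smoothTransition.contDiff (n := 1)).differentiable (by simp) x |>.hasDerivAt

theorem st_deriv_cont : Continuous (deriv Real.smoothTransition) :=
  (Real.smoothTransition.contDiff (n := 1)).continuous_deriv (by simp)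

theorem st_deriv_zero {x : ℝ} (h : x < 0 ∨ 1 < x) : deriv Real.smoothTransition x = 0 := by
  rcases h with h | h
  · have : Real.smoothTransition =ᶠ[nhds x] fun _ => 0 := by
      filter_upwards [Iio_mem_nhds h] with y hy
      exact Real.smoothTransition.zero_of_nonpos (le_of_lt hy)
    rw [this.deriv_eq]; simp
  · have : Real.smoothTransition =ᶠ[nhds x] fun _ => 1 := by
      filter_upwards [Ioi_mem_nhds h] with y hy
      exact Real.smoothTransition.one_of_one_le (le_of_lt hy)
    rw [this.deriv_eq]; simp

theorem kst_hasDeriv (ε r : ℝ) :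
    HasDerivAt (fun r => - Real.smoothTransition ((1 - r^2)/ε)) (kst ε r) r := by
  have h1 : HasDerivAt (fun r : ℝ => (1 - r^2)/ε) (-(2*r)/ε) r := by
    have := ((hasDerivAt_pow 2 r).const_sub 1).div_const ε
    simpa using this
  have h2 := ((st_hasDeriv ((1 - r^2)/ε)).comp r h1).neg
  refine h2.congr_deriv ?_
  unfold kst; ring

theorem kst_nonneg {ε r : ℝ} (hε : 0 < ε) (hr : 0 ≤ r) : 0 ≤ kst ε r := by
  unfold kst
  have := Real.smoothTransition.monotone.deriv_nonneg (x := (1 - r^2)/ε)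
  positivity

theorem kst_cont (ε : ℝ) : Continuous (kst ε) := by
  unfold kst
  have := st_deriv_cont
  fun_prop

theorem kst_zero {ε r : ℝ} (hε : 0 < ε) (hr : 1 < r ∨ (0 ≤ r ∧ r < 1 - ε)) : kst ε r = 0 := by
  unfold kst
  rw [st_deriv_zero, zero_mul]
  rcases hr with hr | ⟨h0, hr⟩
  · left
    apply div_neg_of_neg_of_pos _ hε
    nlinarith
  · right
    rw [lt_div_iff₀ hε]
    nlinarith

theorem kst_integral {ε : ℝ} (hε : 0 < ε) (hε1 : ε ≤ 1) :
    IntegrableOn (kst ε) (Set.Ioi 0) ∧ ∫ r in Set.Ioi 0, kst ε r = 1 := by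
  have ht : Tendsto (fun r => - Real.smoothTransition ((1 - r^2)/ε)) atTop (nhds 0) := by
    refine tendsto_const_nhds.congr' ?_
    filter_upwards [eventually_ge_atTop 1] with r hr
    rw [Real.smoothTransition.zero_of_nonpos, neg_zero]
    apply div_nonpos_of_nonpos_of_nonneg _ hε.le
    nlinarith
  constructor
  · exact integrableOn_Ioi_deriv_of_nonneg' (fun x _ => kst_hasDeriv ε x)
      (fun x hx => kst_nonneg hε (le_of_lt hx)) ht
  · rw [integral_Ioi_of_hasDerivAt_of_nonneg' (fun x _ => kst_hasDeriv ε x)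
      (fun x hx => kst_nonneg hε (le_of_lt hx)) ht, Real.smoothTransition.one_of_one_le]
    · norm_num
    · rw [le_div_iff₀ hε]; linarith

def chi (n : ℕ) (ε : ℝ) (x : E n) : ℝ := Real.smoothTransition ((1 - ‖x‖^2)/ε)

theorem chi_contDiff (n : ℕ) (ε : ℝ) : ContDiff ℝ 1 (chi n ε) := by
  unfold chi
  exact Real.smoothTransition.contDiff.comp ((contDiff_const.sub (contDiff_norm_sq ℝ)).div_const ε)

theorem chi_fderiv (n : ℕ) (ε : ℝ) (x : E n) (i : Fin n) :
    fderiv ℝ (chi n ε) x (EuclideanSpace.single i 1) =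
      - (deriv Real.smoothTransition ((1 - ‖x‖^2)/ε) * (2 * x i / ε)) := by
  have h1 : HasFDerivAt (fun x : E n => (1 - ‖x‖^2)/ε) ((-(2 : ℝ) / ε) • (innerSL ℝ x)) x := by
    have := ((hasStrictFDerivAt_norm_sq x).hasFDerivAt.const_sub 1).mul_const ε⁻¹
    refine (this.congr_fderiv ?_)
    ext y
    simp
    ring
  have h2 := (st_hasDeriv ((1 - ‖x‖^2)/ε)).comp_hasFDerivAt x h1
  have : fderiv ℝ (chi n ε) x = _ := h2.fderiv
  rw [this]
  have h3 : inner ℝ x (EuclideanSpace.single i (1:ℝ)) = x i := by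
    rw [real_inner_comm, EuclideanSpace.inner_single_left]; simp
  simp [h3]
  ring

theorem chi_zero (n : ℕ) {ε : ℝ} (hε : 0 < ε) {x : E n} (hx : 1 ≤ ‖x‖) : chi n ε x = 0 := by
  unfold chi
  apply Real.smoothTransition.zero_of_nonpos
  apply div_nonpos_of_nonpos_of_nonneg _ hε.le
  nlinarith

theorem chi_compact (n : ℕ) {ε : ℝ} (hε : 0 < ε) : HasCompactSupport (chi n ε) :=
  HasCompactSupport.intro (isCompact_closedBall (0 : E n) 1) (fun x hx => chi_zero n hε (by
    simp at hx; exact hx.le))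

theorem div_ball_eps {n : ℕ} (hn : 5 ≤ n) (v : E n → ℝ) (hv : ContDiff ℝ 1 v) (i : Fin n) {ε : ℝ}
    (hε : 0 < ε) :
    ∫ x, chi n ε x * fderiv ℝ v x (EuclideanSpace.single i 1) =
    ∫ p : Sp n × ℝ, kst ε p.2 * (p.2 ^ (n-1) * (v (p.2 • (p.1 : E n)) * (p.1 : E n) i))
      ∂((sg n).prod (volume.restrict (Set.Ioi (0:ℝ)))) := by
  have hc := chi_contDiff n ε
  have hcs := chi_compact n hε
  have c1 : Continuous fun x => fderiv ℝ v x (EuclideanSpace.single i 1) :=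
    (hv.continuous_fderiv (by simp)).clm_apply continuous_const
  have c2 : Continuous fun x => fderiv ℝ (chi n ε) x (EuclideanSpace.single i 1) :=
    (hc.continuous_fderiv (by simp)).clm_apply continuous_const
  have s2 : HasCompactSupport fun x => fderiv ℝ (chi n ε) x (EuclideanSpace.single i 1) :=
    (hcs.fderiv ℝ).comp_left (g := fun L : E n →L[ℝ] ℝ => L (EuclideanSpace.single i 1)) (by simp)
  have I1 : Integrable (fun x ↦ fderiv ℝ (chi n ε) x (EuclideanSpace.single i 1) * v x) :=
    (c2.mul hv.continuous).integrable_of_hasCompactSupport s2.mul_right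
  rw [integral_mul_fderiv_eq_neg_fderiv_mul_of_integrable I1
    ((hc.continuous.mul c1).integrable_of_hasCompactSupport hcs.mul_right)
    ((hc.continuous.mul hv.continuous).integrable_of_hasCompactSupport hcs.mul_right)
    (fun x _ => hc.differentiable (by simp) x) (fun x _ => hv.differentiable (by simp) x)]
  have hpol := (polar_integrable hn _ I1.neg).2
  simp only [Pi.neg_apply] at hpol
  rw [← integral_neg, hpol]
  refine integral_congr_ae ?_
  have : ∀ᵐ p : Sp n × ℝ ∂((sg n).prod (volume.restrict (Set.Ioi (0:ℝ)))), 0 < p.2 := by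
    have h := (Measure.quasiMeasurePreserving_snd (μ := sg n) (ν := volume.restrict (Set.Ioi (0:ℝ)))).ae
      (p := fun r => 0 < r) (ae_restrict_mem measurableSet_Ioi)
    exact h
  filter_upwards [this] with p hp
  have hnorm : ‖p.2 • (p.1 : E n)‖ = p.2 := by
    rw [norm_smul, p.1.norm_eq, mul_one, Real.norm_of_nonneg hp.le]
  simp only [chi_fderiv, hnorm, kst]
  simp
  ring

theorem div_ball_glob {n : ℕ} (hn : 5 ≤ n) (v : E n → ℝ) (hv : ContDiff ℝ 1 v) (i : Fin n) :
    ∫ x in ball (0 : E n) 1, fderiv ℝ v x (EuclideanSpace.single i 1) =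
    ∫ ω : Sp n, v ω * (ω : E n) i ∂(sg n) := by
  have c1 : Continuous fun x => fderiv ℝ v x (EuclideanSpace.single i 1) :=
    (hv.continuous_fderiv (by simp)).clm_apply continuous_const
  set e : ℕ → ℝ := fun k => 1 / ((k:ℝ) + 1) with he
  have epos : ∀ k, 0 < e k := fun k => by simp only [he]; positivity
  have ele : ∀ k, e k ≤ 1 := fun k => by
    simp only [he]; rw [div_le_one (by positivity)]; simp
  have elim : Tendsto e atTop (nhds 0) := tendsto_one_div_add_atTop_nhds_zero_nat
  have L1 : Tendsto (fun k => ∫ x, chi n (e k) x * fderiv ℝ v x (EuclideanSpace.single i 1)) atTop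
      (nhds (∫ x in ball (0 : E n) 1, fderiv ℝ v x (EuclideanSpace.single i 1))) := by
    rw [← integral_indicator measurableSet_ball]
    apply tendsto_integral_of_dominated_convergence
      ((closedBall (0 : E n) 1).indicator fun x => ‖fderiv ℝ v x (EuclideanSpace.single i 1)‖)
    · intro k
      exact ((chi_contDiff n (e k)).continuous.mul c1).aestronglyMeasurable
    · rw [integrable_indicator_iff measurableSet_closedBall]
      exact c1.norm.continuousOn.integrableOn_compact (isCompact_closedBall _ _)
    · intro k
      refine ae_of_all _ fun x => ?_
      by_cases hx : x ∈ closedBall (0 : E n) 1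
      · rw [Set.indicator_of_mem hx, norm_mul]
        have : ‖chi n (e k) x‖ ≤ 1 := by
          unfold chi
          rw [Real.norm_of_nonneg (Real.smoothTransition.nonneg _)]
          exact Real.smoothTransition.le_one _
        nlinarith [norm_nonneg (fderiv ℝ v x (EuclideanSpace.single i 1))]
      · rw [Set.indicator_of_notMem hx, chi_zero n (epos k)]
        · simp
        · simp at hx; exact hx.le
    · refine ae_of_all _ fun x => ?_
      by_cases hx : x ∈ ball (0 : E n) 1
      · rw [Set.indicator_of_mem hx]
        refine tendsto_const_nhds.congr' ?_
        have hx' : 0 < 1 - ‖x‖^2 := by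
          simp at hx; nlinarith [norm_nonneg x]
        filter_upwards [elim.eventually (gt_mem_nhds hx')] with k hk
        unfold chi
        rw [Real.smoothTransition.one_of_one_le, one_mul]
        rw [le_div_iff₀ (epos k)]; linarith
      · rw [Set.indicator_of_notMem hx]
        refine tendsto_const_nhds.congr fun k => ?_
        rw [chi_zero n (epos k), zero_mul]
        simpa using hx
  have L2 : Tendsto (fun k => ∫ x, chi n (e k) x * fderiv ℝ v x (EuclideanSpace.single i 1)) atTop
      (nhds (∫ ω : Sp n, v ω * (ω : E n) i ∂(sg n))) := by
    rw [Metric.tendsto_atTop]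
    intro η hη
    set D : E n → ℝ := fun x => ‖x‖^(n-2) * (v x * x i) with hD
    have hDc : Continuous D := by
      have := hv.continuous
      have h2 : Continuous fun x : E n => x i := by fun_prop
      simp only [hD]; fun_prop
    have huc := (isCompact_closedBall (0 : E n) 1).uniformContinuousOn_of_continuous hDc.continuousOn
    rw [Metric.uniformContinuousOn_iff] at huc
    set S := (sg n).real Set.univ with hS
    have hS0 : 0 ≤ S := measureReal_nonneg
    obtain ⟨δ, hδ, huc⟩ := huc (η / (S + 1)) (by positivity)
    obtain ⟨N, hN⟩ := (elim.eventually (gt_mem_nhds hδ)).exists_forall_of_atTop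
    refine ⟨N, fun k hk => ?_⟩
    have hek := hN k hk
    rw [div_ball_eps hn v hv i (epos k)]
    obtain ⟨kI, k1⟩ := kst_integral (epos k) (ele k)
    set μ := (sg n).prod (volume.restrict (Set.Ioi (0:ℝ))) with hμ
    have hvi : Continuous fun ω : Sp n => v ω * (ω : E n) i := by
      have := hv.continuous
      fun_prop
    have hviI : Integrable (fun ω : Sp n => v ω * (ω : E n) i) (sg n) :=
      hvi.integrable_of_hasCompactSupport (HasCompactSupport.of_compactSpace _)
    have r1 : ∫ ω : Sp n, v ω * (ω : E n) i ∂(sg n) = ∫ p : Sp n × ℝ, (v p.1 * (p.1 : E n) i) * kst (e k) p.2 ∂μ := by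
      rw [hμ, integral_prod_mul (fun ω : Sp n => v ω * (ω : E n) i) (kst (e k)), k1, mul_one]
    have r1I : Integrable (fun p : Sp n × ℝ => (v p.1 * (p.1 : E n) i) * kst (e k) p.2) μ :=
      hviI.mul_prod kI
    have kI2 : Integrable (fun p : Sp n × ℝ => kst (e k) p.2) μ := by
      have := (integrable_const (1:ℝ) (μ := sg n)).mul_prod kI
      simpa using this
    have hae : ∀ᵐ p : Sp n × ℝ ∂μ, 0 < p.2 := by
      have h := (Measure.quasiMeasurePreserving_snd (μ := sg n) (ν := volume.restrict (Set.Ioi (0:ℝ)))).ae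
        (p := fun r => 0 < r) (ae_restrict_mem measurableSet_Ioi)
      exact h
    have key : ∀ᵐ p : Sp n × ℝ ∂μ, ‖kst (e k) p.2 * (p.2 ^ (n-1) * (v (p.2 • (p.1 : E n)) * (p.1 : E n) i)) - (v p.1 * (p.1 : E n) i) * kst (e k) p.2‖ ≤ η / (S+1) * kst (e k) p.2 := by
      filter_upwards [hae] with p hp
      have kn := kst_nonneg (epos k) hp.le
      by_cases hz : 1 < p.2 ∨ (0 ≤ p.2 ∧ p.2 < 1 - e k)
      · rw [kst_zero (epos k) hz]; simp
      · push Not at hz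
        obtain ⟨z1, z2⟩ := hz
        have z2 := z2 hp.le
        have hnorm : ‖p.2 • (p.1 : E n)‖ = p.2 := by
          rw [norm_smul, p.1.norm_eq, mul_one, Real.norm_of_nonneg hp.le]
        have hd := huc (p.2 • (p.1 : E n)) (by simp [hnorm, z1]) p.1 (by simp) (by
          rw [dist_eq_norm]
          have : p.2 • (p.1 : E n) - p.1 = (p.2 - 1) • (p.1 : E n) := by
            rw [sub_smul, one_smul]
          rw [this, norm_smul, p.1.norm_eq, mul_one, Real.norm_eq_abs, abs_lt]
          constructor <;> linarith)
        have e1 : D (p.2 • (p.1 : E n)) = p.2 ^ (n-1) * (v (p.2 • (p.1 : E n)) * (p.1 : E n) i) := by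
          simp only [hD, hnorm]
          have : n - 1 = (n - 2) + 1 := by omega
          rw [this, pow_succ]
          simp; ring
        have e2 : D p.1 = v p.1 * (p.1 : E n) i := by
          simp only [hD]; simp
        rw [e1, e2, Real.dist_eq] at hd
        rw [mul_comm (v p.1 * (p.1 : E n) i), ← mul_sub, norm_mul, Real.norm_of_nonneg kn, mul_comm]
        exact mul_le_mul_of_nonneg_right hd.le kn
    have m1 : Integrable (fun p : Sp n × ℝ => kst (e k) p.2 * (p.2 ^ (n-1) * (v (p.2 • (p.1 : E n)) * (p.1 : E n) i)) - (v p.1 * (p.1 : E n) i) * kst (e k) p.2) μ := by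
      refine (kI2.const_mul (η / (S+1))).mono' ?_ key
      have := hv.continuous
      have := kst_cont (e k)
      apply Continuous.aestronglyMeasurable
      fun_prop
    have m2 : Integrable (fun p : Sp n × ℝ => kst (e k) p.2 * (p.2 ^ (n-1) * (v (p.2 • (p.1 : E n)) * (p.1 : E n) i))) μ := by
      refine (m1.add r1I).congr (ae_of_all _ fun p => ?_)
      simp
    rw [r1, Real.dist_eq, ← integral_sub m2 r1I]
    calc _ ≤ ∫ p : Sp n × ℝ, η / (S+1) * kst (e k) p.2 ∂μ := 
          norm_integral_le_of_norm_le (kI2.const_mul _) key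
      _ = η / (S+1) * S := by
          rw [integral_const_mul, hμ]
          have := integral_prod_mul (μ := sg n) (ν := volume.restrict (Set.Ioi (0:ℝ))) (fun _ => (1:ℝ)) (kst (e k))
          simp only [one_mul] at this
          rw [this, k1]
          simp [hS]
      _ < η := by
          rw [div_mul_eq_mul_div, div_lt_iff₀ (by positivity)]
          nlinarith
  exact tendsto_nhds_unique L1 L2

theorem fderiv_sum_coord {n : ℕ} (L : E n →L[ℝ] ℝ) (x : E n) :
    ∑ i, L (EuclideanSpace.single i 1) * x i = L x := by
  conv_rhs => rw [← (EuclideanSpace.basisFun (Fin n) ℝ).sum_repr x]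
  rw [map_sum]
  refine Finset.sum_congr rfl fun i _ => ?_
  simp [mul_comm]

theorem green_glob {n : ℕ} (hn : 5 ≤ n) (a b : E n → ℝ) (ha : ContDiff ℝ 2 a) (hb : ContDiff ℝ 2 b) :
    ∫ x in ball (0 : E n) 1, (a x * lap n b x - b x * lap n a x) =
    ∫ ω : Sp n, (a ω * fderiv ℝ b ω ω - b ω * fderiv ℝ a ω ω) ∂(sg n) := by
  have da : ∀ i, ContDiff ℝ 1 fun x => fderiv ℝ a x (EuclideanSpace.single i 1) := fun i =>
    (ha.fderiv_right (m := 1) (by norm_num)).clm_apply contDiff_const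
  have db : ∀ i, ContDiff ℝ 1 fun x => fderiv ℝ b x (EuclideanSpace.single i 1) := fun i =>
    (hb.fderiv_right (m := 1) (by norm_num)).clm_apply contDiff_const
  have a1 := ha.of_le (m := 1) (by norm_num)
  have b1 := hb.of_le (m := 1) (by norm_num)
  set v : Fin n → E n → ℝ := fun i x => a x * fderiv ℝ b x (EuclideanSpace.single i 1) -
    b x * fderiv ℝ a x (EuclideanSpace.single i 1) with hv
  have cv : ∀ i, ContDiff ℝ 1 (v i) := fun i => (a1.mul (db i)).sub (b1.mul (da i))
  have h1 : ∀ i x, fderiv ℝ (v i) x (EuclideanSpace.single i 1) = 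
      a x * fderiv ℝ (fun y => fderiv ℝ b y (EuclideanSpace.single i 1)) x (EuclideanSpace.single i 1)
      - b x * fderiv ℝ (fun y => fderiv ℝ a y (EuclideanSpace.single i 1)) x (EuclideanSpace.single i 1) := by
    intro i x
    have dda := (da i).differentiable (by simp) x |>.hasFDerivAt
    have ddb := (db i).differentiable (by simp) x |>.hasFDerivAt
    have d1 := a1.differentiable (by simp) x |>.hasFDerivAt
    have d2 := b1.differentiable (by simp) x |>.hasFDerivAt
    have := ((d1.mul ddb).sub (d2.mul dda)).fderiv
    have e : fderiv ℝ (v i) x = _ := this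
    rw [e]
    simp
    ring
  have h2 : ∀ x, (a x * lap n b x - b x * lap n a x) = ∑ i, fderiv ℝ (v i) x (EuclideanSpace.single i 1) := by
    intro x
    simp only [h1, lap, Finset.mul_sum, Finset.sum_sub_distrib]
  have h3 : ∀ ω : Sp n, (a ω * fderiv ℝ b ω ω - b ω * fderiv ℝ a ω ω) = ∑ i, v i ω * (ω : E n) i := by
    intro ω
    rw [← fderiv_sum_coord (fderiv ℝ b ω), ← fderiv_sum_coord (fderiv ℝ a ω)]
    simp only [Finset.mul_sum, ← Finset.sum_sub_distrib, hv]
    refine Finset.sum_congr rfl fun i _ => ?_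
    ring
  simp only [h2, h3]
  rw [integral_finsetSum, integral_finsetSum]
  · exact Finset.sum_congr rfl fun i _ => div_ball_glob hn (v i) (cv i) i
  · intro i _
    apply Continuous.integrable_of_hasCompactSupport _ (HasCompactSupport.of_compactSpace _)
    have := (cv i).continuous
    fun_prop
  · intro i _
    have c : Continuous fun x => fderiv ℝ (v i) x (EuclideanSpace.single i 1) :=
      ((cv i).continuous_fderiv (by simp)).clm_apply continuous_const
    exact (c.continuousOn.integrableOn_compact (isCompact_closedBall (0 : E n) 1)).mono_set ball_subset_closedBall

theorem extend_glob {n : ℕ} {R : ℝ} (hR : 1 < R) (a : E n → ℝ) (ha : ContDiffOn ℝ 2 a (ball 0 R)) :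
    ∃ b : E n → ℝ, ContDiff ℝ 2 b ∧ ∀ x ∈ closedBall (0 : E n) 1, b =ᶠ[nhds x] a := by
  let χ : ContDiffBump (0 : E n) := ⟨1 + (R-1)/3, 1 + 2*(R-1)/3, by linarith, by linarith⟩
  refine ⟨fun x => χ x * a x, ?_, ?_⟩
  · rw [contDiff_iff_contDiffAt]
    intro x
    by_cases hx : x ∈ ball (0 : E n) R
    · exact χ.contDiff.contDiffAt.mul (ha.contDiffAt (isOpen_ball.mem_nhds hx))
    · have : (fun x => χ x * a x) =ᶠ[nhds x] fun _ => 0 := by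
        have hx' : x ∈ (closedBall (0 : E n) (1 + 2*(R-1)/3))ᶜ := by
          simp at hx ⊢; linarith
        filter_upwards [isClosed_closedBall.isOpen_compl.mem_nhds hx'] with y hy
        have : χ y = 0 := by
          apply χ.zero_of_le_dist
          simp at hy
          simp [χ]; linarith
        rw [this, zero_mul]
      exact contDiffAt_const.congr_of_eventuallyEq this
  · intro x hx
    have hx' : x ∈ ball (0 : E n) (1 + (R-1)/3) := by
      simp at hx ⊢; linarith
    filter_upwards [isOpen_ball.mem_nhds hx'] with y hy
    have : χ y = 1 := by
      apply χ.one_of_mem_closedBall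
      exact ball_subset_closedBall hy
    rw [this, one_mul]

theorem lap_congr {n : ℕ} {a b : E n → ℝ} {x : E n} (h : a =ᶠ[nhds x] b) : lap n a x = lap n b x := by
  unfold lap
  refine Finset.sum_congr rfl fun i _ => ?_
  have : (fun y => fderiv ℝ a y (EuclideanSpace.single i 1)) =ᶠ[nhds x]
      (fun y => fderiv ℝ b y (EuclideanSpace.single i 1)) := by
    filter_upwards [h.eventuallyEq_nhds] with y hy
    rw [hy.fderiv_eq]
  rw [this.fderiv_eq]

theorem green {n : ℕ} (hn : 5 ≤ n) {R : ℝ} (hR : 1 < R) (a b : E n → ℝ)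
    (ha : ContDiffOn ℝ 2 a (ball 0 R)) (hb : ContDiffOn ℝ 2 b (ball 0 R)) :
    ∫ x in ball (0 : E n) 1, (a x * lap n b x - b x * lap n a x) =
    ∫ ω : Sp n, (a ω * fderiv ℝ b ω ω - b ω * fderiv ℝ a ω ω) ∂(sg n) := by
  obtain ⟨a', ca, ea⟩ := extend_glob hR a ha
  obtain ⟨b', cb, eb⟩ := extend_glob hR b hb
  have := green_glob hn a' b' ca cb
  rw [setIntegral_congr_fun (g := fun x => a' x * lap n b' x - b' x * lap n a' x) measurableSet_ball, this]
  · refine integral_congr_ae (ae_of_all _ fun ω => ?_)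
    have h := ea (ω : E n) (by simp)
    have h' := eb (ω : E n) (by simp)
    simp only [h.fderiv_eq, h'.fderiv_eq, h.eq_of_nhds, h'.eq_of_nhds]
  · intro x hx
    have h := ea x (ball_subset_closedBall hx)
    have h' := eb x (ball_subset_closedBall hx)
    simp only [lap_congr h, lap_congr h', h.eq_of_nhds, h'.eq_of_nhds]

theorem inner_single_right' {n : ℕ} (x : E n) (i : Fin n) :
    inner ℝ x (EuclideanSpace.single i (1:ℝ)) = x i := by
  rw [real_inner_comm, EuclideanSpace.inner_single_left]; simp

/-- model function `(α + β ⟨y-p,p⟩) |y-p|^(2c)` -/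
def mf {n : ℕ} (p : E n) (α β c : ℝ) (y : E n) : ℝ :=
  (α + β * inner ℝ (y - p) p) * (‖y - p‖^2) ^ c

theorem q_hasFDerivAt {n : ℕ} (p y : E n) :
    HasFDerivAt (fun y : E n => ‖y - p‖^2) ((2:ℝ) • innerSL ℝ (y - p)) y := by
  have h := (hasStrictFDerivAt_norm_sq (y - p)).hasFDerivAt
  have h2 : HasFDerivAt (fun y : E n => y - p) (ContinuousLinearMap.id ℝ (E n)) y :=
    (hasFDerivAt_id y).sub_const p
  have := h.comp y h2
  refine this.congr_fderiv ?_
  ext z; simp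

theorem qpow_hasFDerivAt {n : ℕ} (p y : E n) (c : ℝ) (hy : y ≠ p) :
    HasFDerivAt (fun y : E n => (‖y - p‖^2) ^ c)
      ((c * (‖y - p‖^2)^(c-1) * 2) • innerSL ℝ (y - p)) y := by
  have hq : ‖y - p‖^2 ≠ 0 := by
    simpa [sub_eq_zero] using hy
  have := (q_hasFDerivAt p y).rpow_const (p := c) (Or.inl hq)
  refine this.congr_fderiv ?_
  rw [smul_smul]

theorem lin_hasFDerivAt {n : ℕ} (p y : E n) (α β : ℝ) :
    HasFDerivAt (fun y : E n => α + β * inner ℝ (y - p) p) (β • innerSL ℝ p) y := by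
  have h2 : HasFDerivAt (fun y : E n => y - p) (ContinuousLinearMap.id ℝ (E n)) y :=
    (hasFDerivAt_id y).sub_const p
  have h3 := ((h2.inner ℝ (hasFDerivAt_const p y)).const_mul β).const_add α
  refine h3.congr_fderiv ?_
  ext z; simp [real_inner_comm]

theorem mf_contDiffOn {n : ℕ} (p : E n) (α β c : ℝ) : ContDiffOn ℝ 2 (mf p α β c) {p}ᶜ := by
  unfold mf
  apply ContDiffOn.mul
  · exact (contDiff_const.add (contDiff_const.mul ((contDiff_id.sub contDiff_const).inner ℝ contDiff_const))).contDiffOn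
  · apply ContDiffOn.rpow_const_of_ne
    · exact ((contDiff_id.sub contDiff_const).norm_sq ℝ).contDiffOn
    · intro y hy
      have : y ≠ p := hy
      simpa [sub_eq_zero] using this

theorem mf_fderiv {n : ℕ} (p y : E n) (α β c : ℝ) (hy : y ≠ p) (v : E n) :
    fderiv ℝ (mf p α β c) y v = β * inner ℝ p v * (‖y - p‖^2)^c +
      (α + β * inner ℝ (y - p) p) * (c * (‖y - p‖^2)^(c-1) * 2 * inner ℝ (y-p) v) := by
  have := ((lin_hasFDerivAt p y α β).mul (qpow_hasFDerivAt p y c hy)).fderiv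
  have e : fderiv ℝ (mf p α β c) y = _ := this
  rw [e]; simp only [add_apply, smul_apply, innerSL_apply_apply, smul_eq_mul]; ring

theorem coord_hasFDerivAt {n : ℕ} (p y : E n) (i : Fin n) :
    HasFDerivAt (fun y : E n => (y - p) i) (innerSL ℝ (EuclideanSpace.single i (1:ℝ))) y := by
  have h2 : HasFDerivAt (fun y : E n => y - p) (ContinuousLinearMap.id ℝ (E n)) y :=
    (hasFDerivAt_id y).sub_const p
  have h3 := ((hasFDerivAt_const (EuclideanSpace.single i (1:ℝ)) y).inner ℝ h2)
  have e : (fun y : E n => (y - p) i) = fun y => inner ℝ (EuclideanSpace.single i (1:ℝ)) (y - p) := by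
    ext y; rw [real_inner_comm, inner_single_right']
  rw [e]
  refine h3.congr_fderiv ?_
  ext z; simp

theorem mf_second {n : ℕ} (p y : E n) (α β c : ℝ) (hy : y ≠ p) (i : Fin n) :
    fderiv ℝ (fun z => fderiv ℝ (mf p α β c) z (EuclideanSpace.single i 1)) y
      (EuclideanSpace.single i 1) =
    4 * c * β * (‖y - p‖^2)^(c-1) * (p i * (y - p) i) +
    (α + β * inner ℝ (y - p) p) * (2 * c * (‖y - p‖^2)^(c-1) +
      4 * c * (c-1) * (‖y - p‖^2)^(c-2) * ((y - p) i)^2) := by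
  have ev : (fun z => fderiv ℝ (mf p α β c) z (EuclideanSpace.single i 1)) =ᶠ[nhds y]
      fun y => (β * p i) * (‖y - p‖^2)^c +
      ((α + β * inner ℝ (y - p) p) * ((2 * c) * ((‖y - p‖^2)^(c-1) * (y-p) i))) := by
    filter_upwards [isOpen_ne.mem_nhds hy] with z hz
    rw [mf_fderiv p z α β c hz, inner_single_right', inner_single_right']
    ring
  rw [ev.fderiv_eq]
  have := (((qpow_hasFDerivAt p y c hy).const_mul (β * p i)).add
    ((lin_hasFDerivAt p y α β).mul
      (((qpow_hasFDerivAt p y (c-1) hy).mul (coord_hasFDerivAt p y i)).const_mul (2*c)))).fderiv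
  have e : fderiv ℝ (fun y => (β * p i) * (‖y - p‖^2)^c +
      ((α + β * inner ℝ (y - p) p) * ((2 * c) * ((‖y - p‖^2)^(c-1) * (y-p) i)))) y = _ := this
  rw [e]
  have : c - 1 - 1 = c - 2 := by ring
  simp only [add_apply, smul_apply, innerSL_apply_apply, inner_single_right', smul_eq_mul, this, Pi.mul_apply]
  have h1 : (EuclideanSpace.single i (1:ℝ)) i = (1:ℝ) := by simp
  rw [h1]
  ring

theorem mf_lap {n : ℕ} (p y : E n) (α β c : ℝ) (hy : y ≠ p) :
    lap n (mf p α β c) y = 4 * c * β * (‖y - p‖^2)^(c-1) * inner ℝ (y - p) p + 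
     (α + β * inner ℝ (y - p) p) * (2 * c * (n + 2 * c - 2)) * (‖y - p‖^2)^(c-1) := by
  unfold lap
  simp only [mf_second p y α β c hy]
  have hq : 0 < ‖y - p‖^2 := by
    have : 0 < ‖y - p‖ := norm_pos_iff.2 (sub_ne_zero.2 hy)
    positivity
  have h1 : ∑ i, p i * (y - p) i = inner ℝ (y - p) p := by
    rw [PiLp.inner_apply]
    rfl
  have h2 : ∑ i, ((y - p) i)^2 = ‖y - p‖^2 := by
    rw [EuclideanSpace.norm_sq_eq]
    simp
  have h3 : (‖y - p‖^2)^(c-1) = (‖y - p‖^2)^(c-2) * ‖y - p‖^2 := by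
    rw [← Real.rpow_add_one hq.ne']; congr 1; ring
  rw [Finset.sum_add_distrib, ← Finset.mul_sum, ← Finset.mul_sum, Finset.sum_add_distrib, ← Finset.mul_sum Finset.univ (fun i => ((y - p) i)^2), h1, h2, h3]
  simp only [Finset.sum_const, Finset.card_univ, Fintype.card_fin, nsmul_eq_mul]
  ring

theorem lap_add {n : ℕ} {a b : E n → ℝ} {x : E n} (ha : ContDiffAt ℝ 2 a x) (hb : ContDiffAt ℝ 2 b x) :
    lap n (fun y => a y + b y) x = lap n a x + lap n b x := by
  unfold lap
  rw [← Finset.sum_add_distrib]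
  refine Finset.sum_congr rfl fun i _ => ?_
  have ev : (fun y => fderiv ℝ (fun y => a y + b y) y (EuclideanSpace.single i 1)) =ᶠ[nhds x]
     fun y => fderiv ℝ a y (EuclideanSpace.single i 1) + fderiv ℝ b y (EuclideanSpace.single i 1) := by
    filter_upwards [ha.eventually (by simp), hb.eventually (by simp)] with y h1 h2
    rw [fderiv_fun_add (h1.differentiableAt (by simp)) (h2.differentiableAt (by simp))]
    simp
  rw [ev.fderiv_eq]
  have da : DifferentiableAt ℝ (fun y => fderiv ℝ a y (EuclideanSpace.single i 1)) x :=
    ((ha.fderiv_right (m := 1) (by norm_num)).clm_apply contDiffAt_const).differentiableAt (by simp)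
  have db : DifferentiableAt ℝ (fun y => fderiv ℝ b y (EuclideanSpace.single i 1)) x :=
    ((hb.fderiv_right (m := 1) (by norm_num)).clm_apply contDiffAt_const).differentiableAt (by simp)
  rw [fderiv_fun_add da db]
  simp

theorem fderiv_scale {n : ℕ} (a : E n → ℝ) (t : ℝ) (y v : E n) :
    fderiv ℝ (fun y => a (t • y)) y v = t * fderiv ℝ a (t • y) v := by
  rw [fderiv_comp_smul]; simp

theorem lap_scale {n : ℕ} (a : E n → ℝ) (t : ℝ) (y : E n) :
    lap n (fun y => a (t • y)) y = t^2 * lap n a (t • y) := by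
  unfold lap
  simp only [fderiv_scale]
  rw [Finset.mul_sum]
  refine Finset.sum_congr rfl fun i _ => ?_
  have h := fderiv_scale (fun z => t * fderiv ℝ a z (EuclideanSpace.single i 1)) t y (EuclideanSpace.single i 1)
  refine h.trans ?_
  have h2 : fderiv ℝ (fun z => t * fderiv ℝ a z (EuclideanSpace.single i 1)) (t • y) =
      t • fderiv ℝ (fun z => fderiv ℝ a z (EuclideanSpace.single i 1)) (t • y) := by
    exact congrFun (fderiv_const_smul_field (𝕜 := ℝ) (f := fun z => fderiv ℝ a z (EuclideanSpace.single i 1)) t) (t • y)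
  rw [h2]
  simp only [smul_apply, smul_eq_mul]
  ring

theorem deriv_under {X : Type*} [TopologicalSpace X] [CompactSpace X] [MeasurableSpace X]
    [OpensMeasurableSpace X] (μ : Measure X) [IsFiniteMeasure μ]
    {a b : ℝ} (F F' : ℝ → X → ℝ) (hF : ∀ t ∈ Set.Ioo a b, ∀ x, HasDerivAt (fun t => F t x) (F' t x) t)
    (hc : ∀ t ∈ Set.Ioo a b, Continuous (F t))
    (hF' : ContinuousOn (fun p : ℝ × X => F' p.1 p.2) (Set.Ioo a b ×ˢ Set.univ))
    {t : ℝ} (ht : t ∈ Set.Ioo a b) :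
    HasDerivAt (fun t => ∫ x, F t x ∂μ) (∫ x, F' t x ∂μ) t := by
  obtain ⟨ε, hε, hb⟩ := Metric.nhds_basis_closedBall.mem_iff.1 (isOpen_Ioo.mem_nhds ht)
  have hcomp : IsCompact (closedBall t ε ×ˢ (Set.univ : Set X)) :=
    (isCompact_closedBall t ε).prod isCompact_univ
  obtain ⟨C, hC⟩ := hcomp.exists_bound_of_continuousOn (hF'.mono (Set.prod_mono hb le_rfl))
  have hF't : Continuous (F' t) := by
    have : ContinuousOn (fun x : X => F' t x) Set.univ :=
      hF'.comp (f := fun x : X => (t, x)) (by fun_prop) (fun x _ => ⟨ht, trivial⟩)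
    rwa [continuousOn_univ] at this
  refine (hasDerivAt_integral_of_dominated_loc_of_deriv_le (F := F) (F' := F') (bound := fun _ => C)
    (s := ball t ε) (ball_mem_nhds t hε) ?_ ?_ ?_ ?_ ?_ ?_).2
  · filter_upwards [isOpen_Ioo.mem_nhds ht] with s hs
    exact (hc s hs).aestronglyMeasurable_of_compactSpace
  · exact ((hc t ht).integrable_of_hasCompactSupport (HasCompactSupport.of_compactSpace _))
  · exact hF't.aestronglyMeasurable_of_compactSpace
  · exact ae_of_all _ fun x s hs => hC (s, x) ⟨ball_subset_closedBall hs, trivial⟩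
  · exact integrable_const _
  · exact ae_of_all _ fun x s hs => hF s (hb (ball_subset_closedBall hs)) x

structure Harm {n : ℕ} (v : E n → ℝ) : Prop where
  cd : ContDiffOn ℝ 2 v (ball 0 1)
  lap0 : ∀ y ∈ ball (0 : E n) 1, lap n v y = 0

theorem Harm.one {n : ℕ} : Harm (fun _ : E n => (1:ℝ)) := by
  refine ⟨contDiffOn_const, fun y _ => ?_⟩
  unfold lap
  simp

theorem harm_const {n : ℕ} (hn : 5 ≤ n) {v w : E n → ℝ} (hv : Harm v) (hw : Harm w) {c : ℝ} (hc : 0 < c)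
    {s t : ℝ} (hs : s ∈ Set.Ioo c 1) (ht : t ∈ Set.Ioo c 1) :
    ∫ y : Sp n, v (s • (y : E n)) * w ((c/s) • (y : E n)) ∂(sg n) =
    ∫ y : Sp n, v (t • (y : E n)) * w ((c/t) • (y : E n)) ∂(sg n) := by
  set F : ℝ → Sp n → ℝ := fun s y => v (s • (y : E n)) * w ((c/s) • (y : E n)) with hF
  set F' : ℝ → Sp n → ℝ := fun s y => fderiv ℝ v (s • (y : E n)) y * w ((c/s) • (y : E n)) +
    v (s • (y : E n)) * ((-c/s^2) * fderiv ℝ w ((c/s) • (y : E n)) y) with hF'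
  have mem1 : ∀ s ∈ Set.Ioo c 1, ∀ y : Sp n, s • (y : E n) ∈ ball (0 : E n) 1 := by
    intro s hs y
    have : 0 < s := hc.trans hs.1
    simp [norm_smul, abs_of_pos this, hs.2]
  have mem2 : ∀ s ∈ Set.Ioo c 1, ∀ y : Sp n, (c/s) • (y : E n) ∈ ball (0 : E n) 1 := by
    intro s hs y
    have h0 : 0 < s := hc.trans hs.1
    simp only [mem_ball_zero_iff, norm_smul, y.norm_eq, mul_one, Real.norm_eq_abs]
    rw [abs_of_pos (by positivity), div_lt_one h0]
    exact hs.1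
  have dv : ∀ z ∈ ball (0 : E n) 1, HasFDerivAt v (fderiv ℝ v z) z := fun z hz =>
    ((hv.cd.contDiffAt (isOpen_ball.mem_nhds hz)).differentiableAt (by simp)).hasFDerivAt
  have dw : ∀ z ∈ ball (0 : E n) 1, HasFDerivAt w (fderiv ℝ w z) z := fun z hz =>
    ((hw.cd.contDiffAt (isOpen_ball.mem_nhds hz)).differentiableAt (by simp)).hasFDerivAt
  have cv : ContinuousOn (fderiv ℝ v) (ball 0 1) :=
    hv.cd.continuousOn_fderiv_of_isOpen isOpen_ball (by norm_num)
  have cw : ContinuousOn (fderiv ℝ w) (ball 0 1) :=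
    hw.cd.continuousOn_fderiv_of_isOpen isOpen_ball (by norm_num)
  have hsn : ∀ s ∈ Set.Ioo c 1, s ≠ 0 := fun s hs => (hc.trans hs.1).ne'
  have c1 : ContinuousOn (fun p : ℝ × Sp n => p.1 • (p.2 : E n)) (Set.Ioo c 1 ×ˢ Set.univ) := by fun_prop
  have c2 : ContinuousOn (fun p : ℝ × Sp n => (c / p.1) • (p.2 : E n)) (Set.Ioo c 1 ×ˢ Set.univ) := by
    apply ContinuousOn.fun_smul
    · exact continuousOn_const.div continuousOn_fst (fun p hp => hsn _ hp.1)
    · fun_prop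
  have c3 : ContinuousOn (fun p : ℝ × Sp n => (p.2 : E n)) (Set.Ioo c 1 ×ˢ Set.univ) := by fun_prop
  have m1 : Set.MapsTo (fun p : ℝ × Sp n => p.1 • (p.2 : E n)) (Set.Ioo c 1 ×ˢ Set.univ) (ball 0 1) :=
    fun p hp => mem1 _ hp.1 _
  have m2 : Set.MapsTo (fun p : ℝ × Sp n => (c / p.1) • (p.2 : E n)) (Set.Ioo c 1 ×ˢ Set.univ) (ball 0 1) :=
    fun p hp => mem2 _ hp.1 _
  have C1 := hv.cd.continuousOn.comp c1 m1
  have C2 := hw.cd.continuousOn.comp c2 m2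
  have C1' := (cv.comp c1 m1).clm_apply c3
  have C2' := (cw.comp c2 m2).clm_apply c3
  have cF : ContinuousOn (fun p : ℝ × Sp n => F p.1 p.2) (Set.Ioo c 1 ×ˢ Set.univ) := C1.mul C2
  have cF' : ContinuousOn (fun p : ℝ × Sp n => F' p.1 p.2) (Set.Ioo c 1 ×ˢ Set.univ) := by
    refine (C1'.mul C2).add (C1.mul (ContinuousOn.mul ?_ C2'))
    exact continuousOn_const.div (continuousOn_fst.pow 2) (fun p hp => pow_ne_zero 2 (hsn _ hp.1))
  have hderiv : ∀ s ∈ Set.Ioo c 1, HasDerivAt (fun s => ∫ y, F s y ∂(sg n)) 0 s := by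
    intro s hs
    have h0 : 0 < s := hc.trans hs.1
    have := deriv_under (sg n) F F' (a := c) (b := 1) ?_ ?_ cF' hs
    · convert this using 1
      symm
      have hR : 1 < min (1/s) (s/c) := by
        rw [lt_min_iff]
        exact ⟨by rw [lt_div_iff₀ h0]; linarith [hs.2], by rw [lt_div_iff₀ hc]; linarith [hs.1]⟩
      have cda : ContDiffOn ℝ 2 (fun y => v (s • y)) (ball 0 (min (1/s) (s/c))) := by
        refine hv.cd.comp (f := fun y : E n => s • y) (contDiff_const_smul s).contDiffOn fun y hy => ?_
        simp only [mem_ball_zero_iff, norm_smul, Real.norm_eq_abs, abs_of_pos h0] at hy ⊢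
        have := hy.trans_le (min_le_left _ _)
        rw [lt_div_iff₀ h0] at this
        linarith
      have cdb : ContDiffOn ℝ 2 (fun y => w ((c/s) • y)) (ball 0 (min (1/s) (s/c))) := by
        refine hw.cd.comp (f := fun y : E n => (c/s) • y) (contDiff_const_smul (c/s)).contDiffOn fun y hy => ?_
        have hcs : 0 < c / s := by positivity
        simp only [mem_ball_zero_iff, norm_smul, Real.norm_eq_abs, abs_of_pos hcs] at hy ⊢
        have := hy.trans_le (min_le_right _ _)
        rw [lt_div_iff₀ hc] at this
        rw [div_mul_eq_mul_div, div_lt_one h0]; linarith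
      have G := green hn hR _ _ cda cdb
      have L : ∫ x in ball (0 : E n) 1, (v (s • x) * lap n (fun y => w ((c/s) • y)) x - w ((c/s) • x) * lap n (fun y => v (s • y)) x) = 0 := by
        rw [setIntegral_congr_fun (g := fun _ => (0:ℝ)) measurableSet_ball]
        · simp
        · intro x hx
          have hx' : ‖x‖ < 1 := by simpa using hx
          have e1 : lap n v (s • x) = 0 := hv.lap0 _ (by
            simp only [mem_ball_zero_iff, norm_smul, Real.norm_eq_abs, abs_of_pos h0]
            nlinarith [hs.2, norm_nonneg x])
          have e2 : lap n w ((c/s) • x) = 0 := hw.lap0 _ (by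
            have hcs : 0 < c / s := by positivity
            have hcs1 : c / s < 1 := by rw [div_lt_one h0]; exact hs.1
            simp only [mem_ball_zero_iff, norm_smul, Real.norm_eq_abs, abs_of_pos hcs]
            nlinarith [norm_nonneg x])
          simp only [lap_scale, e1, e2]; ring
      rw [L] at G
      have : ∀ y : Sp n, F' s y = (-1/s) * (v (s • (y : E n)) * fderiv ℝ (fun y => w ((c/s) • y)) y y - w ((c/s) • (y : E n)) * fderiv ℝ (fun y => v (s • y)) y y) := by
        intro y
        rw [fderiv_scale, fderiv_scale]
        simp only [hF']
        field_simp
        ring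
      simp only [this]
      rw [integral_const_mul, ← G, mul_zero]
    · intro t ht y
      have g1 : HasDerivAt (fun t : ℝ => t • (y : E n)) (y : E n) t := by
        simpa using (hasDerivAt_id t).smul_const (y : E n)
      have g2 : HasDerivAt (fun t : ℝ => (c/t) • (y : E n)) ((-c/t^2) • (y : E n)) t := by
        have : HasDerivAt (fun t : ℝ => c / t) (-c/t^2) t := by
          have := (hasDerivAt_inv (hsn t ht)).const_mul c
          refine (this.congr_deriv ?_).congr_of_eventuallyEq ?_
          · ring
          · exact Eventually.of_forall fun x => by simp [div_eq_mul_inv]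
        exact this.smul_const _
      have k1 := (dv _ (mem1 t ht y)).comp_hasDerivAt t g1
      have k2 := (dw _ (mem2 t ht y)).comp_hasDerivAt t g2
      have := k1.mul k2
      refine this.congr_deriv ?_
      simp [hF']
    · intro t ht
      have : ContinuousOn (fun x : Sp n => F t x) Set.univ :=
        cF.comp (f := fun x : Sp n => (t, x)) (by fun_prop) (fun x _ => ⟨ht, trivial⟩)
      rwa [continuousOn_univ] at this
  have := isOpen_Ioo.is_const_of_deriv_eq_zero (f := fun s => ∫ y, F s y ∂(sg n)) isPreconnected_Ioo
    (fun s hs => (hderiv s hs).differentiableAt.differentiableWithinAt)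
    (fun s hs => (hderiv s hs).deriv) hs ht
  exact this

def qz (z r : ℝ) : ℝ := (1-r)^2 + r*z
def Pk (n : ℕ) (z r : ℝ) : ℝ := (1-r^2) * (qz z r)^(-(n:ℝ)/2)
def zz {n : ℕ} (x y : Sp n) : ℝ := ‖(x:E n) - y‖^2
def PE {n : ℕ} (x : E n) (y : E n) : ℝ := (1 - ‖y‖^2) * (‖y - x‖^2)^(-(n:ℝ)/2)
def AS (n : ℕ) : ℝ := (sg n).real Set.univ

theorem zz_nonneg {n : ℕ} (x y : Sp n) : 0 ≤ zz x y := by unfold zz; positivity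
theorem zz_symm {n : ℕ} (x y : Sp n) : zz x y = zz y x := by unfold zz; rw [norm_sub_rev]
theorem zz_eq {n : ℕ} (x y : Sp n) : zz x y = 2 - 2 * inner ℝ (x : E n) y := by
  unfold zz
  rw [@norm_sub_sq_real, x.norm_eq, y.norm_eq]; ring
theorem zz_cont {n : ℕ} : Continuous fun p : Sp n × Sp n => zz p.1 p.2 := by unfold zz; fun_prop
theorem zz_le {n : ℕ} (x y : Sp n) : zz x y ≤ 4 := by
  unfold zz
  have : ‖(x : E n) - y‖ ≤ 2 := by
    calc _ ≤ ‖(x : E n)‖ + ‖(y : E n)‖ := norm_sub_le _ _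
      _ = 2 := by rw [x.norm_eq, y.norm_eq]; norm_num
  nlinarith [norm_nonneg ((x : E n) - y)]

theorem qz_pos {z r : ℝ} (hz : 0 ≤ z) (h0 : 0 ≤ r) (h1 : r < 1) : 0 < qz z r := by
  unfold qz
  have : 0 < 1 - r := by linarith
  positivity

theorem Pk_pos {n : ℕ} {z r : ℝ} (hz : 0 ≤ z) (h0 : 0 ≤ r) (h1 : r < 1) : 0 < Pk n z r := by
  unfold Pk
  have := Real.rpow_pos_of_pos (qz_pos hz h0 h1) (-(n:ℝ)/2)
  have : 0 < 1 - r^2 := by nlinarith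
  positivity

theorem normsq_eq_qz {n : ℕ} (x y : Sp n) (r : ℝ) : ‖r • (y : E n) - x‖^2 = qz (zz x y) r := by
  rw [@norm_sub_sq_real, norm_smul, zz_eq, inner_smul_left, x.norm_eq, y.norm_eq, real_inner_comm]
  unfold qz
  simp
  ring

theorem PE_eq {n : ℕ} (x y : Sp n) (r : ℝ) : PE (x : E n) (r • (y : E n)) = Pk n (zz x y) r := by
  unfold PE Pk
  rw [normsq_eq_qz, norm_smul, y.norm_eq]
  simp

theorem PE_harm {n : ℕ} (x : Sp n) : Harm (PE (x : E n)) := by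
  have hsub : ball (0 : E n) 1 ⊆ {(x : E n)}ᶜ := by
    intro y hy h
    have h : y = x := h
    rw [h] at hy; simp at hy
  have he : ∀ y ∈ ball (0 : E n) 1, PE (x : E n) y = mf (x : E n) (-1) 0 (1 - (n:ℝ)/2) y + mf (x : E n) 0 (-2) (-(n:ℝ)/2) y := by
    intro y hy
    have hyx : y ≠ x := hsub hy
    have hq : 0 < ‖y - x‖^2 := by
      have : 0 < ‖y - x‖ := norm_pos_iff.2 (sub_ne_zero.2 hyx)
      positivity
    unfold PE mf
    have h3 : (‖y - x‖^2)^(1 - (n:ℝ)/2) = (‖y - x‖^2)^(-(n:ℝ)/2) * ‖y - x‖^2 := by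
      rw [← Real.rpow_add_one hq.ne']; congr 1; ring
    have h4 : ‖y - x‖^2 = ‖y‖^2 - 2 * inner ℝ y x + 1 := by
      rw [@norm_sub_sq_real, x.norm_eq]; ring
    have h5 : inner ℝ (y - x) (x : E n) = inner ℝ y (x : E n) - 1 := by
      rw [inner_sub_left, x.inner_self]
    rw [h3, h5]
    conv_rhs => 
      rw [show ∀ A : ℝ, (-1 + 0 * (inner ℝ y (x : E n) - 1)) * (A * ‖y - x‖^2) = - A * ‖y - x‖^2 from fun A => by ring, h4]
    rw [h4]
    ring
  have c1 := (mf_contDiffOn (x : E n) (-1) 0 (1 - (n:ℝ)/2)).mono hsub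
  have c2 := (mf_contDiffOn (x : E n) 0 (-2) (-(n:ℝ)/2)).mono hsub
  constructor
  · exact (c1.add c2).congr he
  · intro y hy
    have ev : PE (x : E n) =ᶠ[nhds y] fun y => mf (x : E n) (-1) 0 (1 - (n:ℝ)/2) y + mf (x : E n) 0 (-2) (-(n:ℝ)/2) y := by
      filter_upwards [isOpen_ball.mem_nhds hy] with z hz using he z hz
    rw [lap_congr ev, lap_add (c1.contDiffAt (isOpen_ball.mem_nhds hy)) (c2.contDiffAt (isOpen_ball.mem_nhds hy)),
      mf_lap _ _ _ _ _ (hsub hy), mf_lap _ _ _ _ _ (hsub hy)]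
    ring

theorem qz_cont (r : ℝ) : Continuous fun z => qz z r := by unfold qz; fun_prop

theorem Pk_cont {n : ℕ} {r : ℝ} (h0 : 0 ≤ r) (h1 : r < 1) :
    Continuous fun p : Sp n × Sp n => Pk n (zz p.1 p.2) r := by
  unfold Pk
  apply continuous_const.mul
  apply Continuous.rpow_const
  · exact (qz_cont r).comp zz_cont
  · intro p; left; exact (qz_pos (zz_nonneg _ _) h0 h1).ne'

theorem Pk_cont1 {n : ℕ} {r : ℝ} (h0 : 0 ≤ r) (h1 : r < 1) (x : Sp n) :
    Continuous fun y : Sp n => Pk n (zz x y) r := by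
  unfold Pk
  apply continuous_const.mul
  apply Continuous.rpow_const
  · apply (qz_cont r).comp
    unfold zz
    fun_prop
  · intro p; left; exact (qz_pos (zz_nonneg _ _) h0 h1).ne'

theorem cont_int {n : ℕ} {f : Sp n → ℝ} (hf : Continuous f) : Integrable f (sg n) :=
  hf.integrable_of_hasCompactSupport (HasCompactSupport.of_compactSpace _)

theorem Pk_int {n : ℕ} (hn : 5 ≤ n) {r : ℝ} (h0 : 0 < r) (h1 : r < 1) (x : Sp n) :
    ∫ y, Pk n (zz x y) r ∂(sg n) = AS n := by
  have hconst : ∀ s ∈ Set.Ioo 0 r, ∫ y : Sp n, PE (x : E n) (s • (y : E n)) ∂(sg n) = ∫ y, Pk n (zz x y) r ∂(sg n) := by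
    intro s hs
    have := harm_const hn (PE_harm x) Harm.one (c := s/2) (s := s) (t := r) (by linarith [hs.1]) ⟨by linarith [hs.1], by linarith [hs.2]⟩
      ⟨by linarith [hs.1, hs.2], h1⟩
    simp only [mul_one] at this
    rw [this]
    simp only [PE_eq]
  have hlim : Tendsto (fun s : ℝ => ∫ y : Sp n, PE (x : E n) (s • (y : E n)) ∂(sg n)) (nhdsWithin 0 (Set.Ioi 0)) (nhds (∫ y : Sp n, 1 ∂(sg n))) := by
    have hc : ContinuousOn (PE (x : E n)) (closedBall 0 (1/2)) := by
      refine (PE_harm x).cd.continuousOn.mono ?_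
      intro y hy; simp at hy ⊢; linarith
    obtain ⟨C, hC⟩ := (isCompact_closedBall (0 : E n) (1/2)).exists_bound_of_continuousOn hc
    have mem : ∀ᶠ s : ℝ in nhdsWithin 0 (Set.Ioi 0), 0 < s ∧ s < 1/2 := by
      have : Set.Ioo (0:ℝ) (1/2) ∈ nhdsWithin (0:ℝ) (Set.Ioi 0) := Ioo_mem_nhdsGT (by norm_num)
      exact this
    apply tendsto_integral_filter_of_dominated_convergence (fun _ => C)
    · filter_upwards [mem] with s hs
      simp only [PE_eq]
      exact (Pk_cont1 hs.1.le (by linarith [hs.2]) x).aestronglyMeasurable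
    · filter_upwards [mem] with s hs
      refine ae_of_all _ fun y => hC _ ?_
      simp only [mem_closedBall_zero_iff, norm_smul, y.norm_eq, mul_one, Real.norm_eq_abs, abs_of_pos hs.1]
      exact hs.2.le
    · exact integrable_const _
    · refine ae_of_all _ fun y => ?_
      have h1 : PE (x : E n) 0 = 1 := by unfold PE; simp
      have hca : ContinuousAt (PE (x : E n)) ((0:ℝ) • (y : E n)) := by
        rw [zero_smul]
        exact (PE_harm x).cd.continuousOn.continuousAt (isOpen_ball.mem_nhds (by simp))
      have h2 : ContinuousAt (fun s : ℝ => PE (x : E n) (s • (y : E n))) 0 :=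
        ContinuousAt.comp (f := fun s : ℝ => s • (y : E n)) hca (by fun_prop)
      have := h2.tendsto
      simp only [zero_smul, h1] at this
      exact this.mono_left nhdsWithin_le_nhds
  have hlim2 : Tendsto (fun s : ℝ => ∫ y : Sp n, PE (x : E n) (s • (y : E n)) ∂(sg n)) (nhdsWithin 0 (Set.Ioi 0)) (nhds (∫ y, Pk n (zz x y) r ∂(sg n))) := by
    refine tendsto_const_nhds.congr' ?_
    have : Set.Ioo (0:ℝ) r ∈ nhdsWithin (0:ℝ) (Set.Ioi 0) := Ioo_mem_nhdsGT h0
    filter_upwards [this] with s hs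
    exact (hconst s hs).symm
  rw [tendsto_nhds_unique hlim2 hlim]
  simp [AS]

theorem Pk_far {n : ℕ} {r z δ : ℝ} (h0 : 1/2 ≤ r) (h1 : r < 1) (hδ : 0 < δ) (hz : δ ≤ z) :
    Pk n z r ≤ (1 - r^2) * (δ/2)^(-(n:ℝ)/2) := by
  unfold Pk
  have : 0 ≤ 1 - r^2 := by nlinarith
  apply mul_le_mul_of_nonneg_left _ this
  apply Real.rpow_le_rpow_of_nonpos (by positivity)
  · unfold qz; nlinarith [sq_nonneg (1-r)]
  · have : (0:ℝ) ≤ n := by positivity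
    linarith

theorem AS_nonneg (n : ℕ) : 0 ≤ AS n := measureReal_nonneg

theorem Pk_approx {n : ℕ} (hn : 5 ≤ n) (x : Sp n) (f : Sp n → ℝ) (hf : Continuous f) :
    Tendsto (fun r => ∫ y, Pk n (zz x y) r * f y ∂(sg n)) (nhdsWithin 1 (Set.Iio 1)) (nhds (AS n * f x)) := by
  rw [Metric.tendsto_nhds]
  intro ε hε
  have hS := AS_nonneg n
  obtain ⟨δ, hδ, hfδ⟩ := Metric.continuous_iff.1 hf x (ε / (2 * (AS n + 1))) (by positivity)
  obtain ⟨M, hM⟩ := isCompact_univ.exists_bound_of_continuousOn (hf.continuousOn (s := Set.univ))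
  have hM0 : 0 ≤ M := (norm_nonneg _).trans (hM x trivial)
  set K := (δ^2/2)^(-(n:ℝ)/2) with hK
  have hK0 : 0 ≤ K := Real.rpow_nonneg (by positivity) _
  have hlim : Tendsto (fun r : ℝ => (1 - r^2) * K * (2 * M) * AS n) (nhdsWithin 1 (Set.Iio 1)) (nhds 0) := by
    have : ContinuousAt (fun r : ℝ => (1 - r^2) * K * (2 * M) * AS n) 1 := by fun_prop
    have := this.tendsto
    simp at this
    exact this.mono_left nhdsWithin_le_nhds
  have e1 := hlim.eventually (gt_mem_nhds (show (0:ℝ) < ε/2 by positivity))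
  have e2 : ∀ᶠ r : ℝ in nhdsWithin 1 (Set.Iio 1), r ∈ Set.Ioo (1/2 : ℝ) 1 := Ioo_mem_nhdsLT (by norm_num)
  filter_upwards [e1, e2] with r hr1 hr
  have r0 : 0 < r := by linarith [hr.1]
  have cP := Pk_cont1 (n := n) r0.le hr.2 x
  rw [← Pk_int hn r0 hr.2 x, ← integral_mul_const, Real.dist_eq, ← integral_sub (cont_int (cP.fun_mul hf)) (cont_int (cP.fun_mul continuous_const))]
  have hr2 : 0 ≤ 1 - r^2 := by nlinarith [hr.2]
  have key : ∀ y : Sp n, ‖Pk n (zz x y) r * f y - Pk n (zz x y) r * f x‖ ≤ Pk n (zz x y) r * (ε / (2 * (AS n + 1))) + (1 - r^2) * K * (2 * M) := by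
    intro y
    have pp := Pk_pos (n := n) (zz_nonneg x y) r0.le hr.2
    rw [← mul_sub, norm_mul, Real.norm_of_nonneg pp.le]
    by_cases hy : dist y x < δ
    · have := hfδ y hy
      rw [Real.dist_eq] at this
      have h1 : Pk n (zz x y) r * ‖f y - f x‖ ≤ Pk n (zz x y) r * (ε / (2 * (AS n + 1))) := 
        mul_le_mul_of_nonneg_left this.le pp.le
      have h2 : 0 ≤ (1 - r^2) * K * (2 * M) := by positivity
      linarith
    · have hz : δ^2 ≤ zz x y := by
        unfold zz
        have : δ ≤ ‖(x : E n) - y‖ := by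
          rw [not_lt, dist_comm] at hy
          have h : dist x y = ‖(x : E n) - y‖ := by rw [Subtype.dist_eq, dist_eq_norm]
          rwa [h] at hy
        nlinarith
      have p1 := Pk_far (n := n) hr.1.le hr.2 (by positivity) hz
      have p2 : ‖f y - f x‖ ≤ 2 * M := by
        have := norm_sub_le (f y) (f x)
        linarith [hM y trivial, hM x trivial]
      have h1 : Pk n (zz x y) r * ‖f y - f x‖ ≤ ((1 - r^2) * K) * (2 * M) :=
        mul_le_mul p1 p2 (norm_nonneg _) (by positivity)
      have h2 : 0 ≤ Pk n (zz x y) r * (ε / (2 * (AS n + 1))) := by positivity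
      linarith
  have hI : Integrable (fun y => Pk n (zz x y) r * (ε / (2 * (AS n + 1))) + (1 - r^2) * K * (2 * M)) (sg n) :=
    cont_int ((cP.fun_mul continuous_const).fun_add continuous_const)
  calc _ ≤ ∫ y, (Pk n (zz x y) r * (ε / (2 * (AS n + 1))) + (1 - r^2) * K * (2 * M)) ∂(sg n) :=
        norm_integral_le_of_norm_le hI (ae_of_all _ key)
    _ = AS n * (ε / (2 * (AS n + 1))) + (1 - r^2) * K * (2 * M) * AS n := by
        rw [integral_add (cont_int (cP.fun_mul continuous_const)) (integrable_const _), integral_mul_const, Pk_int hn r0 hr.2 x]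
        simp [AS]; ring
    _ < ε := by
        have : AS n * (ε / (2 * (AS n + 1))) ≤ ε/2 := by
          rw [mul_div_assoc', div_le_iff₀ (by positivity)]
          nlinarith
        linarith

theorem Pk_semi {n : ℕ} (hn : 5 ≤ n) {a b : ℝ} (a0 : 0 < a) (a1 : a < 1) (b0 : 0 < b) (b1 : b < 1) (x x' : Sp n) :
    ∫ y, Pk n (zz x y) a * Pk n (zz x' y) b ∂(sg n) = AS n * Pk n (zz x x') (a*b) := by
  set c := a * b with hc
  have c0 : 0 < c := by positivity
  have ca : c < a := by nlinarith
  have c1 : c < 1 := by linarith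
  set w := PE (x' : E n) with hw
  have hwH : Harm w := PE_harm x'
  have hconst : ∀ t ∈ Set.Ioo c 1, ∫ y, Pk n (zz x y) a * Pk n (zz x' y) b ∂(sg n) = 
      ∫ y : Sp n, Pk n (zz x y) t * w ((c/t) • (y : E n)) ∂(sg n) := by
    intro t ht
    have := harm_const hn (PE_harm x) hwH c0 (s := a) (t := t) ⟨ca, a1⟩ ht
    have hcb : c / a = b := by rw [hc]; field_simp
    simp only [hcb, hw, PE_eq] at this ⊢
    exact this
  have hgc : Continuous fun y : Sp n => w (c • (y : E n)) := by
    simp only [hw, PE_eq]; exact Pk_cont1 c0.le c1 x'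
  have L1 := Pk_approx hn x (fun y => w (c • (y : E n))) hgc
  have L2 : Tendsto (fun t => ∫ y : Sp n, Pk n (zz x y) t * w ((c/t) • (y : E n)) ∂(sg n) - ∫ y : Sp n, Pk n (zz x y) t * w (c • (y : E n)) ∂(sg n)) (nhdsWithin 1 (Set.Iio 1)) (nhds 0) := by
    rw [Metric.tendsto_nhds]
    intro ε hε
    have hS := AS_nonneg n
    set t0 := (1 + c)/2 with ht0
    have t00 : 0 < t0 := by positivity
    have hρ : c / t0 < 1 := by rw [div_lt_one t00]; linarith
    have huc := (isCompact_closedBall (0 : E n) (c/t0)).uniformContinuousOn_of_continuous (f := w)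
      (hwH.cd.continuousOn.mono (by intro y hy; simp at hy ⊢; linarith))
    rw [Metric.uniformContinuousOn_iff] at huc
    obtain ⟨δ, hδ, huc⟩ := huc (ε / (AS n + 1)) (by positivity)
    have hl : Tendsto (fun t : ℝ => c / t - c) (nhdsWithin 1 (Set.Iio 1)) (nhds 0) := by
      have : ContinuousAt (fun t : ℝ => c / t - c) 1 := by
        apply ContinuousAt.sub _ continuousAt_const
        exact continuousAt_const.div continuousAt_id (by norm_num)
      have := this.tendsto
      simp at this
      exact this.mono_left nhdsWithin_le_nhds
    have e2 : ∀ᶠ r : ℝ in nhdsWithin 1 (Set.Iio 1), r ∈ Set.Ioo t0 1 := Ioo_mem_nhdsLT (by linarith)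
    filter_upwards [hl.eventually (gt_mem_nhds hδ), e2] with t h1 ht
    have tp : 0 < t := t00.trans ht.1
    have cP := Pk_cont1 (n := n) tp.le ht.2 x
    have ct : c / t < 1 := by rw [div_lt_one tp]; linarith [ht.1]
    have hgt : Continuous fun y : Sp n => w ((c/t) • (y : E n)) := by
      simp only [hw, PE_eq]; exact Pk_cont1 (by positivity) ct x'
    rw [dist_zero_right, ← integral_sub (cont_int (cP.fun_mul hgt)) (cont_int (cP.fun_mul hgc))]
    have hct : c ≤ c / t := by rw [le_div_iff₀ tp]; nlinarith [ht.2]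
    have hct0 : c / t ≤ c / t0 := div_le_div_of_nonneg_left c0.le t00 ht.1.le
    have key : ∀ y : Sp n, ‖Pk n (zz x y) t * w ((c/t) • (y : E n)) - Pk n (zz x y) t * w (c • (y : E n))‖ ≤ Pk n (zz x y) t * (ε / (AS n + 1)) := by
      intro y
      have pp := Pk_pos (n := n) (zz_nonneg x y) tp.le ht.2
      rw [← mul_sub, norm_mul, Real.norm_of_nonneg pp.le]
      apply mul_le_mul_of_nonneg_left _ pp.le
      have := huc ((c/t) • (y : E n)) (by
        simp only [mem_closedBall_zero_iff, norm_smul, y.norm_eq, mul_one, Real.norm_eq_abs, abs_of_pos (div_pos c0 tp)]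
        exact hct0) (c • (y : E n)) (by
        simp only [mem_closedBall_zero_iff, norm_smul, y.norm_eq, mul_one, Real.norm_eq_abs, abs_of_pos c0]
        linarith) (by
        rw [dist_eq_norm, ← sub_smul, norm_smul, y.norm_eq, mul_one, Real.norm_of_nonneg (by linarith)]
        exact h1)
      exact this.le
    calc _ ≤ ∫ y, Pk n (zz x y) t * (ε / (AS n + 1)) ∂(sg n) :=
          norm_integral_le_of_norm_le (cont_int (cP.fun_mul continuous_const)) (ae_of_all _ key)
      _ = AS n * (ε / (AS n + 1)) := by rw [integral_mul_const, Pk_int hn tp ht.2 x]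
      _ < ε := by
          rw [mul_div_assoc', div_lt_iff₀ (by positivity)]
          nlinarith
  have L3 := L2.add L1
  simp only [sub_add_cancel, zero_add] at L3
  have L4 : Tendsto (fun t => ∫ y : Sp n, Pk n (zz x y) t * w ((c/t) • (y : E n)) ∂(sg n)) (nhdsWithin 1 (Set.Iio 1)) (nhds (∫ y, Pk n (zz x y) a * Pk n (zz x' y) b ∂(sg n))) := by
    refine tendsto_const_nhds.congr' ?_
    have : Set.Ioo c (1:ℝ) ∈ nhdsWithin (1:ℝ) (Set.Iio 1) := Ioo_mem_nhdsLT c1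
    filter_upwards [this] with s hs
    exact (hconst s hs)
  rw [tendsto_nhds_unique L4 L3, hw, PE_eq, zz_symm]

theorem AS_pos {n : ℕ} (hn : 5 ≤ n) : 0 < AS n := by
  have : Nonempty (Fin n) := ⟨⟨0, by omega⟩⟩
  have : Nontrivial (E n) := inferInstance
  unfold AS
  rw [Measure.toSphere_real_apply_univ]
  have h1 : 0 < (volume : Measure (E n)).real (ball 0 1) :=
    ENNReal.toReal_pos (measure_ball_pos _ _ (by norm_num)).ne' measure_ball_lt_top.ne
  have h2 : 0 < (n : ℝ) := by have : 0 < n := by omega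
                              exact_mod_cast this
  simp only [finrank_euclideanSpace, Fintype.card_fin]
  positivity

theorem sg_noatom {n : ℕ} (hn : 5 ≤ n) (x : Sp n) : sg n {x} = 0 := by
  by_contra h
  have hpos : 0 < (sg n).real {x} := by
    rw [measureReal_def]; exact ENNReal.toReal_pos h (measure_ne_top _ _)
  have key : ∀ r ∈ Set.Ioo (0:ℝ) 1, (sg n).real {x} ≤ AS n * (1-r) := by
    intro r hr
    have cP := Pk_cont1 (n := n) hr.1.le hr.2 x
    have h1 : ∫ y in {x}, Pk n (zz x y) r ∂(sg n) ≤ AS n := by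
      rw [← Pk_int hn hr.1 hr.2 x]
      exact setIntegral_le_integral (cont_int cP) (ae_of_all _ fun y => (Pk_pos (zz_nonneg _ _) hr.1.le hr.2).le)
    rw [integral_singleton, smul_eq_mul] at h1
    have hz : zz x x = 0 := by unfold zz; simp
    have hr1 : 0 < 1 - r := by linarith [hr.2]
    have h2 : (1-r)⁻¹ ≤ Pk n (zz x x) r := by
      unfold Pk qz
      rw [hz, mul_zero, add_zero]
      have : ((1-r)^2)^(-(n:ℝ)/2) = ((1-r)^n)⁻¹ := by
        rw [← Real.rpow_natCast, ← Real.rpow_mul hr1.le, ← Real.rpow_natCast, ← Real.rpow_neg hr1.le]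
        congr 1; push_cast; ring
      rw [this, inv_le_iff_one_le_mul₀ hr1]
      have h4 : (1-r)^n ≤ (1-r)^2 := pow_le_pow_of_le_one hr1.le (by linarith [hr.1]) (by omega)
      have h5 : 0 < (1-r)^n := by positivity
      rw [mul_assoc, ← div_eq_inv_mul, ← mul_div_assoc, le_div_iff₀ h5]
      nlinarith [hr.1]
    have h3 : (sg n).real {x} * (1-r)⁻¹ ≤ AS n := (mul_le_mul_of_nonneg_left h2 hpos.le).trans h1
    rwa [← div_eq_mul_inv, div_le_iff₀ hr1] at h3
  have hl : Tendsto (fun r : ℝ => AS n * (1-r)) (nhdsWithin 1 (Set.Iio 1)) (nhds 0) := by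
    have : ContinuousAt (fun r : ℝ => AS n * (1-r)) 1 := by fun_prop
    have := this.tendsto
    simp at this
    exact this.mono_left nhdsWithin_le_nhds
  have := ge_of_tendsto hl (b := (sg n).real {x}) (by
    have : Set.Ioo (0:ℝ) 1 ∈ nhdsWithin (1:ℝ) (Set.Iio 1) := Ioo_mem_nhdsLT (by norm_num)
    filter_upwards [this] with r hr using key r hr)
  linarith

theorem zz_pos {n : ℕ} {x y : Sp n} (h : y ≠ x) : 0 < zz x y := by
  unfold zz
  have : 0 < ‖(x : E n) - y‖ := norm_pos_iff.2 (sub_ne_zero.2 fun h' => h (Subtype.ext h'.symm))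
  positivity

theorem ae_zz_pos {n : ℕ} (hn : 5 ≤ n) (x : Sp n) : ∀ᵐ y ∂(sg n), 0 < zz x y := by
  have : {x}ᶜ ∈ ae (sg n) := by rw [mem_ae_iff, compl_compl]; exact sg_noatom hn x
  filter_upwards [this] with y hy using zz_pos hy

def hh (n : ℕ) : ℝ := (n:ℝ)/2 - 1

theorem hh_ge {n : ℕ} (hn : 5 ≤ n) : 3/2 ≤ hh n := by
  unfold hh
  have : (5:ℝ) ≤ n := by exact_mod_cast hn
  linarith

theorem Pk_hh (n : ℕ) (z r : ℝ) : Pk n z r = (1-r^2) * (qz z r)^(-hh n - 1) := by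
  unfold Pk hh; congr 2; ring

theorem qz_deriv (z r : ℝ) : HasDerivAt (fun r => qz z r) (z - 2*(1-r)) r := by
  unfold qz
  have h1 : HasDerivAt (fun r : ℝ => (1-r)^2) (2*(1-r)*(-1)) r := by
    refine (((hasDerivAt_id' r).const_sub 1).fun_pow 2).congr_deriv ?_
    norm_num
  refine (h1.fun_add ((hasDerivAt_id' r).mul_const z)).congr_deriv ?_
  ring

theorem kder (h z r : ℝ) (p : ℝ → ℝ) (p' : ℝ) (hr : 0 < r) (hq : 0 < qz z r) (hp : HasDerivAt p p' r) :
    HasDerivAt (fun r => r^(h-2) * ((qz z r)^(-h) * p r))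
      (r^(h-3) * (qz z r)^(-h-1) * ((h-2) * qz z r * p r - h * (z - 2*(1-r)) * r * p r + r * qz z r * p')) r := by
  have hq' := qz_deriv z r
  have h1 := (Real.hasDerivAt_rpow_const (p := h-2) (Or.inl hr.ne')).fun_mul ((hq'.rpow_const (p := -h) (Or.inl hq.ne')).fun_mul hp)
  refine h1.congr_deriv ?_
  have e1 : r^(h-2) = r^(h-3) * r := by rw [← Real.rpow_add_one hr.ne']; congr 1; ring
  have e2 : qz z r^(-h) = qz z r^(-h-1) * qz z r := by rw [← Real.rpow_add_one hq.ne']; congr 1; ring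
  have e3 : r^(h-2-1) = r^(h-3) := by congr 1; ring
  rw [e1, e2, e3]
  ring

theorem qz_pos' {z r : ℝ} (hz : 0 < z) (h0 : 0 ≤ r) : 0 < qz z r := by
  unfold qz
  rcases h0.eq_or_lt with h | h
  · subst h; norm_num
  · positivity

theorem qz_contr (z : ℝ) : Continuous fun r => qz z r := by unfold qz; fun_prop

theorem Pk_contr {n : ℕ} {z : ℝ} (hz : 0 < z) : ContinuousOn (fun r => Pk n z r) (Set.Icc 0 1) := by
  unfold Pk
  apply ContinuousOn.mul (by fun_prop)
  apply (qz_contr z).continuousOn.rpow_const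
  intro r hr; left; exact (qz_pos' hz hr.1).ne'

theorem rpowq_tendsto {h z : ℝ} (hz : 0 < z) {p : ℝ → ℝ} (hp : Continuous p) :
    Tendsto (fun r => (qz z r)^(-h) * p r) (nhdsWithin 1 (Set.Iio 1)) (nhds (z^(-h) * p 1)) := by
  have : ContinuousAt (fun r => (qz z r)^(-h) * p r) 1 := by
    apply ContinuousAt.mul _ hp.continuousAt
    exact (qz_contr z).continuousAt.rpow_const (Or.inl (qz_pos' hz (by norm_num)).ne')
  have := this.tendsto
  simp only [qz, sub_self, one_mul] at this
  norm_num at this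
  exact this.mono_left nhdsWithin_le_nhds

theorem Pk_sub_one (n : ℕ) : ∃ C, 0 ≤ C ∧ ∀ z ∈ Set.Icc (0:ℝ) 4, ∀ r ∈ Set.Icc (0:ℝ) (1/2), |Pk n z r - 1| ≤ C * r := by
  set C1 : ℝ := ((n:ℝ)/2) * (1/4:ℝ)^(-(n:ℝ)/2-1) with hC1
  set C2 : ℝ := (1/4:ℝ)^(-(n:ℝ)/2) with hC2
  have n0 : (0:ℝ) ≤ n := by positivity
  have hC1n : 0 ≤ C1 := by positivity
  have hC2n : 0 ≤ C2 := by positivity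
  refine ⟨C1*3 + C2, by positivity, ?_⟩
  intro z hz r hr
  have hq1 : 1/4 ≤ qz z r := by
    unfold qz
    have := mul_nonneg hr.1 hz.1
    nlinarith [hr.1, hr.2]
  have hq3 : |qz z r - 1| ≤ 3*r := by
    unfold qz; rw [abs_le]
    have h1 := mul_nonneg hr.1 hz.1
    have h2 := mul_nonneg hr.1 (sub_nonneg.2 hz.2)
    constructor <;> nlinarith [hr.1, hr.2]
  have hmv : |qz z r^(-(n:ℝ)/2) - 1| ≤ C1 * |qz z r - 1| := by
    have := Convex.norm_image_sub_le_of_norm_hasDerivWithin_le (s := Set.Ici (1/4:ℝ)) (f := fun t : ℝ => t^(-(n:ℝ)/2))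
      (f' := fun t => (-(n:ℝ)/2) * t^(-(n:ℝ)/2-1)) (C := C1) (x := 1) (y := qz z r) (by
        intro t ht
        have : (0:ℝ) < t := lt_of_lt_of_le (by norm_num) ht
        exact (Real.hasDerivAt_rpow_const (Or.inl this.ne')).hasDerivWithinAt) (by
        intro t ht
        have ht0 : (0:ℝ) < t := lt_of_lt_of_le (by norm_num) ht
        rw [norm_mul, Real.norm_eq_abs, Real.norm_eq_abs, neg_div, abs_neg, abs_of_nonneg (by positivity), abs_of_nonneg (by positivity), hC1, ← neg_div]
        apply mul_le_mul_of_nonneg_left _ (by positivity)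
        exact Real.rpow_le_rpow_of_nonpos (by norm_num) ht (by linarith)) (convex_Ici _) (by norm_num) hq1
    simpa using this
  have h4 : qz z r^(-(n:ℝ)/2) ≤ C2 := Real.rpow_le_rpow_of_nonpos (by norm_num) hq1 (by linarith)
  have h5 : 0 ≤ qz z r^(-(n:ℝ)/2) := by positivity
  have : Pk n z r - 1 = (qz z r^(-(n:ℝ)/2) - 1) - r^2 * qz z r^(-(n:ℝ)/2) := by unfold Pk; ring
  rw [this]
  calc _ ≤ |qz z r^(-(n:ℝ)/2) - 1| + |r^2 * qz z r^(-(n:ℝ)/2)| := abs_sub _ _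
    _ ≤ C1 * (3*r) + r * C2 := by
        apply add_le_add (hmv.trans (mul_le_mul_of_nonneg_left hq3 hC1n))
        rw [abs_of_nonneg (by positivity)]
        apply mul_le_mul _ h4 h5 hr.1
        nlinarith [hr.1, hr.2]
    _ = _ := by ring

def wK (h r : ℝ) : ℝ := h*(h-1) * r^(h-3) * (1-r)^2 * (3*r/(h+3) - (h-2)*(1-r)^2/4)
def cK (h : ℝ) : ℝ := 3/((h+2)*(h+3))
def w1 (h r : ℝ) : ℝ := h*(h-1) * r^(h-2) * (1-r)^2

theorem w1_nonneg {h r : ℝ} (hh : 3/2 ≤ h) (hr : 0 ≤ r) : 0 ≤ w1 h r := by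
  unfold w1
  have : 0 < h - 1 := by linarith
  positivity

theorem w1_int {h : ℝ} (hh : 3/2 ≤ h) : IntegrableOn (w1 h) (Set.Ioo 0 1) := by
  have : IntervalIntegrable (fun r : ℝ => r^(h-2)) volume 0 1 := intervalIntegral.intervalIntegrable_rpow' (by linarith)
  have := this.mul_continuousOn (g := fun r => h*(h-1)*(1-r)^2) (by fun_prop)
  rw [intervalIntegrable_iff_integrableOn_Ioo_of_le (by norm_num)] at this
  refine this.congr_fun (fun r _ => by unfold w1; ring) measurableSet_Ioo

theorem w1Pk_int {n : ℕ} (hn : 5 ≤ n) {z : ℝ} (hz : 0 < z) : IntegrableOn (fun r => w1 (hh n) r * Pk n z r) (Set.Ioo 0 1) := by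
  have h3 := hh_ge hn
  have : IntervalIntegrable (fun r : ℝ => r^(hh n-2)) volume 0 1 := intervalIntegral.intervalIntegrable_rpow' (by linarith)
  have := this.mul_continuousOn (g := fun r => (hh n*(hh n-1)*(1-r)^2) * Pk n z r) (by
    rw [Set.uIcc_of_le (by norm_num)]
    exact ContinuousOn.mul (by fun_prop) (Pk_contr hz))
  rw [intervalIntegrable_iff_integrableOn_Ioo_of_le (by norm_num)] at this
  refine this.congr_fun (fun r _ => by unfold w1; ring) measurableSet_Ioo

theorem wK_bound {n : ℕ} (hn : 5 ≤ n) : ∃ C, 0 ≤ C ∧ ∀ z ∈ Set.Icc (0:ℝ) 4, ∀ r ∈ Set.Ioo (0:ℝ) 1,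
    |wK (hh n) r * (Pk n z r - 1)| ≤ C * (w1 (hh n) r * (Pk n z r + 1)) := by
  obtain ⟨C, hC, hb⟩ := Pk_sub_one n
  have h3 := hh_ge hn
  set h := hh n
  refine ⟨(C + 2) * (1 + h), by positivity, ?_⟩
  intro z hz r hr
  have hP := Pk_pos (n := n) hz.1 hr.1.le hr.2
  have hw := w1_nonneg h3 hr.1.le
  have e1 : wK h r * r = w1 h r * (3*r/(h+3) - (h-2)*(1-r)^2/4) := by
    have : r^(h-2) = r^(h-3) * r := by rw [← Real.rpow_add_one hr.1.ne']; congr 1; ring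
    unfold wK w1; rw [this]; ring
  have hbr : |3*r/(h+3) - (h-2)*(1-r)^2/4| ≤ 1 + h := by
    have h1 : 0 ≤ 3*r/(h+3) := by have := hr.1; positivity
    have h2 : 3*r/(h+3) ≤ 1 := by rw [div_le_one (by linarith)]; nlinarith [hr.2]
    have h4 : 0 ≤ (1-r)^2 := by positivity
    have h5 : (1-r)^2 ≤ 1 := by nlinarith [hr.1, hr.2]
    rw [abs_le]; constructor <;> nlinarith
  have hPP : |Pk n z r - 1| ≤ (C+2) * r * (Pk n z r + 1) := by
    by_cases hr2 : r ≤ 1/2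
    · have := hb z hz r ⟨hr.1.le, hr2⟩
      have h6 := mul_nonneg (mul_nonneg (show 0 ≤ C + 2 by linarith) hr.1.le) hP.le
      nlinarith [hr.1]
    · have : |Pk n z r - 1| ≤ Pk n z r + 1 := by rw [abs_le]; constructor <;> linarith
      have h6 : 1 ≤ (C+2)*r := by nlinarith
      nlinarith
  have hr0 := hr.1
  have : |wK h r| * r = w1 h r * |3*r/(h+3) - (h-2)*(1-r)^2/4| := by
    rw [← abs_of_pos hr0, ← abs_mul, abs_of_pos hr0, e1, abs_mul, abs_of_nonneg hw]
  rw [abs_mul]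
  calc _ ≤ |wK h r| * ((C+2) * r * (Pk n z r + 1)) := mul_le_mul_of_nonneg_left hPP (abs_nonneg _)
    _ = (|wK h r| * r) * ((C+2) * (Pk n z r + 1)) := by ring
    _ = w1 h r * |3*r/(h+3) - (h-2)*(1-r)^2/4| * ((C+2) * (Pk n z r + 1)) := by rw [this]
    _ ≤ w1 h r * (1 + h) * ((C+2) * (Pk n z r + 1)) := by gcongr
    _ = _ := by ring

theorem wKPk_int {n : ℕ} (hn : 5 ≤ n) {z : ℝ} (hz : 0 < z) (hz4 : z ≤ 4) :
    IntegrableOn (fun r => wK (hh n) r * (Pk n z r - 1)) (Set.Ioo 0 1) := by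
  obtain ⟨C, hC, hb⟩ := wK_bound hn
  have h3 := hh_ge hn
  have hi := ((w1Pk_int hn hz).add (w1_int h3)).const_mul C
  refine Integrable.mono' hi ?_ ?_
  · apply ContinuousOn.aestronglyMeasurable _ measurableSet_Ioo
    apply ContinuousOn.mul
    · unfold wK
      apply ContinuousOn.mul _ (by fun_prop)
      apply ContinuousOn.mul _ (by fun_prop)
      apply ContinuousOn.mul (by fun_prop)
      apply ContinuousOn.rpow_const (by fun_prop)
      intro r hr; left; exact hr.1.ne'
    · exact ((Pk_contr hz).mono Set.Ioo_subset_Icc_self).sub continuousOn_const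
  · filter_upwards [ae_restrict_mem measurableSet_Ioo] with r hr
    refine (hb z ⟨hz.le, hz4⟩ r hr).trans_eq ?_
    simp only [Pi.add_apply]; ring

/-- FTC on Ioo 0 1 -/
theorem ftc01 {F f : ℝ → ℝ} {a b : ℝ} (hd : ∀ r ∈ Set.Ioo (0:ℝ) 1, HasDerivAt F (f r) r) (hi : IntegrableOn f (Set.Ioo 0 1))
    (h0 : Tendsto F (nhdsWithin 0 (Set.Ioi 0)) (nhds a)) (h1 : Tendsto F (nhdsWithin 1 (Set.Iio 1)) (nhds b)) :
    ∫ r in Set.Ioo 0 1, f r = b - a := by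
  rw [← integral_Ioc_eq_integral_Ioo, ← intervalIntegral.integral_of_le (by norm_num)]
  exact intervalIntegral.integral_eq_sub_of_hasDerivAt_of_tendsto (by norm_num) hd
    ((intervalIntegrable_iff_integrableOn_Ioo_of_le (by norm_num)).2 hi) h0 h1

theorem rpow_small {α : ℝ} (hα : -1 < α) {F : ℝ → ℝ} {F' : ℝ} (hF : HasDerivAt F F' 0) (hF0 : F 0 = 0) :
    Tendsto (fun r => r^α * F r) (nhdsWithin 0 (Set.Ioi 0)) (nhds 0) := by
  have h1 : Tendsto (fun r : ℝ => r⁻¹ * F r) (nhdsWithin 0 (Set.Ioi 0)) (nhds F') := by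
    have := hF.tendsto_slope_zero_right
    simpa [hF0] using this
  have h2 : Tendsto (fun r : ℝ => r^(α+1)) (nhdsWithin 0 (Set.Ioi 0)) (nhds 0) := by
    have : ContinuousAt (fun r : ℝ => r^(α+1)) 0 := Real.continuousAt_rpow_const _ _ (Or.inr (by linarith))
    have := this.tendsto
    rw [Real.zero_rpow (by linarith)] at this
    exact this.mono_left nhdsWithin_le_nhds
  have h3 := h2.mul h1
  rw [zero_mul] at h3
  refine h3.congr' ?_
  filter_upwards [self_mem_nhdsWithin] with r hr
  have hr : 0 < r := hr
  rw [Real.rpow_add_one hr.ne']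
  field_simp

theorem K1 {n : ℕ} (hn : 5 ≤ n) {z : ℝ} (hz : 0 < z) :
    ∫ r in Set.Ioo 0 1, w1 (hh n) r * Pk n z r = z^(1 - hh n) := by
  have h3 := hh_ge hn
  set h := hh n with hhd
  set p : ℝ → ℝ := fun r => r * ((h-1)*(1-r)^2 + qz z r) with hp
  have pc : Continuous p := by
    have := qz_contr z
    fun_prop
  have pd : ∀ r, HasDerivAt p (((h-1)*(1-r)^2 + qz z r) + r * (-2*(h-1)*(1-r) + (z - 2*(1-r)))) r := by
    intro r
    have e : p = fun r => (h)*(r^3 - 2*r^2 + r) + r^2*z := by ext r; simp only [hp, qz]; ring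
    rw [e]
    have h1 := (((hasDerivAt_pow 3 r).fun_sub ((hasDerivAt_pow 2 r).const_mul 2)).fun_add (hasDerivAt_id' r)).const_mul h
    have h2 := h1.fun_add ((hasDerivAt_pow 2 r).mul_const z)
    refine h2.congr_deriv ?_
    unfold qz; norm_num; ring
  have := ftc01 (F := fun r => r^(h-2) * ((qz z r)^(-h) * p r)) (f := fun r => w1 h r * Pk n z r) (a := 0) (b := z^(1-h)) ?_
    (w1Pk_int hn hz) ?_ ?_
  · rw [this, sub_zero]
  · intro r hr
    refine (kder h z r p _ hr.1 (qz_pos' hz hr.1.le) (pd r)).congr_deriv ?_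
    rw [Pk_hh, ← hhd]
    have : r^(h-2) = r^(h-3) * r := by rw [← Real.rpow_add_one hr.1.ne']; congr 1; ring
    simp only [w1, hp]
    rw [this]
    generalize (qz z r)^(-h-1) = Q
    unfold qz
    ring
  · have := ((qz_deriv z 0).rpow_const (p := -h) (Or.inl (by simp [qz] : qz z 0 ≠ 0))).fun_mul (pd 0)
    exact rpow_small (by linarith) this (by simp [hp])
  · have h1 := rpowq_tendsto (h := h) hz pc
    have h2 : Tendsto (fun r : ℝ => r^(h-2)) (nhdsWithin 1 (Set.Iio 1)) (nhds 1) := by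
      have : ContinuousAt (fun r : ℝ => r^(h-2)) 1 := Real.continuousAt_rpow_const _ _ (Or.inl (by norm_num))
      have := this.tendsto
      rw [Real.one_rpow] at this
      exact this.mono_left nhdsWithin_le_nhds
    have := h2.mul h1
    convert this using 2
    simp only [hp, qz]
    rw [show 1 - h = -h + 1 by ring, Real.rpow_add_one hz.ne']
    ring

theorem K2 {n : ℕ} (hn : 5 ≤ n) {z : ℝ} (hz : 0 < z) (hz4 : z ≤ 4) :
    ∫ r in Set.Ioo 0 1, wK (hh n) r * (Pk n z r - 1) =
      3/(hh n+3) * z^(1 - hh n) - z^(2 - hh n)/2 + 2 * cK (hh n)/(hh n+1) := by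
  have h3 := hh_ge hn
  set h := hh n with hhd
  have sd : ∀ r : ℝ, HasDerivAt (fun r : ℝ => (1-r)^2) (2*(1-r)*(-1)) r := by
    intro r
    refine (((hasDerivAt_id' r).const_sub 1).fun_pow 2).congr_deriv ?_
    norm_num
  set p : ℝ → ℝ := fun r => 3/(h+3) * (r * ((h-1)*(1-r)^2 + qz z r)) - 
    ((h-1)*(h-2)*((1-r)^2*(1-r)^2) + 2*(h-2)*((1-r)^2*qz z r) + 2*(qz z r * qz z r))/4 with hp
  have pc : Continuous p := by
    have := qz_contr z
    fun_prop
  have pd := fun r : ℝ => (((hasDerivAt_id' r).fun_mul (((sd r).const_mul (h-1)).fun_add (qz_deriv z r))).const_mul (3/(h+3))).fun_sub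
    ((((((sd r).fun_mul (sd r)).const_mul ((h-1)*(h-2))).fun_add (((sd r).fun_mul (qz_deriv z r)).const_mul (2*(h-2)))).fun_add
      (((qz_deriv z r).fun_mul (qz_deriv z r)).const_mul 2)).div_const 4)
  set v : ℝ → ℝ := fun r => (1-r)^2*(1-r) * (-(h*(h-1)/4) + h*(h-1)*(h-2)/(4*(h+2)) * r) - 
    cK h * (r * (h - 2*(h-1)*r + h*(h-1)/(h+1)*r^2)) with hv
  have vd := fun r : ℝ => (((sd r).fun_mul ((hasDerivAt_id' r).const_sub 1)).fun_mul
      (((hasDerivAt_id' r).const_mul (h*(h-1)*(h-2)/(4*(h+2)))).const_add (-(h*(h-1)/4)))).fun_sub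
    (((hasDerivAt_id' r).fun_mul ((((hasDerivAt_id' r).const_mul (2*(h-1))).const_sub h).fun_add
      ((hasDerivAt_pow 2 r).const_mul (h*(h-1)/(h+1))))).const_mul (cK h))
  have := ftc01 (F := fun r => r^(h-2) * ((qz z r)^(-h) * p r) - r^(h-2) * v r) (f := fun r => wK h r * (Pk n z r - 1)) (a := 0) 
    (b := 3/(h+3) * z^(1-h) - z^(2-h)/2 + 2 * cK h/(h+1)) ?_
    (wKPk_int hn hz hz4) ?_ ?_
  · rw [this, sub_zero]
  · intro r hr
    have hr0 := hr.1
    refine ((kder h z r p _ hr.1 (qz_pos' hz hr.1.le) (pd r)).fun_sub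
      ((Real.hasDerivAt_rpow_const (p := h-2) (Or.inl hr.1.ne')).fun_mul (vd r))).congr_deriv ?_
    rw [Pk_hh, ← hhd]
    have e1 : r^(h-2) = r^(h-3) * r := by rw [← Real.rpow_add_one hr.1.ne']; congr 1; ring
    have e3 : r^(h-2-1) = r^(h-3) := by congr 1; ring
    simp only [wK, hp]
    rw [e1, e3]
    generalize r^(h-3) = R
    generalize (qz z r)^(-h-1) = Q
    rw [show ∀ A B C : ℝ, h*(h-1)*R*A*B*(C*Q-1) = R*Q*(h*(h-1)*A*B*C) - R*(h*(h-1)*A*B) by intros; ring]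
    congr 1
    · congr 1
      unfold qz
      field_simp
      ring
    · rw [show ∀ A B : ℝ, (h-2)*R*A + R*r*B = R*((h-2)*A+r*B) by intros; ring]
      congr 1
      simp only [hv, cK]
      push_cast
      field_simp
      ring
  · have := (((qz_deriv z 0).rpow_const (p := -h) (Or.inl (by simp [qz] : qz z 0 ≠ 0))).fun_mul (pd 0)).fun_sub (vd 0)
    have := rpow_small (α := h-2) (by linarith) this (by simp [qz]; ring)
    refine this.congr fun r => ?_
    simp only [hp, hv]; ring
  · have h1 := rpowq_tendsto (h := h) hz pc
    have h2 : Tendsto (fun r : ℝ => r^(h-2)) (nhdsWithin 1 (Set.Iio 1)) (nhds 1) := by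
      have : ContinuousAt (fun r : ℝ => r^(h-2)) 1 := Real.continuousAt_rpow_const _ _ (Or.inl (by norm_num))
      have := this.tendsto
      rw [Real.one_rpow] at this
      exact this.mono_left nhdsWithin_le_nhds
    have h4 : Tendsto v (nhdsWithin 1 (Set.Iio 1)) (nhds (v 1)) := by
      have : Continuous v := by fun_prop
      exact this.continuousAt.tendsto.mono_left nhdsWithin_le_nhds
    have := (h2.mul h1).sub (h2.mul h4)
    convert this using 2
    have hp1 : p 1 = 3/(h+3) * z - z^2/2 := by simp only [hp, qz]; ring
    have hv1 : v 1 = - (2 * cK h/(h+1)) := by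
      simp only [hv]
      have : h + 1 ≠ 0 := by linarith
      field_simp; ring
    rw [hp1, hv1, show 1 - h = -h + 1 by ring, show 2 - h = -h + 1 + 1 by ring, Real.rpow_add_one hz.ne' (-h+1), Real.rpow_add_one hz.ne' (-h)]
    generalize z^(-h) = Y
    ring

/-- potential kernel in terms of Poisson kernels -/
theorem K3 {n : ℕ} (hn : 5 ≤ n) {z r : ℝ} (hz : 0 ≤ z) (hr : r ∈ Set.Ioo (0:ℝ) 1) :
    ∫⁻ s in Set.Ioo 0 r, ENNReal.ofReal (hh n * s^(hh n-1) * Pk n z s) = ENNReal.ofReal (r^(hh n) * (qz z r)^(-hh n)) := by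
  have h3 := hh_ge hn
  set h := hh n with hhd
  have hsub : ∀ s ∈ Set.Icc 0 r, 0 < qz z s := fun s hs => qz_pos hz hs.1 (lt_of_le_of_lt hs.2 hr.2)
  have hc : ContinuousOn (fun s => h * s^(h-1) * Pk n z s) (Set.Icc 0 r) := by
    apply ContinuousOn.mul
    · apply ContinuousOn.mul (by fun_prop)
      exact ContinuousOn.rpow_const (by fun_prop) (fun s hs => Or.inr (by linarith))
    · unfold Pk
      apply ContinuousOn.mul (by fun_prop)
      apply (qz_contr z).continuousOn.rpow_const
      intro s hs; left; exact (hsub s hs).ne'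
  have hc2 : ContinuousOn (fun s => s^h * (qz z s)^(-h)) (Set.Icc 0 r) := by
    apply ContinuousOn.mul
    · exact ContinuousOn.rpow_const (by fun_prop) (fun s hs => Or.inr (by linarith))
    · apply (qz_contr z).continuousOn.rpow_const
      intro s hs; left; exact (hsub s hs).ne'
  have hItg : IntervalIntegrable (fun s => h * s^(h-1) * Pk n z s) volume 0 r := by
    apply ContinuousOn.intervalIntegrable
    rwa [Set.uIcc_of_le hr.1.le]
  have hI : ∫ s in (0:ℝ)..r, h * s^(h-1) * Pk n z s = r^h * (qz z r)^(-h) := by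
    have := intervalIntegral.integral_eq_sub_of_hasDerivAt_of_le hr.1.le hc2 (f' := fun s => h * s^(h-1) * Pk n z s) (by
      intro s hs
      have hq := hsub s ⟨hs.1.le, hs.2.le⟩
      refine ((Real.hasDerivAt_rpow_const (p := h) (Or.inl hs.1.ne')).fun_mul ((qz_deriv z s).rpow_const (p := -h) (Or.inl hq.ne'))).congr_deriv ?_
      rw [Pk_hh, ← hhd]
      have e1 : s^h = s^(h-1) * s := by rw [← Real.rpow_add_one hs.1.ne']; congr 1; ring
      have e2 : qz z s^(-h) = qz z s^(-h-1) * qz z s := by rw [← Real.rpow_add_one hq.ne']; congr 1; ring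
      rw [e1, e2]
      generalize qz z s^(-h-1) = Q
      unfold qz
      ring) hItg
    rw [this, Real.zero_rpow (by linarith)]; ring
  rw [← hI, intervalIntegral.integral_of_le hr.1.le, integral_Ioc_eq_integral_Ioo, 
    ofReal_integral_eq_lintegral_ofReal]
  · exact (intervalIntegrable_iff_integrableOn_Ioo_of_le hr.1.le).1 hItg
  · filter_upwards [ae_restrict_mem measurableSet_Ioo] with s hs
    have := Pk_pos (n := n) hz hs.1.le (hs.2.trans hr.2)
    have h1 := hs.1
    simp only [Pi.zero_apply]
    positivity

theorem Pk_meas (n : ℕ) : Measurable fun p : ℝ × ℝ => Pk n p.1 p.2 := by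
  unfold Pk qz; fun_prop

theorem zz_meas {n : ℕ} : Measurable fun p : Sp n × Sp n => zz p.1 p.2 := zz_cont.measurable
theorem zz_meas1 {n : ℕ} (x : Sp n) : Measurable fun y : Sp n => zz x y := by
  have : Continuous fun y : Sp n => zz x y := by unfold zz; fun_prop
  exact this.measurable

theorem Pk_lint {n : ℕ} (hn : 5 ≤ n) {r : ℝ} (hr : r ∈ Set.Ioo (0:ℝ) 1) (x : Sp n) :
    ∫⁻ y, ENNReal.ofReal (Pk n (zz x y) r) ∂(sg n) = ENNReal.ofReal (AS n) := by
  rw [← Pk_int hn hr.1 hr.2 x, ofReal_integral_eq_lintegral_ofReal (cont_int (Pk_cont1 hr.1.le hr.2 x))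
    (ae_of_all _ fun y => (Pk_pos (zz_nonneg _ _) hr.1.le hr.2).le)]

/-- lower bound: z^{a-h} is controlled by an integral of Poisson kernels -/
theorem zlow {n : ℕ} (a : ℝ) (ha : -1/2 < a) : ∃ C : ℝ, 0 ≤ C ∧ ∀ z ∈ Set.Ioc (0:ℝ) 4,
    ENNReal.ofReal (z^(a - hh n)) ≤ ENNReal.ofReal C * ∫⁻ r in Set.Ioo 0 1, ENNReal.ofReal ((1-r)^(2*a) * Pk n z r) := by
  -- on the interval 1 - r in (√z/8, √z/4)
  set c1 : ℝ := min ((1/64:ℝ)^a) ((1/16:ℝ)^a) with hc1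
  have hc1p : 0 < c1 := lt_min (by positivity) (by positivity)
  set c2 : ℝ := (2:ℝ)^(-(n:ℝ)/2) with hc2
  have hc2p : 0 < c2 := by positivity
  set c : ℝ := c1 * (c2/8) * (1/8) with hc
  have hcp : 0 < c := by positivity
  refine ⟨c⁻¹, by positivity, ?_⟩
  intro z hz
  have hz0 := hz.1
  set t := Real.sqrt z with ht
  have htp : 0 < t := Real.sqrt_pos.2 hz.1
  have htz : t^2 = z := Real.sq_sqrt hz.1.le
  have ht2 : t ≤ 2 := by nlinarith [hz.2]
  have key : ∀ r ∈ Set.Ioo (1 - t/4) (1 - t/8), c1 * (c2/8) * (t * z^(a - (n:ℝ)/2)) ≤ (1-r)^(2*a) * Pk n z r := by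
    intro r hr
    have hr0 : 1/2 ≤ r := by linarith [hr.1]
    have hr1 : r < 1 := by linarith [hr.2]
    have u1 : t/8 ≤ 1 - r := by linarith [hr.2]
    have u2 : 1 - r ≤ t/4 := by linarith [hr.1]
    have up : 0 < 1 - r := by linarith
    have e1 : c1 * z^a ≤ (1-r)^(2*a) := by
      rw [Real.rpow_mul up.le, Real.rpow_two]
      have hs1 : z/64 ≤ (1-r)^2 := by nlinarith
      have hs2 : (1-r)^2 ≤ z/16 := by nlinarith
      rcases le_or_gt 0 a with h | h
      · calc c1 * z^a ≤ (1/64:ℝ)^a * z^a := by gcongr; exact min_le_left _ _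
          _ = (z/64)^a := by rw [← Real.mul_rpow (by norm_num) hz0.le]; congr 1; ring
          _ ≤ _ := Real.rpow_le_rpow (by positivity) hs1 h
      · calc c1 * z^a ≤ (1/16:ℝ)^a * z^a := by gcongr; exact min_le_right _ _
          _ = (z/16)^a := by rw [← Real.mul_rpow (by norm_num) hz0.le]; congr 1; ring
          _ ≤ _ := Real.rpow_le_rpow_of_nonpos (by positivity) hs2 h.le
    have e2 : (c2/8) * (t * z^(-(n:ℝ)/2)) ≤ Pk n z r := by
      unfold Pk
      have h1 : t/8 ≤ 1 - r^2 := by nlinarith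
      have hq : qz z r ≤ 2 * z := by unfold qz; nlinarith
      have h2 : c2 * z^(-(n:ℝ)/2) ≤ (qz z r)^(-(n:ℝ)/2) := by
        rw [hc2, ← Real.mul_rpow (by norm_num) hz0.le]
        have n0 : (0:ℝ) ≤ n := by positivity
        exact Real.rpow_le_rpow_of_nonpos (qz_pos hz0.le (by linarith) hr1) hq (by linarith)
      calc (c2/8) * (t * z^(-(n:ℝ)/2)) = (t/8) * (c2 * z^(-(n:ℝ)/2)) := by ring
        _ ≤ _ := mul_le_mul h1 h2 (by positivity) (by linarith)
    calc c1 * (c2/8) * (t * z^(a - (n:ℝ)/2)) = (c1 * z^a) * ((c2/8) * (t * z^(-(n:ℝ)/2))) := by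
          rw [show a - (n:ℝ)/2 = a + (-(n:ℝ)/2) by ring, Real.rpow_add hz0]; ring
      _ ≤ _ := mul_le_mul e1 e2 (by positivity) (by positivity)
  have hsub : Set.Ioo (1 - t/4) (1 - t/8) ⊆ Set.Ioo 0 1 := by
    intro r hr; exact ⟨by linarith [hr.1], by linarith [hr.2]⟩
  have h1 : ENNReal.ofReal (c1 * (c2/8) * (t * z^(a - (n:ℝ)/2))) * volume (Set.Ioo (1 - t/4) (1 - t/8)) ≤ 
      ∫⁻ r in Set.Ioo 0 1, ENNReal.ofReal ((1-r)^(2*a) * Pk n z r) := by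
    refine le_trans ?_ (lintegral_mono_set hsub)
    rw [← setLIntegral_const]
    exact setLIntegral_mono' measurableSet_Ioo fun r hr => ENNReal.ofReal_le_ofReal (key r hr)
  refine le_trans ?_ (mul_le_mul_right h1 _)
  rw [Real.volume_Ioo, ← ENNReal.ofReal_mul (by positivity), ← ENNReal.ofReal_mul (by positivity)]
  apply ENNReal.ofReal_le_ofReal
  apply le_of_eq
  have : z^(a - hh n) = z^(a - (n:ℝ)/2) * z := by rw [← Real.rpow_add_one hz0.ne']; unfold hh; congr 1; ring
  rw [this]
  have e3 : c1 * (c2/8) * (t * z^(a - (n:ℝ)/2)) * (1 - t/8 - (1 - t/4)) = c * (z^(a - (n:ℝ)/2) * z) := by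
    rw [hc]
    linear_combination (c1 * c2 * z^(a - (n:ℝ)/2) / 64 : ℝ) * htz
  rw [e3, ← mul_assoc, inv_mul_cancel₀ hcp.ne', one_mul]

theorem zlint {n : ℕ} (hn : 5 ≤ n) {β : ℝ} (hβ : β < ((n:ℝ)-1)/2) : ∃ C : ℝ, 0 ≤ C ∧ ∀ x : Sp n, 
    ∫⁻ y, ENNReal.ofReal (zz x y^(-β)) ∂(sg n) ≤ ENNReal.ofReal C := by
  set a := hh n - β with ha
  have ha2 : -1/2 < a := by rw [ha]; unfold hh; linarith
  obtain ⟨C, hC, hl⟩ := zlow (n := n) a ha2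
  have hItg : IntegrableOn (fun r : ℝ => (1-r)^(2*a)) (Set.Ioo 0 1) := by
    have := (intervalIntegral.intervalIntegrable_rpow' (r := 2*a) (a := 0) (b := 1) (by linarith)).comp_sub_left 1
    norm_num at this
    exact (intervalIntegrable_iff_integrableOn_Ioo_of_le (by norm_num)).1 this.symm
  refine ⟨C * ((∫ r in Set.Ioo 0 1, (1-r)^(2*a)) * AS n), ?_, ?_⟩
  · have : 0 ≤ ∫ r in Set.Ioo (0:ℝ) 1, (1-r)^(2*a) := setIntegral_nonneg measurableSet_Ioo fun r hr => 
      Real.rpow_nonneg (by linarith [hr.2]) _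
    have := AS_nonneg n
    positivity
  intro x
  have m1 : Measurable fun p : Sp n × ℝ => ENNReal.ofReal ((1-p.2)^(2*a) * Pk n (zz x p.1) p.2) := by
    apply ENNReal.measurable_ofReal.comp
    apply Measurable.mul (by fun_prop)
    exact (Pk_meas n).comp (((zz_meas1 x).comp measurable_fst).prodMk measurable_snd)
  calc ∫⁻ y, ENNReal.ofReal (zz x y^(-β)) ∂(sg n) 
      ≤ ∫⁻ y, (ENNReal.ofReal C * ∫⁻ r in Set.Ioo (0:ℝ) 1, ENNReal.ofReal ((1-r)^(2*a) * Pk n (zz x y) r) ∂volume) ∂(sg n) := by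
        apply lintegral_mono_ae
        filter_upwards [ae_zz_pos hn x] with y hy
        have := hl _ ⟨hy, zz_le x y⟩
        rwa [show a - hh n = -β by rw [ha]; ring] at this
    _ = ENNReal.ofReal C * ∫⁻ r in Set.Ioo (0:ℝ) 1, (∫⁻ y, ENNReal.ofReal ((1-r)^(2*a) * Pk n (zz x y) r) ∂(sg n)) ∂volume := by
        rw [lintegral_const_mul _ m1.lintegral_prod_right', lintegral_lintegral_swap m1.aemeasurable]
    _ = ENNReal.ofReal C * ∫⁻ r in Set.Ioo (0:ℝ) 1, ENNReal.ofReal ((1-r)^(2*a)) * ENNReal.ofReal (AS n) := by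
        congr 1
        refine setLIntegral_congr_fun measurableSet_Ioo fun r hr => ?_
        rw [← Pk_lint hn hr x, ← lintegral_const_mul]
        · refine lintegral_congr fun y => ?_
          rw [ENNReal.ofReal_mul (Real.rpow_nonneg (by linarith [hr.2]) _)]
        · exact ENNReal.measurable_ofReal.comp (Pk_cont1 hr.1.le hr.2 x).measurable
    _ = _ := by
        rw [lintegral_mul_const _ (by fun_prop), ENNReal.ofReal_mul hC, ENNReal.ofReal_mul, ofReal_integral_eq_lintegral_ofReal hItg]
        · filter_upwards [ae_restrict_mem measurableSet_Ioo] with r hr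
          exact Real.rpow_nonneg (by linarith [hr.2]) _
        · exact setIntegral_nonneg measurableSet_Ioo fun r hr => Real.rpow_nonneg (by linarith [hr.2]) _

theorem zint {n : ℕ} (hn : 5 ≤ n) {β : ℝ} (hβ : β < ((n:ℝ)-1)/2) : ∃ C : ℝ, 0 ≤ C ∧ ∀ x : Sp n, 
    Integrable (fun y => zz x y^(-β)) (sg n) ∧ ∫ y, zz x y^(-β) ∂(sg n) ≤ C := by
  obtain ⟨C, hC, hl⟩ := zlint hn hβ
  refine ⟨C, hC, fun x => ?_⟩
  have hm : AEStronglyMeasurable (fun y => zz x y^(-β)) (sg n) := ((zz_meas1 x).pow_const _).aestronglyMeasurable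
  have hnn : ∀ y : Sp n, 0 ≤ zz x y^(-β) := fun y => Real.rpow_nonneg (zz_nonneg _ _) _
  constructor
  · refine ⟨hm, ?_⟩
    rw [hasFiniteIntegral_iff_ofReal (ae_of_all _ hnn)]
    exact lt_of_le_of_lt (hl x) ENNReal.ofReal_lt_top
  · rw [integral_eq_lintegral_of_nonneg_ae (ae_of_all _ hnn) hm]
    exact ENNReal.toReal_le_of_le_ofReal hC (hl x)

abbrev ss (n : ℕ) : Measure (Sp n × Sp n) := (sg n).prod (sg n)

theorem bdd_int {α : Type*} [MeasurableSpace α] {μ : Measure α} [IsFiniteMeasure μ] {f : α → ℝ} {M : ℝ}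
    (hf : Measurable f) (hM : ∀ x, |f x| ≤ M) : Integrable f μ :=
  Integrable.of_bound hf.aestronglyMeasurable M (ae_of_all _ hM)

theorem Pk_bound {n : ℕ} {z r : ℝ} (hz : 0 ≤ z) (h0 : 0 ≤ r) (h1 : r < 1) :
    |Pk n z r| ≤ ((1-r)^2)^(-(n:ℝ)/2) := by
  rw [abs_of_pos (Pk_pos hz h0 h1)]
  unfold Pk
  have h2 : (qz z r)^(-(n:ℝ)/2) ≤ ((1-r)^2)^(-(n:ℝ)/2) := by
    have : 0 < 1 - r := by linarith
    have n0 : (0:ℝ) ≤ n := by positivity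
    apply Real.rpow_le_rpow_of_nonpos (by positivity) _ (by linarith)
    unfold qz; nlinarith [mul_nonneg h0 hz]
  have h3 : 0 ≤ (qz z r)^(-(n:ℝ)/2) := Real.rpow_nonneg (qz_pos hz h0 h1).le _
  nlinarith [sq_nonneg r]

theorem Pk_measxy {n : ℕ} (r : ℝ) : Measurable fun p : Sp n × Sp n => Pk n (zz p.1 p.2) r :=
  (Pk_meas n).comp (zz_meas.prodMk measurable_const)

def Ph {n : ℕ} (g : Sp n → ℝ) (r : ℝ) : ℝ := ∫ p, g p.1 * g p.2 * (Pk n (zz p.1 p.2) r - 1) ∂(ss n)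
def Ug {n : ℕ} (g : Sp n → ℝ) (a : ℝ) (y : Sp n) : ℝ := ∫ x, (Pk n (zz x y) a - 1) * g x ∂(sg n)

theorem Pk_semi' {n : ℕ} (hn : 5 ≤ n) {a b : ℝ} (ha : a ∈ Set.Ioo (0:ℝ) 1) (hb : b ∈ Set.Ioo (0:ℝ) 1) (x x' : Sp n) :
    ∫ y, (Pk n (zz x y) a - 1) * (Pk n (zz x' y) b - 1) ∂(sg n) = AS n * (Pk n (zz x x') (a*b) - 1) := by
  have c1 := Pk_cont1 (n := n) ha.1.le ha.2 x
  have c2 := Pk_cont1 (n := n) hb.1.le hb.2 x'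
  have e : ∀ y : Sp n, (Pk n (zz x y) a - 1) * (Pk n (zz x' y) b - 1) = 
      Pk n (zz x y) a * Pk n (zz x' y) b - Pk n (zz x y) a - Pk n (zz x' y) b + 1 := fun y => by ring
  simp only [e]
  rw [integral_add, integral_sub, integral_sub, Pk_semi hn ha.1 ha.2 hb.1 hb.2, Pk_int hn ha.1 ha.2, Pk_int hn hb.1 hb.2]
  · simp only [integral_const, smul_eq_mul, mul_one, AS]; ring
  · exact cont_int (c1.fun_mul c2)
  · exact cont_int c1
  · exact cont_int ((c1.fun_mul c2).fun_sub c1)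
  · exact cont_int c2
  · exact cont_int (((c1.fun_mul c2).fun_sub c1).fun_sub c2)
  · exact integrable_const _

theorem Ug_meas {n : ℕ} {g : Sp n → ℝ} (hg : Measurable g) (a : ℝ) : Measurable (Ug g a) := by
  have : StronglyMeasurable fun p : Sp n × Sp n => (Pk n (zz p.2 p.1) a - 1) * g p.2 := by
    apply Measurable.stronglyMeasurable
    have := (Pk_measxy (n := n) a).comp measurable_swap
    exact (this.sub_const 1).mul (hg.comp measurable_snd)
  exact (this.integral_prod_right (ν := sg n)).measurable

theorem Ug_bound {n : ℕ} {g : Sp n → ℝ} {M : ℝ} (hM : ∀ x, |g x| ≤ M) {a : ℝ} (ha : a ∈ Set.Ioo (0:ℝ) 1) : 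
    ∃ C, ∀ y, |Ug g a y| ≤ C := by
  refine ⟨(((1-a)^2)^(-(n:ℝ)/2) + 1) * M * (sg n).real Set.univ, fun y => ?_⟩
  unfold Ug
  rw [← Real.norm_eq_abs]
  apply norm_integral_le_of_norm_le_const
  refine ae_of_all _ fun x => ?_
  rw [norm_mul]
  have h1 := Pk_bound (n := n) (zz_nonneg x y) ha.1.le ha.2
  have h2 : ‖Pk n (zz x y) a - 1‖ ≤ ((1-a)^2)^(-(n:ℝ)/2) + 1 := by
    have := norm_sub_le (Pk n (zz x y) a) 1
    simp only [Real.norm_eq_abs, abs_one] at this ⊢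
    linarith
  exact mul_le_mul h2 (hM x) (norm_nonneg _) (by linarith [norm_nonneg (Pk n (zz x y) a - 1)])

theorem Ug_mul {n : ℕ} (hn : 5 ≤ n) {g : Sp n → ℝ} {M : ℝ} (hg : Measurable g) (hM : ∀ x, |g x| ≤ M) 
    {a b : ℝ} (ha : a ∈ Set.Ioo (0:ℝ) 1) (hb : b ∈ Set.Ioo (0:ℝ) 1) :
    ∫ y, Ug g a y * Ug g b y ∂(sg n) = AS n * Ph g (a*b) := by
  have e : ∀ y : Sp n, Ug g a y * Ug g b y = ∫ p, ((Pk n (zz p.1 y) a - 1) * g p.1) * ((Pk n (zz p.2 y) b - 1) * g p.2) ∂(ss n) := by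
    intro y
    unfold Ug
    rw [← integral_prod_mul]
  simp only [e]
  rw [integral_integral_swap]
  · unfold Ph
    rw [← integral_const_mul]
    refine integral_congr_ae (ae_of_all _ fun p => ?_)
    simp only
    have : ∀ y : Sp n, ((Pk n (zz p.1 y) a - 1) * g p.1) * ((Pk n (zz p.2 y) b - 1) * g p.2) = 
      (Pk n (zz p.1 y) a - 1) * (Pk n (zz p.2 y) b - 1) * (g p.1 * g p.2) := fun y => by ring
    simp only [this]
    rw [integral_mul_const, Pk_semi' hn ha hb]; ring
  · set A := ((1-a)^2)^(-(n:ℝ)/2) + 1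
    set B := ((1-b)^2)^(-(n:ℝ)/2) + 1
    have m1 : ∀ c : ℝ, Measurable fun q : Sp n × (Sp n × Sp n) => Pk n (zz q.2.1 q.1) c := fun c =>
      Measurable.comp (g := fun p : Sp n × Sp n => Pk n (zz p.1 p.2) c) (f := fun q : Sp n × (Sp n × Sp n) => (q.2.1, q.1)) (Pk_measxy c) (by fun_prop)
    have m2 : ∀ c : ℝ, Measurable fun q : Sp n × (Sp n × Sp n) => Pk n (zz q.2.2 q.1) c := fun c =>
      Measurable.comp (g := fun p : Sp n × Sp n => Pk n (zz p.1 p.2) c) (f := fun q : Sp n × (Sp n × Sp n) => (q.2.2, q.1)) (Pk_measxy c) (by fun_prop)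
    refine bdd_int (M := A * M * (B * M)) ?_ ?_
    · exact (((m1 a).sub_const 1).mul (hg.comp (by fun_prop))).mul (((m2 b).sub_const 1).mul (hg.comp (by fun_prop)))
    · have key : ∀ c ∈ Set.Ioo (0:ℝ) 1, ∀ x y : Sp n, |(Pk n (zz x y) c - 1) * g x| ≤ (((1-c)^2)^(-(n:ℝ)/2) + 1) * M := by
        intro c hc x y
        rw [abs_mul]
        have h1 := Pk_bound (n := n) (zz_nonneg x y) hc.1.le hc.2
        have h2 : |Pk n (zz x y) c - 1| ≤ ((1-c)^2)^(-(n:ℝ)/2) + 1 := by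
          have := norm_sub_le (Pk n (zz x y) c) 1
          simp only [Real.norm_eq_abs, abs_one] at this ⊢
          linarith
        exact mul_le_mul h2 (hM x) (abs_nonneg _) (by linarith [abs_nonneg (Pk n (zz x y) c - 1)])
      rintro ⟨y, x, x'⟩
      simp only [Function.uncurry]
      rw [abs_mul]
      have k1 := key a ha x y
      exact mul_le_mul k1 (key b hb x' y) (abs_nonneg _) ((abs_nonneg _).trans k1)

theorem cs_int {α : Type*} [MeasurableSpace α] {μ : Measure α} [IsFiniteMeasure μ] {f g : α → ℝ} 
    (hf : Measurable f) (hg : Measurable g) (bf : ∃ C, ∀ x, |f x| ≤ C) (bg : ∃ C, ∀ x, |g x| ≤ C) :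
    (∫ x, f x * g x ∂μ)^2 ≤ (∫ x, f x * f x ∂μ) * (∫ x, g x * g x ∂μ) := by
  obtain ⟨C, hC⟩ := bf
  obtain ⟨D, hD⟩ := bg
  have i1 : ∀ {u v : α → ℝ} {A B : ℝ}, Measurable u → Measurable v → (∀ x, |u x| ≤ A) → (∀ x, |v x| ≤ B) → Integrable (fun x => u x * v x) μ := by
    intro u v A B hu hv hA hB
    refine bdd_int (M := A * B) (hu.mul hv) fun x => ?_
    rw [abs_mul]
    exact mul_le_mul (hA x) (hB x) (abs_nonneg _) ((abs_nonneg _).trans (hA x))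
  have iff := i1 hf hf hC hC
  have ifg := i1 hf hg hC hD
  have igg := i1 hg hg hD hD
  have key : ∀ t : ℝ, 0 ≤ (∫ x, g x * g x ∂μ) * (t * t) + (2 * ∫ x, f x * g x ∂μ) * t + ∫ x, f x * f x ∂μ := by
    intro t
    have : 0 ≤ ∫ x, (g x * g x * (t*t) + 2 * t * (f x * g x) + f x * f x) ∂μ := by
      apply integral_nonneg
      intro x
      have : g x * g x * (t*t) + 2 * t * (f x * g x) + f x * f x = (g x * t + f x)^2 := by ring
      simp only [Pi.zero_apply, this]
      positivity
    rw [integral_add ((igg.mul_const _).fun_add (ifg.const_mul _)) iff, integral_add (igg.mul_const _) (ifg.const_mul _), integral_mul_const, integral_const_mul] at this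
    linarith
  have := discrim_le_zero key
  unfold discrim at this
  nlinarith

theorem Ph_nonneg {n : ℕ} (hn : 5 ≤ n) {g : Sp n → ℝ} {M : ℝ} (hg : Measurable g) (hM : ∀ x, |g x| ≤ M) 
    {r : ℝ} (hr : r ∈ Set.Ioo (0:ℝ) 1) : 0 ≤ Ph g r := by
  have hs : Real.sqrt r ∈ Set.Ioo (0:ℝ) 1 := ⟨Real.sqrt_pos.2 hr.1, by rw [Real.sqrt_lt' (by norm_num)]; simpa using hr.2⟩
  have := Ug_mul hn hg hM hs hs
  rw [Real.mul_self_sqrt hr.1.le] at this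
  have h2 : 0 ≤ AS n * Ph g r := by
    rw [← this]; exact integral_nonneg fun y => mul_self_nonneg _
  exact nonneg_of_mul_nonneg_right h2 (AS_pos hn)

theorem Ph_logconv {n : ℕ} (hn : 5 ≤ n) {g : Sp n → ℝ} {M : ℝ} (hg : Measurable g) (hM : ∀ x, |g x| ≤ M) 
    {r s t : ℝ} (hr : r ∈ Set.Ioo (0:ℝ) 1) (ht : t ∈ Set.Ioo (0:ℝ) 1) (hs : 0 < s) (h : s^2 = r * t) : Ph g s^2 ≤ Ph g r * Ph g t := by
  have hr' : Real.sqrt r ∈ Set.Ioo (0:ℝ) 1 := ⟨Real.sqrt_pos.2 hr.1, by rw [Real.sqrt_lt' (by norm_num)]; simpa using hr.2⟩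
  have ht' : Real.sqrt t ∈ Set.Ioo (0:ℝ) 1 := ⟨Real.sqrt_pos.2 ht.1, by rw [Real.sqrt_lt' (by norm_num)]; simpa using ht.2⟩
  have e1 := Ug_mul hn hg hM hr' hr'
  have e2 := Ug_mul hn hg hM ht' ht'
  have e3 := Ug_mul hn hg hM hr' ht'
  have hst : Real.sqrt r * Real.sqrt t = s := by
    rw [← Real.sqrt_mul hr.1.le, ← h, Real.sqrt_sq hs.le]
  rw [Real.mul_self_sqrt hr.1.le] at e1
  rw [Real.mul_self_sqrt ht.1.le] at e2
  rw [hst] at e3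
  have := cs_int (μ := sg n) (Ug_meas hg (Real.sqrt r)) (Ug_meas hg (Real.sqrt t)) (Ug_bound hM hr') (Ug_bound hM ht')
  rw [e1, e2, e3] at this
  have hA := AS_pos hn
  have : (AS n)^2 * (Ph g s^2) ≤ (AS n)^2 * (Ph g r * Ph g t) := by nlinarith
  exact le_of_mul_le_mul_left this (by positivity)

theorem Ph_small {n : ℕ} {g : Sp n → ℝ} {M : ℝ} (hM : ∀ x, |g x| ≤ M) : 
    ∃ C, ∀ r ∈ Set.Ioo (0:ℝ) (1/2), |Ph g r| ≤ C * r := by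
  obtain ⟨C, hC, hb⟩ := Pk_sub_one n
  refine ⟨M * M * C * (ss n).real Set.univ, fun r hr => ?_⟩
  unfold Ph
  have := norm_integral_le_of_norm_le_const (μ := ss n) (f := fun p : Sp n × Sp n => g p.1 * g p.2 * (Pk n (zz p.1 p.2) r - 1)) (C := M * M * (C * r)) (ae_of_all _ fun p => by
    rw [norm_mul, norm_mul]
    have h1 := hM p.1
    have h0 := (abs_nonneg _).trans h1
    exact mul_le_mul (mul_le_mul h1 (hM p.2) (abs_nonneg _) h0) (hb _ ⟨zz_nonneg _ _, zz_le _ _⟩ r ⟨hr.1.le, hr.2.le⟩) (abs_nonneg _) (by positivity))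
  refine this.trans_eq ?_
  ring

theorem Ph_mono {n : ℕ} (hn : 5 ≤ n) {g : Sp n → ℝ} {M : ℝ} (hg : Measurable g) (hM : ∀ x, |g x| ≤ M) 
    {r s : ℝ} (hr : 0 < r) (hrs : r ≤ s) (hs : s < 1) : Ph g r / r ≤ Ph g s / s := by
  rcases hrs.eq_or_lt with h | hrs
  · rw [h]
  have s0 : 0 < s := hr.trans hrs
  set l := r / s with hl
  have l0 : 0 < l := by positivity
  have l1 : l < 1 := by rw [hl, div_lt_one s0]; exact hrs
  set x : ℕ → ℝ := fun k => s * l^k with hx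
  have xm : ∀ k, x k ∈ Set.Ioo (0:ℝ) 1 := fun k => ⟨by positivity, by
    have : l^k ≤ 1 := pow_le_one₀ l0.le l1.le
    calc x k ≤ s * 1 := mul_le_mul_of_nonneg_left this s0.le
      _ < 1 := by linarith⟩
  set A : ℕ → ℝ := fun k => Ph g (x k) / x k with hA
  have A0 : ∀ k, 0 ≤ A k := fun k => div_nonneg (Ph_nonneg hn hg hM (xm k)) (xm k).1.le
  have Ac : ∀ k, A (k+1)^2 ≤ A k * A (k+2) := by
    intro k
    have h1 := Ph_logconv hn hg hM (s := x (k+1)) (xm k) (xm (k+2)) (xm (k+1)).1 (by simp only [hx]; ring)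
    have h2 : x (k+1)^2 = x k * x (k+2) := by simp only [hx]; ring
    simp only [hA]
    rw [div_pow, div_mul_div_comm, h2]
    exact div_le_div_of_nonneg_right h1 (mul_pos (xm k).1 (xm (k+2)).1).le
  have e0 : A 0 = Ph g s / s := by simp [hA, hx]
  have e1 : A 1 = Ph g r / r := by
    have : x 1 = r := by simp only [hx, hl]; field_simp
    simp only [hA, this]
  rw [← e0, ← e1]
  by_contra hcon
  push Not at hcon
  have hA0 : 0 < A 0 := by
    rcases (A0 0).eq_or_lt with h | h
    · have := Ac 0
      rw [← h] at this hcon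
      norm_num at this
      nlinarith
    · exact h
  set ρ := A 1 / A 0 with hρ
  have ρ1 : 1 < ρ := by rw [hρ, one_lt_div hA0]; exact hcon
  have ind : ∀ k, 0 < A k ∧ ρ * A k ≤ A (k+1) := by
    intro k
    induction k with
    | zero => exact ⟨hA0, by rw [hρ]; field_simp; simp⟩
    | succ k ih =>
      have hp : 0 < A (k+1) := lt_of_lt_of_le (by have := ih.1; positivity) ih.2
      refine ⟨hp, ?_⟩
      have h1 := Ac k
      have h2 : A k * (ρ * A (k+1)) ≤ A k * A (k+2) := by
        calc _ = (ρ * A k) * A (k+1) := by ring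
          _ ≤ A (k+1) * A (k+1) := mul_le_mul_of_nonneg_right ih.2 hp.le
          _ = A (k+1)^2 := by ring
          _ ≤ _ := h1
      exact le_of_mul_le_mul_left h2 ih.1
  have grow : ∀ k, ρ^k * A 0 ≤ A k := by
    intro k
    induction k with
    | zero => simp
    | succ k ih =>
      calc ρ^(k+1) * A 0 = ρ * (ρ^k * A 0) := by ring
        _ ≤ ρ * A k := mul_le_mul_of_nonneg_left ih (by linarith)
        _ ≤ _ := (ind k).2
  obtain ⟨C, hC⟩ := Ph_small hM
  have hxlim : Tendsto x atTop (nhds 0) := by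
    have := (tendsto_pow_atTop_nhds_zero_of_lt_one l0.le l1).const_mul s
    simpa using this
  have hglim : Tendsto (fun k => ρ^k * A 0) atTop atTop :=
    (tendsto_pow_atTop_atTop_of_one_lt ρ1).atTop_mul_const hA0
  obtain ⟨k, hk1, hk2⟩ := ((hxlim.eventually (gt_mem_nhds (show (0:ℝ) < 1/2 by norm_num))).and (hglim.eventually_gt_atTop C)).exists
  have h1 := hC (x k) ⟨(xm k).1, hk1⟩
  have h2 : A k ≤ C := by
    simp only [hA]
    rw [div_le_iff₀ (xm k).1]
    exact (le_abs_self _).trans h1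
  linarith [grow k]

theorem ae_ss_pos {n : ℕ} (hn : 5 ≤ n) : ∀ᵐ p ∂(ss n), 0 < zz p.1 p.2 := by
  have hm : MeasurableSet {p : Sp n × Sp n | 0 < zz p.1 p.2} := measurableSet_lt measurable_const zz_meas
  rw [Measure.ae_prod_iff_ae_ae hm]
  exact ae_of_all _ fun x => ae_zz_pos hn x

theorem zzint {n : ℕ} (hn : 5 ≤ n) {β : ℝ} (hβ : β < ((n:ℝ)-1)/2) : 
    Integrable (fun p : Sp n × Sp n => zz p.1 p.2^(-β)) (ss n) := by
  obtain ⟨C, hC, h⟩ := zint hn hβ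
  have hm : Measurable fun p : Sp n × Sp n => zz p.1 p.2^(-β) := zz_meas.pow_const _
  rw [integrable_prod_iff hm.aestronglyMeasurable]
  refine ⟨ae_of_all _ fun x => (h x).1, ?_⟩
  refine Integrable.of_bound hm.aestronglyMeasurable.norm.integral_prod_right' C (ae_of_all _ fun x => ?_)
  have e : ∀ y, ‖zz x y^(-β)‖ = zz x y^(-β) := fun y => by
    rw [Real.norm_eq_abs, abs_of_nonneg (Real.rpow_nonneg (zz_nonneg _ _) _)]
  simp only [e]
  rw [Real.norm_eq_abs, abs_of_nonneg (integral_nonneg fun y => Real.rpow_nonneg (zz_nonneg _ _) _)]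
  exact (h x).2

theorem zzint_bdd {n : ℕ} (hn : 5 ≤ n) {β : ℝ} (hβ : β < ((n:ℝ)-1)/2) {G : Sp n × Sp n → ℝ} {M : ℝ} (hG : Measurable G)
    (hM : ∀ p, |G p| ≤ M) : Integrable (fun p : Sp n × Sp n => G p * zz p.1 p.2^(-β)) (ss n) :=
  (zzint hn hβ).bdd_mul (c := M) hG.aestronglyMeasurable (ae_of_all _ hM)

theorem gg_meas {n : ℕ} {g : Sp n → ℝ} (hg : Measurable g) : Measurable fun p : Sp n × Sp n => g p.1 * g p.2 :=
  (hg.comp measurable_fst).mul (hg.comp measurable_snd)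

theorem gg_bdd {n : ℕ} {g : Sp n → ℝ} {M : ℝ} (hM : ∀ x, |g x| ≤ M) (p : Sp n × Sp n) : |g p.1 * g p.2| ≤ M * M := by
  rw [abs_mul]
  exact mul_le_mul (hM _) (hM _) (abs_nonneg _) ((abs_nonneg _).trans (hM p.1))

theorem wPh_fub {n : ℕ} (hn : 5 ≤ n) {g : Sp n → ℝ} {M : ℝ} (hg : Measurable g) (hM : ∀ x, |g x| ≤ M) :
    IntegrableOn (fun r => wK (hh n) r * Ph g r) (Set.Ioo 0 1) ∧ 
    ∫ r in Set.Ioo 0 1, wK (hh n) r * Ph g r = 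
    ∫ p, g p.1 * g p.2 * (3/(hh n+3) * zz p.1 p.2^(1 - hh n) - zz p.1 p.2^(2 - hh n)/2 + 2 * cK (hh n)/(hh n+1)) ∂(ss n) := by
  have h3 := hh_ge hn
  obtain ⟨C, hC, hb⟩ := wK_bound hn
  set F : (Sp n × Sp n) × ℝ → ℝ := fun q => g q.1.1 * g q.1.2 * (wK (hh n) q.2 * (Pk n (zz q.1.1 q.1.2) q.2 - 1)) with hF
  have hFm : Measurable F := by
    have m1 : Measurable fun q : (Sp n × Sp n) × ℝ => g q.1.1 * g q.1.2 := (gg_meas hg).comp measurable_fst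
    have m2 : Measurable fun r : ℝ => wK (hh n) r := by unfold wK; fun_prop
    have m3 : Measurable fun q : (Sp n × Sp n) × ℝ => (zz q.1.1 q.1.2, q.2) := (zz_meas.comp measurable_fst).prodMk measurable_snd
    exact m1.mul ((m2.comp measurable_snd).mul ((Measurable.comp (g := fun p : ℝ × ℝ => Pk n p.1 p.2) (Pk_meas n) m3).sub_const 1))
  have hi : Integrable F ((ss n).prod (volume.restrict (Set.Ioo 0 1))) := by
    rw [integrable_prod_iff hFm.aestronglyMeasurable]
    constructor
    · filter_upwards [ae_ss_pos hn] with p hp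
      exact (wKPk_int hn hp (zz_le _ _)).const_mul (g p.1 * g p.2)
    · have hd : Integrable (fun p : Sp n × Sp n => M * M * C * (zz p.1 p.2^(-(hh n-1)) + ∫ r in Set.Ioo 0 1, w1 (hh n) r)) (ss n) :=
        ((zzint hn (by unfold hh; linarith)).add (integrable_const _)).const_mul _
      refine Integrable.mono' hd hFm.norm.aestronglyMeasurable.integral_prod_right' ?_
      filter_upwards [ae_ss_pos hn] with p hp
      rw [Real.norm_eq_abs, abs_of_nonneg (integral_nonneg fun y => norm_nonneg _)]
      have e : zz p.1 p.2^(-(hh n-1)) + ∫ r in Set.Ioo 0 1, w1 (hh n) r = ∫ r in Set.Ioo 0 1, w1 (hh n) r * (Pk n (zz p.1 p.2) r + 1) := by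
        rw [show -(hh n - 1) = 1 - hh n by ring, ← K1 hn hp, ← integral_add (w1Pk_int hn hp) (w1_int h3)]
        congr 1; ext r; ring
      have hi2 : IntegrableOn (fun r => w1 (hh n) r * (Pk n (zz p.1 p.2) r + 1)) (Set.Ioo 0 1) := 
        ((w1Pk_int hn hp).add (w1_int h3)).congr_fun (fun r _ => by simp only [Pi.add_apply]; ring) measurableSet_Ioo
      rw [e, ← integral_const_mul]
      refine setIntegral_mono_on ((wKPk_int hn hp (zz_le _ _)).const_mul (g p.1 * g p.2)).norm (hi2.const_mul _) measurableSet_Ioo fun r hr => ?_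
      simp only [F]
      rw [norm_mul, mul_assoc (M*M)]
      exact mul_le_mul (gg_bdd hM p) (hb _ ⟨zz_nonneg _ _, zz_le _ _⟩ r hr) (norm_nonneg _) ((abs_nonneg _).trans (gg_bdd hM p))
  have e1 : ∀ r, wK (hh n) r * Ph g r = ∫ p, F (p, r) ∂(ss n) := fun r => by
    unfold Ph
    rw [← integral_const_mul]
    congr 1; ext p; simp only [F]; ring
  simp only [e1]
  refine ⟨hi.integral_prod_right, ?_⟩
  rw [← integral_prod_symm F hi, integral_prod F hi]
  apply integral_congr_ae
  filter_upwards [ae_ss_pos hn] with p hp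
  simp only [F]
  rw [integral_const_mul, K2 hn hp (zz_le _ _)]

theorem w1b_int {h : ℝ} (hh : 3/2 ≤ h) : IntegrableOn (fun r => w1 h r * (3*r/(h+3) - (h-2)*(1-r)^2/4)) (Set.Ioo 0 1) ∧ 
    0 ≤ ∫ r in Set.Ioo 0 1, w1 h r * (3*r/(h+3) - (h-2)*(1-r)^2/4) := by
  have hi : IntegrableOn (fun r => w1 h r * (3*r/(h+3) - (h-2)*(1-r)^2/4)) (Set.Ioo 0 1) := by
    have : IntervalIntegrable (fun r : ℝ => r^(h-2)) volume 0 1 := intervalIntegral.intervalIntegrable_rpow' (by linarith)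
    have := this.mul_continuousOn (g := fun r => h*(h-1)*(1-r)^2 * (3*r/(h+3) - (h-2)*(1-r)^2/4)) (by fun_prop)
    rw [intervalIntegrable_iff_integrableOn_Ioo_of_le (by norm_num)] at this
    refine this.congr_fun (fun r _ => by unfold w1; ring) measurableSet_Ioo
  refine ⟨hi, ?_⟩
  set β := (h-2)/(4*(h+3)) with hβ
  set α := (h*β - 3/(h+3) - (h-2)/2)/(h+2) with hα
  have key : ∫ r in Set.Ioo 0 1, (w1 h r * (3*r/(h+3) - (h-2)*(1-r)^2/4) - cK h * w1 h r) = 0 - 0 := by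
    apply ftc01 (F := fun r => r^(h-1) * (h*(h-1)*(1-r)^3*(α + β*r)))
    · intro r hr
      have d1 : HasDerivAt (fun r : ℝ => (1-r)^3) (3*(1-r)^2*(-1)) r := by
        refine (((hasDerivAt_id' r).const_sub 1).fun_pow 3).congr_deriv ?_
        norm_num
      have d2 : HasDerivAt (fun r : ℝ => α + β*r) β r := by
        refine (((hasDerivAt_id' r).const_mul β).const_add α).congr_deriv ?_
        ring
      have d3 := (Real.hasDerivAt_rpow_const (p := h-1) (Or.inl hr.1.ne')).fun_mul ((d1.const_mul (h*(h-1))).fun_mul d2)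
      refine d3.congr_deriv ?_
      have e1 : r^(h-1) = r^(h-2) * r := by rw [← Real.rpow_add_one hr.1.ne']; congr 1; ring
      rw [e1, show h - 1 - 1 = h - 2 by ring]
      unfold w1 cK
      have a1 : h + 2 ≠ 0 := by linarith
      have a2 : h + 3 ≠ 0 := by linarith
      rw [hα, hβ]
      field_simp
      ring
    · exact hi.sub ((w1_int hh).const_mul _)
    · have : ContinuousAt (fun r : ℝ => r^(h-1) * (h*(h-1)*(1-r)^3*(α + β*r))) 0 := by
        apply ContinuousAt.mul (Real.continuousAt_rpow_const _ _ (Or.inr (by linarith))) (by fun_prop)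
      have := this.tendsto
      simp only [Real.zero_rpow (show h - 1 ≠ 0 by linarith), zero_mul] at this
      exact this.mono_left nhdsWithin_le_nhds
    · have : ContinuousAt (fun r : ℝ => r^(h-1) * (h*(h-1)*(1-r)^3*(α + β*r))) 1 := by
        apply ContinuousAt.mul (Real.continuousAt_rpow_const _ _ (Or.inl (by norm_num))) (by fun_prop)
      have := this.tendsto
      simp only [sub_self] at this
      norm_num at this
      exact this.mono_left nhdsWithin_le_nhds
  rw [integral_sub hi ((w1_int hh).const_mul _), integral_const_mul] at key
  have : 0 ≤ cK h := by unfold cK; positivity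
  have h4 : 0 ≤ ∫ r in Set.Ioo 0 1, w1 h r := setIntegral_nonneg measurableSet_Ioo fun r hr => w1_nonneg hh hr.1.le
  nlinarith [mul_nonneg this h4]

theorem spectral {n : ℕ} (hn : 5 ≤ n) {g : Sp n → ℝ} {M : ℝ} (hg : Measurable g) (hM : ∀ x, |g x| ≤ M) :
    0 ≤ ∫ p, g p.1 * g p.2 * (3/(hh n+3) * zz p.1 p.2^(1 - hh n) - zz p.1 p.2^(2 - hh n)/2 + 2 * cK (hh n)/(hh n+1)) ∂(ss n) := by
  obtain ⟨i1, i2⟩ := wPh_fub hn hg hM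
  rw [← i2]
  have h3 := hh_ge hn
  set h := hh n
  obtain ⟨j1, j2⟩ := w1b_int h3
  have hc : ∃ c, 0 ≤ c ∧ ∀ r ∈ Set.Ioo (0:ℝ) 1, 0 ≤ (3*r/(h+3) - (h-2)*(1-r)^2/4) * (Ph g r / r - c) := by
    by_cases h2 : h ≤ 2
    · refine ⟨0, le_rfl, fun r hr => ?_⟩
      have a1 := hr.1
      have a2 := Ph_nonneg hn hg hM hr
      rw [sub_zero]
      have : (h-2)*(1-r)^2/4 ≤ 0 := by nlinarith [sq_nonneg (1-r)]
      have a3 : 0 ≤ 3*r/(h+3) := by positivity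
      exact mul_nonneg (by linarith) (by positivity)
    · push Not at h2
      have hm : ∀ r ∈ Set.Icc (0:ℝ) 1, ∀ s ∈ Set.Icc (0:ℝ) 1, r ≤ s → (3*r/(h+3) - (h-2)*(1-r)^2/4) ≤ (3*s/(h+3) - (h-2)*(1-s)^2/4) := by
        intro r hr s hs hrs
        have a1 : 3*r/(h+3) ≤ 3*s/(h+3) := by gcongr
        have a2 : (1-s)^2 ≤ (1-r)^2 := by nlinarith [hr.1, hs.2]
        nlinarith
      have hcont : ContinuousOn (fun r : ℝ => (3*r/(h+3) - (h-2)*(1-r)^2/4)) (Set.Icc 0 1) := by fun_prop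
      have := intermediate_value_Ioo (by norm_num) hcont (a := (0:ℝ)) (b := 1)
      obtain ⟨r0, hr0, e0⟩ := this (show (0:ℝ) ∈ _ from ⟨by norm_num; linarith, by norm_num; positivity⟩)
      simp only at e0
      have r0' : r0 ∈ Set.Icc (0:ℝ) 1 := ⟨hr0.1.le, hr0.2.le⟩
      refine ⟨Ph g r0 / r0, div_nonneg (Ph_nonneg hn hg hM hr0) hr0.1.le, fun r hr => ?_⟩
      have r' : r ∈ Set.Icc (0:ℝ) 1 := ⟨hr.1.le, hr.2.le⟩
      rcases le_total r r0 with hle | hle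
      · have a1 := hm r r' r0 r0' hle
        have a2 := Ph_mono hn hg hM hr.1 hle hr0.2
        apply mul_nonneg_of_nonpos_of_nonpos <;> linarith
      · have a1 := hm r0 r0' r r' hle
        have a2 := Ph_mono hn hg hM hr0.1 hle hr.2
        apply mul_nonneg <;> linarith
  obtain ⟨c, hc0, hc⟩ := hc
  calc 0 ≤ c * ∫ r in Set.Ioo 0 1, w1 h r * (3*r/(h+3) - (h-2)*(1-r)^2/4) := mul_nonneg hc0 j2
    _ = ∫ r in Set.Ioo 0 1, c * (w1 h r * (3*r/(h+3) - (h-2)*(1-r)^2/4)) := (integral_const_mul _ _).symm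
    _ ≤ _ := by
      refine setIntegral_mono_on (j1.const_mul _) i1 measurableSet_Ioo fun r hr => ?_
      have e : wK h r * Ph g r = w1 h r * ((3*r/(h+3) - (h-2)*(1-r)^2/4) * (Ph g r / r)) := by
        have e1 : r^(h-2) = r^(h-3) * r := by rw [← Real.rpow_add_one hr.1.ne']; congr 1; ring
        have := hr.1.ne'
        unfold wK w1
        rw [e1]; field_simp
      rw [e]
      have := mul_nonneg (w1_nonneg h3 hr.1.le) (hc r hr)
      nlinarith

def gam (β : ℝ) : ℝ := (Real.sqrt (1 - β^2))⁻¹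

theorem gam_pos {β : ℝ} (hβ : |β| < 1) : 0 < gam β ∧ gam β^2 * (1 - β^2) = 1 := by
  have h : 0 < 1 - β^2 := by nlinarith [abs_lt.1 hβ]
  have h2 := Real.sqrt_pos.2 h
  refine ⟨by unfold gam; positivity, ?_⟩
  unfold gam
  rw [inv_pow, Real.sq_sqrt h.le]
  field_simp

theorem gam_neg (β : ℝ) : gam (-β) = gam β := by unfold gam; rw [neg_sq]

def bo {n : ℕ} (e : E n) (β : ℝ) (x : E n) : E n := x + ((gam β - 1) * inner ℝ e x + gam β * β * ‖x‖) • e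

theorem bo_inner {n : ℕ} {e : E n} (he : ‖e‖ = 1) (β : ℝ) (x : E n) : 
    inner ℝ e (bo e β x) = gam β * (inner ℝ e x + β * ‖x‖) := by
  unfold bo
  rw [inner_add_right, inner_smul_right, real_inner_self_eq_norm_sq, he]; ring

theorem bo_inner2 {n : ℕ} {e : E n} (he : ‖e‖ = 1) {β : ℝ} (hβ : |β| < 1) (x y : E n) : 
    inner ℝ (bo e β x) (bo e β y) - gam β * (‖x‖ + β * inner ℝ e x) * (gam β * (‖y‖ + β * inner ℝ e y)) = inner ℝ x y - ‖x‖ * ‖y‖ := by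
  have h := (gam_pos hβ).2
  have e1 : inner ℝ (bo e β x) (bo e β y) = inner ℝ x y - inner ℝ e x * inner ℝ e y + inner ℝ e (bo e β x) * inner ℝ e (bo e β y) := by
    unfold bo
    simp only [inner_add_right, inner_add_left, inner_smul_right, inner_smul_left, real_inner_self_eq_norm_sq, he, real_inner_comm e, conj_trivial]
    ring
  rw [e1, bo_inner he, bo_inner he]
  linear_combination (inner ℝ e x * inner ℝ e y - ‖x‖*‖y‖) * h

theorem bo_aux {n : ℕ} {e : E n} (he : ‖e‖ = 1) {β : ℝ} (hβ : |β| < 1) (x : E n) (hx : x ≠ 0) : 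
    0 < gam β * (‖x‖ + β * inner ℝ e x) := by
  have h1 : |inner ℝ e x| ≤ ‖x‖ := by have := abs_real_inner_le_norm e x; rwa [he, one_mul] at this
  have h2 := norm_pos_iff.2 hx
  have h3 : |β * inner ℝ e x| < ‖x‖ := by
    rw [abs_mul]; nlinarith [abs_nonneg β, abs_nonneg (inner ℝ e x)]
  have := (abs_lt.1 h3).1
  exact mul_pos (gam_pos hβ).1 (by linarith)

theorem bo_norm {n : ℕ} {e : E n} (he : ‖e‖ = 1) {β : ℝ} (hβ : |β| < 1) (x : E n) : 
    ‖bo e β x‖ = gam β * (‖x‖ + β * inner ℝ e x) := by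
  by_cases hx : x = 0
  · subst hx; simp [bo]
  have h := bo_inner2 he hβ x x
  rw [real_inner_self_eq_norm_sq, real_inner_self_eq_norm_sq] at h
  have h2 := bo_aux he hβ x hx
  rw [← sq_eq_sq₀ (norm_nonneg _) h2.le]
  linarith

theorem bo_inv {n : ℕ} {e : E n} (he : ‖e‖ = 1) {β : ℝ} (hβ : |β| < 1) (x : E n) : bo e (-β) (bo e β x) = x := by
  have h := (gam_pos hβ).2
  rw [show bo e (-β) (bo e β x) = bo e β x + ((gam (-β) - 1) * inner ℝ e (bo e β x) + gam (-β) * (-β) * ‖bo e β x‖) • e from rfl]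
  rw [bo_inner he, bo_norm he hβ, gam_neg]
  unfold bo
  rw [add_assoc, ← add_smul]
  convert add_zero x
  convert zero_smul ℝ e
  linear_combination (inner ℝ e x) * h

theorem bo_smul {n : ℕ} (e : E n) (β : ℝ) {r : ℝ} (hr : 0 ≤ r) (x : E n) : bo e β (r • x) = r • bo e β x := by
  unfold bo
  rw [inner_smul_right, norm_smul, Real.norm_eq_abs, abs_of_nonneg hr, smul_add, smul_smul]
  congr 2; ring

theorem bo_ne {n : ℕ} {e : E n} (he : ‖e‖ = 1) {β : ℝ} (hβ : |β| < 1) {x : E n} (hx : x ≠ 0) : bo e β x ≠ 0 := by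
  rw [← norm_pos_iff, bo_norm he hβ]; exact bo_aux he hβ x hx

theorem bo_cont {n : ℕ} (e : E n) (β : ℝ) : Continuous (bo e β) := by unfold bo; fun_prop

def boD {n : ℕ} (e : E n) (β : ℝ) (x : E n) : E n →L[ℝ] E n :=
  ContinuousLinearMap.id ℝ _ + ((gam β - 1) • innerSL ℝ e + (gam β * β) • (‖x‖⁻¹ • innerSL ℝ x)).smulRight e

theorem boD_det {n : ℕ} {e : E n} (he : ‖e‖ = 1) (β : ℝ) {x : E n} : 
    (boD e β x).det = gam β * (1 + β * (‖x‖⁻¹ * inner ℝ e x)) := by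
  have : ((boD e β x : E n →L[ℝ] E n) : E n →ₗ[ℝ] E n) = LinearMap.transvection 
      (((gam β - 1) • innerSL ℝ e + (gam β * β) • (‖x‖⁻¹ • innerSL ℝ x) : E n →L[ℝ] ℝ) : E n →ₗ[ℝ] ℝ) e := by
    ext v
    simp [boD, LinearMap.transvection]
  rw [ContinuousLinearMap.det, this, LinearMap.transvection.det]
  simp [he, real_inner_comm]
  ring

theorem bo_fderiv {n : ℕ} (e : E n) (β : ℝ) {x : E n} (hx : x ≠ 0) : HasFDerivAt (bo e β) (boD e β x) x := by
  have h1 : HasFDerivAt (fun x : E n => ‖x‖) (‖x‖⁻¹ • innerSL ℝ x) x := by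
    have := (hasStrictFDerivAt_norm_sq (F := E n) x).hasFDerivAt.sqrt (by positivity)
    simp only [Real.sqrt_sq (norm_nonneg _)] at this
    refine this.congr_fderiv ?_
    ext v
    have := norm_pos_iff.2 hx
    simp
    field_simp
  have h2 : HasFDerivAt (fun x : E n => inner ℝ e x) (innerSL ℝ e) x := (innerSL ℝ e).hasFDerivAt
  have h3 := (hasFDerivAt_id x).add (((h2.const_mul (gam β - 1)).add (h1.const_mul (gam β * β))).smul_const e)
  exact h3

theorem bo_lint {n : ℕ} {e : E n} (he : ‖e‖ = 1) {β : ℝ} (hβ : |β| < 1) (F : E n → ℝ≥0∞) :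
    ∫⁻ y, F y = ∫⁻ x, ENNReal.ofReal (gam β * (1 + β * (‖x‖⁻¹ * inner ℝ e x))) * F (bo e β x) := by
  have hm : MeasurableSet ({0}ᶜ : Set (E n)) := (measurableSet_singleton _).compl
  have himg : bo e β '' {0}ᶜ = {0}ᶜ := by
    ext y; constructor
    · rintro ⟨x, hx, rfl⟩; exact bo_ne he hβ hx
    · intro hy
      have hβ' : |-β| < 1 := by rwa [abs_neg]
      refine ⟨bo e (-β) y, bo_ne he hβ' hy, ?_⟩
      have := bo_inv he hβ' y
      rwa [neg_neg] at this
  have h := lintegral_image_eq_lintegral_abs_det_fderiv_mul (volume : Measure (E n)) hm (f := bo e β) (f' := boD e β)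
    (fun x hx => (bo_fderiv e β hx).hasFDerivWithinAt) 
    (fun x _ y _ hxy => by rw [← bo_inv he hβ x, hxy, bo_inv he hβ y]) F
  have hall : ∀ G : E n → ℝ≥0∞, ∀ hne : n ≠ 0, ∫⁻ x in {0}ᶜ, G x = ∫⁻ x, G x := by
    intro G hne
    have : Nonempty (Fin n) := ⟨⟨0, Nat.pos_of_ne_zero hne⟩⟩
    have : Nontrivial (E n) := inferInstance
    rw [restrict_compl_singleton]
  have hne : n ≠ 0 := by
    rintro rfl
    rw [Subsingleton.elim e 0, norm_zero] at he
    norm_num at he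
  rw [himg, hall _ hne] at h
  rw [h, ← hall _ hne]
  apply setLIntegral_congr_fun hm
  intro x hx
  simp only
  rw [boD_det he]
  congr 2
  apply abs_of_pos
  have h1 := bo_aux he hβ x hx
  have h2 := norm_pos_iff.2 (show x ≠ 0 from hx)
  have : gam β * (1 + β * (‖x‖⁻¹ * inner ℝ e x)) = gam β * (‖x‖ + β * inner ℝ e x) * ‖x‖⁻¹ := by field_simp
  rw [this]; positivity

theorem rad_lint {n : ℕ} (hn : 5 ≤ n) {b : ℝ} (hb : 0 < b) (a : ℝ≥0∞) :
    ∫⁻ r in Set.Ioi (0:ℝ), ENNReal.ofReal (r^(n-1)) * (Set.Iio b).indicator (fun _ => a) r = ENNReal.ofReal (b^n/n) * a := by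
  have e1 : ∀ r : ℝ, ENNReal.ofReal (r^(n-1)) * (Set.Iio b).indicator (fun _ => a) r = 
     (Set.Iio b).indicator (fun r => ENNReal.ofReal (r^(n-1))) r * a := by
    intro r
    by_cases h : r ∈ Set.Iio b
    · simp only [Set.indicator_of_mem h]
    · simp only [Set.indicator_of_notMem h, mul_zero, zero_mul]
  simp only [e1]
  have m1 : Measurable fun r : ℝ => ENNReal.ofReal (r^(n-1)) := by fun_prop
  rw [lintegral_mul_const _ (m1.indicator measurableSet_Iio), setLIntegral_indicator measurableSet_Iio]
  congr 1
  rw [Set.inter_comm, Set.Ioi_inter_Iio, ← ofReal_integral_eq_lintegral_ofReal]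
  · rw [← integral_Ioc_eq_integral_Ioo, ← intervalIntegral.integral_of_le hb.le, integral_pow]
    have : n - 1 + 1 = n := by omega
    rw [this, zero_pow (by omega), sub_zero]
    congr 2
    rw [← Nat.cast_add_one, this]
  · have : IntegrableOn (fun r : ℝ => r^(n-1)) (Set.Icc 0 b) := (by fun_prop : Continuous fun r : ℝ => r^(n-1)).continuousOn.integrableOn_Icc
    exact this.mono_set Set.Ioo_subset_Icc_self
  · filter_upwards [ae_restrict_mem measurableSet_Ioo] with r hr
    exact pow_nonneg hr.1.le _

theorem boost {n : ℕ} (hn : 5 ≤ n) {e : E n} (he : ‖e‖ = 1) {β : ℝ} (hβ : |β| < 1) :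
    ∃ T : Sp n → Sp n, ∃ Ω : Sp n → ℝ, Continuous T ∧ Continuous Ω ∧ (∀ x, 0 < Ω x) ∧
      (∀ x, Ω x * (gam β * (1 - β * inner ℝ e (T x : E n))) = 1) ∧
      (∀ x y, zz (T x) (T y) = zz x y / (Ω x * Ω y)) ∧
      (∀ φ : Sp n → ℝ≥0∞, Measurable φ → ∫⁻ x, ENNReal.ofReal ((Ω x^(n-1))⁻¹) * φ (T x) ∂(sg n) = ∫⁻ x, φ x ∂(sg n)) := by
  set Ω : Sp n → ℝ := fun x => gam β * (1 + β * inner ℝ e (x : E n)) with hΩ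
  have x0 : ∀ x : Sp n, (x : E n) ≠ 0 := fun x => by rw [← norm_pos_iff, x.norm_eq]; norm_num
  have Ωpos : ∀ x, 0 < Ω x := fun x => by
    have := bo_aux he hβ x (x0 x)
    rwa [x.norm_eq] at this
  have Ωn : ∀ x : Sp n, ‖bo e β x‖ = Ω x := fun x => by rw [bo_norm he hβ, x.norm_eq]
  have Ωc : Continuous Ω := by simp only [hΩ]; fun_prop
  set T : Sp n → Sp n := fun x => ⟨(Ω x)⁻¹ • bo e β x, by
    rw [mem_sphere_zero_iff_norm, norm_smul, Ωn, norm_inv, Real.norm_eq_abs, abs_of_pos (Ωpos x)]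
    exact inv_mul_cancel₀ (Ωpos x).ne'⟩ with hT
  have Tv : ∀ x, (T x : E n) = (Ω x)⁻¹ • bo e β x := fun x => rfl
  have Tc : Continuous T := by
    apply Continuous.subtype_mk
    exact (Ωc.inv₀ fun x => (Ωpos x).ne').smul ((bo_cont e β).comp continuous_subtype_val)
  have g1 := gam_pos hβ
  refine ⟨T, Ω, Tc, Ωc, Ωpos, ?_, ?_, ?_⟩
  · intro x
    rw [Tv, inner_smul_right, bo_inner he, x.norm_eq]
    have := (Ωpos x).ne'
    have e1 : Ω x * (gam β * (1 - β * ((Ω x)⁻¹ * (gam β * (inner ℝ e (x:E n) + β * 1))))) = 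
      gam β * (Ω x - β * (gam β * (inner ℝ e (x:E n) + β))) := by field_simp
    rw [e1]
    simp only [hΩ]
    linear_combination g1.2
  · intro x y
    rw [zz_eq, zz_eq, Tv, Tv, inner_smul_left, inner_smul_right, conj_trivial]
    have h := bo_inner2 he hβ (x : E n) y
    rw [x.norm_eq, y.norm_eq] at h
    have a1 := (Ωpos x).ne'
    have a2 := (Ωpos y).ne'
    have h' : inner ℝ (bo e β (x:E n)) (bo e β (y:E n)) = inner ℝ (x:E n) y - 1 + Ω x * Ω y := by
      simp only [hΩ]; linarith
    rw [h']
    field_simp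
    ring
  · intro φ hφ
    obtain ⟨ψ, hψ, hψφ⟩ := (MeasurableEmbedding.subtype_coe (isClosed_sphere.measurableSet : MeasurableSet (sphere (0:E n) 1))).exists_measurable_extend hφ (fun _ => ⟨0⟩)
    have hψ' : ∀ x : Sp n, ψ (x : E n) = φ x := fun x => congrFun hψφ x
    set F : E n → ℝ≥0∞ := (ball (0:E n) 1).indicator fun y => ψ (‖y‖⁻¹ • y) with hF
    have Fm : Measurable F := (hψ.comp (by fun_prop)).indicator measurableSet_ball
    have h := bo_lint he hβ F
    have Fm2 : Measurable fun x : E n => ENNReal.ofReal (gam β * (1 + β * (‖x‖⁻¹ * inner ℝ e x))) * F (bo e β x) := by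
      have m1 : Measurable fun x : E n => inner ℝ e x := (by fun_prop : Continuous fun x : E n => inner ℝ e x).measurable
      have m2 : Measurable fun x : E n => gam β * (1 + β * (‖x‖⁻¹ * inner ℝ e x)) := ((((measurable_norm.inv).mul m1).const_mul β).const_add 1).const_mul _
      exact m2.ennreal_ofReal.mul (Fm.comp (bo_cont e β).measurable)
    rw [polar_lintegral hn F Fm, polar_lintegral hn _ Fm2] at h
    have FF : ∀ (v : E n) (r s : ℝ), 0 < r → 0 < s → ‖v‖ = s → F (r • v) = (Set.Iio s⁻¹).indicator (fun _ => ψ (s⁻¹ • v)) r := by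
      intro v r s hr hs hv
      have hnorm : ‖r • v‖ = r * s := by rw [norm_smul, hv, Real.norm_eq_abs, abs_of_pos hr]
      have hiff : r • v ∈ ball (0:E n) 1 ↔ r ∈ Set.Iio s⁻¹ := by
        rw [mem_ball_zero_iff, hnorm, Set.mem_Iio, lt_inv_comm₀ hr hs, ← one_div, lt_div_iff₀ hr, mul_comm]
      by_cases hc : r ∈ Set.Iio s⁻¹
      · rw [Set.indicator_of_mem hc, hF, Set.indicator_of_mem (hiff.2 hc), hnorm, smul_smul]
        congr 2
        field_simp
      · rw [Set.indicator_of_notMem hc, hF, Set.indicator_of_notMem (fun h => hc (hiff.1 h))]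
    have L : ∀ ω : Sp n, ∫⁻ r in Set.Ioi (0:ℝ), ENNReal.ofReal (r ^ (n-1)) * F (r • (ω : E n)) = ENNReal.ofReal (1/n) * φ ω := by
      intro ω
      rw [setLIntegral_congr_fun measurableSet_Ioi (g := fun r : ℝ => ENNReal.ofReal (r^(n-1)) * (Set.Iio (1:ℝ)⁻¹).indicator (fun _ => ψ ((1:ℝ)⁻¹ • (ω:E n))) r)
        (fun r hr => by simp only; rw [FF ω r 1 hr one_pos ω.norm_eq]), rad_lint hn (by norm_num)]
      simp [hψ']
    have R : ∀ ω : Sp n, ∫⁻ r in Set.Ioi (0:ℝ), ENNReal.ofReal (r ^ (n-1)) * (ENNReal.ofReal (gam β * (1 + β * (‖r • (ω:E n)‖⁻¹ * inner ℝ e (r • (ω:E n))))) * F (bo e β (r • (ω : E n)))) = 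
       ENNReal.ofReal (1/n) * (ENNReal.ofReal ((Ω ω^(n-1))⁻¹) * φ (T ω)) := by
      intro ω
      have a1 := Ωpos ω
      rw [setLIntegral_congr_fun measurableSet_Ioi (g := fun r : ℝ => ENNReal.ofReal (Ω ω) * (ENNReal.ofReal (r^(n-1)) * (Set.Iio (Ω ω)⁻¹).indicator (fun _ => φ (T ω)) r))
        (fun r hr => by 
          have hr' : 0 < r := hr
          simp only
          rw [bo_smul e β hr'.le, FF _ r (Ω ω) hr a1 (Ωn ω), ← Tv, hψ', norm_smul, ω.norm_eq, inner_smul_right, Real.norm_eq_abs, abs_of_pos hr']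
          rw [show (r*1)⁻¹ * (r * inner ℝ e (ω:E n)) = inner ℝ e (ω:E n) by field_simp]
          simp only [hΩ]
          ring)]
      rw [lintegral_const_mul' _ _ ENNReal.ofReal_ne_top, rad_lint hn (by positivity), ← mul_assoc, ← mul_assoc, ← ENNReal.ofReal_mul a1.le, ← ENNReal.ofReal_mul (by positivity)]
      congr 2
      have : n = n - 1 + 1 := by omega
      rw [inv_pow]
      conv_lhs => rw [show (Ω ω)^n = (Ω ω)^(n-1) * Ω ω by rw [← pow_succ, ← this]]
      field_simp
    simp only [L, R] at h
    rw [lintegral_const_mul' _ _ ENNReal.ofReal_ne_top, lintegral_const_mul' _ _ ENNReal.ofReal_ne_top] at h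
    have c0 : ENNReal.ofReal (1/n) ≠ 0 := by
      rw [ENNReal.ofReal_ne_zero_iff]
      have : (0:ℝ) < n := by exact_mod_cast (by omega)
      positivity
    exact ((ENNReal.mul_right_inj c0 ENNReal.ofReal_ne_top).1 h).symm

def Iq {n : ℕ} (g : Sp n → ℝ) : ℝ := ∫ p, g p.1 * g p.2 * zz p.1 p.2^(1 - hh n) ∂(ss n)

structure BM {n : ℕ} (g : Sp n → ℝ) : Prop where
  m : Measurable g
  b : ∃ M, ∀ x, |g x| ≤ M
  p : ∀ x, 0 ≤ g x

theorem Iq_int {n : ℕ} (hn : 5 ≤ n) {g : Sp n → ℝ} {M : ℝ} (hg : Measurable g) (hM : ∀ x, |g x| ≤ M) :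
    Integrable (fun p : Sp n × Sp n => g p.1 * g p.2 * zz p.1 p.2^(1 - hh n)) (ss n) := by
  have := zzint_bdd hn (β := hh n - 1) (by unfold hh; linarith) (gg_meas hg) (gg_bdd hM)
  rwa [neg_sub] at this

theorem Iq_nonneg {n : ℕ} {g : Sp n → ℝ} (hg : BM g) : 0 ≤ Iq g :=
  integral_nonneg fun p => mul_nonneg (mul_nonneg (hg.p _) (hg.p _)) (Real.rpow_nonneg (zz_nonneg _ _) _)

theorem Iq_lint {n : ℕ} (hn : 5 ≤ n) {g : Sp n → ℝ} (hg : BM g) : 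
    ENNReal.ofReal (Iq g) = ∫⁻ x, ∫⁻ y, ENNReal.ofReal (g x * g y * zz x y^(1 - hh n)) ∂(sg n) ∂(sg n) := by
  obtain ⟨M, hM⟩ := hg.b
  unfold Iq
  rw [ofReal_integral_eq_lintegral_ofReal (Iq_int hn hg.m hM) (ae_of_all _ fun p => mul_nonneg (mul_nonneg (hg.p _) (hg.p _)) (Real.rpow_nonneg (zz_nonneg _ _) _))]
  rw [lintegral_prod]
  exact ((gg_meas hg.m).mul (zz_meas.pow_const _)).ennreal_ofReal.aemeasurable

theorem rpow_bdd {n : ℕ} {g : Sp n → ℝ} (hg : BM g) {p : ℝ} (hp : 0 ≤ p) : BM (fun x => g x^p) := by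
  obtain ⟨M, hM⟩ := hg.b
  refine ⟨hg.m.pow_const p, ⟨M^p, fun x => ?_⟩, fun x => Real.rpow_nonneg (hg.p x) _⟩
  rw [abs_of_nonneg (Real.rpow_nonneg (hg.p x) _)]
  exact Real.rpow_le_rpow (hg.p x) ((le_abs_self _).trans (hM x)) hp

theorem BM.int {n : ℕ} {g : Sp n → ℝ} (hg : BM g) : Integrable g (sg n) := by
  obtain ⟨M, hM⟩ := hg.b
  exact bdd_int hg.m hM

theorem young {n : ℕ} (hn : 5 ≤ n) {p : ℝ} (hp : (2*hh n+1)/(hh n+2) < p) (hp2 : p ≤ 2) :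
    ∃ C, ∀ g : Sp n → ℝ, BM g → ∫ x, g x^p ∂(sg n) = 1 → Iq g ≤ C := by
  have h3 := hh_ge hn
  have hp1 : 1 < p := by
    refine lt_of_le_of_lt ?_ hp
    rw [le_div_iff₀ (by linarith)]; linarith
  set a := 1 - 1/p with ha
  have ha0 : 0 < a := by rw [ha, sub_pos, div_lt_one (by linarith)]; exact hp1
  have ha2 : a ≤ 1/2 := by
    have : 1/2 ≤ 1/p := by apply one_div_le_one_div_of_le <;> linarith
    rw [ha]; linarith
  set β := (hh n - 1)/(2*a) with hβ
  have hβ2 : β < ((n:ℝ)-1)/2 := by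
    rw [hβ, div_lt_iff₀ (by positivity)]
    have e : ((n:ℝ)-1)/2 = hh n + 1/2 := by unfold hh; ring
    rw [e, ha]
    rw [div_lt_iff₀ (by linarith)] at hp
    have : (1 - 1/p) = (p-1)/p := by field_simp
    rw [this, show (hh n + 1/2)*(2*((p-1)/p)) = (2*hh n+1)*(p-1)/p by ring, lt_div_iff₀ (by linarith)]
    linarith
  obtain ⟨C, hC, hz⟩ := zint hn hβ2
  refine ⟨2*C + 1, fun g hg h1 => ?_⟩
  have hgp := rpow_bdd hg (p := p) (by linarith)
  obtain ⟨M', hM'⟩ := hgp.b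
  obtain ⟨M, hM⟩ := hg.b
  set X : Sp n → ℝ := fun x => g x^p with hX
  have i1 : Integrable (fun q : Sp n × Sp n => X q.1 * zz q.1 q.2^(-β)) (ss n) :=
    zzint_bdd hn hβ2 (hgp.m.comp measurable_fst) (fun q => hM' q.1)
  have i2 : Integrable (fun q : Sp n × Sp n => X q.2 * zz q.1 q.2^(-β)) (ss n) :=
    zzint_bdd hn hβ2 (hgp.m.comp measurable_snd) (fun q => hM' q.2)
  have i3 : Integrable (fun q : Sp n × Sp n => X q.1 * X q.2) (ss n) := bdd_int (gg_meas hgp.m) (gg_bdd hM')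
  have b1 : ∫ q, X q.1 * zz q.1 q.2^(-β) ∂(ss n) ≤ C := by
    rw [integral_prod _ i1]
    calc _ = ∫ x, X x * ∫ y, zz x y^(-β) ∂(sg n) ∂(sg n) := by congr 1; ext x; exact integral_const_mul (X x) _
      _ ≤ ∫ x, X x * C ∂(sg n) := by
        apply integral_mono_of_nonneg (ae_of_all _ fun x => mul_nonneg (hgp.p x) (integral_nonneg fun y => Real.rpow_nonneg (zz_nonneg _ _) _)) (hgp.int.mul_const _)
        exact ae_of_all _ fun x => mul_le_mul_of_nonneg_left (hz x).2 (hgp.p x)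
      _ = C := by rw [integral_mul_const, h1, one_mul]
  have b2 : ∫ q, X q.2 * zz q.1 q.2^(-β) ∂(ss n) = ∫ q, X q.1 * zz q.1 q.2^(-β) ∂(ss n) := by
    rw [← integral_prod_swap]
    congr 1; ext q; simp only [Prod.fst_swap, Prod.snd_swap]; rw [zz_symm]
  have b3 : ∫ q, X q.1 * X q.2 ∂(ss n) = 1 := by
    rw [integral_prod_mul, h1, one_mul]
  unfold Iq
  calc _ ≤ ∫ q, (a * (X q.1 * zz q.1 q.2^(-β)) + a * (X q.2 * zz q.1 q.2^(-β)) + (1-2*a) * (X q.1 * X q.2)) ∂(ss n) := by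
        apply integral_mono (Iq_int hn hg.m hM) (((i1.const_mul a).add (i2.const_mul a)).add (i3.const_mul _))
        intro q
        simp only [Pi.add_apply]
        have X1 : 0 ≤ X q.1 := hgp.p _
        have X2 : 0 ≤ X q.2 := hgp.p _
        have z0 := zz_nonneg q.1 q.2
        have K0 : 0 ≤ zz q.1 q.2^(-β) := Real.rpow_nonneg z0 _
        have y := Real.geom_mean_le_arith_mean3_weighted ha0.le ha0.le (show 0 ≤ 1 - 2*a by linarith) (mul_nonneg X1 K0) (mul_nonneg X2 K0) (mul_nonneg X1 X2) (by ring)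
        refine le_trans (le_of_eq ?_) y
        rw [Real.mul_rpow X1 K0, Real.mul_rpow X2 K0, Real.mul_rpow X1 X2]
        have e1 : ∀ x, 0 ≤ g x → (g x^p)^a * (g x^p)^(1-2*a) = g x := by
          intro x hx
          rw [← Real.rpow_add_of_nonneg (Real.rpow_nonneg hx _) ha0.le (by linarith), ← Real.rpow_mul hx]
          have : p * (a + (1-2*a)) = 1 := by rw [ha]; field_simp; ring
          rw [this, Real.rpow_one]
        have e2 : (zz q.1 q.2^(-β))^a * (zz q.1 q.2^(-β))^a = zz q.1 q.2^(1 - hh n) := by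
          rw [← Real.rpow_add_of_nonneg K0 ha0.le ha0.le, ← Real.rpow_mul z0]
          congr 1; rw [hβ]; field_simp; ring
        rw [← e2]
        nth_rewrite 1 [← e1 q.1 (hg.p _), ← e1 q.2 (hg.p _)]
        simp only [hX]
        ring
    _ = a * ∫ q, X q.1 * zz q.1 q.2^(-β) ∂(ss n) + a * ∫ q, X q.1 * zz q.1 q.2^(-β) ∂(ss n) + (1-2*a) := by
        rw [integral_add ((i1.const_mul a).fun_add (i2.const_mul a)) (i3.const_mul _), integral_add (i1.const_mul a) (i2.const_mul a), integral_const_mul, integral_const_mul, integral_const_mul, b2, b3, mul_one]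
    _ ≤ 2*C + 1 := by nlinarith

theorem holder1 {n : ℕ} {p : ℝ} (hp : 1 < p) {g : Sp n → ℝ} (hg : BM g) (h1 : ∫ x, g x^p ∂(sg n) = 1) :
    (∫ x, g x ∂(sg n))^2 ≤ AS n^(2-2/p) := by
  obtain ⟨M, hM⟩ := hg.b
  have hc := Real.HolderConjugate.conjExponent hp
  have := integral_mul_le_Lp_mul_Lq_of_nonneg hc (μ := sg n) (f := g) (g := fun _ => (1:ℝ)) (ae_of_all _ hg.p) (ae_of_all _ fun _ => zero_le_one)
    (MemLp.of_bound hg.m.aestronglyMeasurable M (ae_of_all _ hM)) (memLp_const _)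
  simp only [mul_one, h1, Real.one_rpow, one_mul, integral_const, smul_eq_mul] at this
  change _ ≤ AS n^_ at this
  have h0 : 0 ≤ ∫ x, g x ∂(sg n) := integral_nonneg hg.p
  calc _ ≤ (AS n^(1/p.conjExponent))^2 := by gcongr
    _ = _ := by
      rw [← Real.rpow_mul_natCast (AS_nonneg n)]
      congr 1
      unfold Real.conjExponent
      push_cast
      have : p - 1 ≠ 0 := by linarith
      field_simp

theorem boost_inv {n : ℕ} (hn : 5 ≤ n) {e : E n} (he : ‖e‖ = 1) {β : ℝ} (hβ : |β| < 1) {p : ℝ} (hp : 0 ≤ p)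
    {g : Sp n → ℝ} (hg : BM g) : ∃ g' : Sp n → ℝ, BM g' ∧ Iq g' = Iq g ∧ 
      ∫ x, g' x^p ∂(sg n) = ∫ x, g x^p * (gam β * (1 - β * inner ℝ e (x : E n)))^((hh n+2)*p - (2*hh n+1)) ∂(sg n) := by
  obtain ⟨T, Ω, Tc, Ωc, Ωp, h1, h2, h3⟩ := boost hn he hβ
  obtain ⟨M, hM⟩ := hg.b
  have wc : ∀ s : ℝ, Continuous fun x => Ω x^s := fun s => Ωc.rpow_const fun x => Or.inl (Ωp x).ne'
  have bddc : ∀ f : Sp n → ℝ, Continuous f → ∃ B, ∀ x, |f x| ≤ B := fun f hf => by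
    obtain ⟨B, hB⟩ := isCompact_univ.exists_bound_of_continuousOn (f := f) hf.continuousOn
    exact ⟨B, fun x => hB x trivial⟩
  have hd : ∀ x, (Ω x^(n-1))⁻¹ = Ω x^(-(2*hh n+1)) := fun x => by
    rw [Real.rpow_neg (Ωp x).le, ← Real.rpow_natCast]
    congr 2
    unfold hh
    push_cast [Nat.cast_sub (show 1 ≤ n by omega)]
    ring
  set g' : Sp n → ℝ := fun x => g (T x) * Ω x^(-(hh n+2)) with hg'
  have BMg : BM g' := by
    obtain ⟨B, hB⟩ := bddc _ (wc (-(hh n+2)))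
    refine ⟨(hg.m.comp Tc.measurable).mul (wc _).measurable, ⟨M*B, fun x => ?_⟩, fun x => mul_nonneg (hg.p _) (Real.rpow_nonneg (Ωp x).le _)⟩
    simp only [hg']
    rw [abs_mul]
    exact mul_le_mul (hM _) (hB x) (abs_nonneg _) ((abs_nonneg _).trans (hM (T x)))
  refine ⟨g', BMg, ?_, ?_⟩
  · have e1 : ENNReal.ofReal (Iq g') = ENNReal.ofReal (Iq g) := by
      rw [Iq_lint hn BMg, Iq_lint hn hg]
      have hm : Measurable fun q : Sp n × Sp n => ENNReal.ofReal (g q.1 * g q.2 * zz q.1 q.2^(1 - hh n)) :=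
        ((gg_meas hg.m).mul (zz_meas.pow_const _)).ennreal_ofReal
      rw [← h3 (fun x => ∫⁻ y, ENNReal.ofReal (g x * g y * zz x y^(1 - hh n)) ∂(sg n)) hm.lintegral_prod_right']
      apply lintegral_congr
      intro x
      rw [← h3 (fun y => ENNReal.ofReal (g (T x) * g y * zz (T x) y^(1 - hh n))) (hm.comp measurable_prodMk_left), ← lintegral_const_mul' _ _ ENNReal.ofReal_ne_top]
      apply lintegral_congr
      intro y
      have a1 := Ωp x
      have a2 := Ωp y
      rw [← ENNReal.ofReal_mul (by positivity), ← ENNReal.ofReal_mul (by positivity), h2, hd, hd, Real.div_rpow (zz_nonneg _ _) (by positivity), Real.mul_rpow a1.le a2.le]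
      congr 1
      simp only [hg']
      have e2 : ∀ w : ℝ, 0 < w → w^(-(hh n+2)) = w^(-(2*hh n+1)) / w^(1-hh n) := fun w hw => by
        rw [← Real.rpow_sub hw]; congr 1; ring
      rw [e2 _ a1, e2 _ a2]
      have b1 : Ω x^(1 - hh n) ≠ 0 := (Real.rpow_pos_of_pos a1 _).ne'
      have b2 : Ω y^(1 - hh n) ≠ 0 := (Real.rpow_pos_of_pos a2 _).ne'
      field_simp
    rwa [ENNReal.ofReal_eq_ofReal_iff (Iq_nonneg BMg) (Iq_nonneg hg)] at e1
  · have gp : ∀ x : Sp n, 0 < gam β * (1 - β * inner ℝ e (x : E n)) := fun x => by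
      have := bo_aux he (β := -β) (by rwa [abs_neg]) x (by rw [← norm_pos_iff, x.norm_eq]; norm_num)
      rw [x.norm_eq, gam_neg] at this
      linarith
    have gc : Continuous fun x : Sp n => (gam β * (1 - β * inner ℝ e (x : E n)))^((hh n+2)*p - (2*hh n+1)) := by
      apply Continuous.rpow_const (by fun_prop) fun x => Or.inl (gp x).ne'
    have fm : Measurable fun x : Sp n => g x^p * (gam β * (1 - β * inner ℝ e (x : E n)))^((hh n+2)*p - (2*hh n+1)) :=
      (hg.m.pow_const p).mul gc.measurable
    rw [integral_eq_lintegral_of_nonneg_ae (ae_of_all _ fun x => Real.rpow_nonneg (BMg.p x) _) (BMg.m.pow_const p).aestronglyMeasurable,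
      integral_eq_lintegral_of_nonneg_ae (ae_of_all _ fun x => mul_nonneg (Real.rpow_nonneg (hg.p x) _) (Real.rpow_nonneg (gp x).le _)) fm.aestronglyMeasurable,
      ← h3 _ fm.ennreal_ofReal]
    congr 1
    apply lintegral_congr
    intro x
    have a1 := Ωp x
    rw [← ENNReal.ofReal_mul (by positivity), hd]
    congr 1
    have e3 : gam β * (1 - β * inner ℝ e (T x : E n)) = Ω x^(-1:ℝ) := by
      rw [Real.rpow_neg_one]; exact eq_inv_of_mul_eq_one_right (h1 x)
    rw [e3, ← Real.rpow_mul a1.le]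
    simp only [hg']
    rw [Real.mul_rpow (hg.p _) (Real.rpow_nonneg a1.le _), ← Real.rpow_mul a1.le, mul_left_comm, ← Real.rpow_add a1]
    congr 2
    ring

theorem pw_up {s a : ℝ} (h1 : 1 ≤ s) (h2 : s ≤ 2) (ha : -1 ≤ a) : (1+a)^s ≤ 1 + s*a + (s-1)*a^2 := by
  have h0 : 0 ≤ 1 + a := by linarith
  have := Real.geom_mean_le_arith_mean2_weighted (show 0 ≤ s-1 by linarith) (show 0 ≤ 2-s by linarith) (sq_nonneg (1+a)) h0 (by ring)
  have e : ((1+a)^2)^(s-1) * (1+a)^(2-s) = (1+a)^s := by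
    rw [← Real.rpow_natCast_mul h0, ← Real.rpow_add_of_nonneg h0 (by push_cast; linarith) (by linarith)]
    congr 1; push_cast; ring
  rw [e] at this
  linarith

theorem pw_even0 {p t u : ℝ} (h1 : 1 < p) (h2 : p < 2) (ht : t < 1) (hu0 : 0 ≤ u) (hu : u ≤ t) :
    ((1+u)^p + (1-u)^p)/2 ≤ 1 + p*(p-1)/2*u^2/(1-t) := by
  set φ : ℝ → ℝ := fun u => 1 + p*(p-1)/2*u^2/(1-t) - ((1+u)^p + (1-u)^p)/2 with hφ
  have hd : ∀ v ∈ Set.Icc 0 t, HasDerivAt φ (p*(p-1)*v/(1-t) - (p*(1+v)^(p-1) - p*(1-v)^(p-1))/2) v := by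
    intro v hv
    have d1 : HasDerivAt (fun v : ℝ => (1+v)^p) (p*(1+v)^(p-1)) v := by
      refine (((hasDerivAt_id' v).const_add 1).rpow_const (p := p) (Or.inl (by linarith [hv.1]))).congr_deriv ?_
      ring
    have d2 : HasDerivAt (fun v : ℝ => (1-v)^p) (-(p*(1-v)^(p-1))) v := by
      refine (((hasDerivAt_id' v).const_sub 1).rpow_const (p := p) (Or.inl (by linarith [hv.2]))).congr_deriv ?_
      ring
    have d3 : HasDerivAt (fun v : ℝ => 1 + p*(p-1)/2*v^2/(1-t)) (p*(p-1)*v/(1-t)) v := by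
      refine (((((hasDerivAt_id' v).fun_pow 2).const_mul (p*(p-1)/2)).div_const (1-t)).const_add 1).congr_deriv ?_
      norm_num; ring
    refine (d3.fun_sub ((d1.fun_add d2).div_const 2)).congr_deriv ?_
    ring
  have hmono : MonotoneOn φ (Set.Icc 0 t) := by
    apply monotoneOn_of_deriv_nonneg (convex_Icc _ _)
    · exact fun v hv => (hd v hv).continuousAt.continuousWithinAt
    · intro v hv
      rw [interior_Icc] at hv
      exact (hd v ⟨hv.1.le, hv.2.le⟩).differentiableAt.differentiableWithinAt
    · intro v hv
      rw [interior_Icc] at hv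
      rw [(hd v ⟨hv.1.le, hv.2.le⟩).deriv]
      have v1 : 0 < 1 - v := by linarith [hv.2]
      have v0 : 0 < v := hv.1
      have t1 : 0 < 1 - t := by linarith
      -- concavity
      have hb := rpow_one_add_le_one_add_mul_self (s := 2*v/(1-v)) (by linarith [show 0 ≤ 2*v/(1-v) by positivity]) (show 0 ≤ p-1 by linarith) (by linarith)
      have e : 1 + 2*v/(1-v) = (1+v)/(1-v) := by field_simp; ring
      rw [e, Real.div_rpow (by linarith) v1.le, div_le_iff₀ (Real.rpow_pos_of_pos v1 _)] at hb
      have hq : (1-v)^(p-1) / (1-v) ≤ 1/(1-t) := by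
        apply div_le_div₀ zero_le_one _ t1 (by linarith [hv.2])
        exact Real.rpow_le_one v1.le (by linarith) (by linarith)
      have h3 : (1+v)^(p-1) - (1-v)^(p-1) ≤ (p-1)*(2*v)*(1/(1-t)) := by
        calc _ ≤ (p-1)*(2*v)*((1-v)^(p-1) / (1-v)) := by
              refine le_of_le_of_eq (sub_le_sub_right hb _) ?_
              field_simp; ring
          _ ≤ _ := by gcongr
      have h4 := mul_le_mul_of_nonneg_left h3 (show 0 ≤ p/2 by linarith)
      have : p*(p-1)*v/(1-t) = p/2*((p-1)*(2*v)*(1/(1-t))) := by field_simp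
      rw [this]; linarith
  have h0 : φ 0 = 0 := by simp [hφ]
  have := hmono ⟨le_rfl, hu0.trans hu⟩ ⟨hu0, hu⟩ hu0
  rw [h0] at this
  simp only [hφ] at this
  linarith

theorem pw_even {p t u : ℝ} (h1 : 1 < p) (h2 : p < 2) (ht : t < 1) (hu : |u| ≤ t) :
    ((1+u)^p + (1-u)^p)/2 ≤ 1 + p*(p-1)/2*u^2/(1-t) := by
  rcases le_total 0 u with h | h
  · exact pw_even0 h1 h2 ht h ((le_abs_self _).trans hu)
  · have := pw_even0 (u := -u) h1 h2 ht (by linarith) ((neg_le_abs _).trans hu)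
    rw [neg_sq, sub_neg_eq_add, ← sub_eq_add_neg] at this
    linarith

theorem BM.mul_cont {n : ℕ} {g : Sp n → ℝ} (hg : BM g) {f : Sp n → ℝ} (hf : Continuous f) : Integrable (fun x => g x * f x) (sg n) := by
  obtain ⟨M, hM⟩ := hg.b
  exact (cont_int hf).bdd_mul (c := M) hg.m.aestronglyMeasurable (ae_of_all _ hM)

theorem inner_le1 {n : ℕ} {e : E n} (he : ‖e‖ = 1) (x : Sp n) : |inner ℝ e (x : E n)| ≤ 1 := by
  have := abs_real_inner_le_norm e x
  rwa [he, x.norm_eq, one_mul] at this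

theorem balance {n : ℕ} (hn : 5 ≤ n) {p S δ : ℝ} (hp1 : 1 < p) (hp2 : p < 2) (η0 : 0 ≤ (hh n+2)*p - (2*hh n+1)) (η1 : (hh n+2)*p - (2*hh n+1) ≤ 1)
    (hS : 0 < S) (hδ : 0 ≤ δ) (hδS : δ ≤ S) (hub : ∀ g : Sp n → ℝ, BM g → Iq g ≤ S * (∫ x, g x^p ∂(sg n))^(2/p))
    {g : Sp n → ℝ} (hg : BM g) (h1 : ∫ x, g x^p ∂(sg n) = 1) (hI : S - δ ≤ Iq g) {e : E n} (he : ‖e‖ = 1) {β : ℝ} (hβ : |β| < 1) :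
    ((hh n+2)*p - (2*hh n+1)) * β * ∫ x, g x^p * inner ℝ e (x : E n) ∂(sg n) ≤ δ/S + β^2 := by
  obtain ⟨g', hg', e1, e2⟩ := boost_inv hn he hβ (p := p) (by linarith) hg
  set η := (hh n+2)*p - (2*hh n+1) with hη
  have hgp := rpow_bdd hg (p := p) (by linarith)
  have g1 := gam_pos hβ
  have b1 : 0 < 1 - β^2 := by nlinarith [abs_lt.1 hβ]
  have gge : 1 ≤ gam β := by
    by_contra h
    push Not at h
    have : gam β^2 < 1 := by nlinarith [g1.1]
    nlinarith [sq_nonneg β, g1.2]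
  set A := ∫ x, g' x^p ∂(sg n) with hA
  have hA0 : 0 ≤ A := integral_nonneg fun x => Real.rpow_nonneg (hg'.p x) _
  have c1 : 1 - δ/S ≤ A^(2/p) := by
    have := hub g' hg'
    rw [e1] at this
    have h2 : S - δ ≤ S * A^(2/p) := hI.trans this
    rw [← mul_le_mul_iff_right₀ hS]
    have : S * (1 - δ/S) = S - δ := by field_simp
    linarith
  have c0 : 0 ≤ 1 - δ/S := by rw [sub_nonneg, div_le_one hS]; exact hδS
  have c2 : 1 - δ/S ≤ A := by
    have c3 : (1 - δ/S)^(p/2) ≤ (A^(2/p))^(p/2) := Real.rpow_le_rpow c0 c1 (by linarith)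
    rw [← Real.rpow_mul hA0, show 2/p*(p/2) = 1 by field_simp, Real.rpow_one] at c3
    refine le_trans ?_ c3
    have := Real.rpow_le_rpow_of_exponent_ge' c0 (by have : 0 ≤ δ/S := by positivity
                                                     linarith) (show 0 ≤ p/2 by linarith) (show p/2 ≤ 1 by linarith)
    rwa [Real.rpow_one] at this
  set m := ∫ x, g x^p * inner ℝ e (x : E n) ∂(sg n) with hm
  have i1 : Integrable (fun x : Sp n => g x^p * inner ℝ e (x : E n)) (sg n) := hgp.mul_cont (by fun_prop)
  have c4 : A ≤ gam β * (1 - η*β*m) := by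
    have : gam β * (1 - η*β*m) = ∫ x, gam β * (g x^p - η*β*(g x^p * inner ℝ e (x : E n))) ∂(sg n) := by
      rw [integral_const_mul, integral_sub hgp.int (i1.const_mul _), integral_const_mul, h1]
    rw [this, e2]
    have wpos : ∀ x : Sp n, 0 < 1 - β * inner ℝ e (x : E n) := fun x => by
      have : |β * inner ℝ e (x : E n)| < 1 := by
        rw [abs_mul]; nlinarith [inner_le1 he x, abs_nonneg β, abs_nonneg (inner ℝ e (x : E n))]
      linarith [(abs_lt.1 this).2]
    apply integral_mono_of_nonneg
    · exact ae_of_all _ fun x => mul_nonneg (hgp.p x) (Real.rpow_nonneg (mul_nonneg g1.1.le (wpos x).le) _)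
    · exact (hgp.int.sub (i1.const_mul _)).const_mul _
    · refine ae_of_all _ fun x => ?_
      simp only
      rw [Real.mul_rpow g1.1.le (wpos x).le]
      have a1 : gam β^η ≤ gam β := by
        have := Real.rpow_le_rpow_of_exponent_le gge η1
        rwa [Real.rpow_one] at this
      have a2 : (1 - β * inner ℝ e (x : E n))^η ≤ 1 + η * (-(β * inner ℝ e (x : E n))) := by
        have := rpow_one_add_le_one_add_mul_self (s := -(β * inner ℝ e (x : E n))) (by linarith [wpos x]) η0 η1
        rwa [← sub_eq_add_neg] at this
      have a3 : 0 ≤ (1 - β * inner ℝ e (x : E n))^η := Real.rpow_nonneg (wpos x).le _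
      have a4 := mul_le_mul a1 a2 a3 g1.1.le
      have a5 := mul_le_mul_of_nonneg_left a4 (hgp.p x)
      linarith
  have hγ : gam β * (1 - β^2) ≤ 1 := by
    have : gam β * (gam β * (1 - β^2)) = 1 := by linear_combination g1.2
    nlinarith
  -- (1-δ/S)(1-β²) ≤ (1-ηβm)
  have c5 : (1 - δ/S) * (1 - β^2) ≤ 1 - η*β*m := by
    have h5 : 1 - δ/S ≤ gam β * (1 - η*β*m) := c2.trans c4
    have h6 : 0 ≤ 1 - η*β*m := by
      by_contra h; push Not at h; nlinarith [g1.1]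
    calc _ ≤ gam β * (1 - η*β*m) * (1 - β^2) := by gcongr
      _ = (1 - η*β*m) * (gam β * (1 - β^2)) := by ring
      _ ≤ (1 - η*β*m) * 1 := by gcongr
      _ = _ := by ring
  have : 0 ≤ δ/S := by positivity
  nlinarith [mul_nonneg this (sq_nonneg β)]

theorem secvar {n : ℕ} (hn : 5 ≤ n) {p S δ : ℝ} (hp1 : 1 < p) (hp2 : p < 2) 
    (hS : 0 < S) (hub : ∀ g : Sp n → ℝ, BM g → Iq g ≤ S * (∫ x, g x^p ∂(sg n))^(2/p))
    {g : Sp n → ℝ} (hg : BM g) (h1 : ∫ x, g x^p ∂(sg n) = 1) (hI : S - δ ≤ Iq g) {e : E n} (he : ‖e‖ = 1) {t : ℝ} (ht0 : 0 < t) (ht : t < 1) :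
    t^2 * Iq (fun x => inner ℝ e (x : E n) * g x) ≤ 
      δ + S * ((p-1)*t^2*(∫ x, g x^p * inner ℝ e (x : E n)^2 ∂(sg n))/(1-t) + (2*t*|∫ x, g x^p * inner ℝ e (x : E n) ∂(sg n)| + t^2)^2) := by
  have hgp := rpow_bdd hg (p := p) (by linarith)
  obtain ⟨M, hM⟩ := hg.b
  set X : Sp n → ℝ := fun x => inner ℝ e (x : E n) with hX
  have Xc : Continuous X := by simp only [hX]; fun_prop
  have X1 : ∀ x, |X x| ≤ 1 := inner_le1 he
  have M0 : ∀ x : Sp n, 0 ≤ M := fun x => (abs_nonneg _).trans (hM x)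
  have tX : ∀ x, |t * X x| ≤ t := fun x => by
    rw [abs_mul, abs_of_pos ht0]; nlinarith [X1 x]
  have hb : ∀ σ : ℝ, |σ| = t → BM (fun x => g x * (1 + σ * X x)) := by
    intro σ hσ
    have hs : ∀ x, |σ * X x| ≤ t := fun x => by rw [abs_mul, hσ]; nlinarith [X1 x]
    refine ⟨hg.m.mul ((Xc.measurable.const_mul σ).const_add 1), ⟨M*2, fun x => ?_⟩, fun x => mul_nonneg (hg.p x) ?_⟩
    · rw [abs_mul]
      refine mul_le_mul (hM x) ?_ (abs_nonneg _) (M0 x)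
      have := abs_le.1 (hs x)
      rw [abs_le]; constructor <;> linarith
    · have := abs_le.1 (hs x)
      linarith
  have bp := hb t (abs_of_pos ht0)
  have bm := hb (-t) (by rw [abs_neg, abs_of_pos ht0])
  have hpol : Iq (fun x => g x * (1 + t * X x)) + Iq (fun x => g x * (1 + -t * X x)) = 2 * Iq g + 2*t^2 * Iq (fun x => X x * g x) := by
    unfold Iq
    obtain ⟨M1, hM1⟩ := bp.b
    obtain ⟨M2, hM2⟩ := bm.b
    have i1 := Iq_int hn bp.m hM1
    have i2 := Iq_int hn bm.m hM2
    have i3 := Iq_int hn hg.m hM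
    have i4 := Iq_int hn (g := fun x => X x * g x) (M := M) (Xc.measurable.mul hg.m) (fun x => by
      rw [abs_mul]; nlinarith [X1 x, hM x, abs_nonneg (X x), abs_nonneg (g x)])
    rw [← integral_add i1 i2, ← integral_const_mul, ← integral_const_mul, ← integral_add (i3.const_mul 2) (i4.const_mul _)]
    congr 1; ext q
    ring
  set q := ∫ x, g x^p * X x^2 ∂(sg n) with hq
  set m := ∫ x, g x^p * X x ∂(sg n) with hm
  have i1 : Integrable (fun x : Sp n => g x^p * X x) (sg n) := hgp.mul_cont Xc
  have i2 : Integrable (fun x : Sp n => g x^p * X x^2) (sg n) := hgp.mul_cont (Xc.pow 2)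
  have q1 : q ≤ 1 := by
    rw [← h1]
    apply integral_mono i2 hgp.int
    intro x
    have : X x^2 ≤ 1 := by rw [← sq_abs]; nlinarith [X1 x, abs_nonneg (X x)]
    nlinarith [hgp.p x]
  have q0 : 0 ≤ q := integral_nonneg fun x => mul_nonneg (hgp.p x) (sq_nonneg _)
  set a : ℝ → ℝ := fun σ => ∫ x, (g x * (1 + σ * X x))^p ∂(sg n) - 1 with ha
  have eint : ∀ σ, |σ| = t → Integrable (fun x => g x^p * (1 + σ * X x)^p) (sg n) ∧ a σ + 1 = ∫ x, g x^p * (1 + σ * X x)^p ∂(sg n) ∧ 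
      |a σ| ≤ 2*t*|m| + t^2 ∧ -1 ≤ a σ := by
    intro σ hσ
    have hs : ∀ x, |σ * X x| ≤ t := fun x => by rw [abs_mul, hσ]; nlinarith [X1 x]
    have hs1 : ∀ x, 0 < 1 + σ * X x := fun x => by linarith [(abs_le.1 (hs x)).1]
    have e1 : ∀ x, (g x * (1 + σ * X x))^p = g x^p * (1 + σ * X x)^p := fun x => Real.mul_rpow (hg.p x) (hs1 x).le
    have i3 : Integrable (fun x => g x^p * (1 + σ * X x)^p) (sg n) := hgp.mul_cont 
      (((Xc.const_mul σ).const_add 1).rpow_const fun x => Or.inl (hs1 x).ne')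
    have e2 : a σ + 1 = ∫ x, g x^p * (1 + σ * X x)^p ∂(sg n) := by
      simp only [ha, e1]; ring
    have lo : 1 + p*σ*m ≤ a σ + 1 := by
      have : 1 + p*σ*m = ∫ x, (g x^p + p*σ*(g x^p * X x)) ∂(sg n) := by
        rw [integral_add hgp.int (i1.const_mul _), h1, integral_const_mul]
      rw [e2, this]
      apply integral_mono (hgp.int.add (i1.const_mul _)) i3
      intro x
      have := one_add_mul_self_le_rpow_one_add (s := σ * X x) (by linarith [hs1 x]) hp1.le
      have := mul_le_mul_of_nonneg_left this (hgp.p x)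
      simp only [Pi.add_apply] at this ⊢
      linarith
    have hi : a σ + 1 ≤ 1 + p*σ*m + (p-1)*σ^2*q := by
      have : 1 + p*σ*m + (p-1)*σ^2*q = ∫ x, (g x^p + p*σ*(g x^p * X x) + (p-1)*σ^2*(g x^p * X x^2)) ∂(sg n) := by
        rw [integral_add (hgp.int.fun_add (i1.const_mul _)) (i2.const_mul _), integral_add hgp.int (i1.const_mul _), h1, integral_const_mul, integral_const_mul]
      rw [e2, this]
      apply integral_mono i3 ((hgp.int.add (i1.const_mul _)).add (i2.const_mul _))
      intro x
      have := pw_up (a := σ * X x) hp1.le hp2.le (by linarith [hs1 x])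
      have := mul_le_mul_of_nonneg_left this (hgp.p x)
      simp only [Pi.add_apply] at this ⊢
      linarith
    have hσ2 : σ^2 = t^2 := by rw [← sq_abs, hσ]
    have r1 : |p*σ*m| ≤ 2*t*|m| := by
      rw [abs_mul, abs_mul, hσ, abs_of_pos (show 0 < p by linarith)]
      gcongr
    have r2 : (p-1)*σ^2*q ≤ t^2 := by
      rw [hσ2]
      have : (p-1)*q ≤ 1 := by nlinarith
      nlinarith [sq_nonneg t]
    have r3 := abs_le.1 r1
    refine ⟨i3, e2, ?_, ?_⟩
    · rw [abs_le]; constructor <;> nlinarith [sq_nonneg t]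
    · have : 0 ≤ a σ + 1 := by
        rw [e2]; exact integral_nonneg fun x => mul_nonneg (hgp.p x) (Real.rpow_nonneg (hs1 x).le _)
      linarith
  obtain ⟨jp, ep, ap, lp⟩ := eint t (abs_of_pos ht0)
  obtain ⟨jm, em, am, lm⟩ := eint (-t) (by rw [abs_neg, abs_of_pos ht0])
  have hsum : a t + a (-t) ≤ p*(p-1)*t^2*q/(1-t) := by
    have : a t + 1 + (a (-t) + 1) ≤ 2 + p*(p-1)*t^2*q/(1-t) := by
      have e3 : 2 + p*(p-1)*t^2*q/(1-t) = ∫ x, (2 * g x^p + p*(p-1)*t^2/(1-t) * (g x^p * X x^2)) ∂(sg n) := by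
        rw [integral_add (hgp.int.const_mul 2) (i2.const_mul _), integral_const_mul, integral_const_mul, h1]; ring
      rw [ep, em, ← integral_add jp jm, e3]
      apply integral_mono (jp.add jm) ((hgp.int.const_mul 2).add (i2.const_mul _))
      intro x
      have := pw_even (u := t * X x) hp1 hp2 ht (tX x)
      have := mul_le_mul_of_nonneg_left this (hgp.p x)
      simp only [Pi.add_apply] at this ⊢
      rw [neg_mul, ← sub_eq_add_neg]
      have e4 : g x^p * (1 + p*(p-1)/2*(t*X x)^2/(1-t)) = g x^p + (p*(p-1)*t^2/(1-t) * (g x^p * X x^2))/2 := by ring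
      rw [e4] at this
      linarith
    linarith
  have s1 : 1 ≤ 2/p := by rw [le_div_iff₀ (by linarith)]; linarith
  have s2 : 2/p ≤ 2 := by rw [div_le_iff₀ (by linarith)]; linarith
  have up : ∀ σ, -1 ≤ a σ → |a σ| ≤ 2*t*|m| + t^2 → (∫ x, (g x * (1 + σ * X x))^p ∂(sg n))^(2/p) ≤ 1 + 2/p*a σ + (2*t*|m| + t^2)^2 := by
    intro σ h h'
    have e5 : ∫ x, (g x * (1 + σ * X x))^p ∂(sg n) = 1 + a σ := by simp only [ha]; ring
    rw [e5]
    refine (pw_up s1 s2 h).trans ?_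
    have : a σ^2 ≤ (2*t*|m| + t^2)^2 := by rw [← sq_abs]; gcongr
    nlinarith [sq_nonneg (a σ)]
  have u1 := (hub _ bp).trans (mul_le_mul_of_nonneg_left (up t lp ap) hS.le)
  have u2 := (hub _ bm).trans (mul_le_mul_of_nonneg_left (up (-t) lm am) hS.le)
  have u3 : 2/p*(a t + a (-t)) ≤ 2*((p-1)*t^2*q/(1-t)) := by
    calc _ ≤ 2/p*(p*(p-1)*t^2*q/(1-t)) := by gcongr
      _ = _ := by field_simp
  have u4 := mul_le_mul_of_nonneg_left u3 hS.le
  linarith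

theorem Iq_zero {n : ℕ} (hn : 5 ≤ n) {p : ℝ} (hp : 0 < p) {g : Sp n → ℝ} (hg : BM g) (h : ∫ x, g x^p ∂(sg n) = 0) : Iq g = 0 := by
  have hgp := rpow_bdd hg hp.le
  obtain ⟨M, hM⟩ := hg.b
  have h0 : ∀ᵐ x ∂(sg n), g x = 0 := by
    filter_upwards [(integral_eq_zero_iff_of_nonneg hgp.p hgp.int).1 h] with x hx
    exact (Real.rpow_eq_zero (hg.p x) hp.ne').1 hx
  unfold Iq
  rw [integral_prod _ (Iq_int hn hg.m hM)]
  apply integral_eq_zero_of_ae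
  filter_upwards [h0] with x hx
  simp [hx]

theorem hub_scale {n : ℕ} (hn : 5 ≤ n) {p S : ℝ} (hp : 0 < p) (hS : ∀ g : Sp n → ℝ, BM g → ∫ x, g x^p ∂(sg n) = 1 → Iq g ≤ S)
    {g : Sp n → ℝ} (hg : BM g) : Iq g ≤ S * (∫ x, g x^p ∂(sg n))^(2/p) := by
  have hgp := rpow_bdd hg hp.le
  set Z := ∫ x, g x^p ∂(sg n) with hZ
  have Z0 : 0 ≤ Z := integral_nonneg hgp.p
  rcases Z0.eq_or_lt with h | h
  · rw [Iq_zero hn hp hg h.symm, ← h, Real.zero_rpow (by positivity), mul_zero]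
  set k := Z^(-(1/p)) with hk
  have k0 : 0 < k := Real.rpow_pos_of_pos h _
  obtain ⟨M, hM⟩ := hg.b
  have b : BM (fun x => k * g x) := ⟨hg.m.const_mul k, ⟨k*M, fun x => by rw [abs_mul, abs_of_pos k0]; gcongr; exact hM x⟩, fun x => mul_nonneg k0.le (hg.p x)⟩
  have e1 : ∫ x, (k * g x)^p ∂(sg n) = 1 := by
    have : ∀ x, (k * g x)^p = k^p * g x^p := fun x => Real.mul_rpow k0.le (hg.p x)
    simp only [this]
    rw [integral_const_mul, ← hZ, hk, ← Real.rpow_mul h.le, show -(1/p)*p = -1 by field_simp, Real.rpow_neg_one, inv_mul_cancel₀ h.ne']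
  have := hS _ b e1
  have e2 : Iq (fun x => k * g x) = k^2 * Iq g := by
    unfold Iq
    rw [← integral_const_mul]; congr 1; ext q; ring
  rw [e2] at this
  have e3 : k^2 * Z^(2/p) = 1 := by
    rw [hk, ← Real.rpow_mul_natCast h.le, ← Real.rpow_add h]
    convert Real.rpow_zero Z using 2
    push_cast; ring
  have h4 : 0 < Z^(2/p) := Real.rpow_pos_of_pos h _
  calc Iq g = k^2 * Iq g * Z^(2/p) := by rw [mul_right_comm, e3, one_mul]
    _ ≤ _ := by gcongr

theorem sum_Iq {n : ℕ} (hn : 5 ≤ n) {g : Sp n → ℝ} (hg : BM g) : 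
    hh n/(hh n+3) * Iq g - 2*cK (hh n)/(hh n+1) * (∫ x, g x ∂(sg n))^2 ≤ ∑ i : Fin n, Iq (fun x => inner ℝ (EuclideanSpace.single i (1:ℝ)) (x : E n) * g x) := by
  obtain ⟨M, hM⟩ := hg.b
  have h3 := hh_ge hn
  have hs := spectral hn hg.m hM
  have i1 := Iq_int hn hg.m hM
  have i2 : Integrable (fun p : Sp n × Sp n => g p.1 * g p.2 * zz p.1 p.2^(2 - hh n)) (ss n) := by
    have := zzint_bdd hn (β := hh n - 2) (by unfold hh; linarith) (gg_meas hg.m) (gg_bdd hM)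
    rwa [neg_sub] at this
  have i3 : Integrable (fun p : Sp n × Sp n => g p.1 * g p.2) (ss n) := bdd_int (gg_meas hg.m) (gg_bdd hM)
  have e1 : ∫ p, g p.1 * g p.2 * (3/(hh n+3) * zz p.1 p.2^(1 - hh n) - zz p.1 p.2^(2 - hh n)/2 + 2 * cK (hh n)/(hh n+1)) ∂(ss n) = 
     3/(hh n+3) * Iq g - 1/2 * (∫ p, g p.1 * g p.2 * zz p.1 p.2^(2 - hh n) ∂(ss n)) + 2 * cK (hh n)/(hh n+1) * (∫ x, g x ∂(sg n))^2 := by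
    have e : (∫ x, g x ∂(sg n))^2 = ∫ p, g p.1 * g p.2 ∂(ss n) := by rw [integral_prod_mul, sq]
    unfold Iq
    have i12 : Integrable (fun p : Sp n × Sp n => 3/(hh n+3) * (g p.1 * g p.2 * zz p.1 p.2^(1 - hh n)) - 1/2 * (g p.1 * g p.2 * zz p.1 p.2^(2 - hh n))) (ss n) :=
      (i1.const_mul _).sub (i2.const_mul _)
    rw [e, ← integral_const_mul, ← integral_const_mul, ← integral_const_mul, ← integral_sub (i1.const_mul _) (i2.const_mul _), 
      ← integral_add i12 (i3.const_mul _)]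
    congr 1; ext p; ring
  have e2 : ∑ i : Fin n, Iq (fun x => inner ℝ (EuclideanSpace.single i (1:ℝ)) (x : E n) * g x) = 
      Iq g - 1/2 * (∫ p, g p.1 * g p.2 * zz p.1 p.2^(2 - hh n) ∂(ss n)) := by
    unfold Iq
    rw [← integral_const_mul, ← integral_sub i1 (i2.const_mul _), ← integral_finsetSum]
    · apply integral_congr_ae
      filter_upwards [ae_ss_pos hn] with p hp
      have e3 : inner ℝ (p.1 : E n) (p.2 : E n) = ∑ i : Fin n, inner ℝ (EuclideanSpace.single i (1:ℝ)) (p.1 : E n) * inner ℝ (EuclideanSpace.single i (1:ℝ)) (p.2 : E n) := by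
        rw [PiLp.inner_apply]
        apply Finset.sum_congr rfl
        intro i _
        simp [EuclideanSpace.inner_single_left, mul_comm]
      have e4 := zz_eq p.1 p.2
      have e5 : zz p.1 p.2^(2 - hh n) = zz p.1 p.2^(1 - hh n) * zz p.1 p.2 := by
        rw [← Real.rpow_add_one hp.ne']; congr 1; ring
      rw [e5]
      have e6 : ∀ i : Fin n, inner ℝ (EuclideanSpace.single i (1:ℝ)) (p.1 : E n) * g p.1 * (inner ℝ (EuclideanSpace.single i (1:ℝ)) (p.2 : E n) * g p.2) * zz p.1 p.2^(1 - hh n) = 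
        inner ℝ (EuclideanSpace.single i (1:ℝ)) (p.1 : E n) * inner ℝ (EuclideanSpace.single i (1:ℝ)) (p.2 : E n) * (g p.1 * g p.2 * zz p.1 p.2^(1 - hh n)) := fun i => by ring
      simp only [e6]
      rw [← Finset.sum_mul, ← e3]
      linear_combination (g p.1 * g p.2 * zz p.1 p.2^(1 - hh n)) * (1/2) * e4
    · intro i _
      have he : ‖(EuclideanSpace.single i (1:ℝ) : E n)‖ = 1 := by simp
      apply Iq_int hn (g := fun x : Sp n => inner ℝ (EuclideanSpace.single i (1:ℝ)) (x : E n) * g x) (M := M) _ (fun x => by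
        rw [abs_mul]; nlinarith [inner_le1 he x, hM x, abs_nonneg (inner ℝ (EuclideanSpace.single i (1:ℝ)) (x : E n)), abs_nonneg (g x)])
      exact (by fun_prop : Continuous fun x : Sp n => inner ℝ (EuclideanSpace.single i (1:ℝ)) (x : E n)).measurable.mul hg.m
  rw [e1] at hs
  rw [e2]
  have : 1 - 3/(hh n+3) = hh n/(hh n+3) := by field_simp; ring
  rw [← this]
  linarith

theorem subcrit {n : ℕ} (hn : 5 ≤ n) {p : ℝ} (η0 : 0 < (hh n+2)*p - (2*hh n+1)) (η1 : (hh n+2)*p - (2*hh n+1) ≤ 1)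
    {g : Sp n → ℝ} (hg : BM g) : (hh n/(hh n+3) - (p-1)) * Iq g ≤ 2*cK (hh n)/(hh n+1) * AS n^(2-2/p) * (∫ x, g x^p ∂(sg n))^(2/p) := by
  have h3 := hh_ge hn
  have hp1 : 1 < p := by nlinarith
  have hp2 : p < 2 := by nlinarith
  have hc0 : 0 ≤ 2*cK (hh n)/(hh n+1) := by unfold cK; positivity
  have hpc : (2*hh n+1)/(hh n+2) < p := by rw [div_lt_iff₀ (by linarith)]; linarith
  obtain ⟨C, hC⟩ := young hn hpc hp2.le
  set V : Set ℝ := {t | ∃ g : Sp n → ℝ, BM g ∧ ∫ x, g x^p ∂(sg n) = 1 ∧ Iq g = t} with hV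
  have Vb : BddAbove V := ⟨C, by rintro t ⟨g, h1, h2, rfl⟩; exact hC g h1 h2⟩
  set S := sSup V with hS
  have hub : ∀ g : Sp n → ℝ, BM g → Iq g ≤ S * (∫ x, g x^p ∂(sg n))^(2/p) := fun g hg =>
    hub_scale hn (by linarith) (fun g hg h1 => le_csSup Vb ⟨g, hg, h1, rfl⟩) hg
  have hgp := rpow_bdd hg (p := p) (by linarith)
  have Z0 : 0 ≤ (∫ x, g x^p ∂(sg n))^(2/p) := Real.rpow_nonneg (integral_nonneg hgp.p) _
  have A0 : 0 ≤ AS n^(2-2/p) := Real.rpow_nonneg (AS_nonneg n) _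
  rcases le_or_gt S 0 with hS0 | hS0
  · have : Iq g = 0 := le_antisymm ((hub g hg).trans (mul_nonpos_of_nonpos_of_nonneg hS0 Z0)) (Iq_nonneg hg)
    rw [this, mul_zero]; positivity
  have Vne : V.Nonempty := by
    by_contra h
    rw [Set.not_nonempty_iff_eq_empty] at h
    rw [hS, h, Real.sSup_empty] at hS0
    exact lt_irrefl _ hS0
  set η := (hh n+2)*p - (2*hh n+1) with hη
  -- the main inequality for near maximizers
  have main : ∀ τ ∈ Set.Ioo (0:ℝ) 1, hh n/(hh n+3) * (S * (1-τ^4)) - 2*cK (hh n)/(hh n+1) * AS n^(2-2/p) ≤ 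
      n * (S*τ^2) + S*((p-1)/(1-τ)) + S * (n * (2*(2*τ^2/η) + τ)^2) := by
    intro τ hτ
    have t0 := hτ.1
    have t1 := hτ.2
    have t4 : τ^4 < 1 := pow_lt_one₀ t0.le t1 (by norm_num)
    have t2 : τ^2 < 1 := pow_lt_one₀ t0.le t1 (by norm_num)
    obtain ⟨I, ⟨u, hu, hu1, rfl⟩, hI⟩ := exists_lt_of_lt_csSup Vne (show S - S*τ^4 < S by have := mul_pos hS0 (pow_pos t0 4); linarith)
    have hup := rpow_bdd hu (p := p) (by linarith)
    have bal : ∀ i : Fin n, |∫ x, u x^p * inner ℝ (EuclideanSpace.single i (1:ℝ)) (x : E n) ∂(sg n)| ≤ 2*τ^2/η := by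
      intro i
      have he : ‖(EuclideanSpace.single i (1:ℝ) : E n)‖ = 1 := by simp
      have ab : |τ^2| < 1 := by rwa [abs_of_pos (by positivity)]
      have b1 := balance hn hp1 hp2 η0.le η1 hS0 (δ := S*τ^4) (by positivity) (by nlinarith) hub hu hu1 hI.le he ab
      have b2 := balance hn hp1 hp2 η0.le η1 hS0 (δ := S*τ^4) (by positivity) (by nlinarith) hub hu hu1 hI.le he (β := -τ^2) (by rwa [abs_neg])
      set m := ∫ x, u x^p * inner ℝ (EuclideanSpace.single i (1:ℝ)) (x : E n) ∂(sg n)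
      have e : S*τ^4/S = τ^4 := by field_simp
      rw [e] at b1 b2
      have tt : 0 < τ^2 := by positivity
      rw [le_div_iff₀ η0]
      rcases abs_cases m with ⟨h, _⟩ | ⟨h, _⟩
      · rw [h]
        refine le_of_mul_le_mul_left ?_ tt
        nlinarith
      · rw [h]
        refine le_of_mul_le_mul_left ?_ tt
        nlinarith
    have sv : ∀ i : Fin n, Iq (fun x => inner ℝ (EuclideanSpace.single i (1:ℝ)) (x : E n) * u x) ≤ 
        S*τ^2 + S * ((p-1)/(1-τ)) * (∫ x, u x^p * inner ℝ (EuclideanSpace.single i (1:ℝ)) (x : E n)^2 ∂(sg n)) + S * (2*(2*τ^2/η) + τ)^2 := by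
      intro i
      have he : ‖(EuclideanSpace.single i (1:ℝ) : E n)‖ = 1 := by simp
      have b1 := secvar hn hp1 hp2 hS0 hub hu hu1 hI.le he t0 t1
      have b2 := bal i
      set m := ∫ x, u x^p * inner ℝ (EuclideanSpace.single i (1:ℝ)) (x : E n) ∂(sg n)
      set q := ∫ x, u x^p * inner ℝ (EuclideanSpace.single i (1:ℝ)) (x : E n)^2 ∂(sg n)
      have tt : 0 < τ^2 := by positivity
      refine le_of_mul_le_mul_left (b1.trans ?_) tt
      have b3 : (2*τ*|m| + τ^2)^2 ≤ τ^2 * (2*(2*τ^2/η) + τ)^2 := by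
        rw [← mul_pow]
        have : 0 ≤ |m| := abs_nonneg m
        gcongr
        nlinarith
      have b4 := mul_le_mul_of_nonneg_left b3 hS0.le
      have e : S * ((p-1)*τ^2*q/(1-τ)) = τ^2 * (S * ((p-1)/(1-τ)) * q) := by ring
      rw [mul_add, e]
      nlinarith
    have sq : ∑ i : Fin n, ∫ x, u x^p * inner ℝ (EuclideanSpace.single i (1:ℝ)) (x : E n)^2 ∂(sg n) = 1 := by
      rw [← integral_finsetSum]
      · refine Eq.trans ?_ hu1
        congr 1; ext x
        rw [← Finset.mul_sum]
        have : ∑ i : Fin n, inner ℝ (EuclideanSpace.single i (1:ℝ)) (x : E n)^2 = ‖(x : E n)‖^2 := by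
          rw [EuclideanSpace.norm_sq_eq]
          apply Finset.sum_congr rfl
          intro i _
          simp [EuclideanSpace.inner_single_left]
        rw [this, x.norm_eq]; ring
      · intro i _
        exact hup.mul_cont (by fun_prop)
    have lo := sum_Iq hn hu
    have hi := Finset.sum_le_sum (s := Finset.univ) fun i (_ : i ∈ Finset.univ) => sv i
    have sq' : ∑ i : Fin n, S * ((p-1)/(1-τ)) * (∫ x, u x^p * inner ℝ (EuclideanSpace.single i (1:ℝ)) (x : E n)^2 ∂(sg n)) = S * ((p-1)/(1-τ)) := by
      rw [← Finset.mul_sum, sq, mul_one]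
    rw [Finset.sum_add_distrib, Finset.sum_add_distrib, sq'] at hi
    simp only [Finset.sum_const, Finset.card_univ, Fintype.card_fin, nsmul_eq_mul] at hi
    have ho := mul_le_mul_of_nonneg_left (holder1 hp1 hu hu1) hc0
    have h6 : hh n/(hh n+3) * (S * (1-τ^4)) ≤ hh n/(hh n+3) * Iq u := by
      apply mul_le_mul_of_nonneg_left _ (by positivity)
      linarith
    linarith
  have lim : hh n/(hh n+3) * S - 2*cK (hh n)/(hh n+1) * AS n^(2-2/p) ≤ S*(p-1) := by
    have c1 : Tendsto (fun τ : ℝ => hh n/(hh n+3) * (S * (1-τ^4)) - 2*cK (hh n)/(hh n+1) * AS n^(2-2/p)) (nhdsWithin 0 (Set.Ioi 0))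
       (nhds (hh n/(hh n+3) * S - 2*cK (hh n)/(hh n+1) * AS n^(2-2/p))) := by
      have : Continuous fun τ : ℝ => hh n/(hh n+3) * (S * (1-τ^4)) - 2*cK (hh n)/(hh n+1) * AS n^(2-2/p) := by fun_prop
      have := this.tendsto 0
      norm_num at this
      exact this.mono_left nhdsWithin_le_nhds
    have c2 : Tendsto (fun τ : ℝ => n * (S*τ^2) + S*((p-1)/(1-τ)) + S * (n * (2*(2*τ^2/η) + τ)^2)) (nhdsWithin 0 (Set.Ioi 0))
       (nhds (S*(p-1))) := by
      have : ContinuousAt (fun τ : ℝ => n * (S*τ^2) + S*((p-1)/(1-τ)) + S * (n * (2*(2*τ^2/η) + τ)^2)) 0 := by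
        have : ContinuousAt (fun τ : ℝ => (p-1)/(1-τ)) 0 := ContinuousAt.div (by fun_prop) (by fun_prop) (by norm_num)
        have h2 : Continuous fun τ : ℝ => S * (n * (2*(2*τ^2/η) + τ)^2) := by fun_prop
        exact ((by fun_prop : ContinuousAt (fun τ : ℝ => n * (S*τ^2)) 0).add (this.const_mul S)).add h2.continuousAt
      have := this.tendsto
      norm_num at this
      exact this.mono_left nhdsWithin_le_nhds
    refine le_of_tendsto_of_tendsto c1 c2 ?_
    filter_upwards [Ioo_mem_nhdsGT (show (0:ℝ) < 1 by norm_num)] with τ hτ using main τ hτ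
  have hfin : (hh n/(hh n+3) - (p-1)) * S ≤ 2*cK (hh n)/(hh n+1) * AS n^(2-2/p) := by linarith
  rcases le_or_gt (hh n/(hh n+3) - (p-1)) 0 with hs | hs
  · refine le_trans (mul_nonpos_of_nonpos_of_nonneg hs (Iq_nonneg hg)) (by positivity)
  · calc _ ≤ (hh n/(hh n+3) - (p-1)) * (S * (∫ x, g x^p ∂(sg n))^(2/p)) := by gcongr; exact hub g hg
      _ = (hh n/(hh n+3) - (p-1)) * S * (∫ x, g x^p ∂(sg n))^(2/p) := by ring
      _ ≤ _ := by gcongr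

theorem HLS {n : ℕ} (hn : 5 ≤ n) {g : Sp n → ℝ} (hg : BM g) : 
    Iq g ≤ 2/(hh n+1) * AS n^(2-2/((2*hh n+1)/(hh n+2))) * (∫ x, g x^((2*hh n+1)/(hh n+2)) ∂(sg n))^(2/((2*hh n+1)/(hh n+2))) := by
  have h3 := hh_ge hn
  set pc := (2*hh n+1)/(hh n+2) with hpc
  have pc1 : 1 < pc := by rw [hpc, lt_div_iff₀ (by linarith)]; linarith
  have hc : 0 < cK (hh n) := by unfold cK; positivity
  obtain ⟨M, hM⟩ := hg.b
  have cont : ContinuousAt (fun p : ℝ => ∫ x, g x^p ∂(sg n)) pc := by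
    apply continuousAt_of_dominated (bound := fun _ => (max 1 M)^(pc+1))
    · exact Eventually.of_forall fun p => (hg.m.pow_const p).aestronglyMeasurable
    · have : ∀ᶠ p in nhds pc, p ∈ Set.Ioo 0 (pc+1) := isOpen_Ioo.mem_nhds ⟨by linarith, by linarith⟩
      filter_upwards [this] with p hp
      refine ae_of_all _ fun x => ?_
      rw [Real.norm_eq_abs, abs_of_nonneg (Real.rpow_nonneg (hg.p x) _)]
      calc g x^p ≤ (max 1 M)^p := Real.rpow_le_rpow (hg.p x) (((le_abs_self _).trans (hM x)).trans (le_max_right _ _)) hp.1.le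
        _ ≤ _ := Real.rpow_le_rpow_of_exponent_le (le_max_left _ _) hp.2.le
    · exact integrable_const _
    · exact ae_of_all _ fun x => Real.continuousAt_const_rpow' (by linarith)
  have c2 : ContinuousAt (fun p : ℝ => 2/p) pc := ContinuousAt.div (by fun_prop) (by fun_prop) (by linarith)
  have cR : ContinuousAt (fun p : ℝ => 2*cK (hh n)/(hh n+1) * AS n^(2-2/p) * (∫ x, g x^p ∂(sg n))^(2/p)) pc := by
    apply ContinuousAt.mul
    · apply ContinuousAt.mul continuousAt_const
      exact ContinuousAt.rpow continuousAt_const (continuousAt_const.sub c2) (Or.inl (AS_pos hn).ne')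
    · exact ContinuousAt.rpow cont c2 (Or.inr (by positivity))
  have cL : ContinuousAt (fun p : ℝ => (hh n/(hh n+3) - (p-1)) * Iq g) pc := by fun_prop
  have key : (hh n/(hh n+3) - (pc-1)) * Iq g ≤ 2*cK (hh n)/(hh n+1) * AS n^(2-2/pc) * (∫ x, g x^pc ∂(sg n))^(2/pc) := by
    refine le_of_tendsto_of_tendsto (b := nhdsWithin pc (Set.Ioi pc)) (cL.tendsto.mono_left nhdsWithin_le_nhds) (cR.tendsto.mono_left nhdsWithin_le_nhds) ?_
    filter_upwards [Ioo_mem_nhdsGT (show pc < pc + 1/(hh n+2) by have : 0 < 1/(hh n+2) := by positivity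
                                                                 linarith)] with p hp
    have e1 : (hh n+2)*pc = 2*hh n+1 := by rw [hpc]; field_simp
    have e2 : (hh n+2)*(pc + 1/(hh n+2)) = 2*hh n+1+1 := by rw [mul_add, e1]; field_simp
    have a1 := mul_lt_mul_of_pos_left hp.1 (show 0 < hh n+2 by linarith)
    have a2 := mul_lt_mul_of_pos_left hp.2 (show 0 < hh n+2 by linarith)
    exact subcrit hn (by linarith) (by linarith) hg
  have e3 : hh n/(hh n+3) - (pc-1) = cK (hh n) := by
    rw [hpc]; unfold cK; field_simp; ring
  rw [e3] at key
  refine le_of_mul_le_mul_left (key.trans_eq ?_) hc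
  ring

theorem kv_aux {v : ℝ} (hv : v ∈ Set.Ioo (0:ℝ) 1) : 
    ∫⁻ ρ in Set.Ioo (√v) 1, ∫⁻ t in Set.Ioo (v/ρ) ρ, ENNReal.ofReal (ρ * t⁻¹) ≤ ENNReal.ofReal ((1-v)^2/(4*v)) := by
  have v0 := hv.1
  have s0 : 0 < √v := Real.sqrt_pos.2 v0
  have s1 : √v < 1 := by rw [Real.sqrt_lt' one_pos]; simpa using hv.2
  have ss : √v^2 = v := Real.sq_sqrt v0.le
  have inner : ∀ ρ ∈ Set.Ioo (√v) 1, ∫⁻ t in Set.Ioo (v/ρ) ρ, ENNReal.ofReal (ρ * t⁻¹) = ENNReal.ofReal (ρ * Real.log (ρ^2/v)) := by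
    intro ρ hρ
    have ρ0 : 0 < ρ := s0.trans hρ.1
    have hl : v/ρ < ρ := by rw [div_lt_iff₀ ρ0]; nlinarith [hρ.1]
    have l0 : 0 < v/ρ := by positivity
    have ii : IntervalIntegrable (fun t : ℝ => ρ * t⁻¹) volume (v/ρ) ρ := by
      apply ContinuousOn.intervalIntegrable
      rw [Set.uIcc_of_le hl.le]
      intro t ht
      have : t ≠ 0 := by have := ht.1; linarith [l0]
      fun_prop (disch := assumption)
    rw [← ofReal_integral_eq_lintegral_ofReal]
    · rw [← integral_Ioc_eq_integral_Ioo, ← intervalIntegral.integral_of_le hl.le, intervalIntegral.integral_const_mul, integral_inv_of_pos l0 ρ0]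
      congr 3; field_simp
    · exact ((intervalIntegrable_iff_integrableOn_Ioc_of_le hl.le).1 ii).mono_set Set.Ioo_subset_Ioc_self
    · filter_upwards [ae_restrict_mem measurableSet_Ioo] with t ht
      have := l0.trans ht.1
      positivity
  rw [setLIntegral_congr_fun measurableSet_Ioo inner]
  have hd : ∀ ρ ∈ Set.uIcc (√v) 1, HasDerivAt (fun ρ : ℝ => (ρ^2 * Real.log (ρ^2/v) - ρ^2)/2) (ρ * Real.log (ρ^2/v)) ρ := by
    intro ρ hρ
    rw [Set.uIcc_of_le s1.le] at hρ
    have ρ0 : 0 < ρ := s0.trans_le hρ.1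
    have h1 : HasDerivAt (fun ρ : ℝ => ρ^2) (2*ρ) ρ := by simpa using hasDerivAt_pow 2 ρ
    have h2 : HasDerivAt (fun ρ : ℝ => Real.log (ρ^2/v)) ((2*ρ/v)/(ρ^2/v)) ρ := (h1.div_const v).log (by positivity)
    refine (((h1.fun_mul h2).fun_sub h1).div_const 2).congr_deriv ?_
    field_simp; ring
  have co : ContinuousOn (fun ρ : ℝ => ρ * Real.log (ρ^2/v)) (Set.uIcc (√v) 1) := by
    rw [Set.uIcc_of_le s1.le]
    apply ContinuousOn.mul continuousOn_id
    apply ContinuousOn.log (by fun_prop)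
    intro ρ hρ
    have : 0 < ρ := s0.trans_le hρ.1
    positivity
  have ft := intervalIntegral.integral_eq_sub_of_hasDerivAt hd co.intervalIntegrable
  rw [← ofReal_integral_eq_lintegral_ofReal]
  · rw [← integral_Ioc_eq_integral_Ioo, ← intervalIntegral.integral_of_le s1.le, ft]
    apply ENNReal.ofReal_le_ofReal
    rw [ss, div_self v0.ne', Real.log_one]
    have : Real.log (1^2/v) = 2 * Real.log (√v)⁻¹ := by
      rw [Real.log_inv, Real.log_sqrt v0.le]; simp; ring
    rw [this]
    -- log bound
    have lb : ∀ x : ℝ, 1 ≤ x → 2 * Real.log x ≤ x - x⁻¹ := by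
      intro x hx
      have hm : MonotoneOn (fun x : ℝ => x - x⁻¹ - 2 * Real.log x) (Set.Ici 1) := by
        have hdd : ∀ x : ℝ, 1 ≤ x → HasDerivAt (fun x : ℝ => x - x⁻¹ - 2 * Real.log x) ((1 - x⁻¹)^2) x := by
          intro x hx
          have x0 : x ≠ 0 := by linarith
          refine (((hasDerivAt_id' x).fun_sub (hasDerivAt_inv x0)).fun_sub ((Real.hasDerivAt_log x0).const_mul 2)).congr_deriv ?_
          field_simp; ring
        apply monotoneOn_of_deriv_nonneg (convex_Ici 1)
        · exact fun x hx => (hdd x hx).continuousAt.continuousWithinAt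
        · intro x hx
          rw [interior_Ici] at hx
          exact (hdd x (le_of_lt hx)).differentiableAt.differentiableWithinAt
        · intro x hx
          rw [interior_Ici] at hx
          rw [(hdd x (le_of_lt hx)).deriv]; positivity
      have := hm (Set.mem_Ici.2 le_rfl) (Set.mem_Ici.2 hx) hx
      simp at this
      linarith
    have l2 : 2 * Real.log (√v)⁻¹ ≤ (v⁻¹ - v)/2 := by
      have := lb v⁻¹ ((one_le_inv₀ v0).2 hv.2.le)
      rw [inv_inv, Real.log_inv] at this
      rw [Real.log_inv, Real.log_sqrt v0.le]; linarith
    have e : (1-v)^2/(4*v) = ((v⁻¹ - v)/2 - 1 + v)/2 := by field_simp; ring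
    rw [e]; linarith
  · exact ((intervalIntegrable_iff_integrableOn_Ioc_of_le s1.le).1 co.intervalIntegrable).mono_set Set.Ioo_subset_Ioc_self
  · filter_upwards [ae_restrict_mem measurableSet_Ioo] with ρ hρ
    have : 0 < ρ := s0.trans hρ.1
    apply mul_nonneg this.le
    apply Real.log_nonneg
    rw [le_div_iff₀ v0]; nlinarith [hρ.1]

def kA (ρ t v : ℝ) : ℝ≥0∞ := if (0<ρ ∧ ρ<1 ∧ 0<t ∧ t<ρ ∧ 0<v ∧ v<t*ρ) then ENNReal.ofReal (ρ * t⁻¹) else 0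

theorem kA_meas : Measurable fun p : ℝ × ℝ × ℝ => kA p.1 p.2.1 p.2.2 := by
  unfold kA
  refine Measurable.ite ?_ (by fun_prop) measurable_const
  simp only [Set.setOf_and]
  have m1 : MeasurableSet {p : ℝ × ℝ × ℝ | 0 < p.1} := measurableSet_lt (by fun_prop) (by fun_prop)
  have m2 : MeasurableSet {p : ℝ × ℝ × ℝ | p.1 < 1} := measurableSet_lt (by fun_prop) (by fun_prop)
  have m3 : MeasurableSet {p : ℝ × ℝ × ℝ | 0 < p.2.1} := measurableSet_lt (by fun_prop) (by fun_prop)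
  have m4 : MeasurableSet {p : ℝ × ℝ × ℝ | p.2.1 < p.1} := measurableSet_lt (by fun_prop) (by fun_prop)
  have m5 : MeasurableSet {p : ℝ × ℝ × ℝ | 0 < p.2.2} := measurableSet_lt (by fun_prop) (by fun_prop)
  have m6 : MeasurableSet {p : ℝ × ℝ × ℝ | p.2.2 < p.2.1 * p.1} := measurableSet_lt (by fun_prop) (by fun_prop)
  exact m1.inter (m2.inter (m3.inter (m4.inter (m5.inter m6))))

theorem kv (v : ℝ) : ∫⁻ ρ, ∫⁻ t, kA ρ t v ∂volume ∂volume ≤ (Set.Ioo (0:ℝ) 1).indicator (fun v => ENNReal.ofReal ((1-v)^2/(4*v))) v := by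
  by_cases hv : v ∈ Set.Ioo (0:ℝ) 1
  · rw [Set.indicator_of_mem hv]
    refine le_trans ?_ (kv_aux hv)
    rw [← lintegral_indicator measurableSet_Ioo]
    apply lintegral_mono
    intro ρ
    by_cases hρ : ρ ∈ Set.Ioo (√v) 1
    · rw [Set.indicator_of_mem hρ, ← lintegral_indicator measurableSet_Ioo]
      apply lintegral_mono
      intro t
      dsimp only [kA]
      split_ifs with h
      · rw [Set.indicator_of_mem]
        exact ⟨by rw [div_lt_iff₀ h.1]; exact h.2.2.2.2.2, h.2.2.2.1⟩
      · exact zero_le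
    · have : ∀ t, kA ρ t v = 0 := by
        intro t
        unfold kA
        rw [if_neg]
        rintro ⟨h1, h2, h3, h4, h5, h6⟩
        exact hρ ⟨by rw [Real.sqrt_lt' h1]; nlinarith, h2⟩
      simp [this]
  · have : ∀ ρ t, kA ρ t v = 0 := by
      intro ρ t
      unfold kA
      rw [if_neg]
      rintro ⟨h1, h2, h3, h4, h5, h6⟩
      exact hv ⟨h5, by nlinarith⟩
    simp [this]

theorem scale_lint {t ρ : ℝ} (ht : 0 < t) (H : ℝ → ℝ≥0∞) (hH : Measurable H) : 
    ∫⁻ t' in Set.Ioo 0 ρ, H (t*t') = ENNReal.ofReal t⁻¹ * ∫⁻ v in Set.Ioo 0 (t*ρ), H v := by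
  have h1 := Real.smul_map_volume_mul_left ht.ne'
  rw [← lintegral_indicator measurableSet_Ioo, ← lintegral_indicator measurableSet_Ioo]
  conv_rhs => rw [← h1]
  rw [lintegral_smul_measure, lintegral_map (hH.indicator measurableSet_Ioo) (by fun_prop), abs_of_pos ht, smul_eq_mul, ← mul_assoc, ← ENNReal.ofReal_mul (by positivity), inv_mul_cancel₀ ht.ne', ENNReal.ofReal_one, one_mul]
  congr 1; ext x
  have : x ∈ Set.Ioo 0 ρ ↔ t * x ∈ Set.Ioo 0 (t*ρ) := by
    simp [ht]
  by_cases hx : x ∈ Set.Ioo 0 ρ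
  · rw [Set.indicator_of_mem hx, Set.indicator_of_mem (this.1 hx)]
  · rw [Set.indicator_of_notMem hx, Set.indicator_of_notMem (fun h => hx (this.2 h))]

theorem triple (H : ℝ → ℝ≥0∞) (hH : Measurable H) : 
    ∫⁻ ρ in Set.Ioo (0:ℝ) 1, ENNReal.ofReal ρ * ∫⁻ t in Set.Ioo 0 ρ, ∫⁻ t' in Set.Ioo 0 ρ, H (t*t') ∂volume ∂volume ∂volume ≤ 
    ∫⁻ v in Set.Ioo (0:ℝ) 1, ENNReal.ofReal ((1-v)^2/(4*v)) * H v := by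
  have hm3 : Measurable fun p : ℝ × ℝ × ℝ => kA p.1 p.2.1 p.2.2 * H p.2.2 := kA_meas.mul (hH.comp (by fun_prop))
  have e1 : ∫⁻ ρ in Set.Ioo (0:ℝ) 1, ENNReal.ofReal ρ * ∫⁻ t in Set.Ioo 0 ρ, ∫⁻ t' in Set.Ioo 0 ρ, H (t*t') ∂volume ∂volume ∂volume = 
      ∫⁻ ρ, ∫⁻ t, ∫⁻ v, kA ρ t v * H v ∂volume ∂volume ∂volume := by
    rw [← lintegral_indicator measurableSet_Ioo]
    apply lintegral_congr
    intro ρ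
    by_cases hρ : ρ ∈ Set.Ioo (0:ℝ) 1
    · rw [Set.indicator_of_mem hρ, ← lintegral_const_mul' _ _ ENNReal.ofReal_ne_top, ← lintegral_indicator measurableSet_Ioo]
      apply lintegral_congr
      intro t
      by_cases ht : t ∈ Set.Ioo 0 ρ
      · rw [Set.indicator_of_mem ht, scale_lint ht.1 H hH, ← mul_assoc, ← ENNReal.ofReal_mul hρ.1.le, ← lintegral_const_mul' _ _ ENNReal.ofReal_ne_top,
          ← lintegral_indicator measurableSet_Ioo]
        apply lintegral_congr
        intro v
        unfold kA
        by_cases hv : v ∈ Set.Ioo 0 (t*ρ)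
        · rw [Set.indicator_of_mem hv, if_pos ⟨hρ.1, hρ.2, ht.1, ht.2, hv.1, hv.2⟩]
        · rw [Set.indicator_of_notMem hv, if_neg, zero_mul]
          rintro ⟨h1, h2, h3, h4, h5, h6⟩
          exact hv ⟨h5, h6⟩
      · rw [Set.indicator_of_notMem ht]
        symm
        have : ∀ v, kA ρ t v = 0 := by
          intro v; unfold kA; rw [if_neg]
          rintro ⟨h1, h2, h3, h4, h5, h6⟩
          exact ht ⟨h3, h4⟩
        simp [this]
    · rw [Set.indicator_of_notMem hρ]
      symm
      have : ∀ t v, kA ρ t v = 0 := by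
        intro t v; unfold kA; rw [if_neg]
        rintro ⟨h1, h2, h3, h4, h5, h6⟩
        exact hρ ⟨h1, h2⟩
      simp [this]
  have e2 : ∫⁻ ρ, ∫⁻ t, ∫⁻ v, kA ρ t v * H v ∂volume ∂volume ∂volume = ∫⁻ v, ∫⁻ ρ, ∫⁻ t, kA ρ t v * H v ∂volume ∂volume ∂volume := by
    have : ∀ ρ, ∫⁻ t, ∫⁻ v, kA ρ t v * H v ∂volume ∂volume = ∫⁻ v, ∫⁻ t, kA ρ t v * H v ∂volume ∂volume := by
      intro ρ
      apply lintegral_lintegral_swap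
      exact Measurable.aemeasurable (Measurable.comp (g := fun p : ℝ × ℝ × ℝ => kA p.1 p.2.1 p.2.2 * H p.2.2) (f := fun q : ℝ × ℝ => (ρ, q.1, q.2)) hm3 (by fun_prop))
    simp only [this]
    apply lintegral_lintegral_swap
    apply Measurable.aemeasurable
    apply Measurable.lintegral_prod_right' (f := fun q : (ℝ × ℝ) × ℝ => kA q.1.1 q.2 q.1.2 * H q.1.2)
    exact Measurable.comp (g := fun p : ℝ × ℝ × ℝ => kA p.1 p.2.1 p.2.2 * H p.2.2) (f := fun q : (ℝ × ℝ) × ℝ => (q.1.1, q.2, q.1.2)) hm3 (by fun_prop)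
  rw [e1, e2, ← lintegral_indicator measurableSet_Ioo]
  apply lintegral_mono
  intro v
  have mv : Measurable fun q : ℝ × ℝ => kA q.1 q.2 v := Measurable.comp (g := fun p : ℝ × ℝ × ℝ => kA p.1 p.2.1 p.2.2) (f := fun q : ℝ × ℝ => (q.1, q.2, v)) kA_meas (by fun_prop)
  have e3 : ∫⁻ ρ, ∫⁻ t, kA ρ t v * H v ∂volume ∂volume = (∫⁻ ρ, ∫⁻ t, kA ρ t v ∂volume ∂volume) * H v := by
    rw [← lintegral_mul_const _ (Measurable.lintegral_prod_right mv)]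
    apply lintegral_congr
    intro ρ
    rw [lintegral_mul_const]
    exact Measurable.comp (g := fun q : ℝ × ℝ => kA q.1 q.2 v) (f := fun t => (ρ, t)) mv (by fun_prop)
  dsimp only
  rw [e3]
  refine (mul_le_mul_left (kv v) _).trans ?_
  by_cases hv : v ∈ Set.Ioo (0:ℝ) 1
  · simp [hv]
  · simp [hv]

def Uf {n : ℕ} (g : Sp n → ℝ) (ω : Sp n) (t : ℝ) : ℝ≥0∞ := ∫⁻ y, ENNReal.ofReal (g y) * ENNReal.ofReal (Pk n (zz y ω) t) ∂(sg n)

def Phf {n : ℕ} (g : Sp n → ℝ) (v : ℝ) : ℝ≥0∞ := ∫⁻ y, ∫⁻ y', ENNReal.ofReal (g y) * (ENNReal.ofReal (g y') * ENNReal.ofReal (Pk n (zz y y') v)) ∂(sg n) ∂(sg n)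

theorem Pk_m3 {n : ℕ} : Measurable fun p : Sp n × Sp n × ℝ => ENNReal.ofReal (Pk n (zz p.1 p.2.1) p.2.2) := by
  apply Measurable.ennreal_ofReal
  exact Measurable.comp (g := fun q : ℝ × ℝ => Pk n q.1 q.2) (f := fun p : Sp n × Sp n × ℝ => (zz p.1 p.2.1, p.2.2)) (Pk_meas n)
    (Measurable.prodMk (Measurable.comp (g := fun q : Sp n × Sp n => zz q.1 q.2) (f := fun p : Sp n × Sp n × ℝ => (p.1, p.2.1)) zz_meas (by fun_prop)) (by fun_prop))

theorem Pk_m3' {n : ℕ} {α : Type*} [MeasurableSpace α] {a b : α → Sp n} {c : α → ℝ} (ha : Measurable a) (hb : Measurable b) (hc : Measurable c) :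
    Measurable fun p => ENNReal.ofReal (Pk n (zz (a p) (b p)) (c p)) :=
  Measurable.comp (g := fun p : Sp n × Sp n × ℝ => ENNReal.ofReal (Pk n (zz p.1 p.2.1) p.2.2)) (f := fun p => (a p, b p, c p)) Pk_m3 (ha.prodMk (hb.prodMk hc))

theorem Uf_meas {n : ℕ} {g : Sp n → ℝ} (hg : BM g) : Measurable fun p : Sp n × ℝ => Uf g p.1 p.2 := by
  unfold Uf
  apply Measurable.lintegral_prod_right' (f := fun q : (Sp n × ℝ) × Sp n => ENNReal.ofReal (g q.2) * ENNReal.ofReal (Pk n (zz q.2 q.1.1) q.1.2))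
  exact ((hg.m.comp (by fun_prop)).ennreal_ofReal).mul (Pk_m3' (by fun_prop) (by fun_prop) (by fun_prop))

theorem Phf_meas {n : ℕ} {g : Sp n → ℝ} (hg : BM g) : Measurable fun v : ℝ => Phf g v := by
  unfold Phf
  apply Measurable.lintegral_prod_right' (f := fun q : ℝ × Sp n => ∫⁻ y', ENNReal.ofReal (g q.2) * (ENNReal.ofReal (g y') * ENNReal.ofReal (Pk n (zz q.2 y') q.1)) ∂(sg n))
  apply Measurable.lintegral_prod_right' (f := fun q : (ℝ × Sp n) × Sp n => ENNReal.ofReal (g q.1.2) * (ENNReal.ofReal (g q.2) * ENNReal.ofReal (Pk n (zz q.1.2 q.2) q.1.1)))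
  exact ((hg.m.comp (by fun_prop)).ennreal_ofReal).mul (((hg.m.comp (by fun_prop)).ennreal_ofReal).mul (Pk_m3' (by fun_prop) (by fun_prop) (by fun_prop)))

theorem Uf_sq {n : ℕ} (hn : 5 ≤ n) {g : Sp n → ℝ} (hg : BM g) {t t' : ℝ} (ht : t ∈ Set.Ioo (0:ℝ) 1) (ht' : t' ∈ Set.Ioo (0:ℝ) 1) :
    ∫⁻ ω, Uf g ω t * Uf g ω t' ∂(sg n) = ENNReal.ofReal (AS n) * Phf g (t*t') := by
  have e1 : ∀ ω, Uf g ω t * Uf g ω t' = ∫⁻ y, ∫⁻ y', ENNReal.ofReal (g y) * (ENNReal.ofReal (g y') * (ENNReal.ofReal (Pk n (zz y ω) t) * ENNReal.ofReal (Pk n (zz y' ω) t'))) ∂(sg n) ∂(sg n) := by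
    intro ω
    unfold Uf
    have mu : ∀ t, Measurable fun y => ENNReal.ofReal (g y) * ENNReal.ofReal (Pk n (zz y ω) t) := fun t =>
      (hg.m.ennreal_ofReal).mul (Pk_m3' (by fun_prop) (by fun_prop) (by fun_prop))
    rw [← lintegral_mul_const _ (mu t)]
    apply lintegral_congr; intro y
    rw [← lintegral_const_mul _ (mu t')]
    apply lintegral_congr; intro y'
    ring
  simp only [e1]
  have m4 : Measurable fun q : (Sp n × Sp n) × Sp n => ENNReal.ofReal (g q.1.2) * (ENNReal.ofReal (g q.2) * (ENNReal.ofReal (Pk n (zz q.1.2 q.1.1) t) * ENNReal.ofReal (Pk n (zz q.2 q.1.1) t'))) :=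
    ((hg.m.comp (by fun_prop)).ennreal_ofReal).mul (((hg.m.comp (by fun_prop)).ennreal_ofReal).mul ((Pk_m3' (by fun_prop) (by fun_prop) (by fun_prop)).mul (Pk_m3' (by fun_prop) (by fun_prop) (by fun_prop))))
  rw [lintegral_lintegral_swap (Measurable.lintegral_prod_right' (f := fun q : (Sp n × Sp n) × Sp n => ENNReal.ofReal (g q.1.2) * (ENNReal.ofReal (g q.2) * (ENNReal.ofReal (Pk n (zz q.1.2 q.1.1) t) * ENNReal.ofReal (Pk n (zz q.2 q.1.1) t')))) m4).aemeasurable]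
  unfold Phf
  have m5 : Measurable fun q : Sp n × Sp n => ENNReal.ofReal (g q.1) * (ENNReal.ofReal (g q.2) * ENNReal.ofReal (Pk n (zz q.1 q.2) (t*t'))) :=
    ((hg.m.comp (by fun_prop)).ennreal_ofReal).mul (((hg.m.comp (by fun_prop)).ennreal_ofReal).mul (Pk_m3' (by fun_prop) (by fun_prop) (by fun_prop)))
  rw [← lintegral_const_mul _ (Measurable.lintegral_prod_right' m5)]
  apply lintegral_congr; intro y
  rw [lintegral_lintegral_swap]
  swap
  · exact Measurable.aemeasurable (Measurable.comp (g := fun q : (Sp n × Sp n) × Sp n => ENNReal.ofReal (g q.1.2) * (ENNReal.ofReal (g q.2) * (ENNReal.ofReal (Pk n (zz q.1.2 q.1.1) t) * ENNReal.ofReal (Pk n (zz q.2 q.1.1) t')))) (f := fun p : Sp n × Sp n => ((p.1, y), p.2)) m4 (by fun_prop))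
  have m6 : Measurable fun y' => ENNReal.ofReal (g y) * (ENNReal.ofReal (g y') * ENNReal.ofReal (Pk n (zz y y') (t*t'))) := 
    Measurable.comp (g := fun q : Sp n × Sp n => ENNReal.ofReal (g q.1) * (ENNReal.ofReal (g q.2) * ENNReal.ofReal (Pk n (zz q.1 q.2) (t*t')))) (f := fun y' => (y, y')) m5 (by fun_prop)
  dsimp only
  rw [← lintegral_const_mul _ m6]
  apply lintegral_congr; intro y'
  rw [lintegral_const_mul' _ _ ENNReal.ofReal_ne_top, lintegral_const_mul' _ _ ENNReal.ofReal_ne_top]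
  have e2 : ∫⁻ ω, ENNReal.ofReal (Pk n (zz y ω) t) * ENNReal.ofReal (Pk n (zz y' ω) t') ∂(sg n) = ENNReal.ofReal (AS n) * ENNReal.ofReal (Pk n (zz y y') (t*t')) := by
    rw [← ENNReal.ofReal_mul (AS_nonneg n), ← Pk_semi hn ht.1 ht.2 ht'.1 ht'.2 y y', ofReal_integral_eq_lintegral_ofReal]
    · apply lintegral_congr; intro ω
      rw [ENNReal.ofReal_mul (Pk_pos (zz_nonneg _ _) ht.1.le ht.2).le]
    · exact cont_int ((Pk_cont1 ht.1.le ht.2 y).mul (Pk_cont1 ht'.1.le ht'.2 y'))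
    · exact ae_of_all _ fun ω => mul_nonneg (Pk_pos (zz_nonneg _ _) ht.1.le ht.2).le (Pk_pos (zz_nonneg _ _) ht'.1.le ht'.2).le
  rw [e2]; ring

theorem Phf_int {n : ℕ} (hn : 5 ≤ n) {g : Sp n → ℝ} (hg : BM g) : 
    ∫⁻ v in Set.Ioo (0:ℝ) 1, ENNReal.ofReal ((1-v)^2/(4*v)) * (ENNReal.ofReal (hh n^2 * v^(hh n-1) * AS n) * Phf g v) = ENNReal.ofReal (hh n * AS n/(4*(hh n-1)) * Iq g) := by
  have h3 := hh_ge hn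
  have c0 : 0 ≤ hh n * AS n/(4*(hh n-1)) := div_nonneg (mul_nonneg (by linarith) (AS_nonneg n)) (by linarith)
  rw [ENNReal.ofReal_mul c0, Iq_lint hn hg, ← lintegral_const_mul' _ _ ENNReal.ofReal_ne_top]
  have m4 : Measurable fun q : (ℝ × Sp n) × Sp n => ENNReal.ofReal (w1 (hh n) q.1.1) * (ENNReal.ofReal (g q.1.2) * (ENNReal.ofReal (g q.2) * ENNReal.ofReal (Pk n (zz q.1.2 q.2) q.1.1))) := by
    refine Measurable.mul ?_ (((hg.m.comp (by fun_prop)).ennreal_ofReal).mul (((hg.m.comp (by fun_prop)).ennreal_ofReal).mul (Pk_m3' (by fun_prop) (by fun_prop) (by fun_prop))))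
    unfold w1
    fun_prop
  have e1 : ∫⁻ v in Set.Ioo (0:ℝ) 1, ENNReal.ofReal ((1-v)^2/(4*v)) * (ENNReal.ofReal (hh n^2 * v^(hh n-1) * AS n) * Phf g v) =
     ∫⁻ v in Set.Ioo (0:ℝ) 1, ENNReal.ofReal (hh n * AS n/(4*(hh n-1))) * ∫⁻ y, ∫⁻ y', ENNReal.ofReal (w1 (hh n) v) * (ENNReal.ofReal (g y) * (ENNReal.ofReal (g y') * ENNReal.ofReal (Pk n (zz y y') v))) ∂(sg n) ∂(sg n) ∂volume := by
    apply setLIntegral_congr_fun measurableSet_Ioo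
    intro v hv
    have v0 := hv.1
    dsimp only
    have : ∀ y, ∫⁻ y', ENNReal.ofReal (w1 (hh n) v) * (ENNReal.ofReal (g y) * (ENNReal.ofReal (g y') * ENNReal.ofReal (Pk n (zz y y') v))) ∂(sg n) = ENNReal.ofReal (w1 (hh n) v) * ∫⁻ y', (ENNReal.ofReal (g y) * (ENNReal.ofReal (g y') * ENNReal.ofReal (Pk n (zz y y') v))) ∂(sg n) := 
      fun y => lintegral_const_mul' _ _ ENNReal.ofReal_ne_top
    simp only [this]
    rw [lintegral_const_mul' _ _ ENNReal.ofReal_ne_top, ← mul_assoc, ← mul_assoc, ← ENNReal.ofReal_mul (by positivity), ← ENNReal.ofReal_mul c0]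
    unfold Phf
    congr 2
    unfold w1
    have : v^(hh n-1) = v^(hh n-2) * v := by rw [← Real.rpow_add_one v0.ne']; congr 1; ring
    rw [this]
    have : hh n - 1 ≠ 0 := by linarith
    field_simp
  rw [e1, lintegral_const_mul' _ _ ENNReal.ofReal_ne_top, lintegral_const_mul' _ _ ENNReal.ofReal_ne_top]
  congr 1
  rw [lintegral_lintegral_swap (Measurable.lintegral_prod_right' m4).aemeasurable]
  apply lintegral_congr; intro y
  rw [lintegral_lintegral_swap]
  swap
  · exact Measurable.aemeasurable (Measurable.comp (g := fun q : (ℝ × Sp n) × Sp n => ENNReal.ofReal (w1 (hh n) q.1.1) * (ENNReal.ofReal (g q.1.2) * (ENNReal.ofReal (g q.2) * ENNReal.ofReal (Pk n (zz q.1.2 q.2) q.1.1)))) (f := fun p : ℝ × Sp n => ((p.1, y), p.2)) m4 (by fun_prop))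
  apply lintegral_congr_ae
  filter_upwards [ae_zz_pos hn y] with y' hy'
  have hz : 0 < zz y y' := by first | exact hy' | (rw [zz_symm]; exact hy')
  rw [ENNReal.ofReal_mul (mul_nonneg (hg.p _) (hg.p _)), ENNReal.ofReal_mul (hg.p _), ← K1 hn hz, ofReal_integral_eq_lintegral_ofReal (w1Pk_int hn hz), ← lintegral_const_mul' _ _ (ENNReal.mul_ne_top ENNReal.ofReal_ne_top ENNReal.ofReal_ne_top)]
  · apply setLIntegral_congr_fun measurableSet_Ioo
    intro v hv
    dsimp only
    rw [ENNReal.ofReal_mul (w1_nonneg h3 hv.1.le)]; ring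
  · filter_upwards [ae_restrict_mem measurableSet_Ioo] with v hv
    exact mul_nonneg (w1_nonneg h3 hv.1.le) (Pk_pos hz.le hv.1.le hv.2).le

theorem Nmeas {n : ℕ} {g : Sp n → ℝ} (hg : BM g) (c : ℝ) : Measurable fun x : E n => ∫⁻ y : Sp n, ENNReal.ofReal (g y * (‖x - y‖^2)^c) ∂(sg n) := by
  apply Measurable.lintegral_prod_right' (f := fun q : E n × Sp n => ENNReal.ofReal (g q.2 * (‖q.1 - q.2‖^2)^c))
  apply Measurable.ennreal_ofReal
  refine (hg.m.comp (by fun_prop)).mul (Measurable.pow_const ?_ c)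
  exact (by fun_prop : Continuous fun q : E n × Sp n => ‖q.1 - q.2‖^2).measurable

theorem N_polar {n : ℕ} (hn : 5 ≤ n) {g : Sp n → ℝ} (hg : BM g) (ω : Sp n) {ρ : ℝ} (hρ : ρ ∈ Set.Ioo (0:ℝ) 1) :
    ENNReal.ofReal (ρ^(n-1)) * (∫⁻ y : Sp n, ENNReal.ofReal (g y * (‖ρ • (ω : E n) - y‖^2)^(-hh n)) ∂(sg n))^2 = 
    ENNReal.ofReal ρ * ∫⁻ t in Set.Ioo 0 ρ, ∫⁻ t' in Set.Ioo 0 ρ, ENNReal.ofReal (hh n * t^(hh n-1)) * (ENNReal.ofReal (hh n * t'^(hh n-1)) * (Uf g ω t * Uf g ω t')) ∂volume ∂volume := by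
  have h3 := hh_ge hn
  have ρ0 := hρ.1
  have e0 : ENNReal.ofReal (ρ^(n-1)) = ENNReal.ofReal ρ * ENNReal.ofReal (ρ^(hh n))^2 := by
    rw [← ENNReal.ofReal_pow (by positivity), ← ENNReal.ofReal_mul ρ0.le]
    congr 1
    rw [← Real.rpow_mul_natCast ρ0.le, ← Real.rpow_natCast, ← Real.rpow_one_add' ρ0.le (by push_cast; linarith)]
    congr 1
    rw [Nat.cast_sub (by omega)]; unfold hh; push_cast; ring
  have e1 : ENNReal.ofReal (ρ^(hh n)) * (∫⁻ y : Sp n, ENNReal.ofReal (g y * (‖ρ • (ω : E n) - y‖^2)^(-hh n)) ∂(sg n)) = ∫⁻ t in Set.Ioo 0 ρ, ENNReal.ofReal (hh n * t^(hh n-1)) * Uf g ω t := by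
    rw [← lintegral_const_mul' _ _ ENNReal.ofReal_ne_top]
    have : ∀ y : Sp n, ENNReal.ofReal (ρ^(hh n)) * ENNReal.ofReal (g y * (‖ρ • (ω : E n) - y‖^2)^(-hh n)) = 
       ∫⁻ t in Set.Ioo 0 ρ, ENNReal.ofReal (hh n * t^(hh n-1)) * (ENNReal.ofReal (g y) * ENNReal.ofReal (Pk n (zz y ω) t)) := by
      intro y
      rw [normsq_eq_qz, ENNReal.ofReal_mul (hg.p y), mul_left_comm, ← ENNReal.ofReal_mul (by positivity), ← K3 hn (zz_nonneg _ _) hρ, ← lintegral_const_mul' _ _ ENNReal.ofReal_ne_top]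
      apply setLIntegral_congr_fun measurableSet_Ioo
      intro t ht
      have t0 := ht.1
      dsimp only
      rw [ENNReal.ofReal_mul (mul_nonneg (by linarith) (by positivity))]; ring
    simp only [this]
    rw [lintegral_lintegral_swap]
    · apply lintegral_congr; intro t
      rw [lintegral_const_mul' _ _ ENNReal.ofReal_ne_top]; rfl
    · apply Measurable.aemeasurable
      refine Measurable.mul (by fun_prop) (((hg.m.comp (by fun_prop)).ennreal_ofReal).mul (Pk_m3' (by fun_prop) (by fun_prop) (by fun_prop)))
  rw [e0, mul_assoc, ← mul_pow, e1, sq]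
  have mU : Measurable fun t => ENNReal.ofReal (hh n * t^(hh n-1)) * Uf g ω t := 
    Measurable.mul (by fun_prop) (Measurable.comp (g := fun p : Sp n × ℝ => Uf g p.1 p.2) (f := fun t => (ω, t)) (Uf_meas hg) (by fun_prop))
  rw [← lintegral_mul_const _ mU]
  congr 1
  apply lintegral_congr; intro t
  rw [← lintegral_const_mul _ mU]
  apply lintegral_congr; intro t'
  ring

theorem N_bound {n : ℕ} (hn : 5 ≤ n) {g : Sp n → ℝ} (hg : BM g) : 
    ∫⁻ x in ball (0 : E n) 1, (∫⁻ y : Sp n, ENNReal.ofReal (g y * (‖x - y‖^2)^(-hh n)) ∂(sg n))^2 ≤ ENNReal.ofReal (hh n * AS n/(4*(hh n-1)) * Iq g) := by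
  have h3 := hh_ge hn
  rw [← Phf_int hn hg]
  refine le_trans ?_ (triple (fun v => ENNReal.ofReal (hh n^2 * v^(hh n-1) * AS n) * Phf g v) (Measurable.mul (by fun_prop) (Phf_meas hg)))
  rw [← lintegral_indicator measurableSet_ball, polar_lintegral hn _ (((Nmeas hg _).pow_const 2).indicator measurableSet_ball)]
  have e1 : ∀ ω : Sp n, ∫⁻ r in Set.Ioi (0:ℝ), ENNReal.ofReal (r ^ (n-1)) * (ball (0:E n) 1).indicator (fun x : E n => (∫⁻ y : Sp n, ENNReal.ofReal (g y * (‖x - y‖^2)^(-hh n)) ∂(sg n))^2) (r • (ω : E n)) = 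
    ∫⁻ ρ in Set.Ioo (0:ℝ) 1, ENNReal.ofReal ρ * ∫⁻ t in Set.Ioo 0 ρ, ∫⁻ t' in Set.Ioo 0 ρ, ENNReal.ofReal (hh n * t^(hh n-1)) * (ENNReal.ofReal (hh n * t'^(hh n-1)) * (Uf g ω t * Uf g ω t')) ∂volume ∂volume ∂volume := by
    intro ω
    rw [← lintegral_indicator measurableSet_Ioi, ← lintegral_indicator measurableSet_Ioo]
    apply lintegral_congr; intro ρ
    by_cases h0 : 0 < ρ
    · rw [Set.indicator_of_mem (Set.mem_Ioi.2 h0)]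
      by_cases h1 : ρ < 1
      · rw [Set.indicator_of_mem (show ρ ∈ Set.Ioo (0:ℝ) 1 from ⟨h0, h1⟩), ← N_polar hn hg ω ⟨h0, h1⟩, Set.indicator_of_mem]
        rw [mem_ball_zero_iff, norm_smul, ω.norm_eq, mul_one, Real.norm_eq_abs, abs_of_pos h0]; exact h1
      · rw [Set.indicator_of_notMem (show ρ ∉ Set.Ioo (0:ℝ) 1 from fun h => h1 h.2), Set.indicator_of_notMem, mul_zero]
        rw [mem_ball_zero_iff, norm_smul, ω.norm_eq, mul_one, Real.norm_eq_abs, abs_of_pos h0]; exact h1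
    · rw [Set.indicator_of_notMem (show ρ ∉ Set.Ioi (0:ℝ) from h0), Set.indicator_of_notMem (show ρ ∉ Set.Ioo (0:ℝ) 1 from fun h => h0 h.1)]
  simp only [e1]
  -- rewrite with indicators to swap
  have mK : Measurable fun q : ((Sp n × ℝ) × ℝ) × ℝ => ENNReal.ofReal (hh n * q.1.2^(hh n-1)) * (ENNReal.ofReal (hh n * q.2^(hh n-1)) * (Uf g q.1.1.1 q.1.2 * Uf g q.1.1.1 q.2)) := by
    have a1 := Measurable.comp (g := fun p : Sp n × ℝ => Uf g p.1 p.2) (f := fun q : ((Sp n × ℝ) × ℝ) × ℝ => (q.1.1.1, q.1.2)) (Uf_meas hg) (by fun_prop)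
    have a2 := Measurable.comp (g := fun p : Sp n × ℝ => Uf g p.1 p.2) (f := fun q : ((Sp n × ℝ) × ℝ) × ℝ => (q.1.1.1, q.2)) (Uf_meas hg) (by fun_prop)
    exact Measurable.mul (by fun_prop) (Measurable.mul (by fun_prop) (a1.mul a2))
  have mS : MeasurableSet {q : ((Sp n × ℝ) × ℝ) × ℝ | q.2 ∈ Set.Ioo 0 q.1.1.2} := by
    have a1 : MeasurableSet {q : ((Sp n × ℝ) × ℝ) × ℝ | 0 < q.2} := measurableSet_lt (by fun_prop) (by fun_prop)
    have a2 : MeasurableSet {q : ((Sp n × ℝ) × ℝ) × ℝ | q.2 < q.1.1.2} := measurableSet_lt (by fun_prop) (by fun_prop)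
    exact a1.inter a2
  have mS2 : MeasurableSet {q : (Sp n × ℝ) × ℝ | q.2 ∈ Set.Ioo 0 q.1.2} := by
    have a1 : MeasurableSet {q : (Sp n × ℝ) × ℝ | 0 < q.2} := measurableSet_lt (by fun_prop) (by fun_prop)
    have a2 : MeasurableSet {q : (Sp n × ℝ) × ℝ | q.2 < q.1.2} := measurableSet_lt (by fun_prop) (by fun_prop)
    exact a1.inter a2
  have m1 : Measurable fun q : (Sp n × ℝ) × ℝ => ∫⁻ t' in Set.Ioo 0 q.1.2, ENNReal.ofReal (hh n * q.2^(hh n-1)) * (ENNReal.ofReal (hh n * t'^(hh n-1)) * (Uf g q.1.1 q.2 * Uf g q.1.1 t')) := by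
    have := Measurable.lintegral_prod_right' (ν := (volume : Measure ℝ)) (mK.indicator mS)
    convert this using 2 with q
    rw [← lintegral_indicator measurableSet_Ioo]; rfl
  have m2 : Measurable fun q : Sp n × ℝ => ∫⁻ t in Set.Ioo 0 q.2, ∫⁻ t' in Set.Ioo 0 q.2, ENNReal.ofReal (hh n * t^(hh n-1)) * (ENNReal.ofReal (hh n * t'^(hh n-1)) * (Uf g q.1 t * Uf g q.1 t')) ∂volume ∂volume := by
    have := Measurable.lintegral_prod_right' (ν := (volume : Measure ℝ)) (m1.indicator mS2)
    convert this using 2 with q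
    rw [← lintegral_indicator measurableSet_Ioo]; rfl
  rw [lintegral_lintegral_swap]
  swap
  · exact Measurable.aemeasurable ((by fun_prop : Measurable fun q : Sp n × ℝ => ENNReal.ofReal q.2).mul m2)
  apply le_of_eq
  apply setLIntegral_congr_fun measurableSet_Ioo
  intro ρ hρ
  dsimp only
  rw [lintegral_const_mul' _ _ ENNReal.ofReal_ne_top]
  congr 1
  rw [lintegral_lintegral_swap]
  swap
  · exact Measurable.aemeasurable (Measurable.comp (g := fun q : (Sp n × ℝ) × ℝ => ∫⁻ t' in Set.Ioo 0 q.1.2, ENNReal.ofReal (hh n * q.2^(hh n-1)) * (ENNReal.ofReal (hh n * t'^(hh n-1)) * (Uf g q.1.1 q.2 * Uf g q.1.1 t'))) (f := fun p : Sp n × ℝ => ((p.1, ρ), p.2)) m1 (by fun_prop))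
  apply setLIntegral_congr_fun measurableSet_Ioo
  intro t ht
  dsimp only
  rw [lintegral_lintegral_swap]
  swap
  · exact Measurable.aemeasurable (Measurable.comp (g := fun q : ((Sp n × ℝ) × ℝ) × ℝ => ENNReal.ofReal (hh n * q.1.2^(hh n-1)) * (ENNReal.ofReal (hh n * q.2^(hh n-1)) * (Uf g q.1.1.1 q.1.2 * Uf g q.1.1.1 q.2))) (f := fun p : Sp n × ℝ => (((p.1, ρ), t), p.2)) mK (by fun_prop))
  apply setLIntegral_congr_fun measurableSet_Ioo
  intro t' ht'
  have t0 := ht.1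
  have t0' := ht'.1
  dsimp only
  rw [lintegral_const_mul' _ _ ENNReal.ofReal_ne_top, lintegral_const_mul' _ _ ENNReal.ofReal_ne_top, Uf_sq hn hg ⟨t0, ht.2.trans hρ.2⟩ ⟨t0', ht'.2.trans hρ.2⟩, ← mul_assoc, ← mul_assoc]
  congr 1
  rw [← ENNReal.ofReal_mul (mul_nonneg (by linarith) (by positivity)), ← ENNReal.ofReal_mul (mul_nonneg (mul_nonneg (by linarith) (by positivity)) (mul_nonneg (by linarith) (by positivity)))]
  rw [Real.mul_rpow t0.le t0'.le]
  congr 1; ring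

theorem lap_contin {n : ℕ} {u : E n → ℝ} (hu : ContDiff ℝ 2 u) : Continuous (lap n u) := by
  unfold lap
  apply continuous_finsetSum
  intro i _
  have h1 : ContDiff ℝ 1 fun y => fderiv ℝ u y (EuclideanSpace.single i 1) := 
    (hu.fderiv_right (m := 1) (by norm_num)).clm_apply contDiff_const
  exact (h1.continuous_fderiv (by norm_num)).clm_apply continuous_const

theorem far_le {n : ℕ} {x : E n} (hx : ‖x‖ ≤ 1) (y : Sp n) {r : ℝ} (h0 : 0 < r) (h1 : r < 1) : ‖x - y‖^2 ≤ ‖x - r⁻¹ • (y : E n)‖^2 := by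
  rw [norm_sub_sq_real, norm_sub_sq_real, norm_smul, y.norm_eq, inner_smul_right, Real.norm_eq_abs, abs_of_pos (inv_pos.2 h0)]
  have : inner ℝ x (y : E n) ≤ 1 := (real_inner_le_norm _ _).trans (by rw [y.norm_eq, mul_one]; exact hx)
  have h2 : 1 < r⁻¹ := (one_lt_inv₀ h0).2 h1
  nlinarith

theorem far_low {n : ℕ} {x : E n} (hx : ‖x‖ ≤ 1) (y : Sp n) {r : ℝ} (h0 : 0 < r) (h1 : r < 1) : (r⁻¹ - 1)^2 ≤ ‖x - r⁻¹ • (y : E n)‖^2 := by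
  have h2 : 1 < r⁻¹ := (one_lt_inv₀ h0).2 h1
  apply pow_le_pow_left₀ (by linarith)
  have := norm_sub_norm_le (r⁻¹ • (y : E n)) x
  rw [norm_smul, y.norm_eq, Real.norm_eq_abs, abs_of_pos (by linarith), norm_sub_rev] at this
  linarith

theorem dual_pt {n : ℕ} (hn : 5 ≤ n) {u f : E n → ℝ} (hu : ContDiff ℝ 2 u) (hb : ∀ x : Sp n, u x = f x)
    (hr : ∀ x : Sp n, fderiv ℝ u x x = -(hh n - 1) * f x) (y : Sp n) {r : ℝ} (h0 : 0 < r) (h1 : r < 1) : 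
    hh n * r^(2*hh n) * (∫ x, Pk n (zz y x) r * f x ∂(sg n)) = 
     (∫ x : Sp n, f x * (‖(x : E n) - r⁻¹ • (y : E n)‖^2)^(-hh n) ∂(sg n)) - ∫ x in ball (0 : E n) 1, lap n u x * (‖x - r⁻¹ • (y : E n)‖^2)^(-hh n) := by
  have h2 : 1 < r⁻¹ := (one_lt_inv₀ h0).2 h1
  set p : E n := r⁻¹ • (y : E n) with hp
  have hpn : ‖p‖ = r⁻¹ := by rw [hp, norm_smul, y.norm_eq, Real.norm_eq_abs, abs_of_pos (by linarith), mul_one]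
  have mfe : ∀ x, mf p 1 0 (-hh n) x = (‖x - p‖^2)^(-hh n) := by intro x; simp [mf]
  have hne : ∀ x ∈ ball (0 : E n) r⁻¹, x ≠ p := by
    rintro x hx rfl
    rw [mem_ball_zero_iff, hpn] at hx; exact lt_irrefl _ hx
  have hG := green hn h2 (mf p 1 0 (-hh n)) u ((mf_contDiffOn p 1 0 (-hh n)).mono (fun x hx => hne x hx)) hu.contDiffOn
  have hl : ∀ x ∈ ball (0 : E n) 1, mf p 1 0 (-hh n) x * lap n u x - u x * lap n (mf p 1 0 (-hh n)) x = lap n u x * (‖x - p‖^2)^(-hh n) := by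
    intro x hx
    rw [mf_lap p x 1 0 (-hh n) (hne x (ball_subset_ball h2.le hx)), mfe]
    have : (n:ℝ) + 2 * (-hh n) - 2 = 0 := by unfold hh; ring
    rw [this]; ring
  rw [setIntegral_congr_fun measurableSet_ball hl] at hG
  have hs : ∀ x : Sp n, mf p 1 0 (-hh n) x * fderiv ℝ u x x - u x * fderiv ℝ (mf p 1 0 (-hh n)) x x = 
     f x * (‖(x : E n) - p‖^2)^(-hh n) - hh n * r^(2*hh n) * (Pk n (zz y x) r * f x) := by
    intro x
    have hxb : (x : E n) ∈ ball (0 : E n) r⁻¹ := by rw [mem_ball_zero_iff, x.norm_eq]; exact h2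
    rw [mf_fderiv p x 1 0 (-hh n) (hne _ hxb), mfe, hr, hb]
    have q0 := qz_pos (zz_nonneg y x) h0.le h1
    have e1 : ‖(x : E n) - p‖^2 = (r⁻¹)^2 * qz (zz y x) r := by
      rw [← normsq_eq_qz, hp, ← mul_pow]
      have : (x : E n) - r⁻¹ • (y : E n) = r⁻¹ • (r • (x : E n) - y) := by rw [smul_sub, smul_smul, inv_mul_cancel₀ h0.ne', one_smul]
      rw [this, norm_smul, Real.norm_eq_abs, abs_of_pos (by linarith)]
    have qp : 0 < ‖(x : E n) - p‖^2 := by rw [e1]; positivity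
    have e2 : 2 * inner ℝ ((x : E n) - p) (x : E n) = ‖(x : E n) - p‖^2 + 1 - (r⁻¹)^2 := by
      rw [inner_sub_left, norm_sub_sq_real, real_inner_self_eq_norm_sq, x.norm_eq, hpn, real_inner_comm]; ring
    have e3 : (‖(x : E n) - p‖^2)^(-hh n) = (‖(x : E n) - p‖^2)^(-hh n-1) * ‖(x : E n) - p‖^2 := by
      rw [← Real.rpow_add_one qp.ne']; congr 1; ring
    have e4 : ((r⁻¹)^2 - 1) * (‖(x : E n) - p‖^2)^(-hh n-1) = r^(2*hh n) * Pk n (zz y x) r := by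
      rw [e1, Real.mul_rpow (by positivity) q0.le, Pk_hh]
      have : ((r⁻¹)^2)^(-hh n-1) = r^(2*hh n) * r^2 := by
        rw [← Real.rpow_natCast, ← Real.rpow_mul (by positivity), Real.inv_rpow h0.le, ← Real.rpow_neg h0.le, ← Real.rpow_natCast, ← Real.rpow_add h0]
        congr 1; push_cast; ring
      rw [this]
      field_simp
    rw [show hh n * r^(2*hh n) * (Pk n (zz y x) r * f x) = hh n * f x * (r^(2*hh n) * Pk n (zz y x) r) by ring, ← e4, e3]
    linear_combination (f x * hh n * (‖(x : E n) - p‖^2)^(-hh n-1)) * e2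
  simp only [hs] at hG
  have fc : Continuous fun x : Sp n => f x := by simp only [← hb]; exact hu.continuous.comp continuous_subtype_val
  have i1 : Integrable (fun x : Sp n => f x * (‖(x : E n) - p‖^2)^(-hh n)) (sg n) := by
    apply cont_int
    apply fc.mul
    apply Continuous.rpow_const (by fun_prop)
    intro x
    have := far_low (x := (x : E n)) (by rw [x.norm_eq]) y h0 h1
    left
    have h3 : 0 < (r⁻¹ - 1)^2 := pow_pos (by linarith) 2
    exact (h3.trans_le this).ne'
  have i2 : Integrable (fun x : Sp n => Pk n (zz y x) r * f x) (sg n) := cont_int ((Pk_cont1 h0.le h1 y).mul fc)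
  rw [integral_sub i1 (i2.const_mul _), integral_const_mul] at hG
  rw [hG]; ring

theorem dual_r {n : ℕ} (hn : 5 ≤ n) {u f : E n → ℝ} (hu : ContDiff ℝ 2 u) (hb : ∀ x : Sp n, u x = f x)
    (hr : ∀ x : Sp n, fderiv ℝ u x x = -(hh n - 1) * f x) {g : Sp n → ℝ} (hg : Measurable g) {M : ℝ} (hM : ∀ x, |g x| ≤ M)
    {l : ℝ} (hl : 0 < l) {r : ℝ} (h0 : 0 < r) (h1 : r < 1) : 
    |hh n * r^(2*hh n) * ∫ y, g y * (∫ x, Pk n (zz y x) r * f x ∂(sg n)) ∂(sg n)| ≤ 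
      (∫ p, |f p.1| * |g p.2| * zz p.1 p.2^(-hh n) ∂(ss n)) + l/2 * (∫ x in ball (0 : E n) 1, (lap n u x)^2) 
       + 1/(2*l) * (hh n * AS n/(4*(hh n-1)) * Iq (fun x => |g x|)) := by
  have h3 := hh_ge hn
  have M0 : 0 ≤ M := by
    obtain ⟨x⟩ : Nonempty (Sp n) := by
      by_contra h
      rw [not_nonempty_iff] at h
      have := AS_pos hn
      unfold AS at this
      simp [Set.univ_eq_empty_iff.2 h] at this
    exact (abs_nonneg _).trans (hM x)
  have bg : BM (fun x => |g x|) := ⟨hg.abs, ⟨M, fun x => by rw [abs_abs]; exact hM x⟩, fun x => abs_nonneg _⟩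
  set Bd := hh n * AS n/(4*(hh n-1)) * Iq (fun x => |g x|) with hBd
  have Bd0 : 0 ≤ Bd := mul_nonneg (div_nonneg (mul_nonneg (by linarith) (AS_nonneg n)) (by linarith)) (Iq_nonneg bg)
  have fc : Continuous fun x : Sp n => f x := by simp only [← hb]; exact hu.continuous.comp continuous_subtype_val
  obtain ⟨F, hF⟩ : ∃ F, ∀ x : Sp n, |f x| ≤ F := by
    obtain ⟨F, hF⟩ := isCompact_univ.exists_bound_of_continuousOn fc.continuousOn
    exact ⟨F, fun x => hF x (Set.mem_univ x)⟩
  have lc := lap_contin hu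
  obtain ⟨B, hB⟩ : ∃ B, ∀ x ∈ closedBall (0 : E n) 1, |lap n u x| ≤ B := (isCompact_closedBall (0 : E n) 1).exists_bound_of_continuousOn lc.continuousOn
  have B0 : 0 ≤ B := (abs_nonneg _).trans (hB 0 (by simp))
  have h2 : 1 < r⁻¹ := (one_lt_inv₀ h0).2 h1
  set v : E n → Sp n → ℝ := fun x y => (‖x - r⁻¹ • (y : E n)‖^2)^(-hh n) with hv
  have v0 : ∀ x y, 0 ≤ v x y := fun x y => by rw [hv]; positivity
  have vm : Measurable fun q : E n × Sp n => v q.1 q.2 := 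
    Measurable.pow_const (by exact (by fun_prop : Continuous fun q : E n × Sp n => ‖q.1 - r⁻¹ • (q.2 : E n)‖^2).measurable) _
  set K := ((r⁻¹ - 1)^2)^(-hh n) with hK
  have K0 : 0 ≤ K := by positivity
  have vK : ∀ x y, ‖x‖ ≤ 1 → v x y ≤ K := fun x y hx => 
    Real.rpow_le_rpow_of_nonpos (pow_pos (by linarith) 2) (far_low hx y h0 h1) (by linarith)
  -- cut-offs
  set L : E n → ℝ := (ball (0 : E n) 1).indicator (lap n u) with hL
  have Lm : Measurable L := lc.measurable.indicator measurableSet_ball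
  have Lb : ∀ x, |L x| ≤ B := by
    intro x
    by_cases hx : x ∈ ball (0 : E n) 1
    · rw [hL, Set.indicator_of_mem hx]; exact hB x (ball_subset_closedBall hx)
    · rw [hL, Set.indicator_of_notMem hx, abs_zero]; exact B0
  set V : E n → Sp n → ℝ := fun x y => (ball (0 : E n) 1).indicator (fun x => v x y) x with hV
  have Vm : Measurable fun q : E n × Sp n => V q.1 q.2 := by
    have : (fun q : E n × Sp n => V q.1 q.2) = (Prod.fst ⁻¹' ball (0 : E n) 1).indicator (fun q : E n × Sp n => v q.1 q.2) := by
      ext q; rfl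
    rw [this]
    exact vm.indicator (measurable_fst measurableSet_ball)
  have V0 : ∀ x y, 0 ≤ V x y := fun x y => Set.indicator_nonneg (fun x _ => v0 x y) x
  have VK : ∀ x y, V x y ≤ K := by
    intro x y
    by_cases hx : x ∈ ball (0 : E n) 1
    · simp only [hV]; rw [Set.indicator_of_mem hx]; exact vK x y (by rw [mem_ball_zero_iff] at hx; exact hx.le)
    · simp only [hV]; rw [Set.indicator_of_notMem hx]; exact K0
  set μB := (volume : Measure (E n)).restrict (ball (0 : E n) 1) with hμ
  have : IsFiniteMeasure μB := ⟨by rw [hμ, Measure.restrict_apply_univ]; exact measure_ball_lt_top⟩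
  set φ : E n → ℝ := fun x => ∫ y, |g y| * V x y ∂(sg n) with hφ
  have gV : ∀ q : E n × Sp n, |(|g q.2| * V q.1 q.2)| ≤ M * K := by
    intro q
    rw [abs_mul, abs_abs, abs_of_nonneg (V0 _ _)]
    exact mul_le_mul (hM _) (VK _ _) (V0 _ _) M0
  have gVm : Measurable fun q : E n × Sp n => |g q.2| * V q.1 q.2 := ((hg.comp measurable_snd).abs).mul Vm
  have gVm1 : ∀ x, Measurable fun y => |g y| * V x y := fun x => 
    Measurable.comp (g := fun q : E n × Sp n => |g q.2| * V q.1 q.2) (f := fun y => (x, y)) gVm (by fun_prop)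
  have gVi : ∀ x, Integrable (fun y => |g y| * V x y) (sg n) := fun x => bdd_int (gVm1 x) (fun y => gV (x, y))
  have φm : Measurable φ := (gVm.stronglyMeasurable.integral_prod_right').measurable
  have φ0 : ∀ x, 0 ≤ φ x := fun x => integral_nonneg fun y => mul_nonneg (abs_nonneg _) (V0 _ _)
  have φb : ∀ x, |φ x| ≤ M * K * AS n := by
    intro x
    have := norm_integral_le_of_norm_le_const (μ := sg n) (f := fun y => |g y| * V x y) (C := M*K) (ae_of_all _ fun y => gV (x, y))
    exact this
  -- the square integral of φ
  have φsq : ∫ x, φ x^2 ∂μB ≤ Bd := by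
    have ip : Integrable (fun x => φ x^2) μB := bdd_int (M := (M*K*AS n)^2) (φm.pow_const 2) (fun x => by rw [abs_pow]; exact pow_le_pow_left₀ (abs_nonneg _) (φb x) 2)
    rw [← ENNReal.ofReal_le_ofReal_iff Bd0, ofReal_integral_eq_lintegral_ofReal ip (ae_of_all _ fun x => sq_nonneg _)]
    refine le_trans ?_ (N_bound hn bg)
    apply setLIntegral_mono' measurableSet_ball
    intro x hx
    have hx1 : ‖x‖ < 1 := by rwa [mem_ball_zero_iff] at hx
    rw [ENNReal.ofReal_pow (φ0 x)]
    gcongr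
    simp only [hφ]
    rw [ofReal_integral_eq_lintegral_ofReal (gVi x) (ae_of_all _ fun y => mul_nonneg (abs_nonneg _) (V0 _ _))]
    apply lintegral_mono
    intro y
    apply ENNReal.ofReal_le_ofReal
    simp only [hV, hv]
    rw [Set.indicator_of_mem hx]
    gcongr ?_ * ?_
    apply Real.rpow_le_rpow_of_nonpos _ (far_le hx1.le y h0 h1) (by linarith)
    apply pow_pos
    rw [norm_pos_iff, sub_ne_zero]
    rintro rfl
    rw [y.norm_eq] at hx1; exact lt_irrefl _ hx1
  -- decomposition
  set A : Sp n → ℝ := fun y => ∫ x : Sp n, f x * v x y ∂(sg n) with hA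
  set W : Sp n → ℝ := fun y => ∫ x, L x * V x y ∂μB with hW
  have LVm : Measurable fun q : Sp n × E n => L q.2 * V q.2 q.1 := (Lm.comp measurable_snd).mul (Measurable.comp (g := fun q : E n × Sp n => V q.1 q.2) (f := fun q : Sp n × E n => (q.2, q.1)) Vm (by fun_prop))
  have LVb : ∀ q : Sp n × E n, |L q.2 * V q.2 q.1| ≤ B * K := by
    intro q
    rw [abs_mul, abs_of_nonneg (V0 _ _)]
    exact mul_le_mul (Lb _) (VK _ _) (V0 _ _) B0
  have fvm : Measurable fun q : Sp n × Sp n => f q.2 * v q.2 q.1 := (fc.measurable.comp measurable_snd).mul (Measurable.comp (g := fun q : E n × Sp n => v q.1 q.2) (f := fun q : Sp n × Sp n => ((q.2 : E n), q.1)) vm (by fun_prop))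
  have F0 : 0 ≤ F ∨ IsEmpty (Sp n) := by
    rcases isEmpty_or_nonempty (Sp n) with h | ⟨⟨x⟩⟩
    · right; exact h
    · left; exact (abs_nonneg _).trans (hF x)
  have fvb : ∀ q : Sp n × Sp n, |f q.2 * v q.2 q.1| ≤ F * K := by
    intro q
    rw [abs_mul, abs_of_nonneg (v0 _ _)]
    exact mul_le_mul (hF _) (vK _ _ (by rw [q.2.norm_eq])) (v0 _ _) ((abs_nonneg _).trans (hF q.2))
  have Am : Measurable A := (fvm.stronglyMeasurable.integral_prod_right').measurable
  have Wm : Measurable W := (LVm.stronglyMeasurable.integral_prod_right').measurable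
  have Ab : ∀ y, |A y| ≤ F * K * AS n := by
    intro y
    have := norm_integral_le_of_norm_le_const (μ := sg n) (f := fun x : Sp n => f x * v x y) (C := F*K) (ae_of_all _ fun x => fvb (y, x))
    exact this
  have Wb : ∀ y, |W y| ≤ B * K * μB.real Set.univ := by
    intro y
    have := norm_integral_le_of_norm_le_const (μ := μB) (f := fun x => L x * V x y) (C := B*K) (ae_of_all _ fun x => LVb (y, x))
    exact this
  have e1 : ∀ y, hh n * r^(2*hh n) * (∫ x, Pk n (zz y x) r * f x ∂(sg n)) = A y - W y := by
    intro y
    rw [dual_pt hn hu hb hr y h0 h1]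
    congr 1
    apply setIntegral_congr_fun measurableSet_ball
    intro x hx
    simp only [hL, hV]
    rw [Set.indicator_of_mem hx, Set.indicator_of_mem hx]
  have e2 : hh n * r^(2*hh n) * ∫ y, g y * (∫ x, Pk n (zz y x) r * f x ∂(sg n)) ∂(sg n) = ∫ y, g y * (A y - W y) ∂(sg n) := by
    rw [← integral_const_mul]
    congr 1; ext y
    rw [← e1]; ring
  rw [e2]
  have igA : Integrable (fun y => |g y| * |A y|) (sg n) := bdd_int (M := M * (F*K*AS n)) (hg.abs.mul Am.abs) (fun y => by
    rw [abs_mul, abs_abs, abs_abs]; exact mul_le_mul (hM _) (Ab _) (abs_nonneg _) M0)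
  have igW : Integrable (fun y => |g y| * |W y|) (sg n) := bdd_int (M := M * (B*K*μB.real Set.univ)) (hg.abs.mul Wm.abs) (fun y => by
    rw [abs_mul, abs_abs, abs_abs]; exact mul_le_mul (hM _) (Wb _) (abs_nonneg _) M0)
  have s1 : |∫ y, g y * (A y - W y) ∂(sg n)| ≤ (∫ y, |g y| * |A y| ∂(sg n)) + ∫ y, |g y| * |W y| ∂(sg n) := by
    rw [← integral_add igA igW]
    refine (abs_integral_le_integral_abs).trans ?_
    apply integral_mono_of_nonneg (ae_of_all _ fun y => abs_nonneg _) (igA.add igW)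
    refine ae_of_all _ fun y => ?_
    simp only [Pi.add_apply]
    rw [abs_mul, ← mul_add]
    exact mul_le_mul_of_nonneg_left (abs_sub _ _) (abs_nonneg _)
  have s2 : ∫ y, |g y| * |A y| ∂(sg n) ≤ ∫ p, |f p.1| * |g p.2| * zz p.1 p.2^(-hh n) ∂(ss n) := by
    have ii : Integrable (fun p : Sp n × Sp n => |f p.1| * |g p.2| * zz p.1 p.2^(-hh n)) (ss n) := by
      refine zzint_bdd hn (G := fun p : Sp n × Sp n => |f p.1| * |g p.2|) (M := F * M) (by unfold hh; linarith) ((fc.measurable.comp measurable_fst).abs.mul (hg.comp measurable_snd).abs) ?_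
      intro p
      rw [abs_mul, abs_abs, abs_abs]
      exact mul_le_mul (hF _) (hM _) (abs_nonneg _) ((abs_nonneg _).trans (hF p.1))
    rw [integral_prod_symm _ ii]
    apply integral_mono_ae igA ii.integral_prod_right
    filter_upwards [ii.prod_left_ae] with y hy
    have hz : ∀ᵐ x ∂(sg n), 0 < zz x y := by
      filter_upwards [ae_zz_pos hn y] with x hx
      rw [zz_symm]; exact hx
    have hq : |A y| ≤ ∫ x, |f x| * v x y ∂(sg n) := by
      refine (abs_integral_le_integral_abs).trans (le_of_eq ?_)
      congr 1; ext x; rw [abs_mul, abs_of_nonneg (v0 _ _)]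
    have iv : Integrable (fun x : Sp n => |f x| * v x y) (sg n) := by
      refine bdd_int (M := F*K) (fc.measurable.abs.mul (Measurable.comp (g := fun q : E n × Sp n => v q.1 q.2) (f := fun x : Sp n => ((x : E n), y)) vm (by fun_prop))) ?_
      intro x
      have := fvb (y, x)
      rw [abs_mul] at this ⊢
      rwa [abs_abs]
    calc |g y| * |A y| ≤ |g y| * ∫ x, |f x| * v x y ∂(sg n) := by gcongr
      _ = ∫ x, |g y| * (|f x| * v x y) ∂(sg n) := by rw [integral_const_mul]
      _ ≤ _ := by
        apply integral_mono_ae (iv.const_mul _) hy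
        filter_upwards [hz] with x hx
        have : v x y ≤ zz x y^(-hh n) := Real.rpow_le_rpow_of_nonpos hx (far_le (by rw [x.norm_eq]) y h0 h1) (by linarith)
        calc |g y| * (|f x| * v x y) = |f x| * |g y| * v x y := by ring
          _ ≤ _ := by gcongr
  have s3 : ∫ y, |g y| * |W y| ∂(sg n) ≤ ∫ x, |L x| * φ x ∂μB := by
    have iL : Integrable (fun q : Sp n × E n => |g q.1| * (|L q.2| * V q.2 q.1)) ((sg n).prod μB) := by
      refine bdd_int (M := M * (B*K)) ((hg.comp measurable_fst).abs.mul ((Lm.comp measurable_snd).abs.mul (Measurable.comp (g := fun q : E n × Sp n => V q.1 q.2) (f := fun q : Sp n × E n => (q.2, q.1)) Vm (by fun_prop)))) ?_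
      intro q
      rw [abs_mul, abs_abs, abs_mul, abs_abs, ← abs_mul]
      exact mul_le_mul (hM _) (LVb q) (abs_nonneg _) M0
    calc ∫ y, |g y| * |W y| ∂(sg n) ≤ ∫ y, ∫ x, |g y| * (|L x| * V x y) ∂μB ∂(sg n) := by
          apply integral_mono igW iL.integral_prod_left
          intro y
          dsimp only
          rw [integral_const_mul]
          apply mul_le_mul_of_nonneg_left _ (abs_nonneg _)
          refine (abs_integral_le_integral_abs).trans (le_of_eq ?_)
          congr 1; ext x; rw [abs_mul, abs_of_nonneg (V0 _ _)]
      _ = ∫ x, ∫ y, |g y| * (|L x| * V x y) ∂(sg n) ∂μB := integral_integral_swap iL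
      _ = _ := by
        congr 1; ext x
        simp only [hφ]
        rw [← integral_const_mul]
        congr 1; ext y; ring
  have iL2 : Integrable (fun x => L x^2) μB := bdd_int (M := B^2) (Lm.pow_const 2) (fun x => by rw [abs_pow]; exact pow_le_pow_left₀ (abs_nonneg _) (Lb x) 2)
  have iφ2 : Integrable (fun x => φ x^2) μB := bdd_int (M := (M*K*AS n)^2) (φm.pow_const 2) (fun x => by rw [abs_pow]; exact pow_le_pow_left₀ (abs_nonneg _) (φb x) 2)
  have s4 : ∫ x, |L x| * φ x ∂μB ≤ l/2 * (∫ x, L x^2 ∂μB) + 1/(2*l) * ∫ x, φ x^2 ∂μB := by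
    rw [← integral_const_mul, ← integral_const_mul, ← integral_add (iL2.const_mul _) (iφ2.const_mul _)]
    apply integral_mono_of_nonneg (ae_of_all _ fun x => mul_nonneg (abs_nonneg _) (φ0 x)) ((iL2.const_mul _).add (iφ2.const_mul _))
    refine ae_of_all _ fun x => ?_
    simp only [Pi.add_apply]
    have : l/2 * L x^2 + 1/(2*l) * φ x^2 - |L x| * φ x = 1/(2*l) * (l * |L x| - φ x)^2 := by
      rw [sub_sq, mul_pow, sq_abs]; field_simp; ring
    have h5 : 0 ≤ 1/(2*l) * (l * |L x| - φ x)^2 := by positivity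
    linarith
  have s5 : ∫ x, L x^2 ∂μB = ∫ x in ball (0 : E n) 1, (lap n u x)^2 := by
    apply setIntegral_congr_fun measurableSet_ball
    intro x hx
    simp only [hL]; rw [Set.indicator_of_mem hx]
  have s6 : 1/(2*l) * (∫ x, φ x^2 ∂μB) ≤ 1/(2*l) * Bd := by gcongr
  rw [s5] at s4
  linarith

theorem dual {n : ℕ} (hn : 5 ≤ n) {u f : E n → ℝ} (hu : ContDiff ℝ 2 u) (hb : ∀ x : Sp n, u x = f x)
    (hr : ∀ x : Sp n, fderiv ℝ u x x = -(hh n - 1) * f x) {g : Sp n → ℝ} (hg : Measurable g) {M : ℝ} (hM : ∀ x, |g x| ≤ M)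
    {l : ℝ} (hl : 0 < l) : 
    hh n * AS n * |∫ y : Sp n, g y * f y ∂(sg n)| ≤ 
      (∫ p, |f p.1| * |g p.2| * zz p.1 p.2^(-hh n) ∂(ss n)) + l/2 * (∫ x in ball (0 : E n) 1, (lap n u x)^2) 
       + 1/(2*l) * (hh n * AS n/(4*(hh n-1)) * Iq (fun x => |g x|)) := by
  have h3 := hh_ge hn
  have fc : Continuous fun x : Sp n => f x := by simp only [← hb]; exact hu.continuous.comp continuous_subtype_val
  obtain ⟨F, hF⟩ : ∃ F, ∀ x : Sp n, |f x| ≤ F := by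
    obtain ⟨F, hF⟩ := isCompact_univ.exists_bound_of_continuousOn fc.continuousOn
    exact ⟨F, fun x => hF x (Set.mem_univ x)⟩
  have lim : Tendsto (fun r : ℝ => ∫ y, g y * (∫ x, Pk n (zz y x) r * f x ∂(sg n)) ∂(sg n)) (nhdsWithin 1 (Set.Iio 1)) (nhds (∫ y, g y * (AS n * f y) ∂(sg n))) := by
    have ev : ∀ᶠ r in nhdsWithin (1:ℝ) (Set.Iio 1), r ∈ Set.Ioo (0:ℝ) 1 := Ioo_mem_nhdsLT one_pos
    apply tendsto_integral_filter_of_dominated_convergence (fun _ => M * (F * AS n))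
    · filter_upwards [ev] with r hr
      apply Measurable.aestronglyMeasurable
      apply hg.mul
      have : Measurable fun q : Sp n × Sp n => Pk n (zz q.1 q.2) r * f q.2 := (Pk_measxy r).mul (fc.measurable.comp measurable_snd)
      exact (this.stronglyMeasurable.integral_prod_right').measurable
    · filter_upwards [ev] with r hr
      refine ae_of_all _ fun y => ?_
      rw [Real.norm_eq_abs, abs_mul]
      refine mul_le_mul (hM y) ?_ (abs_nonneg _) ((abs_nonneg _).trans (hM y))
      refine (abs_integral_le_integral_abs).trans ?_
      rw [← Pk_int hn hr.1 hr.2 y, ← integral_const_mul]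
      apply integral_mono_of_nonneg (ae_of_all _ fun x => abs_nonneg _) ((cont_int (Pk_cont1 hr.1.le hr.2 y)).const_mul F)
      refine ae_of_all _ fun x => ?_
      dsimp only
      have := Pk_pos (n := n) (zz_nonneg y x) hr.1.le hr.2
      rw [abs_mul, abs_of_pos this, mul_comm]
      gcongr
      exact hF x
    · exact integrable_const _
    · refine ae_of_all _ fun y => ?_
      exact (Pk_approx hn y _ fc).const_mul _
  have lim2 : Tendsto (fun r : ℝ => |hh n * r^(2*hh n) * ∫ y, g y * (∫ x, Pk n (zz y x) r * f x ∂(sg n)) ∂(sg n)|) (nhdsWithin 1 (Set.Iio 1)) (nhds |hh n * 1^(2*hh n) * ∫ y, g y * (AS n * f y) ∂(sg n)|) := by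
    apply Tendsto.abs
    refine Tendsto.mul (Tendsto.const_mul _ ?_) lim
    exact ((Real.continuousAt_rpow_const 1 (2*hh n) (Or.inl one_ne_zero)).tendsto).mono_left nhdsWithin_le_nhds
  have e : |hh n * 1^(2*hh n) * ∫ y, g y * (AS n * f y) ∂(sg n)| = hh n * AS n * |∫ y : Sp n, g y * f y ∂(sg n)| := by
    have : ∀ y : Sp n, g y * (AS n * f y) = AS n * (g y * f y) := fun y => by ring
    simp only [this]
    rw [integral_const_mul, Real.one_rpow, mul_one, abs_mul, abs_mul, abs_of_nonneg (by linarith : 0 ≤ hh n), abs_of_nonneg (AS_nonneg n), mul_assoc]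
  rw [← e]
  refine le_of_tendsto lim2 ?_
  filter_upwards [Ioo_mem_nhdsLT (show (0:ℝ) < 1 from one_pos)] with r hr'
  exact dual_r hn hu hb hr hg hM hl hr'.1 hr'.2

theorem sph_integral (n : ℕ) (f : E n → ℝ) :
    ∫ x, f x ∂(sphMeasure n) = ∫ x : Sp n, f x ∂(sg n) := by
  unfold sphMeasure
  exact (MeasurableEmbedding.subtype_coe isClosed_sphere.measurableSet).integral_map f

theorem SA_eq (n : ℕ) : SA n = AS n := by
  unfold SA AS sphMeasure Measure.real
  rw [Measure.map_apply measurable_subtype_coe MeasurableSet.univ]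
  simp

def evC (n : ℕ) : MvPolynomial (Fin n) ℝ →ₗ[ℝ] C(Sp n, ℝ) where
  toFun p := ⟨fun x => MvPolynomial.eval (fun i => (x : E n) i) p, by
    have h1 : Continuous fun y : Fin n → ℝ => MvPolynomial.eval y p := MvPolynomial.continuous_eval p
    have h2 : Continuous fun x : Sp n => (fun i => (x : E n) i) := by fun_prop
    exact h1.comp h2⟩
  map_add' p q := by ext x; simp
  map_smul' c p := by ext x; simp

def meanC (n : ℕ) : C(Sp n, ℝ) →ₗ[ℝ] ℝ where
  toFun w := ∫ x, w x ∂(sg n)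
  map_add' p q := by
    simp only [ContinuousMap.add_apply]
    exact integral_add (cont_int p.continuous) (cont_int q.continuous)
  map_smul' c p := by
    simp only [ContinuousMap.smul_apply, smul_eq_mul, RingHom.id_apply]
    exact integral_const_mul c _

def Wsub (n m : ℕ) : Submodule ℝ C(Sp n, ℝ) :=
  Submodule.map (evC n) (MvPolynomial.restrictTotalDegree (Fin n) ℝ m) ⊓ LinearMap.ker (meanC n)

instance Wsub_fin (n m : ℕ) : Module.Finite ℝ (Wsub n m) := by
  unfold Wsub
  exact Submodule.finiteDimensional_inf_left _ _

theorem Wsub_iff {n m : ℕ} {w : C(Sp n, ℝ)} : w ∈ Wsub n m ↔ ∃ p ∈ P0 n m, evC n p = w := by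
  unfold Wsub
  rw [Submodule.mem_inf, Submodule.mem_map, LinearMap.mem_ker]
  constructor
  · rintro ⟨⟨p, hp, rfl⟩, h⟩
    refine ⟨p, ⟨(MvPolynomial.mem_restrictTotalDegree _ _ _).1 hp, ?_⟩, rfl⟩
    rw [sph_integral]; exact h
  · rintro ⟨p, ⟨hp, h⟩, rfl⟩
    refine ⟨⟨p, (MvPolynomial.mem_restrictTotalDegree _ _ _).2 hp, rfl⟩, ?_⟩
    rw [sph_integral] at h; exact h

def wd (n m : ℕ) : ℕ := Module.finrank ℝ (Wsub n m)
def wb (n m : ℕ) : Module.Basis (Fin (wd n m)) ℝ (Wsub n m) := Module.finBasis ℝ (Wsub n m)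
def bb (n m : ℕ) (i : Fin (wd n m)) : C(Sp n, ℝ) := (wb n m i : C(Sp n, ℝ))

theorem bb_mem {n m : ℕ} (i : Fin (wd n m)) : ∃ p ∈ P0 n m, evC n p = bb n m i :=
  Wsub_iff.1 (wb n m i).2

theorem bb_mean {n m : ℕ} (i : Fin (wd n m)) : ∫ x, bb n m i x ∂(sg n) = 0 := by
  have := (Submodule.mem_inf.1 (wb n m i).2).2
  exact LinearMap.mem_ker.1 this

theorem bb_span {n m : ℕ} {p : MvPolynomial (Fin n) ℝ} (hp : p ∈ P0 n m) :
    ∃ a : Fin (wd n m) → ℝ, ∀ x : Sp n,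
      MvPolynomial.eval (fun i => (x : E n) i) p = ∑ i, a i * bb n m i x := by
  have hw : evC n p ∈ Wsub n m := Wsub_iff.2 ⟨p, hp, rfl⟩
  refine ⟨fun i => (wb n m).repr ⟨_, hw⟩ i, fun x => ?_⟩
  have h := (wb n m).sum_repr ⟨_, hw⟩
  have h2 := congrArg (fun w : Wsub n m => (w : C(Sp n, ℝ)) x) h
  simp only [Submodule.coe_sum, Submodule.coe_smul, ContinuousMap.sum_apply,
    ContinuousMap.smul_apply, smul_eq_mul] at h2
  exact h2.symm

abbrev Fd (n m : ℕ) := EuclideanSpace ℝ (Fin (wd n m))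

def Ev (n m : ℕ) (x : Sp n) : Fd n m := WithLp.toLp 2 (fun i => bb n m i x)

theorem Ev_cont (n m : ℕ) : Continuous (Ev n m) := by
  unfold Ev
  have : Continuous fun x : Sp n => (fun i => bb n m i x) := by
    apply continuous_pi; intro i; exact (bb n m i).continuous
  exact (PiLp.continuous_toLp 2 _).comp this

theorem inner_Ev {n m : ℕ} (a : Fd n m) (x : Sp n) :
    ⟪a, Ev n m x⟫ = ∑ i, a i * bb n m i x := by
  simp [Ev, PiLp.inner_apply, mul_comm]

theorem inner_Ev_mean {n m : ℕ} (a : Fd n m) : ∫ x, ⟪a, Ev n m x⟫ ∂(sg n) = 0 := by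
  simp only [inner_Ev]
  rw [integral_finsetSum]
  · simp only [integral_const_mul, bb_mean, mul_zero, Finset.sum_const_zero]
  · intro i _
    exact (cont_int (bb n m i).continuous).const_mul _

/-- If `⟪a, Ev x⟫ ≤ 0` everywhere then `a = 0`. -/
theorem inner_Ev_pos {n m : ℕ} {a : Fd n m} (h : ∀ x, ⟪a, Ev n m x⟫ ≤ 0) : a = 0 := by
  have hc : Continuous fun x : Sp n => -⟪a, Ev n m x⟫ :=
    (continuous_const.inner (Ev_cont n m)).neg
  have h0 : ∫ x, -⟪a, Ev n m x⟫ ∂(sg n) = 0 := by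
    rw [integral_neg, inner_Ev_mean, neg_zero]
  have h1 : (fun x : Sp n => -⟪a, Ev n m x⟫) =ᵐ[sg n] 0 :=
    (integral_eq_zero_iff_of_nonneg (fun x => by simpa using h x) (cont_int hc)).1 h0
  have h2 : (fun x : Sp n => -⟪a, Ev n m x⟫) = 0 :=
    (Continuous.ae_eq_iff_eq (sg n) hc continuous_const).1 h1
  have h3 : (∑ i, a i • wb n m i) = 0 := by
    apply Subtype.ext
    ext x
    have := congrFun h2 x
    simp only [inner_Ev, Pi.zero_apply, neg_eq_zero] at this
    simp only [Submodule.coe_sum, Submodule.coe_smul, ContinuousMap.sum_apply,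
      ContinuousMap.smul_apply, smul_eq_mul]
    exact this
  have h4 := (Fintype.linearIndependent_iff.1 (wb n m).linearIndependent) a h3
  ext i; simpa using h4 i

theorem exists_c (n m : ℕ) : ∃ c > 0, ∀ a : Fd n m, ‖a‖ = 1 → ∃ x, c ≤ ⟪a, Ev n m x⟫ := by
  by_contra hcon
  push Not at hcon
  have hk : ∀ k : ℕ, ∃ a : Fd n m, ‖a‖ = 1 ∧ ∀ x, ⟪a, Ev n m x⟫ < 1 / ((k : ℝ) + 1) :=
    fun k => hcon _ Nat.one_div_pos_of_nat
  choose a ha hax using hk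
  obtain ⟨b, hb, φ, hφ, hlim⟩ := (isCompact_sphere (0 : Fd n m) 1).tendsto_subseq
    (x := a) (fun k => by simp [ha k])
  have hb0 : b = 0 := by
    apply inner_Ev_pos (n := n) (m := m)
    intro x
    have l1 : Tendsto (fun k => ⟪a (φ k), Ev n m x⟫) atTop (nhds ⟪b, Ev n m x⟫) :=
      hlim.inner tendsto_const_nhds
    have l2 : Tendsto (fun k => 1 / ((φ k : ℝ) + 1)) atTop (nhds 0) :=
      (tendsto_one_div_add_atTop_nhds_zero_nat (𝕜 := ℝ)).comp hφ.tendsto_atTop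
    exact le_of_tendsto_of_tendsto' l1 l2 (fun k => (hax _ x).le)
  rw [hb0] at hb
  simp at hb

theorem mem_hull_cl (n m : ℕ) [Nonempty (Sp n)] : ∃ c > 0, ∀ v : Fd n m, ‖v‖ ≤ c →
    v ∈ closure (convexHull ℝ (Set.range (Ev n m))) := by
  obtain ⟨c, hc, h⟩ := exists_c n m
  refine ⟨c / 2, by positivity, fun v hv => ?_⟩
  by_contra hv'
  obtain ⟨l, s, hl1, hl2⟩ := geometric_hahn_banach_closed_point (convex_convexHull ℝ _).closure
    isClosed_closure hv'
  obtain ⟨a, rfl⟩ := (InnerProductSpace.toDual ℝ (Fd n m)).surjective l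
  simp only [InnerProductSpace.toDual_apply_apply] at hl1 hl2
  have hx : ∀ x, ⟪a, Ev n m x⟫ < ‖a‖ * (c / 2) := fun x => by
    have h1 := hl1 _ (subset_closure (subset_convexHull ℝ _ ⟨x, rfl⟩))
    have h2 := real_inner_le_norm a v
    have h3 : ‖a‖ * ‖v‖ ≤ ‖a‖ * (c / 2) := by gcongr
    linarith
  rcases eq_or_ne a 0 with rfl | ha
  · obtain ⟨x⟩ := ‹Nonempty (Sp n)›
    have := hx x
    simp at this
  · have hn : 0 < ‖a‖ := norm_pos_iff.2 ha
    obtain ⟨x, hxx⟩ := h (‖a‖⁻¹ • a) (by rw [norm_smul, norm_inv, norm_norm, inv_mul_cancel₀ hn.ne'])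
    rw [inner_smul_left] at hxx
    have := hx x
    simp only [conj_trivial] at hxx
    have h5 : c * ‖a‖ ≤ ⟪a, Ev n m x⟫ := by
      have := mul_le_mul_of_nonneg_right hxx hn.le
      have e : ‖a‖⁻¹ * ⟪a, Ev n m x⟫ * ‖a‖ = ⟪a, Ev n m x⟫ := by field_simp
      linarith
    nlinarith [mul_pos hc hn]

theorem mem_hull (n m : ℕ) [Nonempty (Sp n)] : ∃ c > 0, ∀ v : Fd n m, ‖v‖ ≤ c →
    v ∈ convexHull ℝ (Set.range (Ev n m)) := by
  obtain ⟨c, hc, h⟩ := mem_hull_cl n m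
  set K := convexHull ℝ (Set.range (Ev n m)) with hK
  have hKc : Convex ℝ K := convex_convexHull ℝ _
  have hball : ball (0 : Fd n m) c ⊆ closure K := fun v hv => h v (by simpa using (mem_ball_zero_iff.1 hv).le)
  have haff : affineSpan ℝ K = ⊤ := by
    apply top_unique
    rw [← isOpen_ball.affineSpan_eq_top ⟨(0 : Fd n m), mem_ball_self hc⟩]
    apply affineSpan_le.2
    refine hball.trans (closure_minimal (subset_affineSpan ℝ K) ?_)
    exact AffineSubspace.closed_of_finiteDimensional _
  have hItg := hKc.interior_nonempty_iff_affineSpan_eq_top.2 haff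
  have heq := hKc.interior_closure_eq_interior_of_nonempty_interior hItg
  refine ⟨c / 2, by positivity, fun v hv => ?_⟩
  have h1 : ball (0 : Fd n m) c ⊆ interior (closure K) := interior_maximal hball isOpen_ball
  rw [heq] at h1
  exact interior_subset (h1 (mem_ball_zero_iff.2 (by linarith)))

def ThSet (n m : ℕ) (θ : ℝ) : Set ℝ := {t : ℝ | ∃ (ξ : ℕ → E n) (w : ℕ → ℝ),
    (∀ i, ξ i ∈ Metric.sphere (0 : E n) 1) ∧ (∀ i, 0 ≤ w i) ∧ Summable w ∧
    (∑' i, w i) = 1 ∧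
    (∀ p ∈ P0 n m, (∑' i, w i * MvPolynomial.eval (fun j => ξ i j) p) = 0) ∧
    Summable (fun i => w i ^ θ) ∧ t = ∑' i, w i ^ θ}

theorem Theta_eq (n m : ℕ) (θ : ℝ) : Theta n m θ = sInf (ThSet n m θ) := rfl

theorem ThSet_ge {n m : ℕ} {θ : ℝ} (hθ1 : θ < 1) {t : ℝ} (ht : t ∈ ThSet n m θ) : 1 ≤ t := by
  obtain ⟨ξ, w, _, hw, hs, h1, _, hs2, rfl⟩ := ht
  rw [← h1]
  apply hs.tsum_le_tsum _ hs2
  intro i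
  rcases (hw i).eq_or_lt with h | h
  · rw [← h]; exact Real.rpow_nonneg le_rfl _
  · have hle : w i ≤ 1 := by rw [← h1]; exact hs.le_tsum i (fun j _ => hw j)
    calc w i = w i ^ (1 : ℝ) := (Real.rpow_one _).symm
      _ ≤ w i ^ θ := Real.rpow_le_rpow_of_exponent_ge h hle hθ1.le

theorem ThSet_bdd {n m : ℕ} {θ : ℝ} (hθ1 : θ < 1) : BddBelow (ThSet n m θ) :=
  ⟨1, fun _ ht => ThSet_ge hθ1 ht⟩

theorem tsum_fin_ext {k : ℕ} (F : Fin k → ℝ) :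
    HasSum (fun i : ℕ => if h : i < k then F ⟨i, h⟩ else 0) (∑ j, F j) := by
  have h1 : ∑ j, F j = ∑ i ∈ Finset.range k, (if h : i < k then F ⟨i, h⟩ else 0) := by
    rw [Finset.sum_range]
    apply Finset.sum_congr rfl
    intro j _
    simp
  rw [h1]
  apply hasSum_sum_of_ne_finset_zero
  intro b hb
  rw [Finset.mem_range] at hb
  simp [hb]

theorem ThSet_mem_fin {n m k : ℕ} {θ : ℝ} (hθ0 : 0 < θ) (ξ : Fin k → Sp n) (w : Fin k → ℝ)
    (x0 : Sp n) (hw : ∀ i, 0 ≤ w i) (h1 : ∑ i, w i = 1)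
    (h0 : ∑ i, w i • Ev n m (ξ i) = 0) : (∑ i, w i ^ θ) ∈ ThSet n m θ := by
  have hsw := tsum_fin_ext w
  have hsθ := tsum_fin_ext (fun i => w i ^ θ)
  have e1 : (fun i : ℕ => (if h : i < k then w ⟨i, h⟩ else 0) ^ θ) =
      (fun i : ℕ => if h : i < k then w ⟨i, h⟩ ^ θ else 0) := by
    funext i
    split_ifs with h
    · rfl
    · exact Real.zero_rpow hθ0.ne'
  refine ⟨fun i => if h : i < k then (ξ ⟨i, h⟩ : E n) else x0,
    fun i => if h : i < k then w ⟨i, h⟩ else 0, ?_, ?_, hsw.summable, ?_, ?_, ?_, ?_⟩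
  · intro i
    dsimp only
    split_ifs with h
    · exact (ξ _).2
    · exact x0.2
  · intro i
    dsimp only
    split_ifs with h
    · exact hw _
    · exact le_rfl
  · rw [hsw.tsum_eq, h1]
  · intro p hp
    obtain ⟨a, ha⟩ := bb_span hp
    have hs2 := tsum_fin_ext (fun i => w i * MvPolynomial.eval (fun j => (ξ i : E n) j) p)
    have e2 : (fun i : ℕ => (if h : i < k then w ⟨i, h⟩ else 0) *
        MvPolynomial.eval (fun j => (if h : i < k then (ξ ⟨i, h⟩ : E n) else x0) j) p) =
      (fun i : ℕ => if h : i < k then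
        w ⟨i, h⟩ * MvPolynomial.eval (fun j => (ξ ⟨i, h⟩ : E n) j) p else 0) := by
      funext i
      split_ifs with h
      · rfl
      · simp
    simp only [e2]
    rw [hs2.tsum_eq]
    simp only [ha]
    have h2 : ∀ l, ∑ i, w i * bb n m l (ξ i) = 0 := by
      intro l
      have := congrArg (fun v : Fd n m => v l) h0
      simpa [Ev] using this
    simp only [Finset.mul_sum]
    rw [Finset.sum_comm]
    apply Finset.sum_eq_zero
    intro l _
    calc ∑ i, w i * (a l * bb n m l (ξ i)) = a l * ∑ i, w i * bb n m l (ξ i) := by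
          rw [Finset.mul_sum]; apply Finset.sum_congr rfl; intros; ring
      _ = 0 := by rw [h2, mul_zero]
  · rw [e1]; exact hsθ.summable
  · rw [e1]; exact hsθ.tsum_eq.symm

theorem ThSet_mem {n m : ℕ} {ι : Type*} [Fintype ι] {θ : ℝ} (hθ0 : 0 < θ) (ξ : ι → Sp n) (w : ι → ℝ)
    (x0 : Sp n) (hw : ∀ i, 0 ≤ w i) (h1 : ∑ i, w i = 1)
    (h0 : ∑ i, w i • Ev n m (ξ i) = 0) : (∑ i, w i ^ θ) ∈ ThSet n m θ := by
  set e := Fintype.equivFin ι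
  have := ThSet_mem_fin (m := m) hθ0 (fun i => ξ (e.symm i)) (fun i => w (e.symm i)) x0
    (fun i => hw _) (by rw [← h1]; exact e.symm.sum_comp w)
    (by rw [← h0]; exact e.symm.sum_comp (fun i => w i • Ev n m (ξ i)))
  rwa [e.symm.sum_comp (fun i => w i ^ θ)] at this

theorem atoms (n m : ℕ) [Nonempty (Sp n)] : ∃ c > 0, ∀ (v : Fd n m) (t : ℝ), 0 < t → ‖v‖ ≤ t →
    ∃ (k : ℕ) (z : Fin k → Sp n) (τ : Fin k → ℝ), k ≤ wd n m + 1 ∧ (∀ i, 0 ≤ τ i) ∧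
      ∑ i, τ i = t / c ∧ ∑ i, τ i • Ev n m (z i) = v := by
  obtain ⟨c, hc, h⟩ := mem_hull n m
  refine ⟨c, hc, fun v t ht hv => ?_⟩
  have hm : (c / t) • v ∈ convexHull ℝ (Set.range (Ev n m)) := by
    apply h
    rw [norm_smul, Real.norm_of_nonneg (by positivity), div_mul_eq_mul_div, div_le_iff₀ ht]
    gcongr
  obtain ⟨ι, _, z, w, hz, hai, hw, hw1, hwv⟩ := eq_pos_convex_span_of_mem_convexHull hm
  have hcard : Fintype.card ι ≤ wd n m + 1 := by
    have h1 := hai.card_le_finrank_succ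
    have h2 := Submodule.finrank_le (vectorSpan ℝ (Set.range z))
    have h3 : Module.finrank ℝ (Fd n m) = wd n m := by simp
    omega
  have hz' : ∀ i, ∃ x, Ev n m x = z i := fun i => hz ⟨i, rfl⟩
  choose y hy using hz'
  set e := Fintype.equivFin ι
  refine ⟨Fintype.card ι, fun i => y (e.symm i), fun i => t / c * w (e.symm i), hcard,
    fun i => by have := (hw (e.symm i)).le; positivity, ?_, ?_⟩
  · rw [← Finset.mul_sum, e.symm.sum_comp w, hw1, mul_one]
  · simp only [hy, mul_smul]
    rw [← Finset.smul_sum, e.symm.sum_comp (fun i => w i • z i), hwv, smul_smul]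
    have : t / c * (c / t) = 1 := by field_simp
    rw [this, one_smul]

theorem Theta_ge {n m : ℕ} [Nonempty (Sp n)] {θ : ℝ} (hθ0 : 0 < θ) (hθ1 : θ < 1) :
    1 ≤ Theta n m θ := by
  rw [Theta_eq]
  obtain ⟨x0⟩ := ‹Nonempty (Sp n)›
  obtain ⟨c, hc, h⟩ := atoms n m
  obtain ⟨k, z, τ, _, h2, h3, h4⟩ := h 0 c hc (by simpa using hc.le)
  have := ThSet_mem (m := m) hθ0 z τ x0 h2 (by rw [h3, div_self hc.ne']) h4
  exact le_csInf ⟨_, this⟩ (fun t ht => ThSet_ge hθ1 ht)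

theorem Theta_le {n m : ℕ} [Nonempty (Sp n)] {θ : ℝ} (hθ0 : 0 < θ) (hθ1 : θ < 1) :
    ∃ c > 0, ∀ (ι : Type) [Fintype ι] (ξ : ι → Sp n) (w : ι → ℝ) (t : ℝ), 0 < t →
      (∀ i, 0 ≤ w i) → (∀ l, |∑ i, w i * bb n m l (ξ i)| ≤ t) → 0 < ∑ i, w i →
      Theta n m θ * (∑ i, w i) ^ θ ≤ ∑ i, w i ^ θ + c * t ^ θ := by
  obtain ⟨x0⟩ := ‹Nonempty (Sp n)›
  obtain ⟨c, hc, h⟩ := atoms n m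
  set D : ℝ := (wd n m : ℝ) + 1 with hD
  have hDpos : 0 < D := by positivity
  refine ⟨D * (D / c) ^ θ, by positivity, ?_⟩
  intro ι _ ξ w t ht hw hl hpos
  set v : Fd n m := ∑ i, w i • Ev n m (ξ i) with hv
  have hvl : ∀ l, v l = ∑ i, w i * bb n m l (ξ i) := by
    intro l; simp [hv, Ev]
  have hvn : ‖-v‖ ≤ D * t := by
    rw [norm_neg]
    have h1 : ‖v‖ ≤ ∑ l, |v l| := by
      have : v = ∑ l, v l • EuclideanSpace.single l (1 : ℝ) := by
        ext j; simp [Pi.single_apply]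
      calc ‖v‖ = ‖∑ l, v l • EuclideanSpace.single l (1 : ℝ)‖ := by rw [← this]
        _ ≤ ∑ l, ‖v l • EuclideanSpace.single l (1 : ℝ)‖ := norm_sum_le _ _
        _ = ∑ l, |v l| := by simp [norm_smul]
    have h2 : ∑ l, |v l| ≤ ∑ l : Fin (wd n m), t := Finset.sum_le_sum (fun l _ => by rw [hvl]; exact hl l)
    simp at h2
    nlinarith
  obtain ⟨k, z, τ, hk, hτ, hτs, hτv⟩ := h (-v) (D * t) (by positivity) hvn
  set S := ∑ i, w i + D * t / c with hS
  have hSpos : 0 < S := by positivity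
  have key := ThSet_mem (m := m) (ι := ι ⊕ Fin k) hθ0 (Sum.elim ξ z)
    (fun i => S⁻¹ * Sum.elim w τ i) x0
    (by
      rintro (i | i)
      · have := hw i; simp only [Sum.elim_inl]; positivity
      · have := hτ i; simp only [Sum.elim_inr]; positivity)
    (by
      rw [← Finset.mul_sum, Fintype.sum_sum_type]
      simp only [Sum.elim_inl, Sum.elim_inr]
      rw [hτs, ← hS, inv_mul_cancel₀ hSpos.ne'])
    (by
      simp only [mul_smul]
      rw [← Finset.smul_sum, Fintype.sum_sum_type]
      simp only [Sum.elim_inl, Sum.elim_inr]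
      rw [hτv, ← hv, add_neg_cancel, smul_zero])
  have h1 : Theta n m θ ≤ _ := csInf_le (ThSet_bdd hθ1) key
  rw [Fintype.sum_sum_type] at h1
  simp only [Sum.elim_inl, Sum.elim_inr] at h1
  have e1 : ∀ a : ℝ, 0 ≤ a → (S⁻¹ * a) ^ θ = (S ^ θ)⁻¹ * a ^ θ := fun a ha => by
    rw [Real.mul_rpow (by positivity) ha, Real.inv_rpow hSpos.le]
  simp only [e1 _ (hw _), e1 _ (hτ _)] at h1
  rw [← Finset.mul_sum, ← Finset.mul_sum, ← mul_add] at h1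
  have hSθ : 0 < S ^ θ := by positivity
  have h2 : Theta n m θ * S ^ θ ≤ ∑ i, w i ^ θ + ∑ i, τ i ^ θ := by
    rw [inv_mul_eq_div, le_div_iff₀ hSθ] at h1
    exact h1
  have h3 : (∑ i, w i) ^ θ ≤ S ^ θ :=
    Real.rpow_le_rpow hpos.le (by rw [hS]; have : 0 < D * t / c := by positivity
                                  linarith) hθ0.le
  have h4 : ∑ i, τ i ^ θ ≤ D * (D / c) ^ θ * t ^ θ := by
    have h5 : ∀ i, τ i ^ θ ≤ (D / c * t) ^ θ := fun i => by
      apply Real.rpow_le_rpow (hτ i) _ hθ0.le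
      have := Finset.single_le_sum (fun j _ => hτ j) (Finset.mem_univ i)
      rw [hτs] at this
      calc τ i ≤ _ := this
        _ = _ := by ring
    have h6 : ∑ i, τ i ^ θ ≤ k * (D / c * t) ^ θ := by
      have := Finset.sum_le_sum (fun i (_ : i ∈ Finset.univ) => h5 i)
      simpa using this
    have hkD : (k : ℝ) ≤ D := by rw [hD]; exact_mod_cast hk
    calc _ ≤ _ := h6
      _ ≤ D * (D / c * t) ^ θ := by gcongr
      _ = _ := by rw [Real.mul_rpow (by positivity) ht.le]; ring
  have h0 : 0 ≤ Theta n m θ := by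
    haveI : Nonempty (Sp n) := ⟨x0⟩
    linarith [Theta_ge (n := n) (m := m) hθ0 hθ1]
  calc Theta n m θ * (∑ i, w i) ^ θ ≤ Theta n m θ * S ^ θ := by gcongr
    _ ≤ _ := h2
    _ ≤ _ := by linarith

def lab {n : ℕ} (N : ℕ) (x : Sp n) (i : Fin n) : ℤ := ⌊(N : ℝ) * (x : E n) i⌋

theorem lab_meas {n : ℕ} (N : ℕ) (i : Fin n) : Measurable (fun x : Sp n => lab N x i) := by
  unfold lab
  apply Int.measurable_floor.comp
  have : Continuous fun x : Sp n => (N : ℝ) * (x : E n) i := by fun_prop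
  exact this.measurable

theorem pigeon {n : ℕ} {F : Sp n → ℝ} (hF : Integrable F (sg n)) (h1 : ∫ x, F x ∂(sg n) = 1)
    (M N : ℕ) (hM : 0 < M) (i : Fin n) :
    ∃ o : ℕ, o < M ∧ ∫ x, (if lab N x i % (M : ℤ) = (o : ℤ) then F x else 0) ∂(sg n) ≤ 1 / M := by
  have hms : ∀ o : ℕ, MeasurableSet {x : Sp n | lab N x i % (M : ℤ) = (o : ℤ)} := fun o => by
    have : Measurable fun x : Sp n => lab N x i % (M : ℤ) :=
      (Measurable.of_discrete (f := fun a : ℤ => a % (M : ℤ))).comp (lab_meas N i)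
    exact this (measurableSet_singleton _)
  have hItg : ∀ o : ℕ, Integrable (fun x => if lab N x i % (M : ℤ) = (o : ℤ) then F x else 0) (sg n) := by
    intro o
    have := hF.indicator (hms o)
    refine this.congr (Eventually.of_forall fun x => ?_)
    simp only [Set.indicator_apply, Set.mem_ofPred_eq]
  have hsum : ∑ o ∈ Finset.range M,
      ∫ x, (if lab N x i % (M : ℤ) = (o : ℤ) then F x else 0) ∂(sg n) ≤
      ∑ o ∈ Finset.range M, (1 : ℝ) / M := by
    rw [← integral_finsetSum _ (fun o _ => hItg o)]
    have e : ∀ x : Sp n, ∑ o ∈ Finset.range M,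
        (if lab N x i % (M : ℤ) = (o : ℤ) then F x else 0) = F x := by
      intro x
      have hM' : (M : ℤ) ≠ 0 := by exact_mod_cast hM.ne'
      have hp : 0 < (M : ℤ) := by exact_mod_cast hM
      have h0 := Int.emod_nonneg (lab N x i) hM'
      have h2 := Int.emod_lt_of_pos (lab N x i) hp
      obtain ⟨k, hk⟩ := Int.eq_ofNat_of_zero_le h0
      rw [hk] at h2 ⊢
      have : k < M := by exact_mod_cast h2
      simp [Nat.cast_inj, this]
    simp only [e, h1]
    simp
    rw [mul_inv_cancel₀]
    exact_mod_cast hM.ne'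
  obtain ⟨o, ho, h⟩ := Finset.exists_le_of_sum_le (Finset.nonempty_range_iff.2 hM.ne') hsum
  exact ⟨o, Finset.mem_range.1 ho, h⟩

theorem coord_le {n : ℕ} (v : E n) (i : Fin n) : |v i| ≤ ‖v‖ := by
  have := PiLp.norm_apply_le v i
  simpa using this

theorem sep_int {M a b o : ℤ} (hM : 0 < M) (hb : b % M ≠ o) (h0 : 0 ≤ o) (h1 : o < M)
    (h : (a - o) / M < (b - o) / M) : a + 2 ≤ b := by
  set q := (b - o) / M with hq
  have h2 : a - o < q * M := by
    by_contra hc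
    push Not at hc
    have := (Int.le_ediv_iff_mul_le hM).2 hc
    omega
  have h3 : q * M ≤ b - o := Int.ediv_mul_le _ hM.ne'
  have h4 : q * M ≠ b - o := by
    intro he
    apply hb
    have : b = o + M * q := by rw [mul_comm]; omega
    rw [this, Int.add_mul_emod_self_left, Int.emod_eq_of_lt h0 h1]
  omega

theorem cells {n : ℕ} {F : Sp n → ℝ} (hF : Integrable F (sg n)) (hF0 : ∀ x, 0 ≤ F x)
    (h1 : ∫ x, F x ∂(sg n) = 1) (M K : ℕ) (hM : 0 < M) (hK : 0 < K) :
    ∃ (c : Sp n → (Fin n → ℤ)) (G : Set (Sp n)), Measurable c ∧ MeasurableSet G ∧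
      (∀ x, c x ∈ Fintype.piFinset (fun _ : Fin n => Finset.Icc (-(K : ℤ) - 1) K)) ∧
      (∫ x in Gᶜ, F x ∂(sg n) ≤ n / M) ∧
      (∀ x y, x ∈ G → y ∈ G → c x ≠ c y → (1 / ((M : ℝ) * K)) ^ 2 ≤ zz x y) ∧
      (∀ x y, c x = c y → ∀ i, |(x : E n) i - (y : E n) i| ≤ 1 / K) := by
  set N := M * K with hN
  choose o ho hoi using fun i => pigeon hF h1 M N hM i
  have hMz : 0 < (M : ℤ) := by exact_mod_cast hM
  have hMr : 0 < (M : ℝ) := by exact_mod_cast hM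
  have hKr : 0 < (K : ℝ) := by exact_mod_cast hK
  have hNr : 0 < (N : ℝ) := by rw [hN]; push_cast; positivity
  have hNe : (N : ℝ) = M * K := by rw [hN]; push_cast; ring
  have hms : ∀ i, MeasurableSet {x : Sp n | lab N x i % (M : ℤ) = (o i : ℤ)} := fun i => by
    have : Measurable fun x : Sp n => lab N x i % (M : ℤ) :=
      (Measurable.of_discrete (f := fun a : ℤ => a % (M : ℤ))).comp (lab_meas N i)
    exact this (measurableSet_singleton _)
  set B := fun i : Fin n => {x : Sp n | lab N x i % (M : ℤ) = (o i : ℤ)} with hB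
  have hlab : ∀ (x : Sp n) i, (lab N x i : ℝ) ≤ N * (x : E n) i ∧ N * (x : E n) i < lab N x i + 1 :=
    fun x i => ⟨Int.floor_le _, Int.lt_floor_add_one _⟩
  refine ⟨fun x i => (lab N x i - o i) / M, (⋃ i, B i)ᶜ, ?_, ?_, ?_, ?_, ?_, ?_⟩
  · apply measurable_pi_lambda
    intro i
    exact (Measurable.of_discrete (f := fun a : ℤ => (a - o i) / (M : ℤ))).comp (lab_meas N i)
  · exact (MeasurableSet.iUnion hms).compl
  · intro x
    rw [Fintype.mem_piFinset]
    intro i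
    have hx : |(x : E n) i| ≤ 1 := by
      have := coord_le (x : E n) i
      rwa [x.norm_eq] at this
    rw [abs_le] at hx
    have ha1 : -((M : ℤ) * K) ≤ lab N x i := by
      unfold lab
      rw [Int.le_floor]
      push_cast
      rw [hNe]
      nlinarith [mul_pos hMr hKr]
    have ha2 : lab N x i ≤ (M : ℤ) * K := by
      have h := (hlab x i).1
      have : (lab N x i : ℝ) ≤ ((M * K : ℤ) : ℝ) := by
        push_cast
        rw [hNe] at h
        nlinarith [mul_pos hMr hKr]
      exact_mod_cast this
    have ho1 : (o i : ℤ) < M := by exact_mod_cast ho i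
    have ho2 : 0 ≤ (o i : ℤ) := Int.natCast_nonneg _
    rw [Finset.mem_Icc]
    constructor
    · rw [Int.le_ediv_iff_mul_le hMz]
      nlinarith
    · have : (lab N x i - o i) / (M : ℤ) < (K : ℤ) + 1 := by
        rw [Int.ediv_lt_iff_lt_mul hMz]
        nlinarith
      exact Int.lt_add_one_iff.1 this
  · rw [compl_compl, ← integral_indicator (MeasurableSet.iUnion hms)]
    calc ∫ x, (⋃ i, B i).indicator F x ∂(sg n)
        ≤ ∫ x, ∑ i, (B i).indicator F x ∂(sg n) := by
          apply integral_mono (hF.indicator (MeasurableSet.iUnion hms))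
            (integrable_finsetSum _ (fun i _ => hF.indicator (hms i)))
          intro x
          dsimp only
          have hnn : ∀ i, 0 ≤ (B i).indicator F x := fun i => Set.indicator_nonneg (fun y _ => hF0 y) x
          by_cases hx : x ∈ ⋃ i, B i
          · rw [Set.indicator_of_mem hx]
            obtain ⟨i, hi⟩ := Set.mem_iUnion.1 hx
            calc F x = (B i).indicator F x := (Set.indicator_of_mem hi F).symm
              _ ≤ _ := Finset.single_le_sum (fun j _ => hnn j) (Finset.mem_univ i)
          · rw [Set.indicator_of_notMem hx]
            exact Finset.sum_nonneg (fun i _ => hnn i)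
      _ = ∑ i, ∫ x, (B i).indicator F x ∂(sg n) :=
          integral_finsetSum _ (fun i _ => hF.indicator (hms i))
      _ ≤ ∑ i : Fin n, (1 : ℝ) / M := by
          apply Finset.sum_le_sum
          intro i _
          refine le_trans (le_of_eq ?_) (hoi i)
          congr 1
          funext x
          simp only [Set.indicator_apply, hB, Set.mem_ofPred_eq]
      _ = n / M := by simp [div_eq_mul_inv]
  · intro x y hx hy hne
    obtain ⟨i, hi⟩ := Function.ne_iff.1 hne
    have hx' : lab N x i % (M : ℤ) ≠ (o i : ℤ) := fun h => hx (Set.mem_iUnion.2 ⟨i, h⟩)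
    have hy' : lab N y i % (M : ℤ) ≠ (o i : ℤ) := fun h => hy (Set.mem_iUnion.2 ⟨i, h⟩)
    have ho1 : (o i : ℤ) < M := by exact_mod_cast ho i
    have ho2 : 0 ≤ (o i : ℤ) := Int.natCast_nonneg _
    have key : 1 ≤ |(N : ℝ) * ((x : E n) i - (y : E n) i)| := by
      have hxl := hlab x i
      have hyl := hlab y i
      rcases lt_or_gt_of_ne hi with h | h
      · have := sep_int hMz hy' ho2 ho1 h
        have : (lab N x i : ℝ) + 2 ≤ lab N y i := by exact_mod_cast this
        rw [le_abs]; right; linarith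
      · have := sep_int hMz hx' ho2 ho1 h
        have : (lab N y i : ℝ) + 2 ≤ lab N x i := by exact_mod_cast this
        rw [le_abs]; left; linarith
    rw [abs_mul, abs_of_pos hNr] at key
    have h2 : 1 / ((M : ℝ) * K) ≤ |(x : E n) i - (y : E n) i| := by
      rw [← hNe, div_le_iff₀ hNr]; linarith
    have h3 := coord_le ((x : E n) - (y : E n)) i
    rw [PiLp.sub_apply] at h3
    unfold zz
    have h4 : 0 ≤ 1 / ((M : ℝ) * K) := by positivity
    exact pow_le_pow_left₀ h4 (h2.trans h3) 2
  · intro x y hxy i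
    have hi := congrFun hxy i
    dsimp only at hi
    have h1 := Int.emod_nonneg (lab N x i - o i) hMz.ne'
    have h2 := Int.emod_lt_of_pos (lab N x i - o i) hMz
    have h3 := Int.emod_nonneg (lab N y i - o i) hMz.ne'
    have h4 := Int.emod_lt_of_pos (lab N y i - o i) hMz
    have h5 := Int.emod_add_mul_ediv (lab N x i - o i) M
    have h6 := Int.emod_add_mul_ediv (lab N y i - o i) M
    rw [hi] at h5
    have h7 : lab N x i - lab N y i ≤ (M : ℤ) - 1 := by linarith
    have h8 : lab N y i - lab N x i ≤ (M : ℤ) - 1 := by linarith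
    have h7' : (lab N x i : ℝ) - lab N y i ≤ M - 1 := by exact_mod_cast h7
    have h8' : (lab N y i : ℝ) - lab N x i ≤ M - 1 := by exact_mod_cast h8
    have hxl := hlab x i
    have hyl := hlab y i
    have h9 : |(N : ℝ) * ((x : E n) i - (y : E n) i)| ≤ M := by
      rw [abs_le]; constructor <;> linarith
    rw [abs_mul, abs_of_pos hNr, hNe] at h9
    rw [le_div_iff₀ hKr]
    have h10 : (M : ℝ) * (|(x : E n) i - (y : E n) i| * K) ≤ M * 1 := by linarith
    exact le_of_mul_le_mul_left h10 hMr

def Qc {n : ℕ} {ι : Type} (c : Sp n → ι) (G : Set (Sp n)) (j : ι) : Set (Sp n) := G ∩ c ⁻¹' {j}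

theorem Qc_meas {n : ℕ} {ι : Type} [MeasurableSpace ι] [MeasurableSingletonClass ι] {c : Sp n → ι}
    {G : Set (Sp n)} (hc : Measurable c) (hG : MeasurableSet G) (j : ι) : MeasurableSet (Qc c G j) :=
  hG.inter (hc (measurableSet_singleton j))

theorem cut_sum {n : ℕ} {ι : Type} (c : Sp n → ι) (G : Set (Sp n)) (J : Finset ι)
    (hJ : ∀ x, c x ∈ J) (a : ι → ℝ) (Φ : Sp n → ℝ) (x : Sp n) :
    G.indicator (fun x => a (c x) * Φ x) x = ∑ j ∈ J, a j * (Qc c G j).indicator Φ x := by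
  classical
  by_cases hx : x ∈ G
  · rw [Set.indicator_of_mem hx, Finset.sum_eq_single (c x)]
    · rw [Set.indicator_of_mem]
      exact ⟨hx, rfl⟩
    · intro j _ hj
      rw [Set.indicator_of_notMem, mul_zero]
      rintro ⟨_, h⟩
      exact hj h.symm
    · intro h; exact absurd (hJ x) h
  · rw [Set.indicator_of_notMem hx]
    symm
    apply Finset.sum_eq_zero
    intro j _
    rw [Set.indicator_of_notMem, mul_zero]
    exact fun h => hx h.1

theorem cut_int {n : ℕ} {ι : Type} [MeasurableSpace ι] [MeasurableSingletonClass ι] {c : Sp n → ι}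
    {G : Set (Sp n)} (hc : Measurable c) (hG : MeasurableSet G) (J : Finset ι)
    (hJ : ∀ x, c x ∈ J) (a : ι → ℝ) {Φ : Sp n → ℝ} (hΦ : Integrable Φ (sg n)) :
    Integrable (G.indicator (fun x => a (c x) * Φ x)) (sg n) ∧
    ∫ x, G.indicator (fun x => a (c x) * Φ x) x ∂(sg n) =
      ∑ j ∈ J, a j * ∫ x, (Qc c G j).indicator Φ x ∂(sg n) := by
  have hi : ∀ j, Integrable (fun x => a j * (Qc c G j).indicator Φ x) (sg n) := fun j =>
    (hΦ.indicator (Qc_meas hc hG j)).const_mul _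
  have e : G.indicator (fun x => a (c x) * Φ x) =
      fun x => ∑ j ∈ J, a j * (Qc c G j).indicator Φ x := by
    funext x; exact cut_sum c G J hJ a Φ x
  rw [e]
  refine ⟨integrable_finsetSum _ (fun j _ => hi j), ?_⟩
  rw [integral_finsetSum _ (fun j _ => hi j)]
  simp only [integral_const_mul]

theorem BM.indicator {n : ℕ} {g : Sp n → ℝ} (hg : BM g) {s : Set (Sp n)} (hs : MeasurableSet s) :
    BM (s.indicator g) := by
  obtain ⟨M, hM⟩ := hg.b
  refine ⟨hg.m.indicator hs, ⟨M, fun x => ?_⟩, fun x => Set.indicator_nonneg (fun y _ => hg.p y) x⟩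
  by_cases hx : x ∈ s
  · rw [Set.indicator_of_mem hx]; exact hM x
  · rw [Set.indicator_of_notMem hx, abs_zero]; exact (abs_nonneg _).trans (hM x)

theorem BM.const_mul {n : ℕ} {g : Sp n → ℝ} (hg : BM g) {a : ℝ} (ha : 0 ≤ a) :
    BM (fun x => a * g x) := by
  obtain ⟨M, hM⟩ := hg.b
  refine ⟨hg.m.const_mul a, ⟨a * M, fun x => ?_⟩, fun x => mul_nonneg ha (hg.p x)⟩
  rw [abs_mul, abs_of_nonneg ha]
  exact mul_le_mul_of_nonneg_left (hM x) ha

theorem cut_bm {n : ℕ} {ι : Type} [MeasurableSpace ι] [MeasurableSingletonClass ι] {c : Sp n → ι}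
    {G : Set (Sp n)} (hc : Measurable c) (hG : MeasurableSet G) (J : Finset ι)
    (hJ : ∀ x, c x ∈ J) {a : ι → ℝ} (ha : ∀ j, 0 ≤ a j) {B : ℝ} (haB : ∀ j, a j ≤ B)
    {Φ : Sp n → ℝ} (hΦ : BM Φ) : BM (G.indicator (fun x => a (c x) * Φ x)) := by
  obtain ⟨M, hM⟩ := hΦ.b
  refine ⟨?_, ⟨B * M, fun x => ?_⟩, fun x => Set.indicator_nonneg
    (fun y _ => mul_nonneg (ha _) (hΦ.p y)) x⟩
  · have e : G.indicator (fun x => a (c x) * Φ x) =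
        fun x => ∑ j ∈ J, a j * (Qc c G j).indicator Φ x := by
      funext x; exact cut_sum c G J hJ a Φ x
    rw [e]
    exact Finset.measurable_fun_sum _ (fun j _ => (hΦ.m.indicator (Qc_meas hc hG j)).const_mul _)
  · have hM0 : 0 ≤ M := (abs_nonneg _).trans (hM x)
    have hB0 : 0 ≤ B := (ha (c x)).trans (haB _)
    by_cases hx : x ∈ G
    · rw [Set.indicator_of_mem hx, abs_mul, abs_of_nonneg (ha _)]
      exact mul_le_mul (haB _) (hM x) (abs_nonneg _) hB0
    · rw [Set.indicator_of_notMem hx, abs_zero]; positivity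

theorem Iq_cells {n : ℕ} (hn : 5 ≤ n) {ι : Type} [MeasurableSpace ι] [MeasurableSingletonClass ι]
    {c : Sp n → ι} {G : Set (Sp n)} (hc : Measurable c) (hG : MeasurableSet G) (J : Finset ι)
    (hJ : ∀ x, c x ∈ J) {a : ι → ℝ} (ha : ∀ j, 0 ≤ a j) {B : ℝ} (haB : ∀ j, a j ≤ B)
    {Φ : Sp n → ℝ} (hΦ : BM Φ) {s : ℝ} (hs : 0 < s)
    (hsep : ∀ x y, x ∈ G → y ∈ G → c x ≠ c y → s ≤ zz x y) :
    Iq (G.indicator (fun x => a (c x) * Φ x)) ≤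
      ∑ j ∈ J, Iq (fun x => a j * (Qc c G j).indicator Φ x) +
      s ^ (1 - hh n) * (∫ x, G.indicator (fun x => a (c x) * Φ x) x ∂(sg n)) ^ 2 := by
  set g := G.indicator (fun x => a (c x) * Φ x) with hg
  have hgb : BM g := cut_bm hc hG J hJ ha haB hΦ
  have hjb : ∀ j, BM (fun x => a j * (Qc c G j).indicator Φ x) := fun j =>
    (hΦ.indicator (Qc_meas hc hG j)).const_mul (ha j)
  obtain ⟨Mg, hMg⟩ := hgb.b
  have hItg := Iq_int hn hgb.m hMg
  have hintj : ∀ j, Integrable (fun p : Sp n × Sp n => (a j * (Qc c G j).indicator Φ p.1) *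
      (a j * (Qc c G j).indicator Φ p.2) * zz p.1 p.2 ^ (1 - hh n)) (ss n) := fun j => by
    obtain ⟨Mj, hMj⟩ := (hjb j).b
    exact Iq_int hn (hjb j).m hMj
  have hgg : Integrable (fun p : Sp n × Sp n => g p.1 * g p.2) (ss n) := hgb.int.mul_prod hgb.int
  have hsq : (∫ x, g x ∂(sg n)) ^ 2 = ∫ p, g p.1 * g p.2 ∂(ss n) := by
    rw [integral_prod_mul, sq]
  rw [hsq]
  unfold Iq
  rw [← integral_finsetSum _ (fun j _ => hintj j), ← integral_const_mul,
    ← integral_add (integrable_finsetSum _ (fun j _ => hintj j)) (hgg.const_mul _)]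
  apply integral_mono hItg ((integrable_finsetSum _ (fun j _ => hintj j)).add (hgg.const_mul _))
  rintro ⟨x, y⟩
  simp only [Pi.add_apply]
  have hznn : 0 ≤ zz x y ^ (1 - hh n) := Real.rpow_nonneg (zz_nonneg x y) _
  have hsn : 0 ≤ s ^ (1 - hh n) := Real.rpow_nonneg hs.le _
  have hterm : ∀ j ∈ J, 0 ≤ a j * (Qc c G j).indicator Φ x * (a j * (Qc c G j).indicator Φ y) *
      zz x y ^ (1 - hh n) := fun j _ =>
    mul_nonneg (mul_nonneg ((hjb j).p x) ((hjb j).p y)) hznn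
  have hsum0 := Finset.sum_nonneg hterm
  have hgnn : 0 ≤ g x * g y := mul_nonneg (hgb.p x) (hgb.p y)
  by_cases hx : x ∈ G
  · by_cases hy : y ∈ G
    · by_cases hxy : c x = c y
      · have h1 := Finset.single_le_sum hterm (hJ x)
        have e1 : (Qc c G (c x)).indicator Φ x = Φ x := Set.indicator_of_mem (show x ∈ Qc c G (c x) from ⟨hx, rfl⟩) _
        have e2 : (Qc c G (c x)).indicator Φ y = Φ y := Set.indicator_of_mem (show y ∈ Qc c G (c x) from ⟨hy, hxy.symm⟩) _
        rw [e1, e2] at h1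
        have e3 : g x = a (c x) * Φ x := Set.indicator_of_mem hx _
        have e4 : g y = a (c x) * Φ y := by rw [hxy]; exact Set.indicator_of_mem hy _
        rw [← e3, ← e4] at h1
        have := mul_nonneg hsn hgnn
        linarith
      · have hz := hsep x y hx hy hxy
        have hle : zz x y ^ (1 - hh n) ≤ s ^ (1 - hh n) :=
          Real.rpow_le_rpow_of_nonpos hs hz (by linarith [hh_ge hn])
        have := mul_le_mul_of_nonneg_left hle hgnn
        linarith
    · have e : g y = 0 := Set.indicator_of_notMem hy _
      rw [e]; simp only [mul_zero, zero_mul]; linarith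
  · have e : g x = 0 := Set.indicator_of_notMem hx _
    rw [e]; simp only [mul_zero, zero_mul]; linarith

def qq (n : ℕ) : ℝ := (2 * hh n + 1) / (hh n - 1)
def th (n : ℕ) : ℝ := 2 * (hh n - 1) / (2 * hh n + 1)
def pcr (n : ℕ) : ℝ := (2 * hh n + 1) / (hh n + 2)
def alp (n : ℕ) : ℝ := 2 / (hh n + 1) * AS n ^ (2 - 2 / pcr n)

theorem qq_gt {n : ℕ} (hn : 5 ≤ n) : 2 < qq n := by
  have := hh_ge hn
  unfold qq; rw [lt_div_iff₀ (by linarith)]; linarith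

theorem th_pos {n : ℕ} (hn : 5 ≤ n) : 0 < th n := by
  have := hh_ge hn
  unfold th; apply div_pos <;> linarith

theorem th_lt {n : ℕ} (hn : 5 ≤ n) : th n < 1 := by
  have := hh_ge hn
  unfold th; rw [div_lt_one (by linarith)]; linarith

theorem pcr_pos {n : ℕ} (hn : 5 ≤ n) : 0 < pcr n := by
  have := hh_ge hn
  unfold pcr; apply div_pos <;> linarith

theorem qq_pcr {n : ℕ} (hn : 5 ≤ n) : (qq n - 1) * pcr n = qq n := by
  have := hh_ge hn
  have h1 : hh n - 1 ≠ 0 := by linarith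
  have h2 : hh n + 2 ≠ 0 := by linarith
  unfold qq pcr; field_simp; ring

theorem two_pcr {n : ℕ} (hn : 5 ≤ n) : 2 / pcr n = 2 - th n := by
  have := hh_ge hn
  have h1 : 2 * hh n + 1 ≠ 0 := by linarith
  have h2 : hh n + 2 ≠ 0 := by linarith
  unfold th pcr; field_simp; ring

theorem alp_pos {n : ℕ} (hn : 5 ≤ n) : 0 < alp n := by
  have := hh_ge hn
  have := AS_pos hn
  unfold alp; positivity

theorem cell_HLS {n : ℕ} (hn : 5 ≤ n) {F : Sp n → ℝ} (hF : BM F) {Q : Set (Sp n)}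
    (hQ : MeasurableSet Q) {a : ℝ} (ha : 0 ≤ a) :
    Iq (fun x => a * Q.indicator (fun x => F x ^ (qq n - 1)) x) ≤
      alp n * (a ^ 2 * (∫ x, Q.indicator (fun x => F x ^ qq n) x ∂(sg n)) ^ (2 - th n)) := by
  have hq := qq_gt hn
  have hpc := pcr_pos hn
  have hb : BM (fun x => a * Q.indicator (fun x => F x ^ (qq n - 1)) x) :=
    ((rpow_bdd hF (by linarith)).indicator hQ).const_mul ha
  have h := HLS hn hb
  change _ ≤ alp n * (∫ x, (a * Q.indicator (fun x => F x ^ (qq n - 1)) x) ^ pcr n ∂(sg n)) ^ (2 / pcr n) at h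
  have e : ∀ x, (a * Q.indicator (fun x => F x ^ (qq n - 1)) x) ^ pcr n =
      a ^ pcr n * Q.indicator (fun x => F x ^ qq n) x := by
    intro x
    by_cases hx : x ∈ Q
    · rw [Set.indicator_of_mem hx, Set.indicator_of_mem hx,
        Real.mul_rpow ha (Real.rpow_nonneg (hF.p x) _), ← Real.rpow_mul (hF.p x), qq_pcr hn]
    · rw [Set.indicator_of_notMem hx, Set.indicator_of_notMem hx, mul_zero, mul_zero,
        Real.zero_rpow hpc.ne']
  simp only [e] at h
  rw [integral_const_mul, Real.mul_rpow (Real.rpow_nonneg ha _), ← Real.rpow_mul ha,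
    mul_div_cancel₀ _ hpc.ne', two_pcr hn, Real.rpow_two] at h
  · exact h
  · exact integral_nonneg (fun x => Set.indicator_nonneg (fun y _ => Real.rpow_nonneg (hF.p y) _) x)

theorem wt_a {ν η θ : ℝ} (hν : 0 ≤ ν) (hη : 0 < η) (h1 : θ < 1) :
    ((ν + η) ^ (θ - 1)) ^ 2 * ν ^ (2 - θ) ≤ (ν + η) ^ (θ - 1) * ν := by
  rcases hν.eq_or_lt with rfl | hν
  · rw [Real.zero_rpow (by linarith)]; simp
  · have e : ν ^ (2 - θ) = ν ^ (1 - θ) * ν := by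
      rw [show 2 - θ = (1 - θ) + 1 by ring, Real.rpow_add hν, Real.rpow_one]
    have h2 : (ν + η) ^ (θ - 1) * ν ^ (1 - θ) ≤ 1 := by
      have : (ν + η) ^ (θ - 1) ≤ ν ^ (θ - 1) :=
        Real.rpow_le_rpow_of_nonpos hν (by linarith) (by linarith)
      calc _ ≤ ν ^ (θ - 1) * ν ^ (1 - θ) := by gcongr
        _ = 1 := by rw [← Real.rpow_add hν]; simp
    have h3 : 0 ≤ (ν + η) ^ (θ - 1) * ν := by positivity
    rw [e]
    calc _ = ((ν + η) ^ (θ - 1) * ν ^ (1 - θ)) * ((ν + η) ^ (θ - 1) * ν) := by ring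
      _ ≤ 1 * ((ν + η) ^ (θ - 1) * ν) := by gcongr
      _ = _ := one_mul _

theorem wt_b {ν η θ : ℝ} (hν : 0 ≤ ν) (hη : 0 < η) (h0 : 0 < θ) (h1 : θ < 1) :
    ν ^ θ - η ^ θ ≤ (ν + η) ^ (θ - 1) * ν := by
  have hp : 0 < ν + η := by linarith
  have e : (ν + η) ^ θ = (ν + η) ^ (θ - 1) * (ν + η) := by
    rw [← Real.rpow_add_one hp.ne']; congr 1; ring
  have e2 : η ^ θ = η ^ (θ - 1) * η := by
    rw [← Real.rpow_add_one hη.ne']; congr 1; ring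
  have h2 : ν ^ θ ≤ (ν + η) ^ θ := Real.rpow_le_rpow hν (by linarith) h0.le
  have h3 : (ν + η) ^ (θ - 1) ≤ η ^ (θ - 1) :=
    Real.rpow_le_rpow_of_nonpos hη (by linarith) (by linarith)
  have h4 := mul_le_mul_of_nonneg_right h3 hη.le
  linarith

theorem wt_c {ν η θ : ℝ} (hν : 0 ≤ ν) (hη : 0 < η) (h1 : θ < 1) :
    (ν + η) ^ (θ - 1) ≤ η ^ (θ - 1) :=
  Real.rpow_le_rpow_of_nonpos hη (by linarith) (by linarith)

theorem norm_le_card {k : ℕ} (v : EuclideanSpace ℝ (Fin k)) {d : ℝ} (h : ∀ i, |v i| ≤ d) :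
    ‖v‖ ≤ k * d := by
  have h1 : ‖v‖ ≤ ∑ l, |v l| := by
    have : v = ∑ l, v l • EuclideanSpace.single l (1 : ℝ) := by
      ext j; simp [Pi.single_apply]
    calc ‖v‖ = ‖∑ l, v l • EuclideanSpace.single l (1 : ℝ)‖ := by rw [← this]
      _ ≤ ∑ l, ‖v l • EuclideanSpace.single l (1 : ℝ)‖ := norm_sum_le _ _
      _ = ∑ l, |v l| := by simp [norm_smul]
  have h2 : ∑ l, |v l| ≤ ∑ l : Fin k, d := Finset.sum_le_sum (fun l _ => h l)
  simp at h2
  linarith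

/-- moment error of the atomic approximation -/
theorem mom_err {n : ℕ} {ι : Type} [MeasurableSpace ι] [MeasurableSingletonClass ι]
    {c : Sp n → ι} {G : Set (Sp n)} (hc : Measurable c) (hG : MeasurableSet G) (J : Finset ι)
    (hJ : ∀ x, c x ∈ J) {P : Sp n → ℝ} (hP : BM P) (hP1 : ∫ x, P x ∂(sg n) = 1)
    {κ δ b : ℝ} (hκ : ∫ x in Gᶜ, P x ∂(sg n) ≤ κ) (hδ : 0 ≤ δ) (hb : 0 ≤ b)
    (ξ : ι → Sp n) (φ : C(Sp n, ℝ)) (hφ0 : ∫ x, φ x * P x ∂(sg n) = 0)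
    (hφb : ∀ x, |φ x| ≤ b) (hφδ : ∀ x ∈ G, |φ (ξ (c x)) - φ x| ≤ δ) :
    |∑ j ∈ J, φ (ξ j) * ∫ x, (Qc c G j).indicator P x ∂(sg n)| ≤ δ + b * κ := by
  obtain ⟨hi, he⟩ := cut_int hc hG J hJ (fun j => φ (ξ j)) hP.int
  have hφP : Integrable (fun x => φ x * P x) (sg n) := by
    obtain ⟨M, hM⟩ := hP.b
    apply bdd_int (M := b * M) (φ.continuous.measurable.mul hP.m)
    intro x
    change |φ x * P x| ≤ _
    rw [abs_mul]
    exact mul_le_mul (hφb x) (hM x) (abs_nonneg _) hb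
  rw [← he]
  have e : ∫ x, G.indicator (fun x => φ (ξ (c x)) * P x) x ∂(sg n) =
      ∫ x, (G.indicator (fun x => φ (ξ (c x)) * P x) x - φ x * P x) ∂(sg n) := by
    rw [integral_sub hi hφP, hφ0, sub_zero]
  rw [e]
  have hbd : Integrable (fun x => δ * P x + b * Gᶜ.indicator P x) (sg n) :=
    (hP.int.const_mul δ).add ((hP.int.indicator hG.compl).const_mul b)
  calc _ ≤ ∫ x, |G.indicator (fun x => φ (ξ (c x)) * P x) x - φ x * P x| ∂(sg n) :=
        abs_integral_le_integral_abs
    _ ≤ ∫ x, (δ * P x + b * Gᶜ.indicator P x) ∂(sg n) := by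
        apply integral_mono (hi.sub hφP).abs hbd
        intro x
        simp only [Pi.sub_apply]
        have hPx := hP.p x
        by_cases hx : x ∈ G
        · rw [Set.indicator_of_mem hx, Set.indicator_of_notMem (by simpa using hx), mul_zero,
            add_zero, ← sub_mul, abs_mul, abs_of_nonneg hPx]
          exact mul_le_mul_of_nonneg_right (hφδ x hx) hPx
        · rw [Set.indicator_of_notMem hx, Set.indicator_of_mem (show x ∈ Gᶜ from hx), zero_sub, abs_neg,
            abs_mul, abs_of_nonneg hPx]
          have := mul_le_mul_of_nonneg_right (hφb x) hPx
          have := mul_nonneg hδ hPx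
          linarith
    _ = δ + b * ∫ x in Gᶜ, P x ∂(sg n) := by
        rw [integral_add (hP.int.const_mul δ) ((hP.int.indicator hG.compl).const_mul b),
          integral_const_mul, integral_const_mul, hP1, mul_one, integral_indicator hG.compl]
    _ ≤ _ := by gcongr

theorem exists_rpow_small {c ω θ : ℝ} (hc : 0 < c) (hω : 0 < ω) (hθ : 0 < θ) :
    ∃ t > 0, c * t ^ θ = ω := by
  refine ⟨(ω / c) ^ (1 / θ), by positivity, ?_⟩
  rw [← Real.rpow_mul (by positivity), one_div_mul_cancel hθ.ne', Real.rpow_one]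
  field_simp

theorem cellwt {n : ℕ} (hn : 5 ≤ n) (m : ℕ) [Nonempty (Sp n)] {ω : ℝ} (hω : 0 < ω) :
    ∃ B > 0, ∃ R ≥ 0, ∀ F : Sp n → ℝ, BM F → ∫ x, F x ^ qq n ∂(sg n) = 1 →
      (∀ l, ∫ x, bb n m l x * F x ^ qq n ∂(sg n) = 0) →
      ∃ wt : Sp n → ℝ, BM wt ∧ (∀ x, wt x ≤ B) ∧
        Theta n m (th n) - ω ≤ ∫ x, wt x * F x ^ qq n ∂(sg n) ∧
        Iq (fun x => wt x * F x ^ (qq n - 1)) ≤ alp n * (∫ x, wt x * F x ^ qq n ∂(sg n)) +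
          R * (∫ x, F x ^ (qq n - 1) ∂(sg n)) ^ 2 := by
  have hθ0 := th_pos hn
  have hθ1 := th_lt hn
  have hq := qq_gt hn
  have hTh := Theta_ge (n := n) (m := m) hθ0 hθ1
  set Θ := Theta n m (th n) with hΘ
  obtain ⟨c0, hc0, hTle⟩ := Theta_le (n := n) (m := m) hθ0 hθ1
  obtain ⟨t, ht, hct⟩ := exists_rpow_small hc0 (show 0 < ω / 3 by positivity) hθ0
  -- modulus of continuity and bound of the evaluation map
  have huc := CompactSpace.uniformContinuous_of_continuous (Ev_cont n m)
  obtain ⟨d, hd, hdE⟩ := Metric.uniformContinuous_iff.1 huc (t / 2) (by positivity)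
  obtain ⟨b, hb, hbE⟩ : ∃ b > 0, ∀ x, ‖Ev n m x‖ ≤ b := by
    obtain ⟨b, hb⟩ := (isCompact_range (Ev_cont n m)).isBounded.exists_norm_le
    exact ⟨max b 1, by positivity, fun x => (hb _ ⟨x, rfl⟩).trans (le_max_left _ _)⟩
  have hnr : (5 : ℝ) ≤ n := by exact_mod_cast hn
  obtain ⟨K, hK⟩ := exists_nat_gt (n / d)
  have hKr : (0 : ℝ) < K := lt_trans (by positivity) hK
  have hK0 : 0 < K := by exact_mod_cast hKr
  obtain ⟨M, hM⟩ := exists_nat_gt (n * (3 * Θ / ω) + n * (2 * b / t) + 2 * n)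
  have hMr : (0 : ℝ) < M := lt_trans (by positivity) hM
  have hM0 : 0 < M := by exact_mod_cast hMr
  have hκ1 : Θ * (n / M) ≤ ω / 3 := by
    rw [mul_div_assoc', div_le_iff₀ hMr]
    have h1 : (n : ℝ) * (3 * Θ / ω) ≤ M := by
      have : (0 : ℝ) ≤ n * (2 * b / t) + 2 * n := by positivity
      linarith
    have h2 := mul_le_mul_of_nonneg_left h1 (show 0 ≤ ω / 3 by positivity)
    have e : ω / 3 * (n * (3 * Θ / ω)) = Θ * n := by field_simp
    linarith
  have hκ2 : b * (n / M) ≤ t / 2 := by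
    rw [mul_div_assoc', div_le_iff₀ hMr]
    have h1 : (n : ℝ) * (2 * b / t) ≤ M := by
      have : (0 : ℝ) ≤ n * (3 * Θ / ω) + 2 * n := by positivity
      linarith
    have h2 := mul_le_mul_of_nonneg_left h1 (show 0 ≤ t / 2 by positivity)
    have e : t / 2 * (n * (2 * b / t)) = b * n := by field_simp
    linarith
  have hκ3 : (n : ℝ) / M ≤ 1 / 2 := by
    rw [div_le_iff₀ hMr]
    have : (0 : ℝ) ≤ n * (3 * Θ / ω) + n * (2 * b / t) := by positivity
    linarith
  have hκ4 : 0 ≤ (n : ℝ) / M := by positivity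
  set J := Fintype.piFinset (fun _ : Fin n => Finset.Icc (-(K : ℤ) - 1) K) with hJdef
  obtain ⟨η, hη, hηω⟩ := exists_rpow_small (show (0 : ℝ) < J.card + 1 by positivity)
    (show 0 < ω / 3 by positivity) hθ0
  set B := η ^ (th n - 1) with hB
  have hBpos : 0 < B := by positivity
  set s := (1 / ((M : ℝ) * K)) ^ 2 with hs
  have hspos : 0 < s := by positivity
  refine ⟨B, hBpos, s ^ (1 - hh n) * B ^ 2, by positivity, ?_⟩
  intro F hF hF1 hFm
  set P := fun x => F x ^ qq n with hPdef
  have hP : BM P := rpow_bdd hF (by linarith)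
  have hP1 : ∫ x, P x ∂(sg n) = 1 := hF1
  have hΦ : BM (fun x => F x ^ (qq n - 1)) := rpow_bdd hF (by linarith)
  obtain ⟨c, G, hc, hG, hJ, hκ, hsep, hclose⟩ := cells hP.int hP.p hP1 M K hM0 hK0
  set ν : (Fin n → ℤ) → ℝ := fun j => ∫ x, (Qc c G j).indicator P x ∂(sg n) with hν
  have hν0 : ∀ j, 0 ≤ ν j := fun j =>
    integral_nonneg (fun x => Set.indicator_nonneg (fun y _ => hP.p y) x)
  set a : (Fin n → ℤ) → ℝ := fun j => (ν j + η) ^ (th n - 1) with ha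
  have ha0 : ∀ j, 0 ≤ a j := fun j => Real.rpow_nonneg (by have := hν0 j; linarith) _
  have haB : ∀ j, a j ≤ B := fun j => wt_c (hν0 j) hη hθ1
  -- the weight
  have h1bm : BM (fun _ : Sp n => (1 : ℝ)) := ⟨measurable_const, ⟨1, fun _ => by simp⟩, fun _ => zero_le_one⟩
  have hwt : BM (G.indicator (fun x => a (c x) * 1)) := cut_bm hc hG J hJ ha0 haB h1bm
  have hmul : ∀ (Φ : Sp n → ℝ) x, G.indicator (fun x => a (c x) * 1) x * Φ x =
      G.indicator (fun x => a (c x) * Φ x) x := by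
    intro Φ x
    by_cases hx : x ∈ G
    · rw [Set.indicator_of_mem hx, Set.indicator_of_mem hx, mul_one]
    · rw [Set.indicator_of_notMem hx, Set.indicator_of_notMem hx, zero_mul]
  have hT : ∫ x, G.indicator (fun x => a (c x) * 1) x * F x ^ qq n ∂(sg n) = ∑ j ∈ J, a j * ν j := by
    simp only [hmul (fun x => F x ^ qq n)]
    exact (cut_int hc hG J hJ a hP.int).2
  have hwB : ∀ x, G.indicator (fun x => a (c x) * 1) x ≤ B := by
    intro x
    by_cases hx : x ∈ G
    · rw [Set.indicator_of_mem hx, mul_one]; exact haB _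
    · rw [Set.indicator_of_notMem hx]; exact hBpos.le
  refine ⟨G.indicator (fun x => a (c x) * 1), hwt, hwB, ?_, ?_⟩
  · rw [hT]
    -- choose points
    have hpt : ∀ j, ∃ ξ : Sp n, ∀ x, x ∈ Qc c G j → ξ ∈ Qc c G j := by
      intro j
      by_cases hne : (Qc c G j).Nonempty
      · obtain ⟨y, hy⟩ := hne
        exact ⟨y, fun _ _ => hy⟩
      · obtain ⟨x0⟩ := ‹Nonempty (Sp n)›
        exact ⟨x0, fun x hx => absurd ⟨x, hx⟩ hne⟩
    choose ξ hξ using hpt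
    have hcl : ∀ x ∈ G, dist (Ev n m (ξ (c x))) (Ev n m x) < t / 2 := by
      intro x hx
      apply hdE
      have hmem : ξ (c x) ∈ Qc c G (c x) := hξ (c x) x ⟨hx, rfl⟩
      have hce : c (ξ (c x)) = c x := hmem.2
      have h1 := hclose _ _ hce
      have h2 := norm_le_card ((ξ (c x) : E n) - (x : E n)) (d := 1 / K)
        (fun i => by rw [PiLp.sub_apply]; exact h1 i)
      rw [Subtype.dist_eq, dist_eq_norm]
      refine lt_of_le_of_lt h2 ?_
      rw [mul_one_div, div_lt_iff₀ hKr]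
      rw [div_lt_iff₀ hd] at hK
      linarith
    have hmom : ∀ l, |∑ j : J, ν j * bb n m l (ξ j)| ≤ t := by
      intro l
      have h := mom_err hc hG J hJ hP hP1 hκ (show 0 ≤ t / 2 by positivity) hb.le ξ (bb n m l)
        (hFm l) (fun x => ?_) (fun x hx => ?_)
      · have e : ∑ j : J, ν j * bb n m l (ξ j) = ∑ j ∈ J, bb n m l (ξ j) * ν j := by
          rw [← Finset.sum_coe_sort J (fun j => bb n m l (ξ j) * ν j)]
          exact Finset.sum_congr rfl (fun j _ => mul_comm _ _)
        rw [e]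
        exact h.trans (by linarith)
      · have := coord_le (Ev n m x) l
        exact this.trans (hbE x)
      · have h1 := hcl x hx
        rw [dist_eq_norm] at h1
        have := coord_le (Ev n m (ξ (c x)) - Ev n m x) l
        rw [PiLp.sub_apply] at this
        exact this.trans h1.le
    have hνsum : ∑ j : J, ν j = ∫ x in G, P x ∂(sg n) := by
      have h := (cut_int hc hG J hJ (fun _ => (1 : ℝ)) hP.int).2
      simp only [one_mul] at h
      rw [integral_indicator hG] at h
      rw [Finset.sum_coe_sort J ν, h]
    have hmass : 1 - n / M ≤ ∑ j : J, ν j := by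
      rw [hνsum]
      have := integral_add_compl hG hP.int
      rw [hP1] at this
      linarith
    have hpos : 0 < ∑ j : J, ν j := by linarith
    have key := hTle J (fun j => ξ j) (fun j => ν j) t ht (fun j => hν0 j) hmom hpos
    rw [hct] at key
    have h1 : (1 - n / M : ℝ) ≤ (∑ j : J, ν j) ^ th n := by
      calc (1 - n / M : ℝ) = (1 - n / M : ℝ) ^ (1 : ℝ) := (Real.rpow_one _).symm
        _ ≤ (1 - n / M : ℝ) ^ th n :=
          Real.rpow_le_rpow_of_exponent_ge (by linarith) (by linarith) hθ1.le
        _ ≤ _ := Real.rpow_le_rpow (by linarith) hmass hθ0.le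
    have h2 := mul_le_mul_of_nonneg_left h1 (show 0 ≤ Θ by linarith)
    have h3 : ∑ j : J, ν j ^ th n ≤ ∑ j ∈ J, a j * ν j + J.card * η ^ th n := by
      rw [Finset.sum_coe_sort J (fun j => ν j ^ th n)]
      have : ∑ j ∈ J, ν j ^ th n ≤ ∑ j ∈ J, (a j * ν j + η ^ th n) :=
        Finset.sum_le_sum (fun j _ => by have := wt_b (hν0 j) hη hθ0 hθ1; linarith)
      rw [Finset.sum_add_distrib] at this
      simpa using this
    have h4 : 0 < η ^ th n := by positivity
    have h5 : (1 - (n : ℝ) / M) * Θ = Θ - Θ * (n / M) := by ring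
    linarith
  · rw [hT]
    simp only [hmul (fun x => F x ^ (qq n - 1))]
    refine (Iq_cells hn hc hG J hJ ha0 haB hΦ hspos hsep).trans ?_
    apply add_le_add
    · rw [Finset.mul_sum]
      apply Finset.sum_le_sum
      intro j _
      refine (cell_HLS hn hF (Qc_meas hc hG j) (ha0 j)).trans ?_
      exact mul_le_mul_of_nonneg_left (wt_a (hν0 j) hη hθ1) (alp_pos hn).le
    · rw [mul_assoc, ← mul_pow]
      apply mul_le_mul_of_nonneg_left _ (by positivity)
      have hI : BM (G.indicator (fun x => a (c x) * F x ^ (qq n - 1))) := cut_bm hc hG J hJ ha0 haB hΦ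
      apply pow_le_pow_left₀ (integral_nonneg hI.p)
      rw [← integral_const_mul]
      apply integral_mono hI.int (hΦ.int.const_mul B)
      intro x
      dsimp only
      rw [← hmul (fun x => F x ^ (qq n - 1))]
      exact mul_le_mul_of_nonneg_right (hwB x) (hΦ.p x)

theorem pw_small {a d r q : ℝ} (ha : 0 ≤ a) (hd : 0 < d) (hd1 : d ≤ 1) (hr : 1 ≤ r) (hrq : r ≤ q - 1) :
    a ^ r ≤ d * a ^ q + d ^ (-(q + 1)) * a ^ (2 : ℝ) + d := by
  have t1 : 0 ≤ d * a ^ q := by positivity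
  have t2 : 0 ≤ d ^ (-(q + 1)) * a ^ (2 : ℝ) := by positivity
  have hid : 1 ≤ 1 / d := by rw [le_div_iff₀ hd]; linarith
  rcases le_or_gt (1 / d) a with h | h
  · have ha1 : 1 ≤ a := hid.trans h
    have ha0 : 0 < a := by linarith
    have h1 : a ^ r ≤ a ^ (q - 1) := Real.rpow_le_rpow_of_exponent_le ha1 hrq
    have h2 : a ^ (q - 1) ≤ d * a ^ q := by
      have e : a ^ q = a ^ (q - 1) * a := by rw [← Real.rpow_add_one ha0.ne']; congr 1; ring
      rw [e]
      have h3 : 1 ≤ d * a := by rw [div_le_iff₀ hd] at h; linarith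
      have h4 : 0 ≤ a ^ (q - 1) := by positivity
      nlinarith [mul_le_mul_of_nonneg_left h3 h4]
    linarith
  · rcases le_or_gt d a with h' | h'
    · have h1 : a ^ r ≤ (1 / d) ^ (q - 1) :=
        (Real.rpow_le_rpow ha h.le (by linarith)).trans (Real.rpow_le_rpow_of_exponent_le hid hrq)
      have h2 : (1 / d) ^ (q - 1) = d ^ (-(q + 1)) * d ^ (2 : ℝ) := by
        rw [← Real.rpow_add hd, one_div, Real.inv_rpow hd.le, ← Real.rpow_neg hd.le]
        congr 1; ring
      have h3 : d ^ (2 : ℝ) ≤ a ^ (2 : ℝ) := Real.rpow_le_rpow hd.le h' (by norm_num)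
      have h4 : d ^ (-(q + 1)) * d ^ (2 : ℝ) ≤ d ^ (-(q + 1)) * a ^ (2 : ℝ) := by gcongr
      linarith
    · have h1 : a ^ r ≤ d := by
        rcases ha.eq_or_lt with h0 | h0
        · rw [← h0, Real.zero_rpow (by linarith)]; exact hd.le
        · calc a ^ r ≤ a ^ (1 : ℝ) := Real.rpow_le_rpow_of_exponent_ge h0 (by linarith) hr
            _ = a := Real.rpow_one a
            _ ≤ d := h'.le
      linarith

theorem small1 {n : ℕ} (hn : 5 ≤ n) {δ : ℝ} (hδ : 0 < δ) : ∃ η > 0, ∀ F : Sp n → ℝ, BM F →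
    ∫ x, F x ^ qq n ∂(sg n) = 1 → ∫ x, F x ^ (2 : ℝ) ∂(sg n) ≤ η →
    ∀ r : ℝ, 1 ≤ r → r ≤ qq n - 1 → ∫ x, F x ^ r ∂(sg n) ≤ δ := by
  have hA := AS_pos hn
  have hq := qq_gt hn
  set d := min 1 (δ / (2 * (1 + AS n))) with hd
  have hd0 : 0 < d := by positivity
  have hd1 : d ≤ 1 := min_le_left _ _
  have hd2 : d * (1 + AS n) ≤ δ / 2 := by
    have : d ≤ δ / (2 * (1 + AS n)) := min_le_right _ _
    rw [le_div_iff₀ (by positivity)] at this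
    linarith
  refine ⟨δ / 2 * d ^ (qq n + 1), by positivity, fun F hF h1 h2 r hr hrq => ?_⟩
  have i1 := (rpow_bdd hF (show 0 ≤ qq n by linarith)).int
  have i2 := (rpow_bdd hF (show (0 : ℝ) ≤ 2 by norm_num)).int
  have i3 := (rpow_bdd hF (show (0 : ℝ) ≤ r by linarith)).int
  have i4 : Integrable (fun x => d * F x ^ qq n + d ^ (-(qq n + 1)) * F x ^ (2 : ℝ)) (sg n) :=
    (i1.const_mul d).add (i2.const_mul _)
  have i5 : Integrable (fun _ : Sp n => d) (sg n) := integrable_const d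
  calc ∫ x, F x ^ r ∂(sg n)
      ≤ ∫ x, (d * F x ^ qq n + d ^ (-(qq n + 1)) * F x ^ (2 : ℝ) + d) ∂(sg n) :=
        integral_mono i3 (i4.add i5) (fun x => pw_small (hF.p x) hd0 hd1 hr hrq)
    _ = d + d ^ (-(qq n + 1)) * (∫ x, F x ^ (2 : ℝ) ∂(sg n)) + AS n * d := by
        rw [integral_add i4 i5, integral_add (i1.const_mul d) (i2.const_mul _),
          integral_const_mul, integral_const_mul, h1, integral_const, smul_eq_mul, mul_one]
        rfl
    _ ≤ d + d ^ (-(qq n + 1)) * (δ / 2 * d ^ (qq n + 1)) + AS n * d := by gcongr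
    _ = d * (1 + AS n) + δ / 2 := by
        rw [Real.rpow_neg hd0.le]
        have : d ^ (qq n + 1) ≠ 0 := by positivity
        field_simp; ring
    _ ≤ δ := by linarith

theorem young0 {a b q : ℝ} (ha : 0 ≤ a) (hb : 0 ≤ b) (hq : 1 < q) :
    a * b ^ (q - 1) ≤ a ^ q + b ^ q := by
  have e : ∀ c : ℝ, 0 ≤ c → c * c ^ (q - 1) = c ^ q := fun c hc => by
    rw [mul_comm, ← Real.rpow_add_one' hc (by linarith)]; congr 1; ring
  rcases le_total a b with h | h
  · have : a * b ^ (q - 1) ≤ b * b ^ (q - 1) := by gcongr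
    rw [e b hb] at this
    have : 0 ≤ a ^ q := by positivity
    linarith
  · have : a * b ^ (q - 1) ≤ a * a ^ (q - 1) := by
      gcongr
    rw [e a ha] at this
    have : 0 ≤ b ^ q := by positivity
    linarith

theorem ker_split {z r h : ℝ} (hz : 0 < z) (hr : 0 < r) (hh0 : 0 < h) :
    z ^ (-h) ≤ r ^ (-h) + r ^ (1 / 4 : ℝ) * z ^ (-(h + 1 / 4)) := by
  rcases le_or_gt r z with h1 | h1
  · have := Real.rpow_le_rpow_of_nonpos hr h1 (show -h ≤ 0 by linarith)
    have : 0 ≤ r ^ (1 / 4 : ℝ) * z ^ (-(h + 1 / 4)) := by positivity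
    linarith
  · have e : z ^ (-h) = z ^ (1 / 4 : ℝ) * z ^ (-(h + 1 / 4)) := by
      rw [← Real.rpow_add hz]; congr 1; ring
    have h2 : z ^ (1 / 4 : ℝ) ≤ r ^ (1 / 4 : ℝ) := Real.rpow_le_rpow hz.le h1.le (by norm_num)
    have h3 : z ^ (1 / 4 : ℝ) * z ^ (-(h + 1 / 4)) ≤ r ^ (1 / 4 : ℝ) * z ^ (-(h + 1 / 4)) := by gcongr
    have : 0 ≤ r ^ (-h) := by positivity
    linarith

theorem zP_le {n : ℕ} (hn : 5 ≤ n) {β : ℝ} (hβ : β < ((n:ℝ)-1)/2) : ∃ C : ℝ, 0 ≤ C ∧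
    ∀ P : Sp n → ℝ, BM P → ∫ x, P x ∂(sg n) = 1 →
      (Integrable (fun p : Sp n × Sp n => (P p.1 + P p.2) * zz p.1 p.2 ^ (-β)) (ss n) ∧
       ∫ p, (P p.1 + P p.2) * zz p.1 p.2 ^ (-β) ∂(ss n) ≤ C) := by
  obtain ⟨C, hC, hz⟩ := zint hn hβ
  refine ⟨2 * C, by positivity, fun P hP hP1 => ?_⟩
  obtain ⟨M, hM⟩ := hP.b
  have i1 : Integrable (fun p : Sp n × Sp n => P p.1 * zz p.1 p.2 ^ (-β)) (ss n) :=
    zzint_bdd hn hβ (G := fun p => P p.1) (hP.m.comp measurable_fst) (fun p => hM p.1)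
  have i2 : Integrable (fun p : Sp n × Sp n => P p.2 * zz p.1 p.2 ^ (-β)) (ss n) :=
    zzint_bdd hn hβ (G := fun p => P p.2) (hP.m.comp measurable_snd) (fun p => hM p.2)
  have b1 : ∫ p, P p.1 * zz p.1 p.2 ^ (-β) ∂(ss n) ≤ C := by
    rw [integral_prod _ i1]
    calc ∫ x, (∫ y, P x * zz x y ^ (-β) ∂(sg n)) ∂(sg n) ≤ ∫ x, P x * C ∂(sg n) := by
          apply integral_mono i1.integral_prod_left (hP.int.mul_const C)
          intro x
          dsimp only
          rw [integral_const_mul]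
          exact mul_le_mul_of_nonneg_left (hz x).2 (hP.p x)
      _ = C := by rw [integral_mul_const, hP1, one_mul]
  have b2 : ∫ p, P p.2 * zz p.1 p.2 ^ (-β) ∂(ss n) ≤ C := by
    rw [integral_prod_symm _ i2]
    calc ∫ y, (∫ x, P y * zz x y ^ (-β) ∂(sg n)) ∂(sg n) ≤ ∫ y, P y * C ∂(sg n) := by
          apply integral_mono i2.integral_prod_right (hP.int.mul_const C)
          intro y
          dsimp only
          rw [integral_const_mul]
          simp only [fun x => zz_symm x y]
          exact mul_le_mul_of_nonneg_left (hz y).2 (hP.p y)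
      _ = C := by rw [integral_mul_const, hP1, one_mul]
  have e : (fun p : Sp n × Sp n => (P p.1 + P p.2) * zz p.1 p.2 ^ (-β)) =
      fun p => P p.1 * zz p.1 p.2 ^ (-β) + P p.2 * zz p.1 p.2 ^ (-β) := by
    funext p; ring
  rw [e]
  refine ⟨i1.add i2, ?_⟩
  rw [integral_add i1 i2]
  linarith

theorem L_int {n : ℕ} (hn : 5 ≤ n) {A B : Sp n → ℝ} (hA : BM A) (hB : BM B) :
    Integrable (fun p : Sp n × Sp n => A p.1 * B p.2 * zz p.1 p.2 ^ (-hh n)) (ss n) := by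
  obtain ⟨M1, h1⟩ := hA.b
  obtain ⟨M2, h2⟩ := hB.b
  have hm : Measurable fun p : Sp n × Sp n => A p.1 * B p.2 :=
    (hA.m.comp measurable_fst).mul (hB.m.comp measurable_snd)
  refine zzint_bdd hn (β := hh n) (by unfold hh; linarith) (M := M1 * M2) hm (fun p => ?_)
  rw [abs_mul]
  exact mul_le_mul (h1 _) (h2 _) (abs_nonneg _) ((abs_nonneg _).trans (h1 p.1))

theorem small2 {n : ℕ} (hn : 5 ≤ n) {δ : ℝ} (hδ : 0 < δ) : ∃ η > 0, ∀ F : Sp n → ℝ, BM F →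
    ∫ x, F x ^ qq n ∂(sg n) = 1 → ∫ x, F x ^ (2 : ℝ) ∂(sg n) ≤ η →
    ∫ p, F p.1 * F p.2 ^ (qq n - 1) * zz p.1 p.2 ^ (-hh n) ∂(ss n) ≤ δ := by
  have hq := qq_gt hn
  have hh0 := hh_ge hn
  obtain ⟨C, hC, hzP⟩ := zP_le hn (β := hh n + 1 / 4) (by unfold hh; linarith)
  obtain ⟨r, hr, hrC⟩ := exists_rpow_small (show 0 < C + 1 by linarith) (show 0 < δ / 2 by positivity)
    (show (0 : ℝ) < 1 / 4 by norm_num)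
  set d := min 1 (δ / 2 * r ^ hh n) with hd
  have hd0 : 0 < d := by positivity
  have hd1 : d ≤ 1 := min_le_left _ _
  have hd2 : d ≤ δ / 2 * r ^ hh n := min_le_right _ _
  obtain ⟨η, hη, h⟩ := small1 hn hd0
  refine ⟨η, hη, fun F hF h1 h2 => ?_⟩
  have s1 := h F hF h1 h2 1 le_rfl (by linarith)
  have s2 := h F hF h1 h2 (qq n - 1) (by linarith) le_rfl
  simp only [Real.rpow_one] at s1
  have hG : BM (fun x => F x ^ (qq n - 1)) := rpow_bdd hF (by linarith)
  have hP : BM (fun x => F x ^ qq n) := rpow_bdd hF (by linarith)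
  obtain ⟨iz, bz⟩ := hzP _ hP h1
  have iFG : Integrable (fun p : Sp n × Sp n => F p.1 * F p.2 ^ (qq n - 1)) (ss n) :=
    hF.int.mul_prod hG.int
  have eFG : ∫ p, F p.1 * F p.2 ^ (qq n - 1) ∂(ss n) =
      (∫ x, F x ∂(sg n)) * ∫ x, F x ^ (qq n - 1) ∂(sg n) :=
    integral_prod_mul F (fun x => F x ^ (qq n - 1))
  have hrn : 0 < r ^ (-hh n) := by positivity
  calc ∫ p, F p.1 * F p.2 ^ (qq n - 1) * zz p.1 p.2 ^ (-hh n) ∂(ss n)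
      ≤ ∫ p, (r ^ (-hh n) * (F p.1 * F p.2 ^ (qq n - 1)) + r ^ (1 / 4 : ℝ) *
          ((F p.1 ^ qq n + F p.2 ^ qq n) * zz p.1 p.2 ^ (-(hh n + 1 / 4)))) ∂(ss n) := by
        apply integral_mono_ae (L_int hn hF hG) ((iFG.const_mul _).add (iz.const_mul _))
        filter_upwards [ae_ss_pos hn] with p hp
        simp only [Pi.add_apply]
        have k1 := ker_split hp hr (show 0 < hh n by linarith)
        have k2 := young0 (hF.p p.1) (hF.p p.2) (show 1 < qq n by linarith)
        have k3 : 0 ≤ F p.1 * F p.2 ^ (qq n - 1) := mul_nonneg (hF.p _) (hG.p _)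
        have k4 := mul_le_mul_of_nonneg_left k1 k3
        have k5 : 0 ≤ r ^ (1 / 4 : ℝ) * zz p.1 p.2 ^ (-(hh n + 1 / 4)) := by positivity
        have k6 := mul_le_mul_of_nonneg_right k2 k5
        linarith
    _ = r ^ (-hh n) * ((∫ x, F x ∂(sg n)) * ∫ x, F x ^ (qq n - 1) ∂(sg n)) + r ^ (1 / 4 : ℝ) *
          ∫ p, (F p.1 ^ qq n + F p.2 ^ qq n) * zz p.1 p.2 ^ (-(hh n + 1 / 4)) ∂(ss n) := by
        rw [integral_add (iFG.const_mul _) (iz.const_mul _), integral_const_mul, integral_const_mul, eFG]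
    _ ≤ r ^ (-hh n) * (d * 1) + r ^ (1 / 4 : ℝ) * C := by
        have g1 : 0 ≤ ∫ x, F x ^ (qq n - 1) ∂(sg n) := integral_nonneg hG.p
        have g2 : (∫ x, F x ∂(sg n)) * ∫ x, F x ^ (qq n - 1) ∂(sg n) ≤ d * 1 :=
          mul_le_mul s1 (s2.trans hd1) g1 hd0.le
        gcongr
    _ ≤ δ / 2 + δ / 2 := by
        apply add_le_add
        · have := mul_le_mul_of_nonneg_left hd2 hrn.le
          have e : r ^ (-hh n) * (δ / 2 * r ^ hh n) = δ / 2 := by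
            rw [Real.rpow_neg hr.le]
            have : r ^ hh n ≠ 0 := by positivity
            field_simp
          linarith
        · have : 0 < r ^ (1 / 4 : ℝ) := by positivity
          linarith
    _ = δ := by ring

def ALp (n : ℕ) : ℝ := alp n / (4 * hh n * (hh n - 1) * AS n)

theorem ALp_pos {n : ℕ} (hn : 5 ≤ n) : 0 < ALp n := by
  have h1 := hh_ge hn
  have h2 : 0 < hh n - 1 := by linarith
  have h3 : 0 < hh n := by linarith
  have := AS_pos hn
  have := alp_pos hn
  unfold ALp; positivity

theorem abs_BM {n : ℕ} {f : E n → ℝ} (hf : Continuous f) : BM (fun x : Sp n => |f x|) := by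
  have hc : Continuous fun x : Sp n => |f x| := (hf.comp continuous_subtype_val).abs
  refine ⟨hc.measurable, ?_, fun x => abs_nonneg _⟩
  obtain ⟨b, hb⟩ := (isCompact_range hc).isBounded.exists_norm_le
  exact ⟨b, fun x => hb _ ⟨x, rfl⟩⟩

theorem core {n : ℕ} (hn : 5 ≤ n) (m : ℕ) [Nonempty (Sp n)] {ε : ℝ} (hε : 0 < ε) :
    ∃ η > 0, ∀ f u : E n → ℝ, Continuous f → ContDiff ℝ 2 u → (∀ x : Sp n, u x = f x) →
      (∀ x : Sp n, fderiv ℝ u x x = -(hh n - 1) * f x) →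
      ∫ x : Sp n, |f x| ^ qq n ∂(sg n) = 1 →
      (∀ l, ∫ x : Sp n, bb n m l x * |f x| ^ qq n ∂(sg n) = 0) →
      ∫ x : Sp n, |f x| ^ (2 : ℝ) ∂(sg n) ≤ η →
      1 ≤ (ALp n / Theta n m (th n) + ε) * ∫ x in ball (0 : E n) 1, (lap n u x) ^ 2 := by
  have hθ0 := th_pos hn
  have hθ1 := th_lt hn
  have hq := qq_gt hn
  have h1h := hh_ge hn
  have hh1 : 0 < hh n - 1 := by linarith
  have hh0 : 0 < hh n := by linarith
  have hAS := AS_pos hn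
  have hal := alp_pos hn
  have hAL := ALp_pos hn
  have hTh := Theta_ge (n := n) (m := m) hθ0 hθ1
  set Θ := Theta n m (th n) with hΘ
  have hΘ0 : 0 < Θ := by linarith
  set X := 1 / Θ + ε / ALp n with hX
  have hXpos : 0 < X := by positivity
  set ω := ε * Θ / ALp n / (2 * X) with hω
  have hωpos : 0 < ω := by positivity
  obtain ⟨B, hB, R, hR, hcw⟩ := cellwt hn m hωpos
  set A := hh n * AS n with hA
  have hApos : 0 < A := by positivity
  set S := 2 * B / A + R / alp n + 1 with hS
  have hSpos : 0 < S := by positivity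
  set δ := min 1 (ω / S) with hδ
  have hδ0 : 0 < δ := by positivity
  have hδ1 : δ ≤ 1 := min_le_left _ _
  have hδ2 : δ * S ≤ ω := by
    have : δ ≤ ω / S := min_le_right _ _
    rwa [le_div_iff₀ hSpos] at this
  obtain ⟨η1, hη1, hs1⟩ := small1 hn hδ0
  obtain ⟨η2, hη2, hs2⟩ := small2 hn hδ0
  refine ⟨min η1 η2, by positivity, ?_⟩
  intro f u hf hu hb hr hf1 hfm hf2
  have hF : BM (fun x : Sp n => |f x|) := abs_BM hf
  have b1 := hs1 _ hF hf1 (hf2.trans (min_le_left _ _)) (qq n - 1) (by linarith) le_rfl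
  have b2 := hs2 _ hF hf1 (hf2.trans (min_le_right _ _))
  obtain ⟨wt, hwt, hwB, hT, hI⟩ := hcw _ hF hf1 hfm
  have hG : BM (fun x : Sp n => |f x| ^ (qq n - 1)) := rpow_bdd hF (by linarith)
  set T := ∫ x : Sp n, wt x * |f x| ^ qq n ∂(sg n) with hTdef
  set EE := ∫ x in ball (0 : E n) 1, (lap n u x) ^ 2 with hEE
  -- test function
  have eabs : ∀ x : Sp n, |wt x * (|f x| ^ (qq n - 2) * f x)| = wt x * |f x| ^ (qq n - 1) := by
    intro x
    rw [abs_mul, abs_mul, abs_of_nonneg (hwt.p x), abs_of_nonneg (Real.rpow_nonneg (abs_nonneg _) _),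
      ← Real.rpow_add_one' (abs_nonneg _) (by linarith)]
    congr 2; ring
  have emul : ∀ x : Sp n, wt x * (|f x| ^ (qq n - 2) * f x) * f x = wt x * |f x| ^ qq n := by
    intro x
    have e1 : f x * f x = |f x| ^ (2 : ℝ) := by
      rw [Real.rpow_two, sq_abs, sq]
    have e2 : |f x| ^ qq n = |f x| ^ (qq n - 2) * |f x| ^ (2 : ℝ) := by
      rw [← Real.rpow_add' (abs_nonneg _) (by linarith)]; congr 1; ring
    rw [e2, ← e1]; ring
  have hgm : Measurable fun x : Sp n => wt x * (|f x| ^ (qq n - 2) * f x) := by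
    have h1 : Measurable fun x : Sp n => |f x| ^ (qq n - 2) := hF.m.pow_const _
    have h2 : Measurable fun x : Sp n => f x := (hf.comp continuous_subtype_val).measurable
    exact hwt.m.mul (h1.mul h2)
  obtain ⟨MG, hMG⟩ := hG.b
  have hgM : ∀ x : Sp n, |wt x * (|f x| ^ (qq n - 2) * f x)| ≤ B * MG := by
    intro x
    rw [eabs x]
    have h1 := hMG x
    rw [abs_of_nonneg (hG.p x)] at h1
    exact mul_le_mul (hwB x) h1 (hG.p x) hB.le
  set l := alp n / (4 * (hh n - 1)) with hl
  have hlpos : 0 < l := by positivity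
  have hd := dual hn hu hb hr hgm hgM hlpos
  simp only [eabs, emul] at hd
  rw [← hTdef, ← hEE, ← hA] at hd
  have hT0 : 0 ≤ T := integral_nonneg (fun x => mul_nonneg (hwt.p x) (Real.rpow_nonneg (abs_nonneg _) _))
  rw [abs_of_nonneg hT0] at hd
  -- the L term
  have hwG : BM (fun x : Sp n => wt x * |f x| ^ (qq n - 1)) :=
    ⟨hwt.m.mul hG.m, ⟨B * MG, fun x => by rw [← eabs x, abs_abs]; exact hgM x⟩,
      fun x => mul_nonneg (hwt.p x) (hG.p x)⟩
  have hL : ∫ p : Sp n × Sp n, |f p.1| * (wt p.2 * |f p.2| ^ (qq n - 1)) * zz p.1 p.2 ^ (-hh n) ∂(ss n) ≤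
      B * δ := by
    have h1 : ∫ p : Sp n × Sp n, |f p.1| * (wt p.2 * |f p.2| ^ (qq n - 1)) * zz p.1 p.2 ^ (-hh n) ∂(ss n) ≤
        ∫ p : Sp n × Sp n, B * (|f p.1| * |f p.2| ^ (qq n - 1) * zz p.1 p.2 ^ (-hh n)) ∂(ss n) := by
      apply integral_mono (L_int hn hF hwG) ((L_int hn hF hG).const_mul B)
      intro p
      dsimp only
      have h2 : 0 ≤ |f p.1| * |f p.2| ^ (qq n - 1) * zz p.1 p.2 ^ (-hh n) :=
        mul_nonneg (mul_nonneg (abs_nonneg _) (hG.p p.2)) (Real.rpow_nonneg (zz_nonneg _ _) _)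
      have h3 := mul_le_mul_of_nonneg_right (hwB p.2) h2
      linarith
    rw [integral_const_mul] at h1
    exact h1.trans (mul_le_mul_of_nonneg_left b2 hB.le)
  have hint0 : 0 ≤ ∫ x : Sp n, |f x| ^ (qq n - 1) ∂(sg n) := integral_nonneg hG.p
  have hIb : Iq (fun x : Sp n => wt x * |f x| ^ (qq n - 1)) ≤ alp n * T + R * δ := by
    refine hI.trans ?_
    have : (∫ x : Sp n, |f x| ^ (qq n - 1) ∂(sg n)) ^ 2 ≤ δ := by
      have := mul_le_mul b1 (b1.trans hδ1) hint0 hδ0.le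
      rw [sq]; linarith
    have := mul_le_mul_of_nonneg_left this hR
    linarith
  have hco : 1 / (2 * l) * (A / (4 * (hh n - 1)) * Iq (fun x : Sp n => wt x * |f x| ^ (qq n - 1))) ≤
      A * T / 2 + A * (R * δ / alp n) / 2 := by
    have e : 1 / (2 * l) * (A / (4 * (hh n - 1)) * Iq (fun x : Sp n => wt x * |f x| ^ (qq n - 1))) =
        A / (2 * alp n) * Iq (fun x : Sp n => wt x * |f x| ^ (qq n - 1)) := by
      rw [hl]; field_simp
    rw [e]
    have h1 := mul_le_mul_of_nonneg_left hIb (show 0 ≤ A / (2 * alp n) by positivity)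
    have e2 : A / (2 * alp n) * (alp n * T + R * δ) = A * T / 2 + A * (R * δ / alp n) / 2 := by
      field_simp
    linarith
  have hfin : A * (T - ω) ≤ l * EE := by
    have e : A * (δ * S) = 2 * (B * δ) + A * (R * δ / alp n) + A * δ := by
      rw [hS]; field_simp
    have h1 := mul_le_mul_of_nonneg_left hδ2 hApos.le
    have h2 := mul_pos hApos hδ0
    linarith
  have hE : Θ - 2 * ω ≤ ALp n * EE := by
    have e : ALp n = l / A := by
      unfold ALp; rw [hl, hA]; field_simp
    rw [e, div_mul_eq_mul_div, le_div_iff₀ hApos]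
    have h1 := mul_le_mul_of_nonneg_left hT hApos.le
    linarith
  have h3 := mul_le_mul_of_nonneg_left hE hXpos.le
  have e1 : X * (ALp n * EE) = (ALp n / Θ + ε) * EE := by
    rw [hX]; field_simp
  have e2 : X * (2 * ω) = ε * Θ / ALp n := by rw [hω]; field_simp
  have e3 : X * Θ = 1 + ε * Θ / ALp n := by rw [hX]; field_simp
  have e4 : X * (Θ - 2 * ω) = 1 := by rw [mul_sub, e2, e3]; ring
  linarith

theorem qq_eq {n : ℕ} (hn : 5 ≤ n) : 2 * ((n:ℝ) - 1) / ((n:ℝ) - 4) = qq n := by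
  have h : (5:ℝ) ≤ n := by exact_mod_cast hn
  have h1 : (n:ℝ) - 4 ≠ 0 := by linarith
  have h2 : (n:ℝ) / 2 - 1 - 1 ≠ 0 := by linarith
  unfold qq hh
  rw [div_eq_div_iff h1 h2]; ring

theorem th_eq {n : ℕ} (hn : 5 ≤ n) : ((n:ℝ) - 4) / ((n:ℝ) - 1) = th n := by
  have h : (5:ℝ) ≤ n := by exact_mod_cast hn
  have h1 : (n:ℝ) - 1 ≠ 0 := by linarith
  have h2 : 2 * ((n:ℝ) / 2 - 1) + 1 ≠ 0 := by linarith
  unfold th hh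
  rw [div_eq_div_iff h1 h2]; ring

theorem ALp_eq {n : ℕ} (hn : 5 ≤ n) :
    4 / ((n:ℝ) * ((n:ℝ) - 2) * ((n:ℝ) - 4) * SA n ^ ((3:ℝ) / ((n:ℝ) - 1))) = ALp n := by
  have h : (5:ℝ) ≤ n := by exact_mod_cast hn
  have hA := AS_pos hn
  have h1 : (n:ℝ) - 1 ≠ 0 := by linarith
  have h2 : (n:ℝ) - 2 ≠ 0 := by linarith
  have h3 : (n:ℝ) - 4 ≠ 0 := by linarith
  have h0 : (n:ℝ) ≠ 0 := by linarith
  have e : th n = 1 - 3 / ((n:ℝ) - 1) := by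
    rw [← th_eq hn]; field_simp; ring
  have e1 : hh n + 1 = (n:ℝ) / 2 := by unfold hh; ring
  have e2 : hh n - 1 = ((n:ℝ) - 4) / 2 := by unfold hh; ring
  have e3 : hh n = ((n:ℝ) - 2) / 2 := by unfold hh; ring
  have hp : 0 < AS n ^ ((3:ℝ) / ((n:ℝ) - 1)) := Real.rpow_pos_of_pos hA _
  unfold ALp alp
  rw [SA_eq, two_pcr hn, e1, e2, e3, show (2:ℝ) - (2 - th n) = th n by ring, e, Real.rpow_sub hA,
    Real.rpow_one]
  field_simp
  norm_num

theorem lap_smul' {n : ℕ} (c : ℝ) (u : E n → ℝ) (x : E n) :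
    lap n (fun y => c * u y) x = c * lap n u x := by
  unfold lap
  rw [Finset.mul_sum]
  refine Finset.sum_congr rfl fun i _ => ?_
  have h : ∀ (v : E n → ℝ) (z : E n), fderiv ℝ (fun y => c * v y) z = c • fderiv ℝ v z := by
    intro v z
    have := congrFun (fderiv_const_smul_field (𝕜 := ℝ) (f := v) c) z
    simpa [Pi.smul_def, smul_eq_mul] using this
  have h2 : (fun y => fderiv ℝ (fun y => c * u y) y (EuclideanSpace.single i 1)) =
      fun y => c * fderiv ℝ u y (EuclideanSpace.single i 1) := by
    funext y; rw [h]; rfl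
  rw [h2, h]; rfl

theorem tg_nonneg {n : ℕ} (f : E n → ℝ) (x : Sp n) : 0 ≤ tgradNormSq n f x := by
  unfold tgradNormSq
  have h1 : ‖gradient f (x : E n)‖ = ‖fderiv ℝ f x‖ := by
    unfold gradient; exact LinearIsometryEquiv.norm_map _ _
  have h2 := (fderiv ℝ f x).le_opNorm x
  have hx : ‖(x : E n)‖ = 1 := by simp
  rw [hx, mul_one, Real.norm_eq_abs] at h2
  rw [h1]
  have := pow_le_pow_left₀ (abs_nonneg _) h2 2
  rw [sq_abs] at this
  linarith

theorem tg_cont {n : ℕ} {f : E n → ℝ} (hf : ContDiff ℝ (⊤ : ℕ∞) f) :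
    Continuous fun x : Sp n => tgradNormSq n f x := by
  have h := hf.continuous_fderiv (by simp)
  have h1 : Continuous fun x : Sp n => fderiv ℝ f (x : E n) := h.comp continuous_subtype_val
  have h2 : (fun x : Sp n => tgradNormSq n f x) = fun x : Sp n =>
      ‖fderiv ℝ f (x : E n)‖ ^ 2 - (fderiv ℝ f (x : E n) x) ^ 2 := by
    funext x
    unfold tgradNormSq gradient
    rw [LinearIsometryEquiv.norm_map]
  rw [h2]
  exact (h1.norm.pow 2).sub ((h1.clm_apply continuous_subtype_val).pow 2)

theorem stmt3 (n : ℕ) (hn : 5 ≤ n) (m : ℕ) :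
    ∀ ε > (0:ℝ), ∃ C > (0:ℝ), ∀ f u : E n → ℝ, ContDiff ℝ (⊤ : ℕ∞) f → ContDiff ℝ (⊤ : ℕ∞) u →
      (∀ p ∈ P0 n m,
        ∫ x, MvPolynomial.eval (fun i => x i) p * |f x| ^ (2 * ((n:ℝ) - 1) / ((n:ℝ) - 4))
          ∂(sphMeasure n) = 0) →
      (∀ x ∈ Metric.sphere (0 : E n) 1, u x = f x) →
      (∀ x ∈ Metric.sphere (0 : E n) 1, fderiv ℝ u x x = -(((n:ℝ) - 4) / 2) * f x) →
      (∫ x, |f x| ^ (2 * ((n:ℝ) - 1) / ((n:ℝ) - 4)) ∂(sphMeasure n)) ^ (((n:ℝ) - 4) / ((n:ℝ) - 1)) ≤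
        (4 / ((n:ℝ) * ((n:ℝ) - 2) * ((n:ℝ) - 4) * SA n ^ ((3:ℝ) / ((n:ℝ) - 1))) /
              Theta n m (((n:ℝ) - 4) / ((n:ℝ) - 1)) + ε) *
            (∫ x in Metric.ball (0 : E n) 1, (lap n u x) ^ 2) +
          C * ∫ x, (tgradNormSq n f x + ((n:ℝ) * ((n:ℝ) - 4) / 2) * (f x) ^ 2) ∂(sphMeasure n) := by
  intro ε hε
  have h5 : (5:ℝ) ≤ n := by exact_mod_cast hn
  have hne : Nonempty (Sp n) :=
    ⟨⟨EuclideanSpace.single ⟨0, by omega⟩ 1, by simp⟩⟩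
  obtain ⟨η, hη, hcore⟩ := core hn m hε
  obtain ⟨b, hb⟩ : ∃ b, b = (n:ℝ) * ((n:ℝ) - 4) / 2 := ⟨_, rfl⟩
  have hb0 : 0 < b := by rw [hb]; nlinarith
  refine ⟨1 / (η * b), by positivity, ?_⟩
  intro f u hf hu hmom hbd hnd
  rw [qq_eq hn] at hmom ⊢
  rw [th_eq hn, ALp_eq hn, ← hb, sph_integral, sph_integral]
  have hθ0 := th_pos hn
  have hθ1 := th_lt hn
  have hΘ : 1 ≤ Theta n m (th n) := Theta_ge hθ0 hθ1
  have hA := ALp_pos hn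
  have hq := qq_gt hn
  obtain ⟨K, hK⟩ : ∃ K, K = ALp n / Theta n m (th n) + ε := ⟨_, rfl⟩
  have hK0 : 0 < K := by rw [hK]; positivity
  rw [← hK] at hcore ⊢
  obtain ⟨En, hEn⟩ : ∃ En, En = ∫ x in Metric.ball (0 : E n) 1, (lap n u x) ^ 2 := ⟨_, rfl⟩
  have hEn0 : 0 ≤ En := by rw [hEn]; exact integral_nonneg fun x => sq_nonneg _
  obtain ⟨Z, hZ⟩ : ∃ Z, Z = ∫ x : Sp n, |f x| ^ qq n ∂(sg n) := ⟨_, rfl⟩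
  have hZ0 : 0 ≤ Z := by
    rw [hZ]; exact integral_nonneg fun x => Real.rpow_nonneg (abs_nonneg _) _
  obtain ⟨D, hD⟩ : ∃ D, D = ∫ x : Sp n, |f x| ^ (2:ℝ) ∂(sg n) := ⟨_, rfl⟩
  have hfc : Continuous fun x : Sp n => f x := hf.continuous.comp continuous_subtype_val
  have hLow : b * D ≤ ∫ x : Sp n, (tgradNormSq n f x + b * (f x) ^ 2) ∂(sg n) := by
    rw [hD, ← integral_const_mul]
    have e : ∀ x : Sp n, b * |f x| ^ (2:ℝ) = b * (f x) ^ 2 := by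
      intro x; rw [Real.rpow_two, sq_abs]
    simp only [e]
    apply integral_mono
    · exact cont_int (continuous_const.mul (hfc.pow 2))
    · exact cont_int ((tg_cont hf).add (continuous_const.mul (hfc.pow 2)))
    · intro x
      have := tg_nonneg f x
      dsimp only
      linarith
  have hLow2 : D / η ≤ 1 / (η * b) *
      ∫ x : Sp n, (tgradNormSq n f x + b * (f x) ^ 2) ∂(sg n) := by
    have := mul_le_mul_of_nonneg_left hLow (show 0 ≤ 1 / (η * b) by positivity)
    have e : 1 / (η * b) * (b * D) = D / η := by field_simp
    linarith
  have hD0 : 0 ≤ D := by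
    rw [hD]; exact integral_nonneg fun x => Real.rpow_nonneg (abs_nonneg _) _
  have hDη : 0 ≤ D / η := by positivity
  rw [← hEn, ← hZ]
  suffices h : Z ^ th n ≤ K * En + D / η by linarith
  rcases hZ0.eq_or_lt with h0 | hZp
  · rw [← h0, Real.zero_rpow hθ0.ne']
    positivity
  obtain ⟨s, hs⟩ : ∃ s, s = Z ^ (-(1 / qq n)) := ⟨_, rfl⟩
  have hsp : 0 < s := by rw [hs]; exact Real.rpow_pos_of_pos hZp _
  have hsq : s ^ qq n = Z⁻¹ := by
    rw [hs, ← Real.rpow_mul hZ0, ← Real.rpow_neg_one]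
    congr 1; field_simp
  have hthq : th n = 2 / qq n := by
    unfold th qq
    rw [div_div_eq_mul_div]
  have hs2 : s ^ 2 * Z ^ th n = 1 := by
    rw [hs, ← Real.rpow_two, ← Real.rpow_mul hZ0, ← Real.rpow_add hZp, hthq]
    have : -(1 / qq n) * 2 + 2 / qq n = 0 := by ring
    rw [this, Real.rpow_zero]
  have habs : ∀ (r : ℝ) (x : Sp n), |s * f x| ^ r = s ^ r * |f x| ^ r := by
    intro r x
    rw [abs_mul, abs_of_pos hsp, Real.mul_rpow hsp.le (abs_nonneg _)]
  have hZth : 0 < Z ^ th n := Real.rpow_pos_of_pos hZp _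
  by_cases hc : s ^ 2 * D ≤ η
  · have key := hcore (fun x => s * f x) (fun x => s * u x) (continuous_const.mul hf.continuous)
      (contDiff_const.mul (by exact_mod_cast contDiff_infty.mp hu 2))
      (fun x => by simp only [hbd x x.2])
      (fun x => by
        have h1 : fderiv ℝ (fun x => s * u x) (x : E n) = s • fderiv ℝ u x := by
          have := congrFun (fderiv_const_smul_field (𝕜 := ℝ) (f := u) s) (x : E n)
          simpa [Pi.smul_def, smul_eq_mul] using this
        have e2 : hh n - 1 = ((n:ℝ) - 4) / 2 := by unfold hh; ring
        rw [h1, _root_.smul_apply, hnd x x.2, e2, smul_eq_mul]; ring)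
      (by
        simp only [habs]
        rw [integral_const_mul, ← hZ, hsq, inv_mul_cancel₀ hZp.ne'])
      (fun l => by
        obtain ⟨p, hp, hpe⟩ := bb_mem l
        have h1 := hmom p hp
        rw [sph_integral] at h1
        simp only [habs, ← hpe]
        have e : ∀ x : Sp n, evC n p x * (s ^ qq n * |f x| ^ qq n) =
            s ^ qq n * (MvPolynomial.eval (fun i => (x : E n) i) p * |f x| ^ qq n) := by
          intro x
          change MvPolynomial.eval (fun i => (x : E n) i) p * _ = _
          ring
        simp only [e]
        rw [integral_const_mul, h1, mul_zero])
      (by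
        simp only [habs]
        rw [integral_const_mul, ← hD, Real.rpow_two]; exact hc)
    simp only [lap_smul', mul_pow] at key
    rw [integral_const_mul, ← hEn] at key
    have h1 := mul_le_mul_of_nonneg_left key hZth.le
    have e : Z ^ th n * (K * (s ^ 2 * En)) = K * En := by
      calc _ = (s ^ 2 * Z ^ th n) * (K * En) := by ring
        _ = _ := by rw [hs2, one_mul]
    linarith
  · push Not at hc
    have h1 := mul_le_mul_of_nonneg_left hc.le hZth.le
    have e : Z ^ th n * (s ^ 2 * D) = D := by
      calc _ = (s ^ 2 * Z ^ th n) * D := by ring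
        _ = _ := by rw [hs2, one_mul]
    have h2 : Z ^ th n ≤ D / η := by
      rw [le_div_iff₀ hη]; linarith
    have : 0 ≤ K * En := by positivity
    linarith
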